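/- (Property 3, averages case: major arc asymptotics for discrete multipliers.) Let k ∈ ℕ, Γ ⊆ ℕ_0^k∖{0} nonempty finite, k', k'' ∈ {0,…,k} with k' + k'' = k, Ω ⊆ ℝ^k a bounded convex open set with B(0,c_Ω) ⊆ Ω ⊆ B(0,1), τ ∈ (0,1], and N_n := ⌊2^{n^τ}⌋. For every α > 0 there is a constant c > 0, independent of n, ξ, a, q, such that for every n ∈ ℕ and ξ ∈ 𝕋^Γ satisfying |ξ_γ − a_γ/q| ≤ N_n^{−|γ|} L for all γ ∈ Γ, with 1 ≤ q ≤ L, a ∈ A_q^Γ, and 1 ≤ L ≤ exp(c√(log N_n)) (log N_n)^{−α}, one has 𝔪_{N_n}(ξ) − 𝔪_{N_{n−1}}(ξ) = G(a/q) (Φ_{N_n}(ξ − a/q) − Φ_{N_{n−1}}(ξ − a/q)) + O((log N_n)^{−α}). -/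

import Mathlib

open MeasureTheory
open scoped ENNReal NNReal

noncomputable section

/-- Embedding of `ℤ^k` into Euclidean space `ℝ^k`. -/
def zEmbed {k : ℕ} (v : Fin k → ℤ) : EuclideanSpace ℝ (Fin k) :=
  WithLp.toLp 2 fun i => (v i : ℝ)

/-- The dilated set `Ω_t = {x : t⁻¹ x ∈ Ω}`. -/
def dilate {k : ℕ} (Ω : Set (EuclideanSpace ℝ (Fin k))) (t : ℝ) :
    Set (EuclideanSpace ℝ (Fin k)) := {x | t⁻¹ • x ∈ Ω}

/-- The weight `𝟙_{(n,p) ∈ ℤ^{k'} × (±ℙ)^{k''}} ∏_{i ≥ k'} log |p_i|`. -/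
def primeWeight {k : ℕ} (k' : ℕ) (v : Fin k → ℤ) : ℝ :=
  Set.indicator {w : Fin k → ℤ | ∀ i : Fin k, k' ≤ (i : ℕ) → Prime (w i)} (fun _ => 1) v *
    ∏ i : Fin k, if k' ≤ (i : ℕ) then Real.log |(v i : ℝ)| else 1

/-- The Chebyshev function `ϑ_Ω(t)`. -/
def cheby {k : ℕ} (k' : ℕ) (Ω : Set (EuclideanSpace ℝ (Fin k))) (t : ℝ) : ℝ :=
  ∑' v : Fin k → ℤ,
    primeWeight k' v * Set.indicator (dilate Ω t) (fun _ => 1) (zEmbed v)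

/-- `e(x) = e^{2πix}`. -/
def eC (x : ℝ) : ℂ := Complex.exp (2 * Real.pi * Complex.I * x)

/-- The pairing `ξ · 𝒬(v)` for `v ∈ ℤ^k`. -/
def qPair {k : ℕ} (Γ : Finset (Fin k → ℕ)) (ξ : (Fin k → ℕ) → ℝ) (v : Fin k → ℤ) : ℝ :=
  ∑ γ ∈ Γ, ξ γ * ∏ i, ((v i : ℝ)) ^ (γ i)

/-- The pairing `θ · 𝒬(u)` for `u ∈ ℝ^k`. -/
def qPairR {k : ℕ} (Γ : Finset (Fin k → ℕ)) (θ : (Fin k → ℕ) → ℝ)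
    (u : EuclideanSpace ℝ (Fin k)) : ℝ :=
  ∑ γ ∈ Γ, θ γ * ∏ i, (u i) ^ (γ i)

/-- The discrete Fourier multiplier `𝔪_t` of the polynomial averaging operator along
primes associated with the canonical polynomial mapping `𝒬`. -/
def discMultA {k : ℕ} (Γ : Finset (Fin k → ℕ)) (k' : ℕ)
    (Ω : Set (EuclideanSpace ℝ (Fin k))) (t : ℝ) (ξ : (Fin k → ℕ) → ℝ) : ℂ :=
  ((cheby k' Ω t : ℝ) : ℂ)⁻¹ *
    ∑' v : Fin k → ℤ,
      ((primeWeight k' v * Set.indicator (dilate Ω t) (fun _ => 1) (zEmbed v) : ℝ) : ℂ) *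
        eC (qPair Γ ξ v)

/-- The continuous multiplier `Φ_t(ξ) = |Ω_t|⁻¹ ∫_{Ω_t} e(ξ·𝒬(u)) du`. -/
def contMultA {k : ℕ} (Γ : Finset (Fin k → ℕ)) (Ω : Set (EuclideanSpace ℝ (Fin k)))
    (t : ℝ) (ξ : (Fin k → ℕ) → ℝ) : ℂ :=
  (((MeasureTheory.volume (dilate Ω t)).toReal : ℝ) : ℂ)⁻¹ *
    ∫ u in dilate Ω t, eC (qPairR Γ ξ u)

/-- The Gaussian sum `G(a/q)` associated with the canonical polynomial mapping. -/
def gaussSumQ {k : ℕ} (Γ : Finset (Fin k → ℕ)) (k' k'' : ℕ) (q : ℕ)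
    (a : (Fin k → ℕ) → ℕ) : ℂ :=
  ((q : ℂ) ^ k' * (Nat.totient q : ℂ) ^ k'')⁻¹ *
    ∑ v ∈ Fintype.piFinset (fun i : Fin k =>
        if (i : ℕ) < k' then Finset.Icc 1 q
        else (Finset.Icc 1 q).filter fun m => Nat.Coprime m q),
      eC (∑ γ ∈ Γ, ((a γ : ℝ) / (q : ℝ)) * ∏ i, (v i : ℝ) ^ (γ i))

/-- The subexponential sequence `N_n = ⌊2^{n^τ}⌋`. -/
def Nseq (τ : ℝ) (n : ℕ) : ℕ := Nat.floor ((2 : ℝ) ^ ((n : ℝ) ^ τ))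

end

section
open Complex Metric Set Filter Topology

namespace MA

/-- logarithmic derivative bound in a zero-free disc -/
lemma logDeriv_bound {G : ℂ → ℂ} {c : ℂ} {R M : ℝ} (hR : 0 < R) (hM : 0 < M)
    (hG : DifferentiableOn ℂ G (ball c R)) (hne : ∀ z ∈ ball c R, G z ≠ 0)
    (hb : ∀ z ∈ ball c R, ‖G z‖ ≤ Real.exp M * ‖G c‖) {z : ℂ} (hz : dist z c ≤ R / 2) :
    ‖deriv G z / G z‖ ≤ 24 * M / R := by
  have hd : DifferentiableOn ℂ (fun z => deriv G z / G z) (ball c R) :=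
    (hG.deriv isOpen_ball).div hG hne
  obtain ⟨h, hc, hh⟩ := hd.isExactOn_ball.with_val_at c 0
  have hcb : c ∈ ball c R := mem_ball_self hR
  have hhd : DifferentiableOn ℂ h (ball c R) := fun w hw =>
    (hh w hw).differentiableAt.differentiableWithinAt
  have hGd : ∀ w ∈ ball c R, HasDerivAt G (deriv G w) w := fun w hw =>
    (hG.differentiableAt (isOpen_ball.mem_nhds hw)).hasDerivAt
  -- G = G c * exp h
  have key : ∀ w ∈ ball c R, G w * exp (-h w) = G c := by
    intro w hw
    have h1 : ∀ w ∈ ball c R, HasDerivAt (fun w => G w * exp (-h w)) 0 w := by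
      intro w hw
      have := (hGd w hw).mul ((hh w hw).neg.cexp)
      refine this.congr_deriv ?_
      have h3 := hne w hw
      have h4 : G w * (deriv G w / G w) = deriv G w := by field_simp
      linear_combination (-cexp ((-h) w)) * h4
    have h2 := (convex_ball c R).is_const_of_fderivWithin_eq_zero (𝕜 := ℂ)
      (f := fun w => G w * exp (-h w))
      (fun w hw => (h1 w hw).differentiableAt.differentiableWithinAt)
      (fun w hw => by
        rw [fderivWithin_of_isOpen isOpen_ball hw]
        have := (h1 w hw).hasFDerivAt.fderiv
        rw [this]; ext; simp) hw hcb
    rw [h2, hc]; simp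
  have hre : ∀ w ∈ ball c R, (h w).re ≤ M := by
    intro w hw
    have h1 : G w = G c * exp (h w) := by
      rw [← key w hw, mul_assoc, ← Complex.exp_add]; simp
    have h2 := hb w hw
    rw [h1, norm_mul, Complex.norm_exp, mul_comm] at h2
    have h3 := le_of_mul_le_mul_right h2 (norm_pos_iff.2 (hne c hcb))
    exact Real.exp_le_exp.1 h3
  -- BC
  have hbc : ∀ w, dist w c ≤ 3 * R / 4 → ‖h w‖ ≤ 6 * M := by
    intro w hw
    have hmem : w - c ∈ ball (0:ℂ) R := by
      rw [mem_ball_zero_iff, ← dist_eq_norm]; linarith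
    have := borelCaratheodory_zero (f := fun u => h (u + c)) (R := R) (M := M) (z := w - c) hM
      (fun u hu => by
        have : u + c ∈ ball c R := by simpa [mem_ball, dist_eq_norm] using hu
        exact ((hh _ this).differentiableAt.comp u (by fun_prop)).differentiableWithinAt)
      (fun u hu => by
        have : u + c ∈ ball c R := by simpa [mem_ball, dist_eq_norm] using hu
        exact hre _ this) hR hmem (by simpa using hc)
    simp only [sub_add_cancel] at this
    refine this.trans ?_
    rw [← dist_eq_norm, div_le_iff₀ (by linarith)]
    nlinarith
  have hzb : z ∈ ball c R := by rw [mem_ball]; linarith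
  rw [← (hh z hzb).deriv]
  have h5 : ∀ w ∈ closedBall z (R/4), dist w c ≤ 3 * R / 4 := by
    intro w hw
    have := dist_triangle w z c
    rw [mem_closedBall] at hw
    linarith
  have := norm_deriv_le_of_forall_mem_sphere_norm_le (c := z) (R := R/4) (C := 6 * M) (f := h)
    (by positivity)
    (by
      apply DifferentiableOn.diffContOnCl
      rw [closure_ball z (by positivity)]
      exact hhd.mono fun w hw => by
        rw [mem_ball]; linarith [h5 w hw])
    (fun w hw => hbc w (h5 w (sphere_subset_closedBall hw)))
  refine this.trans (le_of_eq ?_)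
  field_simp
  ring

/-- product of linear factors -/
noncomputable def lprod (l : List ℂ) (z : ℂ) : ℂ := (l.map fun ρ => z - ρ).prod

lemma entire_extract {F : ℂ → ℂ} (hF : Differentiable ℂ F) (hne : ∃ z, F z ≠ 0) (ρ : ℂ) :
    ∃ (n : ℕ) (g : ℂ → ℂ), Differentiable ℂ g ∧ g ρ ≠ 0 ∧ ∀ z, F z = (z - ρ) ^ n * g z := by
  have han : AnalyticOnNhd ℂ F univ := fun z _ => hF.analyticAt z
  have hord : analyticOrderAt F ρ ≠ ⊤ := by
    intro h
    rw [analyticOrderAt_eq_top] at h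
    obtain ⟨z, hz⟩ := hne
    exact hz (by
      have := han.eqOn_zero_of_preconnected_of_eventuallyEq_zero isPreconnected_univ (mem_univ ρ) h
      exact this (mem_univ z))
  -- iterate dslope
  obtain ⟨n, hn⟩ := ENat.ne_top_iff_exists.1 hord
  clear hord
  induction n generalizing F with
  | zero =>
    refine ⟨0, F, hF, ?_, by simp⟩
    exact (hF.analyticAt ρ).analyticOrderAt_eq_zero.1 hn.symm
  | succ n ih =>
    have h0 : F ρ = 0 := by
      by_contra h
      rw [(hF.analyticAt ρ).analyticOrderAt_eq_zero.2 h] at hn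
      simp at hn
    have hd : Differentiable ℂ (dslope F ρ) := by
      rw [← differentiableOn_univ] at *
      exact (Complex.differentiableOn_dslope univ_mem).2 hF
    have heq : ∀ z, F z = (z - ρ) * dslope F ρ z := by
      intro z
      have := sub_smul_dslope F ρ z
      rw [h0, sub_zero, smul_eq_mul] at this
      exact this.symm
    have hne' : ∃ z, dslope F ρ z ≠ 0 := by
      obtain ⟨z, hz⟩ := hne
      exact ⟨z, fun h => hz (by rw [heq, h, mul_zero])⟩
    have hord' : analyticOrderAt (dslope F ρ) ρ = n := by
      have h1 : F = (fun z => (z - ρ)) * dslope F ρ := by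
        ext z; exact heq z
      have h2 : analyticOrderAt (fun z : ℂ => z - ρ) ρ = 1 := by
        have := (AnalyticAt.analyticOrderAt_eq_natCast (f := fun z : ℂ => z - ρ) (z₀ := ρ) (n := 1)
          (by fun_prop)).2 ⟨fun _ => 1, analyticAt_const, one_ne_zero, by simp⟩
        simpa using this
      rw [h1, analyticOrderAt_mul (by fun_prop) (hd.analyticAt ρ), h2] at hn
      push_cast at hn
      rw [add_comm] at hn
      exact (ENat.add_right_injective_of_ne_top ENat.one_ne_top hn).symm
    obtain ⟨m, g, h1, h2, h3⟩ := ih hd hne' (fun z _ => hd.analyticAt z) hord'.symm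
    exact ⟨m + 1, g, h1, h2, fun z => by rw [heq, h3]; ring⟩

lemma entire_factor {F : ℂ → ℂ} (hF : Differentiable ℂ F) (hne : ∃ z, F z ≠ 0) (c : ℂ) (R : ℝ) :
    ∃ (l : List ℂ) (g : ℂ → ℂ), Differentiable ℂ g ∧ (∀ z ∈ ball c R, g z ≠ 0) ∧
      (∀ ρ ∈ l, ρ ∈ ball c R) ∧ ∀ z, F z = lprod l z * g z := by
  have hfin : ({z | F z = 0} ∩ ball c R).Finite := by
    have han : AnalyticOnNhd ℂ F univ := fun z _ => hF.analyticAt z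
    obtain ⟨z, hz⟩ := hne
    have h1 := han.preimage_zero_mem_codiscrete hz
    have h2 := (mem_codiscrete'.1 h1)
    have h3 : (closedBall c R ∩ {z | F z = 0}).Finite := by
      have e : {z | F z = 0} = (F ⁻¹' {0}ᶜ)ᶜ := by ext; simp
      rw [e]
      refine IsCompact.finite ?_ ?_
      · exact (isCompact_closedBall c R).inter_right (isClosed_compl_iff.2 h2.1)
      · have := isDiscrete_iff_discreteTopology.1 h2.2
        exact (h2.2.mono inter_subset_right)
    exact h3.subset fun z hz => ⟨ball_subset_closedBall hz.2, hz.1⟩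
  obtain ⟨s, hs⟩ := hfin.exists_finset_coe
  induction s using Finset.induction_on generalizing F with
  | empty =>
    refine ⟨[], F, hF, fun z hz h => ?_, by simp, by simp [lprod]⟩
    have : z ∈ ({z | F z = 0} ∩ ball c R) := ⟨h, hz⟩
    rw [← hs] at this
    simp at this
  | insert ρ s hρ ih =>
    obtain ⟨n, g, h1, h2, h3⟩ := entire_extract hF hne ρ
    have hz : {z | g z = 0} ∩ ball c R = ↑s := by
      ext z
      have : z ∈ ({z | F z = 0} ∩ ball c R) ↔ z ∈ insert ρ s := by rw [← hs]; simp
      by_cases hzρ : z = ρ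
      · subst hzρ; simp [h2, hρ]
      · simp only [mem_inter_iff, mem_ofPred_eq, Finset.mem_coe, h3, Finset.mem_insert, hzρ, false_or,
          mul_eq_zero, pow_eq_zero_iff', sub_eq_zero, false_and] at this ⊢
        exact this
    have hρb : ρ ∈ ball c R := by
      have : ρ ∈ ({z | F z = 0} ∩ ball c R) := by rw [← hs]; simp
      exact this.2
    obtain ⟨l, g', a1, a2, a3, a4⟩ := ih h1 ⟨ρ, h2⟩ (by rw [hz]; exact s.finite_toSet) hz.symm
    refine ⟨List.replicate n ρ ++ l, g', a1, a2, ?_, ?_⟩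
    · intro x hx
      rw [List.mem_append, List.mem_replicate] at hx
      rcases hx with ⟨_, rfl⟩ | hx
      · exact hρb
      · exact a3 x hx
    · intro z
      rw [h3, a4]; simp [lprod, mul_assoc]

lemma re_logDeriv_aux {R M : ℝ} {c : ℂ} (hR : 0 < R) (hM : 0 < M) (l : List ℂ) :
    ∀ (F g : ℂ → ℂ), Differentiable ℂ g → (∀ z ∈ ball c R, g z ≠ 0) →
      (∀ ρ ∈ l, ρ ∈ ball c R ∧ ρ ≠ c) → (∀ z, F z = lprod l z * g z) →
      (∀ z ∈ closedBall c R, ‖F z‖ ≤ Real.exp M * ‖F c‖) →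
      -(24 * M / R) + (l.map fun ρ => ((1 / (c - ρ)).re - (c - ρ).re / R ^ 2)).sum
        ≤ (deriv F c / F c).re := by
  induction l with
  | nil =>
    intro F g hg hne _ hF hb
    have : F = g := by ext z; simp [hF, lprod]
    subst this
    have := logDeriv_bound hR hM hg.differentiableOn hne
      (fun z hz => hb z (ball_subset_closedBall hz)) (z := c) (by simp; positivity)
    have h2 := (abs_le.1 ((abs_re_le_norm _).trans this)).1
    simpa using h2
  | cons ρ l ih =>
    intro F g hg hne hl hF hb
    obtain ⟨hρb, hρc⟩ := hl ρ (by simp)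
    set κ : ℂ → ℂ := fun z => ((R:ℂ) ^ 2 - (starRingEnd ℂ) (ρ - c) * (z - c)) / R with hκ
    set F1 : ℂ → ℂ := fun z => lprod l z * g z with hF1
    have hF1' : ∀ z, F z = (z - ρ) * F1 z := fun z => by rw [hF]; simp [hF1, lprod, mul_assoc]
    have hRc : (R:ℂ) ≠ 0 := by exact_mod_cast hR.ne'
    have hnρ : ‖ρ - c‖ < R := by rwa [← dist_eq_norm]
    have hκc : κ c = R := by simp [hκ]; field_simp
    have hκd : Differentiable ℂ κ := by simp only [hκ]; fun_prop
    have hld : Differentiable ℂ (lprod l) := by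
      clear hF1' hF ih hl hF1 F1
      induction l with
      | nil => 
        have : lprod [] = fun _ => 1 := by ext z; simp [lprod]
        rw [this]; fun_prop
      | cons a l ih => 
        have : lprod (a :: l) = fun z => (z - a) * lprod l z := by ext z; simp [lprod]
        rw [this]; fun_prop
    have hF1d : Differentiable ℂ F1 := by simp only [hF1]; fun_prop
    set F2 : ℂ → ℂ := fun z => lprod l z * (g z * κ z) with hF2
    have hF2' : F2 = fun z => F1 z * κ z := by ext z; simp only [hF2, hF1]; ring
    have hκne : ∀ z ∈ ball c R, κ z ≠ 0 := by
      intro z hz h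
      rw [hκ] at h
      simp only [div_eq_zero_iff, hRc, or_false, sub_eq_zero] at h
      have h1 := congrArg norm h
      rw [norm_mul, norm_pow, RCLike.norm_conj, norm_real, Real.norm_eq_abs, abs_of_pos hR,
        ← dist_eq_norm z c] at h1
      have : dist z c < R := hz
      nlinarith [norm_nonneg (ρ - c), dist_nonneg (x := z) (y := c)]
    have hsph : ∀ z ∈ sphere c R, ‖F2 z‖ = ‖F z‖ := by
      intro z hz
      have hz' : dist z c = R := hz
      suffices h : ‖κ z‖ = ‖z - ρ‖ by
        rw [hF1', norm_mul (z - ρ), ← h, ← norm_mul, hF2', mul_comm]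
      simp only [hκ, norm_div, norm_real, Real.norm_eq_abs, abs_of_pos hR]
      rw [div_eq_iff hR.ne']
      have h1 : (R:ℂ) ^ 2 = (starRingEnd ℂ) (z - c) * (z - c) := by
        rw [← Complex.normSq_eq_conj_mul_self, Complex.normSq_eq_norm_sq, ← dist_eq_norm, hz']
        push_cast; rfl
      rw [h1, ← sub_mul, ← map_sub, norm_mul, RCLike.norm_conj, ← dist_eq_norm z c, hz']
      congr 2; ring
    have hF2d : Differentiable ℂ F2 := by rw [hF2']; fun_prop
    have hcn : ‖F c‖ ≤ ‖F2 c‖ := by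
      rw [hF2', hF1']
      simp only [norm_mul, hκc, norm_real, Real.norm_eq_abs, abs_of_pos hR]
      rw [mul_comm]
      gcongr
      rw [norm_sub_rev]; exact hnρ.le
    have hb2 : ∀ z ∈ closedBall c R, ‖F2 z‖ ≤ Real.exp M * ‖F2 c‖ := by
      intro z hz
      have h1 : ‖F2 z‖ ≤ Real.exp M * ‖F c‖ := by
        apply Complex.norm_le_of_forall_mem_frontier_norm_le (U := ball c R) isBounded_ball
          hF2d.diffContOnCl
        · intro w hw
          rw [frontier_ball c hR.ne'] at hw
          rw [hsph w hw]
          exact hb w (sphere_subset_closedBall hw)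
        · rw [closure_ball c hR.ne']; exact hz
      exact h1.trans (by gcongr)
    have hI := ih F2 (fun z => g z * κ z) (by fun_prop)
      (fun z hz => mul_ne_zero (hne z hz) (hκne z hz)) (fun ρ hρ => hl ρ (by simp [hρ]))
      (fun z => rfl) hb2
    have hF1c : F1 c ≠ 0 := by
      simp only [hF1]
      refine mul_ne_zero ?_ (hne c (mem_ball_self hR))
      simp only [lprod]
      intro h0
      rw [List.prod_eq_zero_iff] at h0
      rw [List.mem_map] at h0
      obtain ⟨a, ha, ha'⟩ := h0
      exact (hl a (by simp [ha])).2 (sub_eq_zero.1 ha').symm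
    have hcρ : c - ρ ≠ 0 := sub_ne_zero.2 hρc.symm
    have e1 : deriv F c / F c = 1 / (c - ρ) + deriv F1 c / F1 c := by
      have hFd : F = fun z => (z - ρ) * F1 z := by ext z; exact hF1' z
      have h1 : HasDerivAt F (1 * F1 c + (c - ρ) * deriv F1 c) c := by
        rw [hFd]
        exact ((hasDerivAt_id c).sub_const ρ).mul hF1d.differentiableAt.hasDerivAt
      rw [h1.deriv, hF1']
      field_simp
    have e2 : deriv F2 c / F2 c = deriv F1 c / F1 c + (starRingEnd ℂ) (c - ρ) / R ^ 2 := by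
      have hκ' : HasDerivAt κ ((starRingEnd ℂ) (c - ρ) / R) c := by
        have h2 : HasDerivAt κ ((0 - (starRingEnd ℂ) (ρ - c) * 1) / R) c :=
          ((hasDerivAt_const c _).sub (((hasDerivAt_id c).sub_const c).const_mul _)).div_const _
        convert h2 using 1
        simp
      have h1 : HasDerivAt F2 (deriv F1 c * κ c + F1 c * ((starRingEnd ℂ) (c - ρ) / R)) c := by
        rw [hF2']
        exact hF1d.differentiableAt.hasDerivAt.mul hκ'
      rw [h1.deriv, hF2']
      simp only [hκc]
      field_simp
    have e3 : ((starRingEnd ℂ) (c - ρ) / (R:ℂ) ^ 2).re = (c - ρ).re / R ^ 2 := by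
      rw [← ofReal_pow, div_ofReal_re]; simp
    have e2' := congrArg Complex.re e2
    rw [add_re, e3] at e2'
    rw [e1, add_re]
    simp only [List.map_cons, List.sum_cons]
    linarith

/-- lower bound for the real part of the logarithmic derivative at the centre -/
lemma re_logDeriv_ge {R M : ℝ} {c : ℂ} (hR : 0 < R) (hM : 0 < M) (l : List ℂ)
    (F g : ℂ → ℂ) (hg : Differentiable ℂ g) (hl : ∀ ρ ∈ l, ρ ∈ ball c R)
    (hF : ∀ z, F z = lprod l z * g z) (hFc : F c ≠ 0)
    (hz : ∀ z, F z = 0 → z.re < c.re)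
    (hb : ∀ z ∈ closedBall c R, ‖F z‖ ≤ Real.exp M * ‖F c‖) :
    -(24 * M / R) + (l.map fun ρ => ((1 / (c - ρ)).re - (c - ρ).re / R ^ 2)).sum
        ≤ (deriv F c / F c).re := by
  have hgc : g c ≠ 0 := fun h => hFc (by rw [hF, h, mul_zero])
  obtain ⟨l', g', h1, h2, h3, h4⟩ := entire_factor hg ⟨c, hgc⟩ c R
  have hF' : ∀ z, F z = lprod (l ++ l') z * g' z := by
    intro z; rw [hF, h4]; simp [lprod, mul_assoc]
  have hroot : ∀ ρ ∈ l ++ l', F ρ = 0 := by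
    intro ρ hρ
    rw [hF']
    simp only [lprod, mul_eq_zero]
    left
    rw [List.prod_eq_zero_iff, List.mem_map]
    exact ⟨ρ, hρ, by simp⟩
  have hmem : ∀ ρ ∈ l ++ l', ρ ∈ ball c R := by
    intro ρ hρ
    rw [List.mem_append] at hρ
    exact hρ.elim (hl ρ) (h3 ρ)
  have := re_logDeriv_aux hR hM (l ++ l') F g' h1 h2
    (fun ρ hρ => ⟨hmem ρ hρ, fun h => hFc (h ▸ hroot ρ hρ)⟩) hF' hb
  refine le_trans ?_ this
  rw [List.map_append, List.sum_append]
  have hnn : 0 ≤ (l'.map fun ρ => ((1 / (c - ρ)).re - (c - ρ).re / R ^ 2)).sum := by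
    apply List.sum_nonneg
    intro x hx
    rw [List.mem_map] at hx
    obtain ⟨ρ, hρ, rfl⟩ := hx
    have hr : ρ ∈ l ++ l' := by simp [hρ]
    have hpos : 0 < (c - ρ).re := by
      have := hz ρ (hroot ρ hr); rw [sub_re]; linarith
    have hlt : normSq (c - ρ) < R ^ 2 := by
      have := hmem ρ hr
      rw [mem_ball, dist_comm, dist_eq_norm] at this
      rw [normSq_eq_norm_sq]
      exact pow_lt_pow_left₀ this (norm_nonneg _) two_ne_zero
    have h0 : 0 < normSq (c - ρ) := normSq_pos.2 (fun h => by rw [h] at hpos; simp at hpos)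
    rw [one_div, inv_re, sub_nonneg]
    gcongr
  linarith

end MA
end


section
open Complex Metric Set Filter Topology MeasureTheory

namespace MA

lemma periodic_sum_bound {q : ℕ} [NeZero q] (f : ZMod q → ℂ) (hf : ∀ x, ‖f x‖ ≤ 1) (N : ℕ) :
    ‖(∑ n ∈ Finset.Icc 1 N, f n) - (∑ x, f x) / q * N‖ ≤ 2 * q := by
  have hq : (q:ℂ) ≠ 0 := by exact_mod_cast NeZero.ne q
  have hA : ‖(∑ x, f x) / q‖ ≤ 1 := by
    rw [norm_div, norm_natCast, div_le_one (by exact_mod_cast NeZero.pos q)]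
    refine (norm_sum_le _ _).trans ((Finset.sum_le_sum fun x _ => hf x).trans ?_)
    simp [ZMod.card]
  induction N using Nat.strong_induction_on with
  | _ N ih =>
    by_cases h : N < q
    · refine (norm_sub_le _ _).trans ?_
      have h1 : ‖∑ n ∈ Finset.Icc 1 N, f n‖ ≤ N := by
        refine (norm_sum_le _ _).trans ((Finset.sum_le_sum fun x _ => hf _).trans ?_)
        simp
      have h2 : ‖(∑ x, f x) / q * N‖ ≤ N := by
        rw [norm_mul, norm_natCast]
        nlinarith [Nat.cast_nonneg (α := ℝ) N]
      have : (N:ℝ) ≤ q := by exact_mod_cast h.le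
      linarith
    · push Not at h
      have := ih (N - q) (Nat.sub_lt (lt_of_lt_of_le (NeZero.pos q) h) (NeZero.pos q))
      obtain ⟨m, rfl⟩ := Nat.exists_eq_add_of_le h
      simp only [Nat.add_sub_cancel_left] at this
      have hs : ∑ n ∈ Finset.Icc 1 (q + m), f n = (∑ n ∈ Finset.Icc 1 m, f n) + ∑ x, f x := by
        have e1 : ∑ n ∈ Finset.Icc 1 (q + m), f n
            = (∑ n ∈ Finset.Icc 1 m, f n) + ∑ n ∈ Finset.Ico (m+1) (m + 1 + q), f n := by
          rw [← Finset.Ico_add_one_right_eq_Icc, ← Finset.Ico_add_one_right_eq_Icc,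
            Finset.sum_Ico_consecutive _ (by omega) (by omega)]
          congr 2; ring
        rw [e1]
        congr 1
        have e2 : ∑ n ∈ Finset.Ico (m+1) (m + 1 + q), f n
            = ∑ n ∈ Finset.range q, f ((n + (m+1) : ℕ) : ZMod q) := by
          rw [Finset.sum_Ico_eq_sum_range]
          simp [add_comm]
        rw [e2, ← Equiv.sum_comp (Equiv.addRight ((m+1 : ℕ) : ZMod q))]
        rw [Finset.sum_nbij' (t := Finset.univ) (g := fun x : ZMod q => f (Equiv.addRight ((m+1 : ℕ) : ZMod q) x))
          (fun n : ℕ => (n : ZMod q)) (fun x : ZMod q => x.val)]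
        · simp
        · intro a _; simp [ZMod.val_lt]
        · intro a ha; exact ZMod.val_cast_of_lt (Finset.mem_range.1 ha)
        · intro a _; simp
        · intro a _; simp [add_assoc]
      rw [hs]
      convert this using 2
      push_cast
      field_simp
      ring

section
variable {q : ℕ} [NeZero q] (χ : DirichletCharacter ℂ q)

/-- density of the character -/
noncomputable def cden : ℂ := (∑ x, χ x) / q

/-- error term of the summatory function -/
noncomputable def cerr (u : ℝ) : ℂ := (∑ n ∈ Finset.Icc 1 ⌊u⌋₊, χ n) - cden χ * u

noncomputable def cint (s : ℂ) : ℂ := ∫ u in Ioi (1:ℝ), cerr χ u * (u:ℂ) ^ (-(s + 1))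

lemma norm_cden : ‖cden χ‖ ≤ 1 := by
  rw [cden, norm_div, norm_natCast, div_le_one (by exact_mod_cast NeZero.pos q)]
  refine (norm_sum_le _ _).trans ((Finset.sum_le_sum fun x _ => χ.norm_le_one x).trans ?_)
  simp [ZMod.card]

lemma cden_eq_zero (h : χ ≠ 1) : cden χ = 0 := by
  rw [cden, χ.sum_eq_zero_of_ne_one h, zero_div]

lemma cerr_le_q {u : ℝ} (hu : 0 ≤ u) : ‖cerr χ u‖ ≤ 3 * q := by
  have h1 := periodic_sum_bound (fun x => χ x) (fun x => χ.norm_le_one x) ⌊u⌋₊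
  have h2 : cerr χ u = ((∑ n ∈ Finset.Icc 1 ⌊u⌋₊, χ n) - (∑ x, χ x) / q * (⌊u⌋₊:ℂ))
      - cden χ * ((u - ⌊u⌋₊ : ℝ) : ℂ) := by
    simp only [cerr, cden]; push_cast; ring
  rw [h2]
  refine (norm_sub_le _ _).trans ?_
  have h3 : ‖cden χ * ((u - ⌊u⌋₊ : ℝ) : ℂ)‖ ≤ 1 := by
    rw [norm_mul, norm_real, Real.norm_eq_abs, abs_of_nonneg (by linarith [Nat.floor_le hu])]
    have := Nat.lt_floor_add_one u
    have := Nat.floor_le hu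
    have := norm_cden χ
    have := norm_nonneg (cden χ)
    nlinarith
  have h4 : (1:ℝ) ≤ q := by exact_mod_cast NeZero.pos q
  linarith

lemma cerr_le_u {u : ℝ} (hu : 0 ≤ u) : ‖cerr χ u‖ ≤ 2 * u := by
  refine (norm_sub_le _ _).trans ?_
  have h1 : ‖∑ n ∈ Finset.Icc 1 ⌊u⌋₊, χ n‖ ≤ u := by
    refine (norm_sum_le _ _).trans ((Finset.sum_le_sum fun x _ => χ.norm_le_one _).trans ?_)
    simpa using Nat.floor_le hu
  have h2 : ‖cden χ * u‖ ≤ u := by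
    rw [norm_mul, norm_real, Real.norm_eq_abs, abs_of_nonneg hu]
    nlinarith [norm_cden χ]
  linarith

lemma measurable_cerr : Measurable (cerr χ) := by
  unfold cerr
  have h1 : Measurable fun u : ℝ => ∑ n ∈ Finset.Icc 1 ⌊u⌋₊, χ n :=
    (measurable_from_nat (f := fun N : ℕ => ∑ n ∈ Finset.Icc 1 N, χ n)).comp Nat.measurable_floor
  exact h1.sub (by fun_prop)

lemma integrableOn_cerr_mul {s : ℂ} (hs : 0 < s.re) :
    IntegrableOn (fun u : ℝ => cerr χ u * (u:ℂ) ^ (-(s + 1))) (Ioi 1) := by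
  have h1 : IntegrableOn (fun u : ℝ => (3 * q) * u ^ (-(s.re + 1))) (Ioi 1) :=
    (integrableOn_Ioi_rpow_of_lt (by linarith) one_pos).const_mul _
  refine Integrable.mono' h1 ?_ ?_
  · refine ((measurable_cerr χ).mul ?_).aestronglyMeasurable
    exact (measurable_ofReal.pow_const _)
  · filter_upwards [ae_restrict_mem measurableSet_Ioi] with u hu
    have hu0 : (0:ℝ) < u := one_pos.trans hu
    rw [norm_mul, norm_cpow_eq_rpow_re_of_pos hu0]
    simp only [neg_re, add_re, one_re]
    gcongr
    exact cerr_le_q χ hu0.le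

lemma norm_cint_le {s : ℂ} (hs : 0 < s.re) : ‖cint χ s‖ ≤ 3 * q / s.re := by
  have h1 : IntegrableOn (fun u : ℝ => (3 * q) * u ^ (-(s.re + 1))) (Ioi 1) :=
    (integrableOn_Ioi_rpow_of_lt (by linarith) one_pos).const_mul _
  refine (norm_integral_le_of_norm_le h1 ?_).trans (le_of_eq ?_)
  · filter_upwards [ae_restrict_mem measurableSet_Ioi] with u hu
    have hu0 : (0:ℝ) < u := one_pos.trans hu
    rw [norm_mul, norm_cpow_eq_rpow_re_of_pos hu0]
    simp only [neg_re, add_re, one_re]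
    gcongr
    exact cerr_le_q χ hu0.le
  · rw [integral_const_mul, integral_Ioi_rpow_of_lt (by linarith) one_pos]
    simp
    field_simp

lemma norm_cint_gen {s : ℂ} (hs : 0 < s.re) {K : ℝ}
    (hK : ∀ u : ℝ, 1 < u → u ≤ q → u ^ (1 - s.re) ≤ K) :
    ‖cint χ s‖ ≤ K * (2 * Real.log q) + (q:ℝ) ^ (1 - s.re) * (3 / s.re) := by
  have hq1 : (1:ℝ) ≤ q := by exact_mod_cast NeZero.pos q
  have hq0 : (0:ℝ) < q := by linarith
  have hi := integrableOn_cerr_mul χ hs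
  have hsplit : cint χ s = (∫ u in Ioc (1:ℝ) q, cerr χ u * (u:ℂ) ^ (-(s + 1)))
      + ∫ u in Ioi (q:ℝ), cerr χ u * (u:ℂ) ^ (-(s + 1)) := by
    rw [cint, ← Ioc_union_Ioi_eq_Ioi hq1, setIntegral_union (Ioc_disjoint_Ioi le_rfl)
      measurableSet_Ioi (hi.mono_set Ioc_subset_Ioi_self) (hi.mono_set (Ioi_subset_Ioi hq1))]
  rw [hsplit]
  refine (norm_add_le _ _).trans ?_
  apply add_le_add
  · have h1 : IntegrableOn (fun u : ℝ => (2 * K) * u⁻¹) (Ioc 1 q) := by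
      refine IntegrableOn.mono_set ?_ Ioc_subset_Icc_self
      refine ContinuousOn.integrableOn_Icc (ContinuousOn.mul continuousOn_const
        (continuousOn_inv₀.mono fun u hu => ?_))
      have : (1:ℝ) ≤ u := hu.1
      simp; linarith
    refine (norm_integral_le_of_norm_le h1 ?_).trans (le_of_eq ?_)
    · filter_upwards [ae_restrict_mem measurableSet_Ioc] with u hu
      have hu0 : (0:ℝ) < u := one_pos.trans hu.1
      rw [norm_mul, norm_cpow_eq_rpow_re_of_pos hu0]
      simp only [neg_re, add_re, one_re]
      calc ‖cerr χ u‖ * u ^ (-(s.re + 1)) ≤ 2 * u * u ^ (-(s.re + 1)) := by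
            gcongr; exact cerr_le_u χ hu0.le
        _ = 2 * u ^ (1 - s.re) * u⁻¹ := by
            rw [← Real.rpow_neg_one u, mul_assoc, mul_assoc, ← Real.rpow_add hu0]
            have e : -(s.re + 1) = (1 - s.re + -1) + -1 := by ring
            rw [e, Real.rpow_add hu0 _ (-1), Real.rpow_neg_one]
            field_simp
        _ ≤ _ := by
            gcongr
            exact hK u hu.1 hu.2
    · rw [integral_const_mul, ← intervalIntegral.integral_of_le hq1,
        integral_inv_of_pos one_pos hq0]
      simp; ring
  · have h1 : IntegrableOn (fun u : ℝ => (3 * q) * u ^ (-(s.re + 1))) (Ioi q) :=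
      (integrableOn_Ioi_rpow_of_lt (by linarith) hq0).const_mul _
    refine (norm_integral_le_of_norm_le h1 ?_).trans (le_of_eq ?_)
    · filter_upwards [ae_restrict_mem measurableSet_Ioi] with u hu
      have hu0 : (0:ℝ) < u := hq0.trans hu
      rw [norm_mul, norm_cpow_eq_rpow_re_of_pos hu0]
      simp only [neg_re, add_re, one_re]
      gcongr
      exact cerr_le_q χ hu0.le
    · rw [integral_const_mul, integral_Ioi_rpow_of_lt (by linarith) hq0]
      have e : (q:ℝ) ^ (1 - s.re) = q * (q:ℝ) ^ (-s.re) := by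
        rw [sub_eq_add_neg, Real.rpow_add hq0, Real.rpow_one]
      rw [e]
      have : -(s.re + 1) + 1 = -s.re := by ring
      rw [this]
      field_simp

lemma differentiableAt_cint {s : ℂ} (hs : 0 < s.re) : DifferentiableAt ℂ (cint χ) s := by
  set f : ℝ → ℂ := (Ioi (1:ℝ)).indicator (cerr χ) with hf
  have hfm : Measurable f := (measurable_cerr χ).indicator measurableSet_Ioi
  have hfb : ∀ u, ‖f u‖ ≤ 3 * q := by
    intro u
    rw [hf]
    by_cases hu : u ∈ Ioi (1:ℝ)
    · rw [indicator_of_mem hu]; exact cerr_le_q χ (one_pos.trans hu).le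
    · rw [indicator_of_notMem hu]; simp
  have hd : DifferentiableAt ℂ (mellin f) (-s) := by
    apply mellin_differentiableAt_of_isBigO_rpow (a := 0) (b := -s.re - 1)
    · refine LocallyIntegrable.locallyIntegrableOn ?_ _
      refine (locallyIntegrable_const (3 * (q:ℝ))).mono hfm.aestronglyMeasurable ?_
      filter_upwards with u
      refine (hfb u).trans (Real.le_norm_self _)
    · refine Asymptotics.IsBigO.of_bound (3 * q) ?_
      filter_upwards with u
      simpa using hfb u
    · simpa using hs
    · refine Asymptotics.IsBigO.of_bound 1 ?_
      have : Ioo (0:ℝ) 1 ∈ 𝓝[>] (0:ℝ) := Ioo_mem_nhdsGT one_pos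
      filter_upwards [this] with u hu
      rw [hf, indicator_of_notMem (by simp [hu.2.le])]
      simp only [norm_zero]
      positivity
    · simp
  have he : cint χ = fun s => mellin f (-s) := by
    ext s
    rw [mellin, cint]
    have : ∀ u : ℝ, (u:ℂ) ^ (-s - 1) • f u
        = (Ioi (1:ℝ)).indicator (fun u : ℝ => cerr χ u * (u:ℂ) ^ (-(s + 1))) u := by
      intro u
      rw [hf]
      by_cases hu : u ∈ Ioi (1:ℝ)
      · rw [indicator_of_mem hu, indicator_of_mem hu, smul_eq_mul, mul_comm, neg_add']
      · rw [indicator_of_notMem hu, indicator_of_notMem hu, smul_zero]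
    simp_rw [this]
    rw [setIntegral_indicator measurableSet_Ioi]
    congr 2
    ext u; simp only [mem_inter_iff, mem_Ioi]
    constructor
    · intro h; exact ⟨by linarith, h⟩
    · exact fun h => h.2
  rw [he]
  exact hd.comp s (by fun_prop)

lemma LSeries_eq_cint {s : ℂ} (hs : 1 < s.re) :
    DirichletCharacter.LFunction χ s = s * cint χ s + cden χ * (s / (s - 1)) := by
  have hs0 : s ≠ 0 := by intro h; simp [h] at hs; linarith
  have hs1 : s - 1 ≠ 0 := by intro h; rw [sub_eq_zero.1 h] at hs; simp at hs
  rw [DirichletCharacter.LFunction_eq_LSeries χ hs,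
    LSeries_eq_mul_integral _ zero_le_one (r := 1) (by simpa using hs)
      (χ.LSeriesSummable_of_one_lt_re hs)]
  · have hi : IntegrableOn (fun u : ℝ => cden χ * (u:ℂ) ^ (-s)) (Ioi 1) :=
      (integrableOn_Ioi_cpow_of_lt (by simpa using hs) one_pos).const_mul _
    have e : ∀ u ∈ Ioi (1:ℝ), (∑ k ∈ Finset.Icc 1 ⌊u⌋₊, χ k) * (u:ℂ) ^ (-(s + 1))
        = cerr χ u * (u:ℂ) ^ (-(s + 1)) + cden χ * (u:ℂ) ^ (-s) := by
      intro u hu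
      have hu0 : (u:ℂ) ≠ 0 := by exact_mod_cast (one_pos.trans hu).ne'
      have : (u:ℂ) ^ (-s) = u * (u:ℂ) ^ (-(s + 1)) := by
        nth_rewrite 2 [← cpow_one (u:ℂ)]
        rw [← cpow_add _ _ hu0]; ring_nf
      rw [this, cerr]; ring
    rw [setIntegral_congr_fun measurableSet_Ioi e,
      integral_add (integrableOn_cerr_mul χ (by linarith)) hi, integral_const_mul,
      integral_Ioi_cpow_of_lt (by simpa using hs) one_pos, mul_add]
    congr 1
    have : -s + 1 ≠ 0 := by intro h; apply hs1; linear_combination -h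
    simp
    field_simp
    ring
  · refine Asymptotics.IsBigO.of_bound 1 (Eventually.of_forall fun n => ?_)
    refine (norm_sum_le _ _).trans ((Finset.sum_le_sum fun x _ => χ.norm_le_one _).trans ?_)
    simp

/-- entire version of the L-function -/
noncomputable def LF : ℂ → ℂ :=
  open Classical in if χ = 1 then DirichletCharacter.LFunctionTrivChar₁ q
    else DirichletCharacter.LFunction χ

/-- indicator of the principal character -/
noncomputable def pri : ℕ := open Classical in if χ = 1 then 1 else 0

lemma LF_diff : Differentiable ℂ (LF χ) := by
  unfold LF
  split_ifs with h
  · exact DirichletCharacter.differentiable_LFunctionTrivChar₁ q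
  · exact DirichletCharacter.differentiable_LFunction h

lemma LF_eq_of_ne {s : ℂ} (hs : s ≠ 1) :
    LF χ s = (s - 1) ^ (pri χ) * DirichletCharacter.LFunction χ s := by
  unfold LF pri
  split_ifs with h
  · subst h
    rw [DirichletCharacter.LFunctionTrivChar₁, Function.update_of_ne hs, pow_one]
  · simp

lemma LF_of_ne_one (h : χ ≠ 1) : LF χ = DirichletCharacter.LFunction χ := by
  simp [LF, h]

lemma LF_ne_zero {s : ℂ} (hs : 1 ≤ s.re) : LF χ s ≠ 0 := by
  by_cases h1 : s = 1
  · subst h1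
    unfold LF
    split_ifs with h
    · exact DirichletCharacter.LFunctionTrivChar₁_apply_one_ne_zero q
    · exact DirichletCharacter.LFunction_apply_one_ne_zero h
  · rw [LF_eq_of_ne χ h1]
    exact mul_ne_zero (pow_ne_zero _ (sub_ne_zero.2 h1))
      (DirichletCharacter.LFunction_ne_zero_of_one_le_re χ (.inr h1) hs)

lemma LF_eq_cint {s : ℂ} (hs : 0 < s.re) :
    LF χ s = (s - 1) ^ (pri χ) * (s * cint χ s) + cden χ * s := by
  set U : Set ℂ := {s | 0 < s.re}
  have hU : IsOpen U := isOpen_lt continuous_const continuous_re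
  have hUc : IsPreconnected U := (convex_halfSpace_re_gt 0).isPreconnected
  have h1 : AnalyticOnNhd ℂ (LF χ) U := fun z _ => (LF_diff χ).analyticAt z
  have h2 : AnalyticOnNhd ℂ (fun s => (s - 1) ^ (pri χ) * (s * cint χ s) + cden χ * s) U := by
    apply DifferentiableOn.analyticOnNhd _ hU
    intro z hz
    have := differentiableAt_cint χ (s := z) hz
    exact DifferentiableAt.differentiableWithinAt (by fun_prop)
  have h3 := h1.eqOn_of_preconnected_of_eventuallyEq h2 hUc (z₀ := 2) (by simp [U]) (by
    have : {s : ℂ | 1 < s.re} ∈ 𝓝 (2:ℂ) :=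
      (isOpen_lt continuous_const continuous_re).mem_nhds (by simp)
    filter_upwards [this] with z hz
    have hz1 : z ≠ 1 := by rintro rfl; simp at hz
    have hz1' := sub_ne_zero.2 hz1
    rw [LF_eq_of_ne χ hz1, LSeries_eq_cint χ hz]
    unfold pri
    split_ifs with h
    · field_simp
    · rw [cden_eq_zero χ h]; simp)
  exact h3 hs

lemma LF_bound {s : ℂ} (hs : 1 / 2 ≤ s.re) : ‖LF χ s‖ ≤ 7 * q * (‖s‖ + 1) ^ 2 := by
  have hq1 : (1:ℝ) ≤ q := by exact_mod_cast NeZero.pos q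
  rw [LF_eq_cint χ (by linarith)]
  have h1 : ‖cint χ s‖ ≤ 6 * q := by
    refine (norm_cint_le χ (by linarith)).trans ?_
    rw [div_le_iff₀ (by linarith)]
    nlinarith
  have h2 : ‖(s - 1) ^ (pri χ)‖ ≤ ‖s‖ + 1 := by
    unfold pri
    split_ifs
    · simpa using norm_sub_le s 1
    · simp
  have h3 := norm_nonneg s
  have hB : ‖cden χ * s‖ ≤ ‖s‖ := by
    rw [norm_mul]; nlinarith [norm_cden χ]
  have hA : ‖(s - 1) ^ (pri χ) * (s * cint χ s)‖ ≤ (‖s‖ + 1) * (‖s‖ * (6 * q)) := by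
    rw [norm_mul, norm_mul]; gcongr
  refine (norm_add_le _ _).trans ?_
  have h6 : 0 ≤ ‖s‖ * q := by positivity
  have h7 : ‖s‖ ≤ ‖s‖ * q := by nlinarith
  nlinarith [mul_nonneg h3 h6]

lemma zeta_sum_bound {σ : ℝ} (h1 : 1 < σ) (h2 : σ ≤ 2) :
    ∑' n : ℕ, ‖LSeries.term 1 σ n‖ ≤ 5 / (σ - 1) := by
  have hs : (1:ℝ) < (σ:ℂ).re := by simpa using h1
  have e1 : ∀ n : ℕ, ((‖LSeries.term 1 σ n‖ : ℝ) : ℂ) = LSeries.term 1 σ n := by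
    intro n
    rw [LSeries.norm_term_eq, LSeries.term]
    split_ifs with h
    · simp
    · simp only [Pi.one_apply, norm_one, ofReal_re]
      rw [ofReal_div, ofReal_one, ofReal_cpow (by positivity)]
      simp
  have e2 : ((∑' n : ℕ, ‖LSeries.term 1 σ n‖ : ℝ) : ℂ) = riemannZeta σ := by
    rw [ofReal_tsum]
    simp_rw [e1]
    exact LSeries_one_eq_riemannZeta hs
  have hnn : 0 ≤ ∑' n : ℕ, ‖LSeries.term 1 σ n‖ := tsum_nonneg fun n => norm_nonneg _
  have e3 : (∑' n : ℕ, ‖LSeries.term 1 σ n‖) = ‖riemannZeta σ‖ := by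
    rw [← e2, norm_real, Real.norm_of_nonneg hnn]
  rw [e3]
  have hb := LSeries_eq_cint (1 : DirichletCharacter ℂ 1) hs
  rw [DirichletCharacter.LFunction_modOne_eq] at hb
  rw [hb]
  have hσ : (0:ℝ) < σ - 1 := by linarith
  have b1 := norm_cint_le (1 : DirichletCharacter ℂ 1) (s := σ) (by simp; linarith)
  have b2 := norm_cden (1 : DirichletCharacter ℂ 1)
  simp only [ofReal_re, Nat.cast_one, mul_one] at b1
  refine (norm_add_le _ _).trans ?_
  rw [norm_mul, norm_mul, norm_div, norm_real, Real.norm_of_nonneg (by linarith),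
    ← ofReal_one, ← ofReal_sub, norm_real, Real.norm_of_nonneg hσ.le]
  have c1 : σ * ‖cint (1 : DirichletCharacter ℂ 1) σ‖ ≤ 3 := by
    calc _ ≤ σ * (3 / σ) := by gcongr
      _ = 3 := by field_simp
  have c2 : ‖cden (1 : DirichletCharacter ℂ 1)‖ * (σ / (σ - 1)) ≤ σ / (σ - 1) := by
    have : 0 ≤ σ / (σ - 1) := by positivity
    nlinarith
  have c3 : 3 + σ / (σ - 1) ≤ 5 / (σ - 1) := by
    rw [← sub_nonneg]
    have : 5 / (σ - 1) - (3 + σ / (σ - 1)) = (8 - 4 * σ) / (σ - 1) := by field_simp; ring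
    rw [this]
    apply div_nonneg <;> linarith
  linarith

lemma L_lower {s : ℂ} (h1 : 1 < s.re) (h2 : s.re ≤ 2) :
    (s.re - 1) / 5 ≤ ‖DirichletCharacter.LFunction χ s‖ := by
  have e := DirichletCharacter.LSeries.mul_mu_eq_one χ h1
  rw [← DirichletCharacter.LFunction_eq_LSeries χ h1] at e
  have hb : ‖LSeries ((fun n : ℕ => χ n) * fun n => ((ArithmeticFunction.moebius n : ℤ) : ℂ)) s‖
      ≤ 5 / (s.re - 1) := by
    refine le_trans ?_ (zeta_sum_bound h1 h2)
    have hsum : Summable fun n => ‖LSeries.term 1 (s.re:ℂ) n‖ :=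
      ((LSeriesSummable_one_iff (s := (s.re:ℂ))).2 (by simpa using h1)).norm
    refine tsum_of_norm_bounded hsum.hasSum fun n => ?_
    rw [LSeries.norm_term_eq, LSeries.norm_term_eq]
    split_ifs with h
    · exact le_rfl
    · simp only [Pi.mul_apply, norm_mul, Pi.one_apply, norm_one, ofReal_re]
      gcongr
      have m1 : ‖((ArithmeticFunction.moebius n : ℤ) : ℂ)‖ ≤ 1 := by
        rw [Complex.norm_intCast]
        exact_mod_cast ArithmeticFunction.abs_moebius_le_one
      have m2 := χ.norm_le_one (n : ZMod q)
      nlinarith [norm_nonneg (χ n), norm_nonneg ((ArithmeticFunction.moebius n : ℤ) : ℂ)]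
  have h3 := congrArg norm e
  rw [norm_mul, norm_one] at h3
  have hσ : (0:ℝ) < s.re - 1 := by linarith
  have h4 : 1 ≤ ‖DirichletCharacter.LFunction χ s‖ * (5 / (s.re - 1)) := by
    nth_rewrite 1 [← h3]; gcongr
  rw [mul_div_assoc', le_div_iff₀ hσ] at h4
  linarith

lemma LF_lower {s : ℂ} (h1 : 1 < s.re) (h2 : s.re ≤ 2) :
    (s.re - 1) ^ 2 / 5 ≤ ‖LF χ s‖ := by
  have hs1 : s ≠ 1 := by rintro rfl; simp at h1
  rw [LF_eq_of_ne χ hs1, norm_mul]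
  have h3 := L_lower χ h1 h2
  have h4 : s.re - 1 ≤ ‖(s - 1) ^ pri χ‖ := by
    unfold pri
    split_ifs
    · have := re_le_norm (s - 1)
      simpa using this
    · simp; linarith
  have h5 : 0 < s.re - 1 := by linarith
  calc (s.re - 1) ^ 2 / 5 = (s.re - 1) * ((s.re - 1) / 5) := by ring
    _ ≤ _ := by gcongr

/-- twisted von Mangoldt function -/
noncomputable def chl (n : ℕ) : ℂ := χ n * ((ArithmeticFunction.vonMangoldt n : ℝ) : ℂ)

lemma LF_logDeriv {s : ℂ} (hs : 1 < s.re) :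
    LSeries (chl χ) s
      = (pri χ) / (s - 1) - deriv (LF χ) s / LF χ s := by
  have hs1 : s ≠ 1 := by rintro rfl; simp at hs
  have hs1' := sub_ne_zero.2 hs1
  have hL := DirichletCharacter.LFunction_ne_zero_of_one_le_re χ (.inr hs1) hs.le
  have e : chl χ = (fun n : ℕ => χ n) * fun n : ℕ => ((ArithmeticFunction.vonMangoldt n : ℝ) : ℂ) :=
    rfl
  rw [e, DirichletCharacter.LSeries_twist_vonMangoldt_eq χ hs,
    ← DirichletCharacter.deriv_LFunction_eq_deriv_LSeries χ hs,
    ← DirichletCharacter.LFunction_eq_LSeries χ hs]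
  unfold pri LF
  split_ifs with h
  · subst h
    rw [DirichletCharacter.deriv_LFunctionTrivChar₁_apply_of_ne_one q hs1,
      DirichletCharacter.LFunctionTrivChar₁, Function.update_of_ne hs1]
    simp only [DirichletCharacter.LFunctionTrivChar] at *
    field_simp
    push_cast
    ring
  · simp [neg_div]

end

end MA
end


section
open Complex Metric Set Filter Topology

namespace MA

set_option linter.unusedSectionVars false
section
variable {q : ℕ} [NeZero q]

lemma chl_summable (χ : DirichletCharacter ℂ q) {s : ℂ} (hs : 1 < s.re) :
    LSeriesSummable (chl χ) s :=
  χ.LSeriesSummable_twist_vonMangoldt hs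

lemma chl_hasSum_re (χ : DirichletCharacter ℂ q) {s : ℂ} (hs : 1 < s.re) :
    HasSum (fun n => (LSeries.term (chl χ) s n).re) (LSeries (chl χ) s).re :=
  Complex.hasSum_re (chl_summable χ hs).hasSum

lemma term_re (χ : DirichletCharacter ℂ q) {σ t : ℝ} {n : ℕ} (hn : n ≠ 0) :
    (LSeries.term (chl χ) (σ + t * I) n).re =
      (ArithmeticFunction.vonMangoldt n * (n:ℝ) ^ (-σ)) * (χ n * (n:ℂ) ^ (-(t * I))).re := by
  have hn' : (n:ℂ) ≠ 0 := by exact_mod_cast hn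
  rw [LSeries.term_of_ne_zero hn, chl, div_eq_mul_inv, ← cpow_neg, neg_add, cpow_add _ _ hn']
  have : (n:ℂ) ^ (-(σ:ℂ)) = (((n:ℝ) ^ (-σ) : ℝ) : ℂ) := by
    rw [ofReal_cpow (by positivity)]; push_cast; rfl
  rw [this, ← re_ofReal_mul]
  congr 1
  push_cast
  ring

lemma norm_npow_I {n : ℕ} (hn : n ≠ 0) (t : ℝ) : ‖(n:ℂ) ^ (-(t * I))‖ = 1 := by
  rw [norm_natCast_cpow_of_pos (Nat.pos_of_ne_zero hn)]; simp

lemma npow_two (n : ℕ) (t : ℝ) :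
    (n:ℂ) ^ (-(((2 * t : ℝ):ℂ) * I)) = ((n:ℂ) ^ (-(t * I))) ^ 2 := by
  rw [← cpow_nat_mul]; congr 1; push_cast; ring

lemma three_four_one (χ : DirichletCharacter ℂ q) {σ : ℝ} (hσ : 1 < σ) (t : ℝ) :
    0 ≤ 3 * (LSeries (chl (1 : DirichletCharacter ℂ q)) σ).re
      + 4 * (LSeries (chl χ) (σ + t * I)).re
      + (LSeries (chl (χ ^ 2)) (σ + ((2 * t : ℝ) : ℂ) * I)).re := by
  have h1 := chl_hasSum_re (1 : DirichletCharacter ℂ q) (s := σ + ((0:ℝ):ℂ) * I) (by simpa using hσ)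
  have h2 := chl_hasSum_re χ (s := σ + t * I) (by simpa using hσ)
  have h3 := chl_hasSum_re (χ ^ 2) (s := σ + ((2 * t : ℝ) : ℂ) * I) (by simpa using hσ)
  have h := ((h1.mul_left 3).add (h2.mul_left 4)).add h3
  have e : (σ:ℂ) + ((0:ℝ):ℂ) * I = σ := by simp
  rw [e] at h
  refine h.nonneg fun n => ?_
  by_cases hn : n = 0
  · simp [hn]
  have e0 : (LSeries.term (chl (1 : DirichletCharacter ℂ q)) σ n).re
      = (LSeries.term (chl (1 : DirichletCharacter ℂ q)) (σ + ((0:ℝ):ℂ) * I) n).re := by rw [e]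
  rw [e0, term_re _ hn, term_re _ hn, term_re _ hn, npow_two]
  have hw := norm_npow_I hn t
  set w := (n:ℂ) ^ (-(t * I)) with hw'
  have hA : 0 ≤ ArithmeticFunction.vonMangoldt n * (n:ℝ) ^ (-σ) :=
    mul_nonneg ArithmeticFunction.vonMangoldt_nonneg (by positivity)
  set A := ArithmeticFunction.vonMangoldt n * (n:ℝ) ^ (-σ)
  by_cases hu : IsUnit (n : ZMod q)
  · have hz : ‖χ n * w‖ = 1 := by
      rw [norm_mul, hw, mul_one]
      obtain ⟨u, hu⟩ := hu
      rw [← hu]; exact χ.unit_norm_eq_one u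
    have e2 : (χ ^ 2) n * w ^ 2 = (χ n * w) ^ 2 := by
      rw [MulChar.pow_apply' χ two_ne_zero]; ring
    rw [e2, MulChar.one_apply hu]
    set z := χ n * w
    have hz2 : z.re ^ 2 + z.im ^ 2 = 1 := by
      have := Complex.sq_norm z
      rw [hz, normSq_apply] at this; linarith
    have : (z ^ 2).re = z.re ^ 2 - z.im ^ 2 := by rw [sq, mul_re]; ring
    rw [this]
    have e3 : ((1:ℂ) * (n:ℂ) ^ (-(((0:ℝ):ℂ) * I))).re = 1 := by simp
    rw [e3]
    have : 3 * (A * 1) + 4 * (A * z.re) + A * (z.re ^ 2 - z.im ^ 2) = 2 * A * (1 + z.re) ^ 2 := by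
      linear_combination (-A) * hz2
    rw [this]; positivity
  · rw [MulChar.map_nonunit _ hu, MulChar.map_nonunit _ hu, MulChar.map_nonunit _ hu]; simp

/-- real characters take real values -/
lemma real_char {χ : DirichletCharacter ℂ q} (h : χ ^ 2 = 1) (n : ZMod q) :
    (χ n = 1 ∨ χ n = -1) ∨ (¬ IsUnit n ∧ χ n = 0) := by
  by_cases hu : IsUnit n
  · left
    have : χ n ^ 2 = 1 := by
      rw [← MulChar.pow_apply' χ two_ne_zero, h, MulChar.one_apply hu]
    exact sq_eq_sq_iff_eq_or_eq_neg.1 (by rw [this, one_pow])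
  · right; exact ⟨hu, MulChar.map_nonunit _ hu⟩

lemma two_char_nonneg {χ ψ : DirichletCharacter ℂ q} (hχ : χ ^ 2 = 1) (hψ : ψ ^ 2 = 1)
    {σ : ℝ} (hσ : 1 < σ) :
    0 ≤ (LSeries (chl (1 : DirichletCharacter ℂ q)) σ).re + (LSeries (chl χ) σ).re
      + (LSeries (chl ψ) σ).re + (LSeries (chl (χ * ψ)) σ).re := by
  have hs : 1 < ((σ:ℂ) + ((0:ℝ):ℂ) * I).re := by simpa using hσ
  have h := (((chl_hasSum_re (1 : DirichletCharacter ℂ q) hs).add (chl_hasSum_re χ hs)).add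
    (chl_hasSum_re ψ hs)).add (chl_hasSum_re (χ * ψ) hs)
  have e : (σ:ℂ) + ((0:ℝ):ℂ) * I = σ := by simp
  rw [e] at h
  refine h.nonneg fun n => ?_
  by_cases hn : n = 0
  · simp [hn]
  rw [← e, term_re _ hn, term_re _ hn, term_re _ hn, term_re _ hn]
  have hA : 0 ≤ ArithmeticFunction.vonMangoldt n * (n:ℝ) ^ (-σ) :=
    mul_nonneg ArithmeticFunction.vonMangoldt_nonneg (by positivity)
  set A := ArithmeticFunction.vonMangoldt n * (n:ℝ) ^ (-σ)
  by_cases hu : IsUnit (n : ZMod q)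
  · rw [MulChar.one_apply hu, MulChar.mul_apply]
    rcases real_char hχ (n : ZMod q) with (a | a) | a
    all_goals rcases real_char hψ (n : ZMod q) with (b | b) | b
    all_goals first
      | exact absurd hu a.1
      | exact absurd hu b.1
      | (rw [a, b]; simp; try linarith)
  · rw [MulChar.map_nonunit _ hu, MulChar.map_nonunit _ hu, MulChar.map_nonunit _ hu,
      MulChar.map_nonunit _ hu]; simp

lemma one_char_nonneg {χ : DirichletCharacter ℂ q} (hχ : χ ^ 2 = 1)
    {σ : ℝ} (hσ : 1 < σ) :
    0 ≤ (LSeries (chl (1 : DirichletCharacter ℂ q)) σ).re + (LSeries (chl χ) σ).re := by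
  have := two_char_nonneg hχ (one_pow 2) hσ
  rw [mul_one] at this
  linarith

end
end MA
end


section
open Complex Metric Set Filter Topology

namespace MA

set_option linter.unusedSectionVars false
section
variable {q : ℕ} [NeZero q]

lemma ell_ge_one (q : ℕ) [NeZero q] {T : ℝ} (hT : 3 ≤ T) : 1 ≤ Real.log (q * T) := by
  have hq1 : (1:ℝ) ≤ q := by exact_mod_cast NeZero.pos q
  rw [Real.le_log_iff_exp_le (by positivity)]
  have := Real.exp_one_lt_d9
  nlinarith

lemma log_le_two_sqrt {x : ℝ} (hx : 0 < x) : Real.log x ≤ 2 * Real.sqrt x := by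
  have h := Real.add_one_le_exp (Real.log (Real.sqrt x))
  rw [Real.exp_log (Real.sqrt_pos.2 hx), Real.log_sqrt hx.le] at h
  linarith

lemma lambda_le (χ : DirichletCharacter ℂ q) {T a : ℝ} (hT : 3 ≤ T) (ha : 0 < a) (ha1 : a ≤ 1)
    {t : ℝ} (ht : |t| ≤ 2 * T) (l : List ℂ) (g : ℂ → ℂ) (hg : Differentiable ℂ g)
    {s : ℂ} (hs : s = ((1 + a / Real.log (q * T) : ℝ) : ℂ) + t * I)
    (hl : ∀ ρ ∈ l, ρ ∈ ball s (1/2)) (hF : ∀ z, LF χ z = lprod l z * g z) :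
    (LSeries (chl χ) s).re ≤ ((pri χ : ℂ) / (s - 1)).re + 624 * Real.log (q * T) / Real.sqrt a
      - (l.map fun ρ => ((1 / (s - ρ)).re - 4 * (s - ρ).re)).sum := by
  have hl1 := ell_ge_one q hT
  set ℓ := Real.log (q * T) with hℓ
  have hq1 : (1:ℝ) ≤ q := by exact_mod_cast NeZero.pos q
  have hqT : (3:ℝ) ≤ q * T := by nlinarith
  have haℓ : 0 < a / ℓ := by positivity
  have haℓ1 : a / ℓ ≤ 1 := by rw [div_le_one (by linarith)]; linarith
  have hre : s.re = 1 + a / ℓ := by rw [hs]; simp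
  have him : s.im = t := by rw [hs]; simp
  have hsr : 1 < s.re := by rw [hre]; linarith
  set M := 13 * ℓ / Real.sqrt a with hM
  have hsa : 0 < Real.sqrt a := Real.sqrt_pos.2 ha
  have hsa1 : Real.sqrt a ≤ 1 := Real.sqrt_le_one.2 ha1
  have hM0 : 0 < M := by positivity
  have hlow := LF_lower χ hsr (by rw [hre]; linarith)
  have hb : ∀ z ∈ closedBall s (1/2), ‖LF χ z‖ ≤ Real.exp M * ‖LF χ s‖ := by
    intro z hz
    rw [mem_closedBall, dist_eq_norm] at hz
    have h1 : 1/2 ≤ z.re := by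
      have := (abs_le.1 ((abs_re_le_norm (z - s)).trans hz)).1
      rw [sub_re] at this; linarith
    have h2 : ‖z‖ ≤ 2 * T + 5/2 := by
      have h3 : ‖s‖ ≤ |s.re| + |s.im| := norm_le_abs_re_add_abs_im s
      rw [him, hre, abs_of_pos (by linarith)] at h3
      have h4 := norm_add_le (z - s) s
      rw [sub_add_cancel] at h4
      linarith
    have h5 := LF_bound χ h1
    have h6 : ‖LF χ z‖ ≤ 112 * (q * T) ^ 2 := by
      refine h5.trans ?_
      have h7 : (‖z‖ + 1) ^ 2 ≤ (4 * T) ^ 2 :=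
        pow_le_pow_left₀ (by positivity) (by linarith) 2
      calc 7 * q * (‖z‖ + 1) ^ 2 ≤ 7 * q * (4 * T) ^ 2 := by gcongr
        _ = 112 * (q * T ^ 2) := by ring
        _ ≤ 112 * (q ^ 2 * T ^ 2) := by
          gcongr; nlinarith
        _ = _ := by ring
    have h7 : 112 * (q * T) ^ 2 ≤ Real.exp M * ((a/ℓ) ^ 2 / 5) := by
      have e1 : Real.exp (7 + 2 * ℓ + 2 * Real.log (ℓ / a)) ≤ Real.exp M := by
        rw [Real.exp_le_exp]
        have := log_le_two_sqrt (x := ℓ / a) (by positivity)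
        rw [Real.sqrt_div (by linarith)] at this
        have h8 : Real.sqrt ℓ ≤ ℓ := by
          rw [Real.sqrt_le_left (by linarith)]; nlinarith
        have h9 : Real.sqrt ℓ / Real.sqrt a ≤ ℓ / Real.sqrt a := by gcongr
        have h10 : ℓ ≤ ℓ / Real.sqrt a := by
          rw [le_div_iff₀ hsa]; nlinarith
        have : M = 13 * (ℓ / Real.sqrt a) := by rw [hM]; ring
        rw [this]; linarith
      rw [Real.exp_add, Real.exp_add] at e1
      have e2 : Real.exp (2 * ℓ) = (q * T) ^ 2 := by
        rw [two_mul, Real.exp_add, hℓ, Real.exp_log (by linarith)]; ring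
      have e3 : Real.exp (2 * Real.log (ℓ / a)) = (ℓ / a) ^ 2 := by
        rw [two_mul, Real.exp_add, Real.exp_log (by positivity)]; ring
      have e4 : (560:ℝ) ≤ Real.exp 7 := by
        have := Real.exp_one_gt_d9
        have : (2.7:ℝ) ^ 7 ≤ Real.exp 1 ^ 7 := by gcongr; linarith
        rw [← Real.exp_nat_mul] at this
        norm_num at this ⊢
        linarith
      rw [e2, e3] at e1
      have e5 : 560 * (q * T) ^ 2 * (ℓ / a) ^ 2 ≤ Real.exp M := le_trans (by gcongr) e1
      calc 112 * (q * T) ^ 2 = (560 * (q * T) ^ 2 * (ℓ / a) ^ 2) * ((a/ℓ) ^ 2 / 5) := by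
            field_simp; ring
        _ ≤ _ := by gcongr
    refine h6.trans (h7.trans ?_)
    gcongr
    rw [hre] at hlow
    simpa using hlow
  have key := re_logDeriv_ge (R := 1/2) (M := M) (c := s) (by norm_num) hM0 l (LF χ) g hg hl hF
    (LF_ne_zero χ hsr.le) (fun z hz => by
      by_contra h
      exact LF_ne_zero χ (by linarith) hz) hb
  rw [LF_logDeriv χ hsr, sub_re]
  have e1 : 24 * M / (1/2) = 624 * ℓ / Real.sqrt a := by rw [hM]; ring
  have e2 : (l.map fun ρ => ((1 / (s - ρ)).re - (s - ρ).re / (1/2) ^ 2)).sum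
      = (l.map fun ρ => ((1 / (s - ρ)).re - 4 * (s - ρ).re)).sum := by
    congr 2; ext ρ; ring
  rw [e1, e2] at key
  linarith

lemma lambda_le' (χ : DirichletCharacter ℂ q) {T a : ℝ} (hT : 3 ≤ T) (ha : 0 < a) (ha1 : a ≤ 1)
    {t : ℝ} (ht : |t| ≤ 2 * T)
    {s : ℂ} (hs : s = ((1 + a / Real.log (q * T) : ℝ) : ℂ) + t * I) :
    (LSeries (chl χ) s).re
      ≤ ((pri χ : ℂ) / (s - 1)).re + 624 * Real.log (q * T) / Real.sqrt a := by
  have := lambda_le χ hT ha ha1 ht [] (LF χ) (LF_diff χ) hs (by simp) (by simp [lprod])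
  simpa using this

/-- factor out one zero -/
lemma factor_one {F : ℂ → ℂ} (hF : Differentiable ℂ F) {ρ : ℂ} (h : F ρ = 0) :
    Differentiable ℂ (dslope F ρ) ∧ ∀ z, F z = (z - ρ) * dslope F ρ z := by
  refine ⟨?_, fun z => ?_⟩
  · rw [← differentiableOn_univ] at *
    exact (Complex.differentiableOn_dslope univ_mem).2 hF
  · have := sub_smul_dslope F ρ z
    rw [h, sub_zero, smul_eq_mul] at this
    exact this.symm

lemma trivial_no_small_zero {s : ℂ} (hs : ‖s - 1‖ < 1/5) : LF (1 : DirichletCharacter ℂ q) s ≠ 0 := by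
  have hre : 4/5 < s.re := by
    have := (abs_lt.1 ((abs_re_le_norm (s - 1)).trans_lt hs)).1
    rw [sub_re, one_re] at this; linarith
  by_cases h1 : s = 1
  · subst h1; exact LF_ne_zero _ (by simp)
  rw [LF_eq_of_ne _ h1]
  refine mul_ne_zero (pow_ne_zero _ (sub_ne_zero.2 h1)) ?_
  have e := DirichletCharacter.LFunctionTrivChar_eq_mul_riemannZeta (N := q) h1
  rw [DirichletCharacter.LFunctionTrivChar] at e
  rw [e]
  apply mul_ne_zero
  · rw [Finset.prod_ne_zero_iff]
    intro p hp h0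
    have hp' := Nat.prime_of_mem_primeFactors hp
    have h2 : ‖(p:ℂ) ^ (-s)‖ = 1 := by rw [← sub_eq_zero.1 h0]; simp
    rw [norm_natCast_cpow_of_pos hp'.pos, neg_re] at h2
    have : (p:ℝ) ^ (-s.re) < 1 :=
      Real.rpow_lt_one_of_one_lt_of_neg (by exact_mod_cast hp'.one_lt) (by linarith)
    linarith
  · intro hz
    have h3 : LF (1 : DirichletCharacter ℂ 1) s = 0 := by
      rw [LF_eq_of_ne _ h1, DirichletCharacter.LFunction_modOne_eq, hz, mul_zero]
    rw [LF_eq_cint _ (by linarith)] at h3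
    have hs0 : s ≠ 0 := by intro h; rw [h] at hre; simp at hre; linarith
    have hc : cden (1 : DirichletCharacter ℂ 1) = 1 := by
      rw [cden]; simp
      exact (congrArg (1 : DirichletCharacter ℂ 1) (Subsingleton.elim _ _)).trans (map_one _)
    have hp : pri (1 : DirichletCharacter ℂ 1) = 1 := by simp [pri]
    rw [hc, hp, pow_one, one_mul] at h3
    have h4 : (s - 1) * cint (1 : DirichletCharacter ℂ 1) s = -1 := by
      have : s * ((s - 1) * cint (1 : DirichletCharacter ℂ 1) s + 1) = 0 := by
        linear_combination h3
      rcases mul_eq_zero.1 this with h | h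
      · exact absurd h hs0
      · linear_combination h
    have h5 := congrArg norm h4
    rw [norm_mul, norm_neg, norm_one] at h5
    have h6 := norm_cint_le (1 : DirichletCharacter ℂ 1) (s := s) (by linarith)
    have h7 : 3 * ((1:ℕ):ℝ) / s.re ≤ 15/4 := by
      rw [div_le_iff₀ (by linarith)]; push_cast; linarith
    have := norm_nonneg (s - 1)
    have := norm_nonneg (cint (1 : DirichletCharacter ℂ 1) s)
    nlinarith

end
end MA
end


section
open Complex Metric Set Filter Topology

namespace MA

set_option linter.unusedSectionVars false
section
variable {q : ℕ} [NeZero q]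

lemma LF_conj {χ : DirichletCharacter ℂ q} (h : χ ^ 2 = 1) {s : ℂ} (hs : 0 < s.re) :
    LF χ ((starRingEnd ℂ) s) = (starRingEnd ℂ) (LF χ s) := by
  have hr : ∀ n : ZMod q, (starRingEnd ℂ) (χ n) = χ n := by
    intro n
    rcases real_char h n with (a | a) | a
    · rw [a]; simp
    · rw [a]; simp
    · rw [a.2]; simp
  have hd : (starRingEnd ℂ) (cden χ) = cden χ := by
    simp [cden, hr]
  have hi : (starRingEnd ℂ) (cint χ s) = cint χ ((starRingEnd ℂ) s) := by
    rw [cint, cint, ← integral_conj]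
    refine MeasureTheory.setIntegral_congr_fun measurableSet_Ioi fun u hu => ?_
    have hu0 : (0:ℝ) < u := one_pos.trans hu
    simp only [map_mul]
    congr 1
    · simp [cerr, hr, hd]
    · rw [show -((starRingEnd ℂ) s + 1) = (starRingEnd ℂ) (-(s + 1)) by simp,
        cpow_conj _ _ (by rw [arg_ofReal_of_nonneg hu0.le]; exact Real.pi_pos.ne), conj_ofReal]
  rw [LF_eq_cint χ (by simpa using hs), LF_eq_cint χ hs]
  simp [hi, hd]

/-- basic small constant -/
noncomputable def aa : ℝ := 1 / 10 ^ 10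

lemma sqrt_aa : Real.sqrt aa = 1 / 10 ^ 5 := by
  rw [aa, Real.sqrt_eq_iff_mul_self_eq_of_pos (by norm_num)]; norm_num

lemma sqrt_4aa : Real.sqrt (4 * aa) = 2 / 10 ^ 5 := by
  rw [aa, Real.sqrt_eq_iff_mul_self_eq_of_pos (by norm_num)]; norm_num

lemma re_pole {x y : ℝ} (_hx : 0 < x) (p : ℕ) :
    ((p:ℂ) / ((x:ℂ) + y * I)).re = p * (x / (x ^ 2 + y ^ 2)) := by
  have : normSq ((x:ℂ) + y * I) = x ^ 2 + y ^ 2 := normSq_add_mul_I x y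
  rw [div_re, this]
  simp
  ring

lemma pri_one : pri (1 : DirichletCharacter ℂ q) = 1 := by simp [pri]
lemma pri_ne {χ : DirichletCharacter ℂ q} (h : χ ≠ 1) : pri χ = 0 := by simp [pri, h]
lemma pri_le (χ : DirichletCharacter ℂ q) : pri χ ≤ 1 := by unfold pri; split_ifs <;> simp

lemma pole_small {x y k : ℝ} (hx : 0 < x) (hk : 0 ≤ k) (hy : k * x ≤ |y|) :
    x / (x ^ 2 + y ^ 2) ≤ (1 / (1 + k ^ 2)) / x := by
  have h1 : (k * x) ^ 2 ≤ y ^ 2 := by rw [← sq_abs y]; gcongr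
  have h2 : x ^ 2 * (1 + k ^ 2) ≤ x ^ 2 + y ^ 2 := by nlinarith
  rw [div_div, div_le_div_iff₀ (by positivity) (by positivity)]
  nlinarith

lemma zf1 (χ : DirichletCharacter ℂ q) {T : ℝ} (hT : 3 ≤ T) {ρ : ℂ} (hz : LF χ ρ = 0)
    (hi : |ρ.im| ≤ T) (hc : χ = 1 ∨ χ ^ 2 ≠ 1 ∨ aa / Real.log (q * T) ≤ |ρ.im|) :
    ρ.re ≤ 1 - aa / 5 / Real.log (q * T) := by
  by_contra hcon
  push Not at hcon
  have hl1 := ell_ge_one q hT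
  set ℓ := Real.log (q * T) with hℓ
  have haa : 0 < aa := by norm_num [aa]
  have haa1 : aa ≤ 1 := by norm_num [aa]
  have hβ1 : ρ.re < 1 := by
    by_contra h; exact LF_ne_zero χ (by linarith) hz
  set x := aa / ℓ with hx
  have hx0 : 0 < x := by positivity
  have hx5 : aa / 5 / ℓ = x / 5 := by rw [hx]; ring
  rw [hx5] at hcon
  have hxs : x ≤ aa := by rw [hx, div_le_iff₀ (by linarith)]; nlinarith
  have hxs' : x ≤ 1 / 10 ^ 10 := hxs
  have hx1 : 1 / x = 10 ^ 10 * ℓ := by rw [hx, aa]; field_simp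
  -- location when χ = 1
  have hloc : χ = 1 → 5 * x ≤ |ρ.im| := by
    rintro rfl
    by_contra h
    push Not at h
    refine trivial_no_small_zero (q := q) (s := ρ) ?_ hz
    refine (norm_le_abs_re_add_abs_im _).trans_lt ?_
    simp only [sub_re, one_re, sub_im, one_im, sub_zero]
    rw [abs_of_neg (by linarith)]
    linarith
  set t := ρ.im with ht
  have hT2 : |t| ≤ 2 * T := by linarith
  have hT4 : |2 * t| ≤ 2 * T := by rw [abs_mul, abs_two]; linarith
  have h341 := three_four_one χ (σ := 1 + x) (by linarith) t
  -- bounds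
  have b1 := lambda_le' (1 : DirichletCharacter ℂ q) hT haa haa1 (t := 0) (by simp; linarith)
    (s := ((1 + x : ℝ):ℂ)) (by simp [hx, hℓ])
  have b3 := lambda_le' (χ ^ 2) hT haa haa1 hT4
    (s := ((1 + x : ℝ):ℂ) + ((2 * t : ℝ) : ℂ) * I) rfl
  obtain ⟨f1, f2⟩ := factor_one (LF_diff χ) hz
  have hsρ : ((1 + x : ℝ):ℂ) + t * I - ρ = ((1 + x - ρ.re : ℝ) : ℂ) := by
    apply Complex.ext <;> simp [ht]
  have b2 := lambda_le χ hT haa haa1 hT2 [ρ] (dslope (LF χ) ρ) f1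
    (s := ((1 + x : ℝ):ℂ) + t * I) rfl (by
      intro ρ' h
      rw [List.mem_singleton] at h
      rw [h, mem_ball, dist_comm, dist_eq_norm, hsρ, norm_real, Real.norm_eq_abs,
        abs_of_pos (by linarith)]
      linarith) (by intro z; rw [f2]; simp [lprod])
  rw [← hℓ, sqrt_aa] at b1 b2 b3
  simp only [List.map_cons, List.map_nil, List.sum_cons, List.sum_nil, add_zero, hsρ] at b2
  rw [← ofReal_one, ← ofReal_div, ofReal_re, ofReal_re] at b2
  have c1 : ((1 + x : ℝ):ℂ) - 1 = (x:ℂ) + ((0:ℝ):ℂ) * I := by push_cast; ring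
  have c2 : ((1 + x : ℝ):ℂ) + t * I - ((1:ℝ):ℂ) = (x:ℂ) + (t:ℂ) * I := by push_cast; ring
  have c3 : ((1 + x : ℝ):ℂ) + ((2 * t : ℝ) : ℂ) * I - 1 = (x:ℂ) + ((2 * t : ℝ):ℂ) * I := by
    push_cast; ring
  rw [c1, re_pole hx0, pri_one] at b1
  rw [c2, re_pole hx0] at b2
  rw [c3, re_pole hx0] at b3
  have d1 : ((1:ℕ):ℝ) * (x / (x ^ 2 + 0 ^ 2)) = 10 ^ 10 * ℓ := by
    rw [← hx1]; field_simp; simp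
  rw [d1] at b1
  have d2 : 4 * (pri χ * (x / (x ^ 2 + t ^ 2))) + pri (χ ^ 2) * (x / (x ^ 2 + (2 * t) ^ 2))
      ≤ (1/5) * (1 / x) := by
    by_cases h1 : χ = 1
    · have h2 := hloc h1
      have p1 := pole_small (k := 5) (y := t) hx0 (by norm_num) h2
      have p2 := pole_small (k := 10) (y := 2 * t) hx0 (by norm_num)
        (by rw [abs_mul, abs_two]; linarith)
      have e1 : χ ^ 2 = 1 := by rw [h1, one_pow]
      rw [e1, h1, pri_one]
      have : 0 < 1 / x := by positivity
      have q1 : 1 / (1 + (5:ℝ) ^ 2) / x = (1 / 26) * (1 / x) := by norm_num; ring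
      have q2 : 1 / (1 + (10:ℝ) ^ 2) / x = (1 / 101) * (1 / x) := by norm_num; ring
      rw [q1] at p1
      rw [q2] at p2
      push_cast
      linarith
    · rw [pri_ne h1]
      rcases hc with h | h | h
      · exact absurd h h1
      · rw [pri_ne h]; simp; positivity
      · have p2 := pole_small (k := 2) (y := 2 * t) hx0 (by norm_num)
          (by rw [abs_mul, abs_two]; linarith)
        have q2 : 1 / (1 + (2:ℝ) ^ 2) / x = (1 / 5) * (1 / x) := by norm_num; ring
        rw [q2] at p2
        have p3 : (pri (χ ^ 2) : ℝ) ≤ 1 := by exact_mod_cast pri_le _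
        have p4 : 0 ≤ x / (x ^ 2 + (2 * t) ^ 2) := by positivity
        have : 0 < 1 / x := by positivity
        simp only [Nat.cast_zero, zero_mul, mul_zero, zero_add]
        nlinarith
  have d3 : (5/6) * (1 / x) ≤ 1 / (1 + x - ρ.re) := by
    rw [mul_one_div, div_le_div_iff₀ hx0 (by linarith)]
    linarith
  rw [hx1] at d2 d3
  have d4 : 1 + x - ρ.re ≤ ℓ := by linarith
  have e5 : 624 * ℓ / (1 / 10 ^ 5) = 62400000 * ℓ := by ring
  rw [e5] at b1 b2 b3
  linarith

/-- lower bound of the zero contribution -/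
lemma zero_contrib {x : ℝ} (hx : 0 < x) (hx1 : x ≤ 1 / 10) {ρ : ℂ} (hβ1 : ρ.re < 1)
    (hβ : 1 - x / 20 < ρ.re) (hγ : |ρ.im| ≤ x / 4) :
    ρ ∈ ball (((1 + x : ℝ):ℂ) + ((0:ℝ):ℂ) * I) (1/2) ∧
    (89/100) * (1 / x) - 8 * x ≤ (1 / (((1 + x : ℝ):ℂ) + ((0:ℝ):ℂ) * I - ρ)).re
      - 4 * (((1 + x : ℝ):ℂ) + ((0:ℝ):ℂ) * I - ρ).re := by
  set u := 1 + x - ρ.re with hu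
  have e : ((1 + x : ℝ):ℂ) + ((0:ℝ):ℂ) * I - ρ = (u:ℂ) + ((-ρ.im : ℝ):ℂ) * I := by
    apply Complex.ext <;> simp [hu]
  have hu0 : 0 < u := by linarith
  have hu1 : u ≤ 21/20 * x := by linarith
  constructor
  · rw [mem_ball, dist_comm, dist_eq_norm]
    refine (norm_le_abs_re_add_abs_im _).trans_lt ?_
    rw [e]
    simp only [add_re, ofReal_re, mul_re, I_re, mul_zero, ofReal_im, I_im, mul_one, sub_self,
      add_zero, add_im, mul_im, zero_add]
    rw [abs_of_pos hu0, abs_neg]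
    linarith
  · rw [e]
    have h1 := re_pole (x := u) (y := -ρ.im) hu0 1
    rw [Nat.cast_one, Nat.cast_one, one_mul] at h1
    rw [h1]
    have h2 : (89/100) * (1 / x) ≤ u / (u ^ 2 + (-ρ.im) ^ 2) := by
      have h3 : ρ.im ^ 2 ≤ (x / 4) ^ 2 := by rw [← sq_abs]; gcongr
      rw [mul_one_div, div_le_div_iff₀ hx (by positivity)]
      have h4 : x ≤ u := by linarith
      nlinarith
    have h5 : ((u:ℂ) + ((-ρ.im : ℝ):ℂ) * I).re = u := by simp
    rw [h5]
    linarith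

lemma zf2 {χ : DirichletCharacter ℂ q} (hχ1 : χ ≠ 1) (hχ : χ ^ 2 = 1) {T : ℝ} (hT : 3 ≤ T)
    {ρ₁ ρ₂ : ℂ} {g : ℂ → ℂ} (hg : Differentiable ℂ g)
    (hF : ∀ z, LF χ z = (z - ρ₁) * ((z - ρ₂) * g z))
    (h1 : 1 - aa / 5 / Real.log (q * T) < ρ₁.re) (h2 : 1 - aa / 5 / Real.log (q * T) < ρ₂.re)
    (h1' : |ρ₁.im| ≤ aa / Real.log (q * T)) (h2' : |ρ₂.im| ≤ aa / Real.log (q * T)) : False := by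
  have hl1 := ell_ge_one q hT
  set ℓ := Real.log (q * T) with hℓ
  have haa : 0 < aa := by norm_num [aa]
  set x := 4 * aa / ℓ with hx
  have hx0 : 0 < x := by positivity
  have hx1 : 1 / x = 2500000000 * ℓ := by rw [hx, aa]; field_simp; norm_num
  have hxs : x ≤ 4 * aa := by rw [hx, div_le_iff₀ (by linarith)]; nlinarith
  have hxs' : x ≤ 1/10 := hxs.trans (by norm_num [aa])
  have e1 : aa / 5 / ℓ = x / 20 := by rw [hx]; ring
  have e2 : aa / ℓ = x / 4 := by rw [hx]; ring
  rw [e1] at h1 h2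
  rw [e2] at h1' h2'
  have hb1 : ρ₁.re < 1 := by
    by_contra h; exact LF_ne_zero χ (s := ρ₁) (by linarith) (by rw [hF]; ring)
  have hb2 : ρ₂.re < 1 := by
    by_contra h; exact LF_ne_zero χ (s := ρ₂) (by linarith) (by rw [hF]; ring)
  obtain ⟨m1, k1⟩ := zero_contrib hx0 hxs' hb1 h1 h1'
  obtain ⟨m2, k2⟩ := zero_contrib hx0 hxs' hb2 h2 h2'
  have hn := one_char_nonneg hχ (σ := 1 + x) (by linarith)
  have e0 : ((1 + x : ℝ):ℂ) + ((0:ℝ):ℂ) * I = ((1 + x : ℝ):ℂ) := by simp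
  have b1 := lambda_le' (1 : DirichletCharacter ℂ q) hT (a := 4 * aa) (by linarith)
    (by norm_num [aa]) (t := 0) (by simp; linarith) (s := ((1 + x : ℝ):ℂ)) (by rw [e0])
  have b2 := lambda_le χ hT (a := 4 * aa) (by linarith)
    (by norm_num [aa]) (t := 0) (by simp; linarith) [ρ₁, ρ₂] g hg (s := ((1 + x : ℝ):ℂ))
    (by rw [e0]) (by
      rw [← e0]
      intro ρ h
      simp only [List.mem_cons, List.not_mem_nil, or_false] at h
      rcases h with h | h <;> rw [h] <;> assumption) (by intro z; rw [hF]; simp [lprod, mul_assoc])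
  rw [e0] at k1 k2
  rw [← hℓ, sqrt_4aa] at b1 b2
  rw [pri_ne hχ1] at b2
  simp only [List.map_cons, List.map_nil, List.sum_cons, List.sum_nil, add_zero] at b2
  have c1 : ((1 + x : ℝ):ℂ) - 1 = (x:ℂ) + ((0:ℝ):ℂ) * I := by push_cast; ring
  rw [c1, re_pole hx0, pri_one] at b1
  have d1 : ((1:ℕ):ℝ) * (x / (x ^ 2 + 0 ^ 2)) = 1 / x := by field_simp; simp
  rw [d1] at b1
  rw [hx1] at b1 k1 k2
  have e5 : 624 * ℓ / (2 / 10 ^ 5) = 31200000 * ℓ := by ring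
  rw [e5] at b1 b2
  simp only [Nat.cast_zero, zero_div, zero_re, zero_add] at b2
  linarith

lemma zf3 {χ ψ : DirichletCharacter ℂ q} (hχ1 : χ ≠ 1) (hχ : χ ^ 2 = 1) (hψ1 : ψ ≠ 1)
    (hψ : ψ ^ 2 = 1) (hne : χ ≠ ψ) {T : ℝ} (hT : 3 ≤ T)
    {ρ₁ ρ₂ : ℂ} (hz1 : LF χ ρ₁ = 0) (hz2 : LF ψ ρ₂ = 0)
    (h1 : 1 - aa / 5 / Real.log (q * T) < ρ₁.re) (h2 : 1 - aa / 5 / Real.log (q * T) < ρ₂.re)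
    (h1' : |ρ₁.im| ≤ aa / Real.log (q * T)) (h2' : |ρ₂.im| ≤ aa / Real.log (q * T)) : False := by
  have hl1 := ell_ge_one q hT
  set ℓ := Real.log (q * T) with hℓ
  have haa : 0 < aa := by norm_num [aa]
  set x := 4 * aa / ℓ with hx
  have hx0 : 0 < x := by positivity
  have hx1 : 1 / x = 2500000000 * ℓ := by rw [hx, aa]; field_simp; norm_num
  have hxs : x ≤ 4 * aa := by rw [hx, div_le_iff₀ (by linarith)]; nlinarith
  have hxs' : x ≤ 1/10 := hxs.trans (by norm_num [aa])
  have e1 : aa / 5 / ℓ = x / 20 := by rw [hx]; ring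
  have e2 : aa / ℓ = x / 4 := by rw [hx]; ring
  rw [e1] at h1 h2
  rw [e2] at h1' h2'
  have hb1 : ρ₁.re < 1 := by
    by_contra h; exact LF_ne_zero χ (s := ρ₁) (by linarith) hz1
  have hb2 : ρ₂.re < 1 := by
    by_contra h; exact LF_ne_zero ψ (s := ρ₂) (by linarith) hz2
  obtain ⟨m1, k1⟩ := zero_contrib hx0 hxs' hb1 h1 h1'
  obtain ⟨m2, k2⟩ := zero_contrib hx0 hxs' hb2 h2 h2'
  have hn := two_char_nonneg hχ hψ (σ := 1 + x) (by linarith)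
  have hprod : χ * ψ ≠ 1 := by
    intro h
    apply hne
    calc χ = χ * ψ ^ 2 := by rw [hψ, mul_one]
      _ = (χ * ψ) * ψ := by rw [sq, mul_assoc]
      _ = ψ := by rw [h, one_mul]
  have e0 : ((1 + x : ℝ):ℂ) + ((0:ℝ):ℂ) * I = ((1 + x : ℝ):ℂ) := by simp
  have b1 := lambda_le' (1 : DirichletCharacter ℂ q) hT (a := 4 * aa) (by linarith)
    (by norm_num [aa]) (t := 0) (by simp; linarith) (s := ((1 + x : ℝ):ℂ)) (by rw [e0])
  have b4 := lambda_le' (χ * ψ) hT (a := 4 * aa) (by linarith)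
    (by norm_num [aa]) (t := 0) (by simp; linarith) (s := ((1 + x : ℝ):ℂ)) (by rw [e0])
  obtain ⟨f1, f2⟩ := factor_one (LF_diff χ) hz1
  obtain ⟨g1, g2⟩ := factor_one (LF_diff ψ) hz2
  have b2 := lambda_le χ hT (a := 4 * aa) (by linarith)
    (by norm_num [aa]) (t := 0) (by simp; linarith) [ρ₁] _ f1 (s := ((1 + x : ℝ):ℂ))
    (by rw [e0]) (by
      rw [← e0]
      intro ρ h
      rw [List.mem_singleton] at h
      rw [h]; assumption) (by intro z; rw [f2]; simp [lprod])
  have b3 := lambda_le ψ hT (a := 4 * aa) (by linarith)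
    (by norm_num [aa]) (t := 0) (by simp; linarith) [ρ₂] _ g1 (s := ((1 + x : ℝ):ℂ))
    (by rw [e0]) (by
      rw [← e0]
      intro ρ h
      rw [List.mem_singleton] at h
      rw [h]; assumption) (by intro z; rw [g2]; simp [lprod])
  rw [e0] at k1 k2
  rw [← hℓ, sqrt_4aa] at b1 b2 b3 b4
  rw [pri_ne hχ1] at b2
  rw [pri_ne hψ1] at b3
  rw [pri_ne hprod] at b4
  simp only [List.map_cons, List.map_nil, List.sum_cons, List.sum_nil, add_zero] at b2 b3
  have c1 : ((1 + x : ℝ):ℂ) - 1 = (x:ℂ) + ((0:ℝ):ℂ) * I := by push_cast; ring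
  rw [c1, re_pole hx0, pri_one] at b1
  have d1 : ((1:ℕ):ℝ) * (x / (x ^ 2 + 0 ^ 2)) = 1 / x := by field_simp; simp
  rw [d1] at b1
  rw [hx1] at b1 k1 k2
  have e5 : 624 * ℓ / (2 / 10 ^ 5) = 31200000 * ℓ := by ring
  rw [e5] at b1 b2 b3 b4
  simp only [Nat.cast_zero, zero_div, zero_re, zero_add] at b2 b3 b4
  linarith

end
end MA
end


section
open Complex Metric Set Filter Topology

namespace MA

set_option linter.unusedSectionVars false
section
variable {q : ℕ} [NeZero q]

lemma zf_dich (χ : DirichletCharacter ℂ q) {T : ℝ} (hT : 3 ≤ T) :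
    (∀ s : ℂ, 1 - aa / 5 / Real.log (q * T) < s.re → |s.im| ≤ T → LF χ s ≠ 0) ∨
    (χ ≠ 1 ∧ χ ^ 2 = 1 ∧ ∃ (β : ℝ) (H : ℂ → ℂ), Differentiable ℂ H ∧
      (∀ s, LF χ s = (s - β) * H s) ∧ 1 - aa / 5 / Real.log (q * T) < β ∧ β < 1 ∧
      ∀ s : ℂ, 1 - aa / 5 / Real.log (q * T) < s.re → |s.im| ≤ T → H s ≠ 0) := by
  by_cases hA : ∀ s : ℂ, 1 - aa / 5 / Real.log (q * T) < s.re → |s.im| ≤ T → LF χ s ≠ 0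
  · exact Or.inl hA
  right
  push Not at hA
  obtain ⟨ρ, h1, h2, h3⟩ := hA
  have key : ∀ s : ℂ, 1 - aa / 5 / Real.log (q * T) < s.re → |s.im| ≤ T → LF χ s = 0 →
      χ ≠ 1 ∧ χ ^ 2 = 1 ∧ |s.im| < aa / Real.log (q * T) := by
    intro s a b c
    by_contra hcon
    have : χ = 1 ∨ χ ^ 2 ≠ 1 ∨ aa / Real.log (q * T) ≤ |s.im| := by
      by_contra hh
      push Not at hh
      exact hcon hh
    have := zf1 χ hT c b this
    linarith
  obtain ⟨k1, k2, k3⟩ := key ρ h1 h2 h3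
  have hl1 := ell_ge_one q hT
  have hpos : 0 < ρ.re := by
    have : aa / 5 / Real.log (q * T) ≤ 1 := by
      rw [div_le_one (by linarith)]; exact le_trans (by norm_num [aa]) hl1
    linarith
  obtain ⟨f1, f2⟩ := factor_one (LF_diff χ) h3
  have him : ρ.im = 0 := by
    by_contra hne
    have hc : LF χ ((starRingEnd ℂ) ρ) = 0 := by rw [LF_conj k2 hpos, h3, map_zero]
    have hne' : (starRingEnd ℂ) ρ - ρ ≠ 0 := by
      intro h
      have := congrArg Complex.im h
      simp at this
      apply hne; linarith
    have hd : dslope (LF χ) ρ ((starRingEnd ℂ) ρ) = 0 := by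
      have := f2 ((starRingEnd ℂ) ρ)
      rw [hc] at this
      rcases mul_eq_zero.1 this.symm with h | h
      · exact absurd h hne'
      · exact h
    obtain ⟨g1, g2⟩ := factor_one f1 hd
    refine zf2 k1 k2 hT (ρ₁ := ρ) (ρ₂ := (starRingEnd ℂ) ρ) g1 (fun z => ?_) h1 (by simpa using h1)
      k3.le (by simpa using k3.le)
    rw [f2, g2]
  have hρ : ρ = (ρ.re : ℂ) := by apply Complex.ext <;> simp [him]
  refine ⟨k1, k2, ρ.re, dslope (LF χ) ρ, f1, ?_, h1, ?_, ?_⟩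
  · intro s; rw [← hρ]; exact f2 s
  · by_contra h; exact LF_ne_zero χ (by linarith) h3
  · intro s a b c
    obtain ⟨_, _, k3'⟩ := key s a b (by rw [f2, c, mul_zero])
    obtain ⟨g1, g2⟩ := factor_one f1 c
    refine zf2 k1 k2 hT (ρ₁ := ρ) (ρ₂ := s) g1 (fun z => ?_) h1 a k3.le k3'.le
    rw [f2, g2]

open Classical in
/-- exponent of the exceptional zero -/
noncomputable def exq (χ1 : DirichletCharacter ℂ q) (κ : ℕ) (χ : DirichletCharacter ℂ q) : ℕ :=
  if χ = χ1 then κ else 0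

lemma zf_main (q : ℕ) [NeZero q] {T : ℝ} (hT : 3 ≤ T) :
    ∃ (χ1 : DirichletCharacter ℂ q) (β : ℝ) (κ : ℕ),
      (κ = 0 ∨ κ = 1 ∧ χ1 ≠ 1 ∧ χ1 ^ 2 = 1 ∧ LF χ1 β = 0) ∧
      1 - aa / 5 / Real.log (q * T) < β ∧ β < 1 ∧
      ∀ χ : DirichletCharacter ℂ q, ∃ H : ℂ → ℂ, Differentiable ℂ H ∧
        (∀ s, LF χ s = (s - β) ^ (exq χ1 κ χ) * H s) ∧
        ∀ s : ℂ, 1 - aa / 5 / Real.log (q * T) < s.re → |s.im| ≤ T → H s ≠ 0 := by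
  have hl1 := ell_ge_one q hT
  have haa : 0 < aa := by norm_num [aa]
  have hη : 0 < aa / 5 / Real.log (q * T) := by positivity
  by_cases hA : ∀ χ : DirichletCharacter ℂ q,
      ∀ s : ℂ, 1 - aa / 5 / Real.log (q * T) < s.re → |s.im| ≤ T → LF χ s ≠ 0
  · refine ⟨1, 1 - aa / 5 / Real.log (q * T) / 2, 0, Or.inl rfl, by linarith, by linarith, ?_⟩
    intro χ
    refine ⟨LF χ, LF_diff χ, fun s => ?_, hA χ⟩
    unfold exq; split_ifs <;> simp
  push Not at hA
  obtain ⟨χ1, s0, hs0⟩ := hA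
  rcases zf_dich χ1 hT with h | ⟨k1, k2, β, H, hH, hF, hβ, hβ1, hne⟩
  · exact absurd hs0.2.2 (h s0 hs0.1 hs0.2.1)
  have hz : LF χ1 β = 0 := by rw [hF]; simp
  refine ⟨χ1, β, 1, Or.inr ⟨rfl, k1, k2, hz⟩, hβ, hβ1, ?_⟩
  intro χ
  by_cases hχ : χ = χ1
  · subst hχ
    exact ⟨H, hH, fun s => by simp [exq, hF], hne⟩
  · rcases zf_dich χ hT with h | ⟨k1', k2', β', H', hH', hF', hβ', hβ1', hne'⟩
    · exact ⟨LF χ, LF_diff χ, fun s => by simp [exq, hχ], h⟩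
    · exfalso
      refine zf3 k1 k2 k1' k2' (Ne.symm hχ) hT (ρ₁ := (β:ℂ)) (ρ₂ := (β':ℂ)) hz (by rw [hF']; simp)
        (by simpa using hβ) (by simpa using hβ') ?_ ?_ <;> simp <;> positivity

/-- upper bound for the cofactor -/
lemma H_upper (χ : DirichletCharacter ℂ q) {β : ℝ} (hβ : 3/4 ≤ β) (_hβ1 : β < 1) {e : ℕ} (he : e ≤ 1)
    {H : ℂ → ℂ} (hH : Differentiable ℂ H) (hF : ∀ s, LF χ s = (s - β) ^ e * H s)
    {s : ℂ} (hs : 1/2 ≤ s.re) : ‖H s‖ ≤ 28 * q * (‖s‖ + 2) ^ 2 := by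
  have h0 : ∀ w : ℂ, 1/2 ≤ w.re → 1/4 ≤ ‖w - β‖ → ‖H w‖ ≤ 28 * q * (‖w‖ + 1) ^ 2 := by
    intro w hw hd
    have h1 := LF_bound χ hw
    rw [hF, norm_mul, norm_pow] at h1
    have h2 : (1/4:ℝ) ≤ ‖w - β‖ ^ e := by
      interval_cases e
      · norm_num
      · simpa using hd
    have := norm_nonneg (H w)
    nlinarith
  by_cases hd : 1/4 ≤ ‖s - β‖
  · refine (h0 s hs hd).trans ?_
    gcongr; norm_num
  · push Not at hd
    refine Complex.norm_le_of_forall_mem_frontier_norm_le (U := ball (β:ℂ) (1/4)) isBounded_ball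
      hH.diffContOnCl ?_ (subset_closure (by rw [mem_ball, dist_eq_norm]; exact hd))
    intro z hz
    rw [frontier_ball _ (by norm_num), mem_sphere, dist_eq_norm] at hz
    have hre : 1/2 ≤ z.re := by
      have := (abs_re_le_norm (z - β))
      rw [hz, abs_le] at this
      simp at this
      linarith
    refine (h0 z hre hz.ge).trans ?_
    have : ‖z‖ ≤ ‖s‖ + 1/2 := by
      have h1 : z = (z - β) - (s - β) + s := by ring
      have h2 : ‖z‖ ≤ ‖z - β‖ + ‖s - β‖ + ‖s‖ := by
        calc ‖z‖ = ‖(z - β) - (s - β) + s‖ := by rw [← h1]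
          _ ≤ _ := (norm_add_le _ _).trans (by gcongr; exact norm_sub_le _ _)
      linarith
    have : ‖z‖ + 1 ≤ ‖s‖ + 2 := by linarith
    gcongr

lemma H_logDeriv (χ : DirichletCharacter ℂ q) {T β : ℝ} (hT : 3 ≤ T)
    (hβ : 1 - aa / 5 / Real.log (q * T) < β) (hβ1 : β < 1) {e : ℕ} (he : e ≤ 1)
    {H : ℂ → ℂ} (hH : Differentiable ℂ H) (hF : ∀ s, LF χ s = (s - β) ^ e * H s)
    (hne : ∀ s : ℂ, 1 - aa / 5 / Real.log (q * T) < s.re → |s.im| ≤ T → H s ≠ 0)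
    {s : ℂ} (hs1 : 1 - aa / 5 / Real.log (q * T) / 4 ≤ s.re)
    (hs2 : s.re ≤ 1 + aa / 5 / Real.log (q * T) * (3/4)) (hs3 : |s.im| ≤ T - 1) :
    ‖deriv H s / H s‖ ≤ 10 ^ 15 * Real.log (q * T) ^ 2 := by
  have hl1 := ell_ge_one q hT
  have hq1 : (1:ℝ) ≤ q := by exact_mod_cast NeZero.one_le
  have hexp : Real.exp (Real.log (q * T)) = q * T := Real.exp_log (by positivity)
  have hlx : Real.log (q * T) ≤ q * T := (Real.log_le_self (by positivity))
  set ℓ := Real.log (q * T) with hℓ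
  set η := aa / 5 / ℓ with hη
  have hη1 : 1 / η = 50000000000 * ℓ := by rw [hη, aa]; field_simp; norm_num
  have hη0 : 0 < η := by rw [hη, aa]; positivity
  have hηs : η ≤ 1/100 := by
    rw [hη, div_le_iff₀ (by linarith)]
    have : aa / 5 ≤ 1 / 100 := by norm_num [aa]
    nlinarith
  set c : ℂ := ((1 + η / 4 : ℝ) : ℂ) + s.im * I with hc
  have hcre : c.re = 1 + η / 4 := by simp [hc]
  have hcim : c.im = s.im := by simp [hc]
  have hcn : ‖c‖ ≤ T + 1 := by
    refine (norm_le_abs_re_add_abs_im c).trans ?_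
    rw [hcre, hcim, abs_of_pos (by linarith)]
    linarith
  have hsc : dist s c ≤ η / 2 := by
    have : s - c = ((s.re - (1 + η / 4) : ℝ) : ℂ) := by apply Complex.ext <;> simp [hc]
    rw [dist_eq_norm, this, norm_real, Real.norm_eq_abs, abs_le]
    constructor <;> linarith
  -- lower bound at centre
  have hlow : η ^ 2 / 80 ≤ (T + 2) * ‖H c‖ := by
    have h1 := LF_lower χ (s := c) (by rw [hcre]; linarith) (by rw [hcre]; linarith)
    rw [hF, norm_mul, norm_pow, hcre] at h1
    have h2 : ‖c - β‖ ^ e ≤ T + 2 := by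
      interval_cases e
      · simp; linarith
      · rw [pow_one]
        refine (norm_sub_le _ _).trans ?_
        rw [norm_real, Real.norm_eq_abs, abs_of_pos (by linarith)]
        linarith
    have := norm_nonneg (H c)
    nlinarith
  have hball : ∀ z ∈ ball c η, 1 - η < z.re ∧ |z.im| ≤ T ∧ ‖z‖ ≤ T + 2 := by
    intro z hz
    rw [mem_ball, dist_eq_norm] at hz
    have h1 := abs_re_le_norm (z - c)
    have h2 := abs_im_le_norm (z - c)
    rw [sub_re, hcre, abs_le] at h1
    rw [sub_im, hcim] at h2
    refine ⟨by linarith, ?_, ?_⟩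
    · have : z.im = (z.im - s.im) + s.im := by ring
      rw [this]
      refine (abs_add_le _ _).trans ?_
      linarith
    · have : z = (z - c) + c := by ring
      rw [this]
      refine (norm_add_le _ _).trans ?_
      linarith
  have hmain : ∀ z ∈ ball c η, ‖H z‖ ≤ Real.exp (100 * ℓ) * ‖H c‖ := by
    intro z hz
    obtain ⟨h1, h2, h3⟩ := hball z hz
    have h4 := H_upper χ (by linarith) hβ1 he hH hF (s := z) (by linarith)
    have h5 : ‖H z‖ ≤ 28 * q * (T + 4) ^ 2 := by
      have : ‖z‖ + 2 ≤ T + 4 := by linarith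
      exact h4.trans (by gcongr)
    have h6 : 1 ≤ 80 * (50000000000 * ℓ) ^ 2 * (T + 2) * ‖H c‖ := by
      rw [← hη1]
      have : η ^ 2 * (80 * (1 / η) ^ 2 * (T + 2) * ‖H c‖) = 80 * ((T + 2) * ‖H c‖) := by
        field_simp
      have h7 : η ^ 2 * 1 ≤ η ^ 2 * (80 * (1 / η) ^ 2 * (T + 2) * ‖H c‖) := by
        rw [this]; linarith
      exact le_of_mul_le_mul_left h7 (by positivity)
    have h8 : 28 * q * (T + 4) ^ 2 * (80 * (50000000000 * ℓ) ^ 2 * (T + 2)) ≤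
        Real.exp (100 * ℓ) := by
      have e1 : Real.exp (100 * ℓ) = Real.exp ℓ ^ 95 * (q * T) ^ 5 := by
        rw [← hexp, ← Real.exp_nat_mul, ← Real.exp_nat_mul, ← Real.exp_add]; congr 1; push_cast; ring
      have e2 : (10:ℝ) ^ 28 ≤ Real.exp ℓ ^ 95 := by
        have : (2:ℝ) ≤ Real.exp ℓ := by
          have := Real.add_one_le_exp ℓ; linarith
        calc (10:ℝ) ^ 28 ≤ 2 ^ 95 := by norm_num
          _ ≤ _ := by gcongr
      rw [e1]
      calc 28 * q * (T + 4) ^ 2 * (80 * (50000000000 * ℓ) ^ 2 * (T + 2))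
          ≤ 28 * q * (3 * T) ^ 2 * (80 * (50000000000 * (q * T)) ^ 2 * (2 * T)) := by
            gcongr <;> linarith
        _ = (28 * 9 * 80 * 2 * 50000000000 ^ 2) * (q ^ 3 * T ^ 5) := by ring
        _ ≤ 10 ^ 28 * (q ^ 5 * T ^ 5) := by
            gcongr
            · norm_num
            · norm_num
        _ = 10 ^ 28 * (q * T) ^ 5 := by rw [mul_pow]
        _ ≤ _ := by gcongr
    calc ‖H z‖ ≤ 28 * q * (T + 4) ^ 2 * 1 := by rw [mul_one]; exact h5
      _ ≤ 28 * q * (T + 4) ^ 2 * (80 * (50000000000 * ℓ) ^ 2 * (T + 2) * ‖H c‖) := by gcongr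
      _ = 28 * q * (T + 4) ^ 2 * (80 * (50000000000 * ℓ) ^ 2 * (T + 2)) * ‖H c‖ := by ring
      _ ≤ _ := by gcongr
  have := logDeriv_bound hη0 (M := 100 * ℓ) (by linarith) hH.differentiableOn
    (fun z hz => hne z (hball z hz).1 (hball z hz).2.1) hmain hsc
  refine this.trans ?_
  have e : 24 * (100 * ℓ) / η = 2400 * ℓ * (1 / η) := by ring
  rw [e, hη1]
  nlinarith

/-- Summary of the zero-free region. -/
lemma zf_final (q : ℕ) [NeZero q] {T : ℝ} (hT : 3 ≤ T) :
    ∃ (χ1 : DirichletCharacter ℂ q) (β : ℝ) (κ : ℕ),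
      (κ = 0 ∨ κ = 1 ∧ χ1 ≠ 1 ∧ χ1 ^ 2 = 1 ∧ LF χ1 β = 0) ∧
      1 - aa / 5 / Real.log (q * T) < β ∧ β < 1 ∧
      ∀ χ : DirichletCharacter ℂ q, ∃ G : ℂ → ℂ,
        (∀ s : ℂ, 1 - aa / 5 / Real.log (q * T) < s.re → |s.im| ≤ T → DifferentiableAt ℂ G s) ∧
        (∀ s : ℂ, 1 < s.re → LSeries (chl χ) s = G s + (pri χ) / (s - 1)
            - (exq χ1 κ χ) / (s - β)) ∧
        (∀ s : ℂ, 1 - aa / 5 / Real.log (q * T) / 4 ≤ s.re →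
          s.re ≤ 1 + aa / 5 / Real.log (q * T) * (3/4) → |s.im| ≤ T - 1 →
          ‖G s‖ ≤ 10 ^ 15 * Real.log (q * T) ^ 2) := by
  obtain ⟨χ1, β, κ, h1, h2, h3, h4⟩ := zf_main q hT
  refine ⟨χ1, β, κ, h1, h2, h3, fun χ => ?_⟩
  obtain ⟨H, hH, hF, hne⟩ := h4 χ
  refine ⟨fun s => - (deriv H s / H s), ?_, ?_, ?_⟩
  · intro s a b
    have hd : DifferentiableAt ℂ (deriv H) s := (hH.analyticAt s).deriv.differentiableAt
    exact (hd.div hH.differentiableAt (hne s a b)).neg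
  · intro s hs
    rw [LF_logDeriv χ hs]
    have hL : LF χ s ≠ 0 := LF_ne_zero χ hs.le
    have hHs : H s ≠ 0 := by intro h; apply hL; rw [hF, h, mul_zero]
    have hsb : s - β ≠ 0 := by
      intro h
      have := congrArg re h
      simp at this
      linarith
    have hfun : LF χ = fun s => (s - β) ^ (exq χ1 κ χ) * H s := funext hF
    have hder : HasDerivAt (LF χ) ((exq χ1 κ χ) * (s - β) ^ (exq χ1 κ χ - 1) * 1 * H s
        + (s - β) ^ (exq χ1 κ χ) * deriv H s) s := by
      rw [hfun]
      exact (((hasDerivAt_id s).sub_const (β:ℂ)).pow _).mul (hH s).hasDerivAt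
    rw [hder.deriv, hF s]
    generalize exq χ1 κ χ = e
    rcases e with _ | e
    · simp; ring
    · simp only [Nat.add_sub_cancel]
      field_simp
      ring
  · intro s a b c
    simp only [norm_neg]
    refine H_logDeriv χ hT h2 h3 (e := exq χ1 κ χ) ?_ hH hF hne a b c
    unfold exq
    split_ifs
    · rcases h1 with h | h
      · omega
      · omega
    · omega

end
end MA
end


section
open Complex Metric Set Filter Topology MeasureTheory

namespace MA

lemma mel3 {σ u : ℝ} (a c : Fin 3 → ℝ) (ha : ∀ i, 0 < σ + a i) (hc : ∑ i, c i = 0) (hu : 0 < u)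
    (hIntg : Integrable fun t : ℝ => ∑ i, (c i : ℂ) / ((σ:ℂ) + t * I + a i)) :
    (1 / (2 * Real.pi) : ℝ) • ∫ t : ℝ, (u:ℂ) ^ (-((σ:ℂ) + t * I)) *
      (∑ i, (c i : ℂ) / ((σ:ℂ) + t * I + a i)) =
      if u ≤ 1 then ((∑ i, c i * u ^ a i : ℝ) : ℂ) else 0 := by
  set f : ℝ → ℂ := fun v => ∑ i, (c i : ℂ) • (Ioc (0:ℝ) 1).indicator (fun t : ℝ => (t:ℂ) ^ (a i : ℂ)) v
    with hf
  have hm : ∀ s : ℂ, s.re = σ → HasMellin f s (∑ i, (c i : ℂ) / (s + a i)) := by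
    intro s hs
    have h1 : ∀ i, HasMellin ((Ioc (0:ℝ) 1).indicator (fun t : ℝ => (t:ℂ) ^ (a i : ℂ))) s
        (1 / (s + a i)) := fun i => hasMellin_cpow_Ioc _ (by simpa [hs] using ha i)
    have h2 := fun i => (h1 i).1.const_smul (c i : ℂ)
    have h3 := fun i => mellin_const_smul
      ((Ioc (0:ℝ) 1).indicator (fun t : ℝ => (t:ℂ) ^ (a i : ℂ))) s (c i : ℂ)
    have h4 := hasMellin_add (h2 0) (h2 1)
    have h5 := hasMellin_add h4.1 (h2 2)
    have hfe : f = fun t => (c 0 : ℂ) • (Ioc (0:ℝ) 1).indicator (fun t : ℝ => (t:ℂ) ^ (a 0 : ℂ)) t +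
        (c 1 : ℂ) • (Ioc (0:ℝ) 1).indicator (fun t : ℝ => (t:ℂ) ^ (a 1 : ℂ)) t +
        (c 2 : ℂ) • (Ioc (0:ℝ) 1).indicator (fun t : ℝ => (t:ℂ) ^ (a 2 : ℂ)) t := by
      funext t; simp [hf, Fin.sum_univ_three]
    rw [hfe]
    refine ⟨h5.1, ?_⟩
    rw [h5.2, h4.2, h3 0, h3 1, h3 2, (h1 0).2, (h1 1).2, (h1 2).2, Fin.sum_univ_three]
    simp only [smul_eq_mul, mul_one_div]
  have hval : ∀ v : ℝ, 0 < v → f v = ((∑ i, c i * (min v 1) ^ a i : ℝ) : ℂ) := by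
    intro v hv
    by_cases h : v ≤ 1
    · rw [min_eq_left h]
      simp only [hf, indicator_of_mem (show v ∈ Ioc (0:ℝ) 1 from ⟨hv, h⟩), smul_eq_mul]
      push_cast
      refine Finset.sum_congr rfl fun i _ => ?_
      rw [ofReal_cpow hv.le]
    · push Not at h
      rw [min_eq_right h.le]
      simp only [Real.one_rpow, mul_one, hc]
      have : v ∉ Ioc (0:ℝ) 1 := fun h' => by linarith [h'.2]
      simp [hf, indicator_of_notMem this]
  have hcont : ContinuousAt f u := by
    have : ContinuousAt (fun v : ℝ => ((∑ i, c i * (min v 1) ^ a i : ℝ) : ℂ)) u := by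
      refine continuous_ofReal.continuousAt.comp ?_
      refine tendsto_finsetSum _ fun i _ => ?_
      refine Tendsto.const_mul _ ?_
      refine ContinuousAt.rpow_const (continuous_id.min continuous_const).continuousAt (Or.inl ?_)
      exact (lt_min hu one_pos).ne'
    refine this.congr ?_
    filter_upwards [lt_mem_nhds hu] with v hv
    exact (hval v hv).symm
  have hmm : ∀ t : ℝ, mellin f ((σ:ℂ) + t * I) = ∑ i, (c i : ℂ) / ((σ:ℂ) + t * I + a i) :=
    fun t => (hm _ (by simp)).2
  have := mellinInv_mellin_eq σ f hu (hm σ (by simp)).1 (by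
    unfold VerticalIntegrable
    simp only [hmm]; exact hIntg) hcont
  rw [mellinInv] at this
  simp only [hmm, smul_eq_mul] at this
  rw [this, hval u hu]
  split_ifs with h
  · rw [min_eq_left h]
  · rw [min_eq_right (not_le.1 h).le]; simp [hc]

/-- the kernel -/
noncomputable def ker (s : ℂ) : ℂ := 1 / (s * (s + 1))

lemma ker_bound {s : ℂ} (hs : 0 < s.re) : ‖ker s‖ ≤ (s.re ^ 2 + s.im ^ 2)⁻¹ := by
  have hs0 : s ≠ 0 := by rintro rfl; simp at hs
  have h1 : ‖s‖ ^ 2 = s.re ^ 2 + s.im ^ 2 := by rw [← normSq_eq_norm_sq, normSq_apply]; ring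
  have h2 : ‖s‖ ≤ ‖s + 1‖ := by
    rw [← sq_le_sq₀ (norm_nonneg _) (norm_nonneg _), ← normSq_eq_norm_sq, ← normSq_eq_norm_sq,
      normSq_apply, normSq_apply]
    simp; nlinarith
  have h3 : 0 < ‖s‖ := norm_pos_iff.2 hs0
  rw [ker, norm_div, norm_one, one_div, norm_mul, ← h1, sq]
  gcongr

lemma ker_bound' {σ t : ℝ} (hs : 1 ≤ σ) : ‖ker ((σ:ℂ) + t * I)‖ ≤ (1 + t ^ 2)⁻¹ := by
  refine (ker_bound (by simp; linarith)).trans ?_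
  simp
  gcongr
  nlinarith

lemma ker_cont {σ : ℝ} (hs : 0 < σ) : Continuous fun t : ℝ => ker ((σ:ℂ) + t * I) := by
  unfold ker
  refine Continuous.div continuous_const (by fun_prop) fun t h => ?_
  rcases mul_eq_zero.1 h with h | h <;> have := congrArg re h <;> simp at this <;> linarith

lemma int_ker {σ : ℝ} (hs : 1 ≤ σ) : Integrable fun t : ℝ => ker ((σ:ℂ) + t * I) :=
  integrable_inv_one_add_sq.mono' (ker_cont (by linarith)).aestronglyMeasurable
    (.of_forall fun _ => ker_bound' hs)

lemma ker_pow_cont {σ x : ℝ} (hs : 0 < σ) (hx : 0 < x) :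
    Continuous fun t : ℝ => (x:ℂ) ^ ((σ:ℂ) + t * I) * ker ((σ:ℂ) + t * I) := by
  refine Continuous.mul ?_ (ker_cont hs)
  exact Continuous.const_cpow (by fun_prop) (Or.inl (by exact_mod_cast hx.ne'))

lemma norm_xpow {σ x t : ℝ} (hx : 0 < x) : ‖(x:ℂ) ^ ((σ:ℂ) + t * I)‖ = x ^ σ := by
  rw [norm_cpow_eq_rpow_re_of_pos hx]; simp

lemma int_ker_pow {σ x : ℝ} (hs : 1 ≤ σ) (hx : 0 < x) :
    Integrable fun t : ℝ => (x:ℂ) ^ ((σ:ℂ) + t * I) * ker ((σ:ℂ) + t * I) := by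
  refine (integrable_inv_one_add_sq.const_mul (x ^ σ)).mono'
    (ker_pow_cont (by linarith) hx).aestronglyMeasurable (.of_forall fun t => ?_)
  rw [norm_mul, norm_xpow hx]
  gcongr
  exact ker_bound' hs

lemma inv_neg_cpow {x : ℝ} (hx : 0 < x) (s : ℂ) : ((x⁻¹ : ℝ) : ℂ) ^ (-s) = (x:ℂ) ^ s := by
  rw [ofReal_inv, cpow_neg, inv_cpow _ _ (by rw [arg_ofReal_of_nonneg hx.le]; exact Real.pi_pos.ne),
    inv_inv]

lemma perron_term {σ x : ℝ} (hs : 1 ≤ σ) (hx : 0 < x) :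
    (1 / (2 * Real.pi) : ℝ) • ∫ t : ℝ, (x:ℂ) ^ ((σ:ℂ) + t * I) * ker ((σ:ℂ) + t * I) =
      if 1 ≤ x then ((1 - x⁻¹ : ℝ) : ℂ) else 0 := by
  have hk : ∀ t : ℝ, ker ((σ:ℂ) + t * I) = ∑ i, ((![1, -1, 0] : Fin 3 → ℝ) i : ℂ) /
      ((σ:ℂ) + t * I + ((![0, 1, 0] : Fin 3 → ℝ) i : ℝ)) := by
    intro t
    simp only [Fin.sum_univ_three, Matrix.cons_val_zero, Matrix.cons_val_one, Matrix.cons_val]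
    have h1 : (σ:ℂ) + t * I ≠ 0 := fun h => by
      have := congrArg re h; simp at this; linarith
    have h2 : (σ:ℂ) + t * I + 1 ≠ 0 := fun h => by
      have := congrArg re h; simp at this; linarith
    unfold ker
    push_cast
    rw [add_zero]
    field_simp
    ring
  have := mel3 (σ := σ) (u := x⁻¹) ![0, 1, 0] ![1, -1, 0]
    (by intro i; fin_cases i <;> simp <;> linarith)
    (by simp [Fin.sum_univ_three]) (inv_pos.2 hx) (by
      simp only [← hk]; exact int_ker hs)
  simp only [← hk, inv_neg_cpow hx] at this
  rw [this]
  by_cases h : 1 ≤ x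
  · rw [if_pos h, if_pos (inv_le_one_of_one_le₀ h)]
    simp [Fin.sum_univ_three]
    ring
  · rw [if_neg h, if_neg]
    rw [inv_le_one₀ hx]; exact h

lemma perron_pole {σ x ρ : ℝ} (hs : 1 < σ) (hx : 1 ≤ x) (hρ : 0 < ρ) (hρ1 : ρ ≤ 1) :
    (1 / (2 * Real.pi) : ℝ) • ∫ t : ℝ, (1 / ((σ:ℂ) + t * I - ρ)) *
        ((x:ℂ) ^ ((σ:ℂ) + t * I) * ker ((σ:ℂ) + t * I)) =
      ((x ^ ρ / (ρ * (ρ + 1)) - 1 / ρ + x⁻¹ / (ρ + 1) : ℝ) : ℂ) ∧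
    Integrable fun t : ℝ => (1 / ((σ:ℂ) + t * I - ρ)) *
        ((x:ℂ) ^ ((σ:ℂ) + t * I) * ker ((σ:ℂ) + t * I)) := by
  have hx0 : 0 < x := by linarith
  have h3 : ∀ t : ℝ, (σ:ℂ) + t * I - ρ ≠ 0 := fun t h => by
      have := congrArg re h; simp at this; linarith
  have hk : ∀ t : ℝ, (1 / ((σ:ℂ) + t * I - ρ)) * ker ((σ:ℂ) + t * I) =
      ∑ i, ((![1 / (ρ * (ρ + 1)), -(1/ρ), 1 / (ρ + 1)] : Fin 3 → ℝ) i : ℂ) /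
      ((σ:ℂ) + t * I + ((![-ρ, 0, 1] : Fin 3 → ℝ) i : ℝ)) := by
    intro t
    simp only [Fin.sum_univ_three, Matrix.cons_val_zero, Matrix.cons_val_one, Matrix.cons_val]
    have h1 : (σ:ℂ) + t * I ≠ 0 := fun h => by
      have := congrArg re h; simp at this; linarith
    have h2 : (σ:ℂ) + t * I + 1 ≠ 0 := fun h => by
      have := congrArg re h; simp at this; linarith
    have h3 := h3 t
    have h4 : (ρ:ℂ) ≠ 0 := by exact_mod_cast hρ.ne'
    have h5 : (ρ:ℂ) + 1 ≠ 0 := by exact_mod_cast (by linarith : (ρ + 1) ≠ 0)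
    unfold ker
    push_cast
    rw [add_zero, ← sub_eq_add_neg]
    field_simp
    ring
  have hcb : ∀ t : ℝ, ‖1 / ((σ:ℂ) + t * I - ρ)‖ ≤ 1 / (σ - ρ) := by
    intro t
    rw [norm_div, norm_one]
    have := abs_re_le_norm ((σ:ℂ) + t * I - ρ)
    simp at this
    have h0 : 0 < σ - ρ := by linarith
    gcongr
    exact (le_abs_self _).trans this
  have hcc : Continuous fun t : ℝ => 1 / ((σ:ℂ) + t * I - ρ) :=
    Continuous.div continuous_const (by fun_prop) h3
  have hIntg : Integrable fun t : ℝ => (1 / ((σ:ℂ) + t * I - ρ)) * ker ((σ:ℂ) + t * I) :=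
    (int_ker hs.le).bdd_mul hcc.aestronglyMeasurable (.of_forall hcb)
  refine ⟨?_, (int_ker_pow hs.le hx0).bdd_mul hcc.aestronglyMeasurable (.of_forall hcb)⟩
  have := mel3 (σ := σ) (u := x⁻¹) ![-ρ, 0, 1] ![1 / (ρ * (ρ + 1)), -(1/ρ), 1 / (ρ + 1)]
    (by intro i; fin_cases i <;> simp <;> linarith)
    (by simp [Fin.sum_univ_three]; field_simp; ring) (inv_pos.2 hx0) (by
      simp only [← hk]; exact hIntg)
  simp only [← hk, inv_neg_cpow hx0] at this
  rw [if_pos (inv_le_one_of_one_le₀ hx)] at this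
  rw [show (fun t : ℝ => (1 / ((σ:ℂ) + t * I - ρ)) * ((x:ℂ) ^ ((σ:ℂ) + t * I) * ker ((σ:ℂ) + t * I)))
    = fun t : ℝ => (x:ℂ) ^ ((σ:ℂ) + t * I) * ((1 / ((σ:ℂ) + t * I - ρ)) * ker ((σ:ℂ) + t * I)) from
    by funext t; ring, this]
  congr 1
  simp only [Fin.sum_univ_three, Matrix.cons_val_zero, Matrix.cons_val_one, Matrix.cons_val]
  rw [Real.inv_rpow hx0.le, Real.rpow_neg hx0.le, inv_inv, Real.rpow_zero, Real.rpow_one]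
  ring

end MA
end


section
open Complex Metric Set Filter Topology MeasureTheory

namespace MA

open ArithmeticFunction in
/-- bound for the Dirichlet series of a sequence bounded by von Mangoldt. -/
lemma lam_sum {a : ℕ → ℂ} (ha : ∀ n, ‖a n‖ ≤ vonMangoldt n) {σ : ℝ} (h1 : 1 < σ) (h2 : σ ≤ 2) :
    Summable (fun n => ‖LSeries.term a σ n‖) ∧ ∑' n, ‖LSeries.term a σ n‖ ≤ 20 / (σ - 1) ^ 2 := by
  set ε := (σ - 1) / 2 with hε
  have hε0 : 0 < ε := by linarith
  have hb : ∀ n, ‖LSeries.term a σ n‖ ≤ (1 / ε) * ‖LSeries.term 1 ((1 + ε : ℝ) : ℂ) n‖ := by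
    intro n
    rw [LSeries.norm_term_eq, LSeries.norm_term_eq]
    split_ifs with h
    · simp
    have hn : (0:ℝ) < n := by exact_mod_cast Nat.pos_of_ne_zero h
    simp only [ofReal_re, Pi.one_apply, norm_one]
    have h3 : ‖a n‖ ≤ (n:ℝ) ^ ε / ε :=
      (ha n).trans (vonMangoldt_le_log.trans (Real.log_le_rpow_div hn.le hε0))
    calc ‖a n‖ / (n:ℝ) ^ σ ≤ ((n:ℝ) ^ ε / ε) / (n:ℝ) ^ σ := by gcongr
      _ = (1 / ε) * (1 / (n:ℝ) ^ (1 + ε)) := by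
        have : σ = ε + (1 + ε) := by rw [hε]; ring
        rw [this, Real.rpow_add hn]
        have := Real.rpow_pos_of_pos hn ε
        field_simp
  have hs : Summable fun n => ‖LSeries.term 1 ((1 + ε : ℝ) : ℂ) n‖ := by
    have : LSeriesSummable 1 ((1 + ε : ℝ) : ℂ) := LSeriesSummable_one_iff.2 (by simp; linarith)
    exact this.norm
  have hs' := hs.mul_left (1 / ε)
  have hsum := Summable.of_nonneg_of_le (fun n => norm_nonneg _) hb hs'
  refine ⟨hsum, (hsum.tsum_le_tsum hb hs').trans ?_⟩
  rw [tsum_mul_left]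
  have := zeta_sum_bound (σ := 1 + ε) (by linarith) (by linarith)
  calc 1 / ε * ∑' n, ‖LSeries.term 1 ((1 + ε : ℝ) : ℂ) n‖ ≤ 1 / ε * (5 / (1 + ε - 1)) := by gcongr
    _ = _ := by rw [hε]; field_simp; ring

open ArithmeticFunction in
lemma perron_sum {a : ℕ → ℂ} (ha : ∀ n, ‖a n‖ ≤ vonMangoldt n) {σ x : ℝ} (h1 : 1 < σ) (h2 : σ ≤ 2)
    (hx : 1 ≤ x) :
    (1 / (2 * Real.pi) : ℝ) • ∫ t : ℝ, LSeries a ((σ:ℂ) + t * I) *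
        ((x:ℂ) ^ ((σ:ℂ) + t * I) * ker ((σ:ℂ) + t * I)) =
      ∑ n ∈ Finset.Icc 1 ⌊x⌋₊, a n * (1 - n / x : ℝ) ∧
    Integrable fun t : ℝ => LSeries a ((σ:ℂ) + t * I) *
        ((x:ℂ) ^ ((σ:ℂ) + t * I) * ker ((σ:ℂ) + t * I)) := by
  have hx0 : 0 < x := by linarith
  obtain ⟨hs, -⟩ := lam_sum ha h1 h2
  set F : ℕ → ℝ → ℂ := fun n t => LSeries.term a ((σ:ℂ) + t * I) n *
        ((x:ℂ) ^ ((σ:ℂ) + t * I) * ker ((σ:ℂ) + t * I)) with hF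
  have hnorm : ∀ n t, ‖F n t‖ = ‖LSeries.term a σ n‖ *
      ‖((x:ℂ) ^ ((σ:ℂ) + t * I) * ker ((σ:ℂ) + t * I))‖ := by
    intro n t
    rw [hF]
    simp only [norm_mul, LSeries.norm_term_eq]
    simp
  have hcont : ∀ n, Continuous fun t : ℝ => LSeries.term a ((σ:ℂ) + t * I) n := by
    intro n
    rcases eq_or_ne n 0 with rfl | hn
    · simp only [LSeries.term_zero]; exact continuous_const
    · simp only [LSeries.term_of_ne_zero hn]
      refine Continuous.div continuous_const ?_ fun t => ?_
      · exact Continuous.const_cpow (by fun_prop) (Or.inl (by exact_mod_cast hn))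
      · rw [cpow_ne_zero_iff]; left; exact_mod_cast hn
  have hIntg : ∀ n, Integrable (F n) := by
    intro n
    refine (((int_ker_pow h1.le hx0).norm).const_mul (‖LSeries.term a σ n‖)).mono'
      ((hcont n).mul (ker_pow_cont (by linarith) hx0)).aestronglyMeasurable (.of_forall fun t => ?_)
    rw [← hnorm]
  have hsum : Summable fun n => ∫ t, ‖F n t‖ := by
    simp only [hnorm, integral_const_mul]
    exact hs.mul_right _
  have hH := hasSum_integral_of_summable_integral_norm hIntg hsum
  have hLS : ∀ t : ℝ, ∑' n, F n t = LSeries a ((σ:ℂ) + t * I) *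
        ((x:ℂ) ^ ((σ:ℂ) + t * I) * ker ((σ:ℂ) + t * I)) := by
    intro t; rw [hF]; simp only; rw [tsum_mul_right]; rfl
  simp only [hLS] at hH
  have hterm : ∀ n, (1 / (2 * Real.pi) : ℝ) • ∫ t, F n t =
      if n ∈ Finset.Icc 1 ⌊x⌋₊ then a n * (1 - n / x : ℝ) else 0 := by
    intro n
    rcases eq_or_ne n 0 with rfl | hn
    · simp [hF]
    have hn0 : (0:ℝ) < n := by exact_mod_cast Nat.pos_of_ne_zero hn
    have : ∀ t : ℝ, F n t = a n * (((x / n : ℝ) : ℂ) ^ ((σ:ℂ) + t * I) * ker ((σ:ℂ) + t * I)) := by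
      intro t
      rw [hF]; simp only
      rw [LSeries.term_of_ne_zero hn, ofReal_div, div_eq_mul_inv (x:ℂ), ← ofReal_inv,
        mul_cpow_ofReal_nonneg hx0.le (by positivity), ofReal_inv, inv_cpow _ _
        (by rw [arg_ofReal_of_nonneg hn0.le]; exact Real.pi_pos.ne)]
      push_cast
      ring
    simp only [this, integral_const_mul]
    rw [← mul_smul_comm, perron_term h1.le (by positivity : 0 < x / n)]
    have hiff : n ∈ Finset.Icc 1 ⌊x⌋₊ ↔ 1 ≤ x / n := by
      rw [Finset.mem_Icc, Nat.le_floor_iff hx0.le, le_div_iff₀ hn0, one_mul]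
      exact ⟨fun h => h.2, fun h => ⟨Nat.one_le_iff_ne_zero.2 hn, h⟩⟩
    by_cases h : 1 ≤ x / n
    · rw [if_pos h, if_pos (hiff.2 h), inv_div]
    · rw [if_neg h, if_neg (fun h' => h (hiff.1 h')), mul_zero]
  refine ⟨?_, ?_⟩
  · have h3 := hH.const_smul (1 / (2 * Real.pi) : ℝ)
    simp only [hterm] at h3
    have h4 : HasSum (fun n => if n ∈ Finset.Icc 1 ⌊x⌋₊ then a n * (1 - n / x : ℝ) else 0)
        (∑ n ∈ Finset.Icc 1 ⌊x⌋₊, a n * (1 - n / x : ℝ)) := by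
      have := hasSum_sum_of_ne_finset_zero (L := SummationFilter.unconditional ℕ) (f := fun n : ℕ => if n ∈ Finset.Icc 1 ⌊x⌋₊ then
        a n * (1 - n / x : ℝ) else 0) (s := Finset.Icc 1 ⌊x⌋₊) (fun n hn => by simp only [if_neg hn])
      rw [Finset.sum_congr rfl (fun n hn => if_pos hn)] at this
      exact this
    exact h3.unique h4
  · have hfin : ∀ t : ℝ, ‖LSeries a ((σ:ℂ) + t * I)‖ ≤ ∑' n, ‖LSeries.term a σ n‖ := by
      intro t
      refine tsum_of_norm_bounded hs.hasSum fun n => ?_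
      rw [LSeries.norm_term_eq, LSeries.norm_term_eq]; simp
    refine (int_ker_pow h1.le hx0).bdd_mul ?_ (.of_forall hfin)
    have : Continuous fun t : ℝ => ∑' n, LSeries.term a ((σ:ℂ) + t * I) n := by
      refine continuous_tsum hcont hs fun n t => ?_
      rw [LSeries.norm_term_eq, LSeries.norm_term_eq]; simp
    exact this.aestronglyMeasurable

lemma tail_bound {g : ℝ → ℂ} {K T : ℝ} (hT : 0 < T) (hK : 0 ≤ K)
    (hb : ∀ t, T ≤ |t| → ‖g t‖ ≤ K * (1 + t ^ 2)⁻¹) (hg : Integrable g) :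
    ‖(∫ t, g t) - ∫ t in (-T)..T, g t‖ ≤ 2 * K / T := by
  have hsplit : (∫ t, g t) - ∫ t in (-T)..T, g t = (∫ t in Iic (-T), g t) + ∫ t in Ioi T, g t := by
    rw [← intervalIntegral.integral_Iic_sub_Iic hg.integrableOn hg.integrableOn,
      ← intervalIntegral.integral_Iic_add_Ioi (b := T) hg.integrableOn hg.integrableOn]
    ring
  have hI : ∫ t in Ioi T, K * (t ^ (-2:ℝ)) = K / T := by
    rw [integral_const_mul, integral_Ioi_rpow_of_lt (by norm_num) hT]
    norm_num
    rw [Real.rpow_neg_one, div_eq_mul_inv]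
  have hi : IntegrableOn (fun t : ℝ => K * (t ^ (-2:ℝ))) (Ioi T) :=
    (integrableOn_Ioi_rpow_of_lt (by norm_num) hT).const_mul K
  have hle : ∀ t : ℝ, T < t → K * (1 + t ^ 2)⁻¹ ≤ K * t ^ (-2:ℝ) := by
    intro t ht
    have : 0 < t := hT.trans ht
    rw [Real.rpow_neg this.le]
    gcongr
    norm_num
  have h1 : ‖∫ t in Ioi T, g t‖ ≤ K / T := by
    rw [← hI]
    refine norm_integral_le_of_norm_le hi ?_
    refine (ae_restrict_iff' measurableSet_Ioi).2 (.of_forall fun t ht => ?_)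
    exact (hb t (le_trans (le_of_lt ht) (le_abs_self t))).trans (hle t ht)
  have h2 : ‖∫ t in Iic (-T), g t‖ ≤ K / T := by
    rw [← integral_comp_neg_Ioi, ← hI]
    refine norm_integral_le_of_norm_le hi ?_
    refine (ae_restrict_iff' measurableSet_Ioi).2 (.of_forall fun t ht => ?_)
    have := hb (-t) (by rw [abs_neg]; exact le_trans (le_of_lt ht) (le_abs_self t))
    rw [neg_sq] at this
    exact this.trans (hle t ht)
  rw [hsplit]
  calc _ ≤ K / T + K / T := (norm_add_le _ _).trans (add_le_add h2 h1)
    _ = _ := by ring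

open ArithmeticFunction in
lemma perron_main {a : ℕ → ℂ} (ha : ∀ n, ‖a n‖ ≤ vonMangoldt n) {G : ℂ → ℂ} {β η B T σ x : ℝ}
    {δ κ : ℕ} (hδ : δ ≤ 1) (hκ : κ ≤ 1) (hη : 0 < η) (hη1 : η ≤ 1/2) (hβ : 0 < β)
    (hβ1 : β < 1) (h1 : 1 < σ) (h2 : σ ≤ 2) (hT : 1 ≤ T) (hB : 0 ≤ B)
    (hd : ∀ s : ℂ, 1 - η ≤ s.re → s.re ≤ σ → |s.im| ≤ T → DifferentiableAt ℂ G s)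
    (hb : ∀ s : ℂ, 1 - η ≤ s.re → s.re ≤ σ → |s.im| ≤ T → ‖G s‖ ≤ B)
    (hL : ∀ s : ℂ, 1 < s.re → LSeries a s = G s + δ / (s - 1) - κ / (s - β)) (hx : 1 ≤ x) :
    ‖(∑ n ∈ Finset.Icc 1 ⌊x⌋₊, a n * (1 - n / x : ℝ))
      - δ * ((x / 2 - 1 + x⁻¹ / 2 : ℝ) : ℂ)
      + κ * ((x ^ β / (β * (β + 1)) - 1 / β + x⁻¹ / (β + 1) : ℝ) : ℂ)‖ ≤
      44 * x ^ σ / ((σ - 1) ^ 2 * T) + 4 * x ^ σ * B / T ^ 2 + 16 * B * x ^ (1 - η) := by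
  have hx0 : 0 < x := by linarith
  have hσ0 : 0 < σ := by linarith
  obtain ⟨s1, i1⟩ := perron_sum ha h1 h2 hx
  obtain ⟨s2, i2⟩ := perron_pole h1 hx one_pos le_rfl
  obtain ⟨s3, i3⟩ := perron_pole h1 hx hβ hβ1.le
  set W : ℂ → ℂ := fun s => (x:ℂ) ^ s * ker s with hW
  set g : ℝ → ℂ := fun t => G ((σ:ℂ) + t * I) * W ((σ:ℂ) + t * I) with hg
  have hge : ∀ t : ℝ, g t = LSeries a ((σ:ℂ) + t * I) * W ((σ:ℂ) + t * I)
      - δ * (1 / ((σ:ℂ) + t * I - (1:ℝ)) * W ((σ:ℂ) + t * I))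
      + κ * (1 / ((σ:ℂ) + t * I - β) * W ((σ:ℂ) + t * I)) := by
    intro t
    rw [hL _ (by simp; exact h1), hg]
    push_cast
    ring
  have hgint : Integrable g := by
    rw [show g = _ from funext hge]
    exact (i1.sub (i2.const_mul (δ:ℂ))).add (i3.const_mul (κ:ℂ))
  have hval : (∑ n ∈ Finset.Icc 1 ⌊x⌋₊, a n * (1 - n / x : ℝ))
      - δ * ((x / 2 - 1 + x⁻¹ / 2 : ℝ) : ℂ)
      + κ * ((x ^ β / (β * (β + 1)) - 1 / β + x⁻¹ / (β + 1) : ℝ) : ℂ) =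
      (1 / (2 * Real.pi) : ℝ) • ∫ t, g t := by
    have hi12 : Integrable fun t : ℝ => LSeries a ((σ:ℂ) + t * I) * W ((σ:ℂ) + t * I)
      - δ * (1 / ((σ:ℂ) + t * I - (1:ℝ)) * W ((σ:ℂ) + t * I)) := i1.sub (i2.const_mul (δ:ℂ))
    simp only [hge]
    rw [integral_add hi12 (i3.const_mul (κ:ℂ)),
      integral_sub i1 (i2.const_mul (δ:ℂ)), integral_const_mul, integral_const_mul,
      smul_add, smul_sub, ← mul_smul_comm, ← mul_smul_comm, s1, s2, s3]
    norm_num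
  rw [hval, norm_smul]
  have hWb : ∀ t : ℝ, ‖W ((σ:ℂ) + t * I)‖ ≤ x ^ σ * (1 + t ^ 2)⁻¹ := by
    intro t
    rw [hW]; simp only
    rw [norm_mul, norm_xpow hx0]
    gcongr
    exact ker_bound' h1.le
  -- tail
  have hxσ : 0 < x ^ σ := Real.rpow_pos_of_pos hx0 σ
  have hS := lam_sum ha h1 h2
  have hσ1 : 1 ≤ 1 / (σ - 1) ^ 2 := by
    rw [le_div_iff₀ (by nlinarith)]; nlinarith
  have htail := tail_bound (g := g) (K := 22 / (σ - 1) ^ 2 * x ^ σ) (T := T) (by linarith)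
    (by positivity) (by
      intro t ht
      rw [hge]
      have hLS : ‖LSeries a ((σ:ℂ) + t * I)‖ ≤ 20 / (σ - 1) ^ 2 := by
        refine (tsum_of_norm_bounded hS.1.hasSum fun n => ?_).trans hS.2
        rw [LSeries.norm_term_eq, LSeries.norm_term_eq]; simp
      have hp : ∀ ρ : ℝ, ‖1 / ((σ:ℂ) + t * I - ρ)‖ ≤ 1 := by
        intro ρ
        rw [norm_div, norm_one]
        have := abs_im_le_norm ((σ:ℂ) + t * I - ρ)
        simp at this
        exact (div_le_one (by linarith)).2 (by linarith)
      have hδ' : ‖(δ:ℂ)‖ ≤ 1 := by rw [Complex.norm_natCast]; exact_mod_cast hδ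
      have hκ' : ‖(κ:ℂ)‖ ≤ 1 := by rw [Complex.norm_natCast]; exact_mod_cast hκ
      have hw := hWb t
      clear_value W
      have hw0 := norm_nonneg (W ((σ:ℂ) + t * I))
      refine (norm_add_le _ _).trans ((add_le_add_left (norm_sub_le _ _) _).trans ?_)
      rw [norm_mul, norm_mul, norm_mul, norm_mul (κ:ℂ), norm_mul (1 / _)]
      calc _ ≤ 20 / (σ - 1) ^ 2 * ‖W ((σ:ℂ) + t * I)‖ + 1 * (1 * ‖W ((σ:ℂ) + t * I)‖) +
            1 * (1 * ‖W ((σ:ℂ) + t * I)‖) := by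
            gcongr
            · exact hp 1
            · exact hp β
        _ = (20 / (σ - 1) ^ 2 + 2 * 1) * ‖W ((σ:ℂ) + t * I)‖ := by ring
        _ ≤ (20 / (σ - 1) ^ 2 + 2 * (1 / (σ - 1) ^ 2)) * (x ^ σ * (1 + t ^ 2)⁻¹) := by gcongr
        _ = _ := by ring) hgint
  -- rectangle
  have hTn : -T ≤ T := by linarith
  have hrect := integral_boundary_rect_eq_zero_of_differentiableOn (fun s => G s * W s)
    (((1 - η : ℝ):ℂ) + ((-T : ℝ):ℂ) * I) ((σ:ℂ) + (T:ℂ) * I) (by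
      intro s hs
      rw [mem_reProdIm] at hs
      simp only [add_re, ofReal_re, mul_re, I_re, mul_zero, ofReal_im, I_im, mul_one, sub_self,
        add_zero, add_im, mul_im, zero_add] at hs
      rw [uIcc_of_le (by linarith), uIcc_of_le hTn] at hs
      have hs1 : 0 < s.re := by linarith [hs.1.1]
      have h0 : s ≠ 0 := by rintro rfl; simp at hs1
      have h0' : s + 1 ≠ 0 := by
        intro h; have := congrArg re h; simp at this; linarith
      refine DifferentiableAt.differentiableWithinAt ?_
      refine (hd s hs.1.1 hs.1.2 (abs_le.2 hs.2)).mul ?_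
      refine DifferentiableAt.mul ?_ ?_
      · exact DifferentiableAt.const_cpow differentiableAt_id (Or.inl (by exact_mod_cast hx0.ne'))
      · unfold ker
        refine DifferentiableAt.div (by fun_prop) (by fun_prop) (mul_ne_zero h0 h0'))
  simp only [add_re, ofReal_re, mul_re, I_re, mul_zero, ofReal_im, I_im, mul_one, sub_self,
        add_zero, add_im, mul_im, zero_add, smul_eq_mul] at hrect
  have hmid : (∫ t in (-T)..T, g t) =
      (∫ t in (-T)..T, G (((1 - η : ℝ):ℂ) + t * I) * W (((1 - η : ℝ):ℂ) + t * I)) +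
      I * ((∫ u in (1 - η)..σ, G ((u:ℂ) + ((-T : ℝ):ℂ) * I) * W ((u:ℂ) + ((-T : ℝ):ℂ) * I)) -
        ∫ u in (1 - η)..σ, G ((u:ℂ) + (T:ℂ) * I) * W ((u:ℂ) + (T:ℂ) * I)) := by
    have hI : I * I = -1 := I_mul_I
    linear_combination (-I) * hrect + ((∫ t in (-T)..T, g t) -
      (∫ t in (-T)..T, G (((1 - η : ℝ):ℂ) + t * I) * W (((1 - η : ℝ):ℂ) + t * I))) * hI
  have hhor : ∀ T' : ℝ, |T'| = T → ‖∫ u in (1 - η)..σ, G ((u:ℂ) + (T':ℂ) * I) *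
      W ((u:ℂ) + (T':ℂ) * I)‖ ≤ 2 * (B * x ^ σ / T ^ 2) := by
    intro T' hT'
    have h3 : ∀ u ∈ uIoc (1 - η) σ, ‖G ((u:ℂ) + (T':ℂ) * I) * W ((u:ℂ) + (T':ℂ) * I)‖ ≤
        B * x ^ σ / T ^ 2 := by
      intro u hu
      rw [uIoc_of_le (by linarith)] at hu
      rw [norm_mul, hW]
      simp only
      rw [norm_mul, norm_xpow hx0]
      have hG := hb ((u:ℂ) + (T':ℂ) * I) (by simp; linarith [hu.1]) (by simp; exact hu.2)
        (by simp [hT'])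
      have hk : ‖ker ((u:ℂ) + (T':ℂ) * I)‖ ≤ 1 / T ^ 2 := by
        refine (ker_bound (by simp; linarith [hu.1])).trans ?_
        simp only [add_re, ofReal_re, mul_re, I_re, mul_zero, ofReal_im, I_im, mul_one, sub_self,
        add_zero, add_im, mul_im, zero_add]
        rw [← sq_abs T', hT', one_div]
        gcongr
        nlinarith
      have hxx : x ^ u ≤ x ^ σ := Real.rpow_le_rpow_of_exponent_le hx hu.2
      calc _ ≤ B * (x ^ σ * (1 / T ^ 2)) := by gcongr
        _ = _ := by ring
    refine (intervalIntegral.norm_integral_le_of_norm_le_const h3).trans ?_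
    rw [abs_of_pos (by linarith), mul_comm]
    gcongr
    linarith
  have hleft : ‖∫ t in (-T)..T, G (((1 - η : ℝ):ℂ) + t * I) * W (((1 - η : ℝ):ℂ) + t * I)‖ ≤
      4 * B * x ^ (1 - η) * Real.pi := by
    have h3 : ∀ t ∈ Ioc (-T) T, ‖G (((1 - η : ℝ):ℂ) + t * I) * W (((1 - η : ℝ):ℂ) + t * I)‖ ≤
        4 * B * x ^ (1 - η) * (1 + t ^ 2)⁻¹ := by
      intro t ht
      rw [norm_mul, hW]
      simp only
      rw [norm_mul, norm_xpow hx0]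
      have hG := hb (((1 - η : ℝ):ℂ) + (t:ℂ) * I) (by simp) (by simp; linarith)
        (by simp; exact abs_le.2 ⟨ht.1.le, ht.2⟩)
      have hk : ‖ker (((1 - η : ℝ):ℂ) + (t:ℂ) * I)‖ ≤ 4 * (1 + t ^ 2)⁻¹ := by
        refine (ker_bound (by simp; linarith)).trans ?_
        simp only [add_re, ofReal_re, mul_re, I_re, mul_zero, ofReal_im, I_im, mul_one, sub_self,
        add_zero, add_im, mul_im, zero_add]
        rw [← div_eq_mul_inv, inv_eq_one_div, div_le_div_iff₀ (by nlinarith) (by positivity)]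
        nlinarith
      calc _ ≤ B * (x ^ (1 - η) * (4 * (1 + t ^ 2)⁻¹)) := by gcongr
        _ = _ := by ring
    have hii := (integrable_inv_one_add_sq.const_mul (4 * B * x ^ (1 - η)))
    refine (intervalIntegral.norm_integral_le_of_norm_le hTn (.of_forall h3)
      hii.intervalIntegrable).trans ?_
    rw [intervalIntegral.integral_of_le hTn]
    refine (setIntegral_le_integral hii (.of_forall fun t => by simp only [Pi.zero_apply]; positivity)).trans ?_
    rw [integral_const_mul, integral_univ_inv_one_add_sq]
  have hfin : ‖∫ t, g t‖ ≤ 2 * (22 / (σ - 1) ^ 2 * x ^ σ) / T +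
      (4 * B * x ^ (1 - η) * Real.pi + (2 * (B * x ^ σ / T ^ 2) + 2 * (B * x ^ σ / T ^ 2))) := by
    have : (∫ t, g t) = ((∫ t, g t) - ∫ t in (-T)..T, g t) + ∫ t in (-T)..T, g t := by ring
    rw [this]
    refine (norm_add_le _ _).trans (add_le_add htail ?_)
    rw [hmid]
    refine (norm_add_le _ _).trans (add_le_add hleft ?_)
    rw [norm_mul, norm_I, one_mul]
    refine (norm_sub_le _ _).trans (add_le_add (hhor _ ?_) (hhor _ ?_))
    · rw [abs_neg, abs_of_pos (by linarith)]
    · rw [abs_of_pos (by linarith)]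
  have hpi : ‖(1 / (2 * Real.pi) : ℝ)‖ ≤ 1 := by
    rw [Real.norm_eq_abs, abs_of_pos (by positivity)]
    rw [div_le_one (by positivity)]
    linarith [Real.pi_gt_three]
  refine (mul_le_of_le_one_left (norm_nonneg _) hpi).trans ?_
  refine hfin.trans ?_
  have hpi4 : Real.pi ≤ 4 := Real.pi_le_four
  have : 4 * B * x ^ (1 - η) * Real.pi ≤ 16 * B * x ^ (1 - η) := by
    have : 0 ≤ B * x ^ (1 - η) := by positivity
    nlinarith
  have e1 : 2 * (22 / (σ - 1) ^ 2 * x ^ σ) / T = 44 * x ^ σ / ((σ - 1) ^ 2 * T) := by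
    field_simp; ring
  rw [e1]
  have e2 : (2 * (B * x ^ σ / T ^ 2) + 2 * (B * x ^ σ / T ^ 2)) = 4 * x ^ σ * B / T ^ 2 := by ring
  rw [e2]
  linarith

end MA
end


section
open Complex Metric Set Filter Topology MeasureTheory

namespace MA

open ArithmeticFunction in
lemma sharp_step {a : ℕ → ℂ} (ha : ∀ n, ‖a n‖ ≤ vonMangoldt n) {β N E x h : ℝ}
    {δ κ : ℕ} (hδ : δ ≤ 1) (hκ : κ ≤ 1) (hβ : 0 < β) (hβ1 : β < 1) (hN : 1 ≤ N)
    (hE : ∀ x : ℝ, 1 ≤ x → x ≤ 2 * N → ‖(∑ n ∈ Finset.Icc 1 ⌊x⌋₊, a n * ((x - n : ℝ) : ℂ)) -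
      ((δ * (x ^ 2 / 2) - κ * (x ^ (β + 1) / (β * (β + 1))) : ℝ) : ℂ)‖ ≤ E)
    (hx : 1 ≤ x) (hxN : x ≤ N) (hh : 0 < h) (hhN : h ≤ N) :
    h * ‖(∑ n ∈ Finset.Icc 1 ⌊x⌋₊, a n) - ((δ * x - κ * (x ^ β / β) : ℝ) : ℂ)‖ ≤
      2 * E + h ^ 2 + h * ((h + 1) * Real.log (2 * N)) := by
  set M : ℝ → ℝ := fun x => δ * (x ^ 2 / 2) - κ * (x ^ (β + 1) / (β * (β + 1))) with hM
  set m : ℝ → ℝ := fun x => δ * x - κ * (x ^ β / β) with hm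
  have hδ' : (δ:ℝ) ≤ 1 := by exact_mod_cast hδ
  have hκ' : (κ:ℝ) ≤ 1 := by exact_mod_cast hκ
  have hδ0 : (0:ℝ) ≤ δ := by positivity
  have hκ0 : (0:ℝ) ≤ κ := by positivity
  have hx0 : 0 < x := by linarith
  have hMd : ∀ y ∈ Icc x (x + h), HasDerivWithinAt (fun y => M y - m x * y) (m y - m x) (Icc x (x + h)) y := by
    intro y hy
    have hy0 : 0 < y := by linarith [hy.1]
    have h1 : HasDerivAt (fun y : ℝ => y ^ (β + 1)) ((β + 1) * y ^ (β + 1 - 1)) y :=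
      Real.hasDerivAt_rpow_const (Or.inl hy0.ne')
    have h2 : HasDerivAt (fun y : ℝ => y ^ 2) (2 * y) y := by simpa using hasDerivAt_pow 2 y
    have h3 := (((h2.div_const 2).const_mul (δ:ℝ)).sub
      ((h1.div_const (β * (β + 1))).const_mul (κ:ℝ))).sub ((hasDerivAt_id y).const_mul (m x))
    refine (h3.congr_deriv ?_).hasDerivWithinAt
    rw [hm]; simp only
    rw [add_sub_cancel_right]
    field_simp
  have hmd : ∀ y ∈ Icc x (x + h), HasDerivWithinAt m (δ - κ * y ^ (β - 1)) (Icc x (x + h)) y := by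
    intro y hy
    have hy0 : 0 < y := by linarith [hy.1]
    have h1 : HasDerivAt (fun y : ℝ => y ^ β) (β * y ^ (β - 1)) y :=
      Real.hasDerivAt_rpow_const (Or.inl hy0.ne')
    have h3 := ((hasDerivAt_id y).const_mul (δ:ℝ)).sub ((h1.div_const β).const_mul (κ:ℝ))
    refine (h3.congr_deriv ?_).hasDerivWithinAt
    field_simp
  have hmem : x ∈ Icc x (x + h) := ⟨le_rfl, by linarith⟩
  have hmem' : x + h ∈ Icc x (x + h) := ⟨by linarith, le_rfl⟩
  have hlip : ∀ y ∈ Icc x (x + h), ‖m y - m x‖ ≤ h := by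
    intro y hy
    have := (convex_Icc x (x + h)).norm_image_sub_le_of_norm_hasDerivWithin_le (C := 1) hmd (by
      intro z hz
      have hz1 : 1 ≤ z := by linarith [hz.1]
      have h1 : z ^ (β - 1) ≤ 1 := Real.rpow_le_one_of_one_le_of_nonpos hz1 (by linarith)
      have h2 : 0 ≤ z ^ (β - 1) := by positivity
      rw [Real.norm_eq_abs, abs_le]
      constructor <;> nlinarith) hmem hy
    refine this.trans ?_
    rw [one_mul, Real.norm_eq_abs, abs_of_nonneg (by linarith [hy.1])]
    linarith [hy.2]
  have hMdiff : ‖M (x + h) - M x - h * m x‖ ≤ h ^ 2 := by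
    have := (convex_Icc x (x + h)).norm_image_sub_le_of_norm_hasDerivWithin_le (C := h) hMd hlip
      hmem hmem'
    rw [add_sub_cancel_left, Real.norm_eq_abs h, abs_of_pos hh] at this
    rw [show M (x + h) - M x - h * m x = M (x + h) - m x * (x + h) - (M x - m x * x) by ring, sq]
    exact this
  -- sums
  have hfl : ⌊x⌋₊ ≤ ⌊x + h⌋₊ := Nat.floor_le_floor (by linarith)
  have hIoc : ∀ f : ℕ → ℂ, ∑ n ∈ Finset.Icc 1 ⌊x + h⌋₊, f n =
      ∑ n ∈ Finset.Icc 1 ⌊x⌋₊, f n + ∑ n ∈ Finset.Ioc ⌊x⌋₊ ⌊x + h⌋₊, f n := by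
    intro f
    have e : ∀ m : ℕ, Finset.Icc 1 m = Finset.Ioc 0 m := fun m => rfl
    rw [e, e, ← Finset.sum_union (Finset.disjoint_left.2 fun i hi hj => by
      rw [Finset.mem_Ioc] at hi hj; omega)]
    congr 1
    ext i; simp only [Finset.mem_Ioc, Finset.mem_union]; omega
  have hR : ‖∑ n ∈ Finset.Ioc ⌊x⌋₊ ⌊x + h⌋₊, a n * ((x + h - n : ℝ) : ℂ)‖ ≤
      h * ((h + 1) * Real.log (2 * N)) := by
    have hl0 : 0 ≤ Real.log (2 * N) := Real.log_nonneg (by linarith)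
    refine (norm_sum_le _ _).trans ?_
    have hb : ∀ n ∈ Finset.Ioc ⌊x⌋₊ ⌊x + h⌋₊, ‖a n * ((x + h - n : ℝ) : ℂ)‖ ≤
        Real.log (2 * N) * h := by
      intro n hn
      rw [Finset.mem_Ioc] at hn
      have h1 : x < n := Nat.lt_of_floor_lt hn.1
      have h2 : (n:ℝ) ≤ x + h := (Nat.le_floor_iff (by linarith)).1 hn.2
      rw [norm_mul, norm_real, Real.norm_eq_abs, abs_of_nonneg (by linarith)]
      have h3 : ‖a n‖ ≤ Real.log (2 * N) := (ha n).trans (vonMangoldt_le_log.trans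
        (Real.log_le_log (by linarith) (by linarith)))
      gcongr
      linarith
    refine (Finset.sum_le_card_nsmul _ _ _ hb).trans ?_
    rw [Nat.card_Ioc, nsmul_eq_mul, Nat.cast_sub hfl]
    have h4 : (⌊x + h⌋₊ : ℝ) ≤ x + h := Nat.floor_le (by linarith)
    have h5 : x < ⌊x⌋₊ + 1 := Nat.lt_floor_add_one x
    have h6 : (⌊x + h⌋₊ : ℝ) - ⌊x⌋₊ ≤ h + 1 := by linarith
    calc _ ≤ (h + 1) * (Real.log (2 * N) * h) := by gcongr
      _ = _ := by ring
  have e1 := hE (x + h) (by linarith) (by linarith)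
  have e2 := hE x hx (by linarith)
  have hid : (h:ℂ) * ((∑ n ∈ Finset.Icc 1 ⌊x⌋₊, a n) - (m x : ℝ)) =
      ((∑ n ∈ Finset.Icc 1 ⌊x + h⌋₊, a n * ((x + h - n : ℝ) : ℂ)) - (M (x + h) : ℝ)) -
      ((∑ n ∈ Finset.Icc 1 ⌊x⌋₊, a n * ((x - n : ℝ) : ℂ)) - (M x : ℝ)) +
      ((M (x + h) - M x - h * m x : ℝ) : ℂ) -
      ∑ n ∈ Finset.Ioc ⌊x⌋₊ ⌊x + h⌋₊, a n * ((x + h - n : ℝ) : ℂ) := by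
    rw [hIoc]
    have : ∑ n ∈ Finset.Icc 1 ⌊x⌋₊, a n * ((x + h - n : ℝ) : ℂ) =
        ∑ n ∈ Finset.Icc 1 ⌊x⌋₊, a n * ((x - n : ℝ) : ℂ) + h * ∑ n ∈ Finset.Icc 1 ⌊x⌋₊, a n := by
      rw [Finset.mul_sum, ← Finset.sum_add_distrib]
      refine Finset.sum_congr rfl fun n _ => ?_
      push_cast; ring
    rw [this]
    push_cast
    ring
  have hnorm : h * ‖(∑ n ∈ Finset.Icc 1 ⌊x⌋₊, a n) - (m x : ℝ)‖ =
      ‖(h:ℂ) * ((∑ n ∈ Finset.Icc 1 ⌊x⌋₊, a n) - (m x : ℝ))‖ := by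
    rw [norm_mul, norm_real, Real.norm_eq_abs, abs_of_pos hh]
  rw [hnorm, hid]
  refine (norm_sub_le _ _).trans ?_
  refine (add_le_add ((norm_add_le _ _).trans (add_le_add (norm_sub_le _ _) le_rfl)) hR).trans ?_
  rw [norm_real ]
  linarith

lemma ev_exp (C : ℝ) (n : ℕ) {b : ℝ} (hb : 0 < b) :
    ∀ᶠ y : ℝ in atTop, C * y ^ n ≤ Real.exp (b * y) := by
  have h := (isLittleO_pow_exp_pos_mul_atTop n hb).bound (c := (|C| + 1)⁻¹) (by positivity)
  filter_upwards [h, eventually_ge_atTop 0] with y hy hy0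
  rw [Real.norm_eq_abs, Real.norm_eq_abs, abs_of_nonneg (by positivity),
    abs_of_pos (Real.exp_pos _)] at hy
  have hC : C * y ^ n ≤ (|C| + 1) * y ^ n := by
    gcongr
    linarith [le_abs_self C]
  refine hC.trans ?_
  calc (|C| + 1) * y ^ n ≤ (|C| + 1) * ((|C| + 1)⁻¹ * Real.exp (b * y)) := by gcongr
    _ = _ := by field_simp

lemma tend_sqrtlog : Tendsto (fun N : ℝ => Real.sqrt (Real.log N)) atTop atTop :=
  Real.tendsto_sqrt_atTop.comp Real.tendsto_log_atTop

/-- constant of the zero free region -/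
noncomputable def c1 : ℝ := aa / 5

lemma exp_two_le : Real.exp 2 ≤ 8 := by
  have : Real.exp 2 = Real.exp 1 * Real.exp 1 := by rw [← Real.exp_add]; norm_num
  have h3 := Real.exp_one_lt_d9
  have h4 := Real.exp_pos 1
  nlinarith

lemma smooth_id {a : ℕ → ℂ} {x β : ℝ} {p e : ℕ} (hx0 : 0 < x) (hβ : 0 < β) :
    (∑ n ∈ Finset.Icc 1 ⌊x⌋₊, a n * ((x - n : ℝ) : ℂ)) -
      ((p * (x ^ 2 / 2) - e * (x ^ (β + 1) / (β * (β + 1))) : ℝ) : ℂ) =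
      (x:ℂ) * ((∑ n ∈ Finset.Icc 1 ⌊x⌋₊, a n * (1 - n / x : ℝ))
      - p * ((x / 2 - 1 + x⁻¹ / 2 : ℝ) : ℂ)
      + e * ((x ^ β / (β * (β + 1)) - 1 / β + x⁻¹ / (β + 1) : ℝ) : ℂ)) +
      ((p * (- x + 1 / 2) + e * (x / β - 1 / (β + 1)) : ℝ) : ℂ) := by
  have hS : (∑ n ∈ Finset.Icc 1 ⌊x⌋₊, a n * ((x - n : ℝ) : ℂ)) =
      x * ∑ n ∈ Finset.Icc 1 ⌊x⌋₊, a n * ((1 - n / x : ℝ) : ℂ) := by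
    rw [Finset.mul_sum]
    refine Finset.sum_congr rfl fun n _ => ?_
    have : (x - n : ℝ) = x * (1 - n / x) := by field_simp
    rw [this]; push_cast; ring
  rw [hS, Real.rpow_add hx0, Real.rpow_one]
  generalize ∑ n ∈ Finset.Icc 1 ⌊x⌋₊, a n * ((1 - n / x : ℝ) : ℂ) = S
  have h1 : (x * (p * (x / 2 - 1 + x⁻¹ / 2)) - x * (e * (x ^ β / (β * (β + 1)) - 1 / β + x⁻¹ / (β + 1)))
      - (p * (- x + 1 / 2) + e * (x / β - 1 / (β + 1))) : ℝ) =
      p * (x ^ 2 / 2) - e * (x ^ β * x / (β * (β + 1))) := by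
    field_simp
    ring
  rw [← h1]
  push_cast
  ring

set_option maxHeartbeats 4000000 in
lemma psi_char : ∃ c : ℝ, 0 < c ∧ ∀ᶠ N : ℝ in atTop, ∀ (q : ℕ) [NeZero q],
    (q:ℝ) ≤ Real.exp (Real.sqrt (Real.log N)) →
    ∃ (χ1 : DirichletCharacter ℂ q) (β : ℝ) (κ : ℕ),
      (κ = 0 ∨ κ = 1 ∧ χ1 ≠ 1 ∧ χ1 ^ 2 = 1 ∧ LF χ1 β = 0) ∧ 1/2 ≤ β ∧ β < 1 ∧
      ∀ χ : DirichletCharacter ℂ q, ∀ x : ℝ, 1 ≤ x → x ≤ N →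
        ‖(∑ n ∈ Finset.Icc 1 ⌊x⌋₊, chl χ n) - ((pri χ * x - exq χ1 κ χ * (x ^ β / β) : ℝ) : ℂ)‖
          ≤ N * Real.exp (-(c * Real.sqrt (Real.log N))) := by
  have hc1 : 0 < c1 := by norm_num [c1, aa]
  have hc1' : c1 ≤ 1 / 100 := by norm_num [c1, aa]
  refine ⟨c1 / 96, by positivity, ?_⟩
  have ev := tend_sqrtlog.eventually (((ev_exp 1 0 (b := 1) one_pos).and (eventually_ge_atTop (4 / c1))).and
    ((ev_exp (10 ^ 18) 4 (b := c1 / 24) (by positivity)).and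
      ((ev_exp 18 2 (b := c1 / 96) (by positivity)))))
  filter_upwards [ev, eventually_ge_atTop (10:ℝ)] with N hev hN10 q _ hq
  obtain ⟨⟨-, hy⟩, hA, hB⟩ := hev
  set y := Real.sqrt (Real.log N) with hyd
  have hN0 : 0 < N := by linarith
  have hlogN : 0 ≤ Real.log N := Real.log_nonneg (by linarith)
  have hy2 : y ^ 2 = Real.log N := Real.sq_sqrt hlogN
  have hNe : N = Real.exp (y ^ 2) := by rw [hy2, Real.exp_log hN0]
  have hyb : 400 ≤ y := by
    refine le_trans ?_ hy
    rw [le_div_iff₀ hc1]; linarith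
  have hq1 : (1:ℝ) ≤ q := by exact_mod_cast NeZero.one_le
  -- T
  set T := Real.exp y + 1 with hTd
  have hexpy : y + 1 ≤ Real.exp y := Real.add_one_le_exp y
  have hT3 : 3 ≤ T := by rw [hTd]; linarith
  have hl1 := ell_ge_one q hT3
  obtain ⟨χ1, β, κ, hex, hβ, hβ1, hG⟩ := zf_final q hT3
  set ℓ := Real.log (q * T) with hℓ
  have hℓ3 : ℓ ≤ 3 * y := by
    have h1 : (q:ℝ) * T ≤ Real.exp (3 * y) := by
      have : T ≤ Real.exp (2 * y) := by
        rw [hTd, show Real.exp (2 * y) = Real.exp y * Real.exp y by rw [← Real.exp_add]; ring_nf]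
        nlinarith only [hexpy, hyb]
      calc (q:ℝ) * T ≤ Real.exp y * Real.exp (2 * y) := by gcongr
        _ = Real.exp (3 * y) := by rw [← Real.exp_add]; ring_nf
    rw [hℓ, ← Real.log_exp (3 * y)]
    exact Real.log_le_log (by positivity) h1
  have hη0d : c1 / (3 * y) ≤ c1 / ℓ := by gcongr
  have hη0 : 0 < c1 / ℓ := by positivity
  have hη0s : c1 / ℓ ≤ 1/100 := by
    rw [div_le_iff₀ (by linarith)]; nlinarith only [hc1', hl1]
  have hc1e : aa / 5 / ℓ = c1 / ℓ := by rw [c1]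
  rw [hc1e] at hβ hG
  have hβ2 : 1/2 ≤ β := by linarith
  have hκ1 : κ ≤ 1 := by rcases hex with h | h <;> omega
  refine ⟨χ1, β, κ, hex, hβ2, hβ1, ?_⟩
  intro χ x hx hxN
  obtain ⟨G, hd, hL, hb⟩ := hG χ
  set e := exq χ1 κ χ with hed
  have he1 : e ≤ 1 := by rw [hed, exq]; split_ifs <;> omega
  have ha : ∀ n, ‖chl χ n‖ ≤ ArithmeticFunction.vonMangoldt n := by
    intro n
    rw [chl, norm_mul, norm_real, Real.norm_eq_abs,
      abs_of_nonneg ArithmeticFunction.vonMangoldt_nonneg]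
    exact mul_le_of_le_one_left ArithmeticFunction.vonMangoldt_nonneg (χ.norm_le_one _)
  set σ := 1 + 1 / y ^ 2 with hσd
  have hσ1 : 1 < σ := by rw [hσd]; have : 0 < 1 / y ^ 2 := by positivity
                         linarith
  have hσ34 : σ ≤ 1 + c1 / ℓ * (3/4) := by
    have h1 : 1 / y ^ 2 ≤ c1 / (3 * y) * (3/4) := by
      rw [div_le_iff₀ hc1] at hy
      rw [div_mul_eq_mul_div, div_le_div_iff₀ (by positivity) (by positivity)]
      nlinarith only [hy, hyb]
    rw [hσd]
    linarith only [h1, hη0d]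
  have hσ2 : σ ≤ 2 := by linarith
  set B := 10 ^ 15 * ℓ ^ 2 with hBd
  have hBb : B ≤ 10 ^ 16 * y ^ 2 := by
    rw [hBd]
    have : ℓ ^ 2 ≤ (3 * y) ^ 2 := by gcongr
    nlinarith only [this, sq_nonneg y]
  have hB0 : 0 ≤ B := by positivity
  set X := Real.exp (c1 / 12 * y) with hX
  have hX1 : 1 ≤ X := Real.one_le_exp (by positivity)
  -- error in the smoothed sum
  have hE : ∀ x : ℝ, 1 ≤ x → x ≤ 2 * N → ‖(∑ n ∈ Finset.Icc 1 ⌊x⌋₊, chl χ n * ((x - n : ℝ) : ℂ)) -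
      ((pri χ * (x ^ 2 / 2) - e * (x ^ (β + 1) / (β * (β + 1))) : ℝ) : ℂ)‖ ≤
      N ^ 2 * (10 ^ 18 * y ^ 4 / X) := by
    intro x hx hx2
    have hx0 : 0 < x := by linarith
    have hp := perron_main ha (G := G) (β := β) (η := c1 / ℓ / 4) (B := B) (T := T - 1) (σ := σ)
      (x := x) (pri_le χ) he1 (by positivity) (by linarith) (by linarith) hβ1 hσ1 hσ2
      (by rw [hTd]; linarith) hB0
      (fun s h1 h2 h3 => hd s (by linarith) (by linarith))
      (fun s h1 h2 h3 => hb s h1 (by linarith) h3) hL hx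
    have hT1 : T - 1 = Real.exp y := by rw [hTd]; ring
    rw [hT1] at hp
    have hxσ : x ^ σ ≤ 16 * N := by
      calc x ^ σ ≤ (2 * N) ^ σ := by gcongr
        _ = (2 * N) * (2 * N) ^ (1 / y ^ 2) := by rw [hσd, Real.rpow_add (by positivity), Real.rpow_one]
        _ ≤ (2 * N) * 8 := by
          gcongr
          have h1 : 2 * N ≤ Real.exp (2 * y ^ 2) := by
            rw [show Real.exp (2 * y ^ 2) = N * N by rw [hNe, ← Real.exp_add]; ring_nf]
            nlinarith only [hN10]
          calc (2 * N) ^ (1 / y ^ 2) ≤ (Real.exp (2 * y ^ 2)) ^ (1 / y ^ 2) := by gcongr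
            _ = Real.exp 2 := by rw [← Real.exp_mul]; congr 1; field_simp
            _ ≤ 8 := exp_two_le
        _ = 16 * N := by ring
    have hxη : x ^ (1 - c1 / ℓ / 4) ≤ 2 * N / X := by
      have h1 : x ^ (1 - c1 / ℓ / 4) ≤ (2 * N) ^ (1 - c1 / ℓ / 4) := by
        gcongr; linarith
      have h2 : (2 * N) ^ (1 - c1 / ℓ / 4) = (2 * N) / (2 * N) ^ (c1 / ℓ / 4) := by
        rw [Real.rpow_sub (by positivity), Real.rpow_one]
      have h3 : X ≤ (2 * N) ^ (c1 / ℓ / 4) := by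
        calc X = N ^ (c1 / (3 * y) / 4) := by
              rw [hX, hNe, ← Real.exp_mul]; congr 1; field_simp; norm_num
          _ ≤ N ^ (c1 / ℓ / 4) := Real.rpow_le_rpow_of_exponent_le (by linarith) (by linarith)
          _ ≤ _ := by gcongr; linarith
      rw [h2] at h1
      exact h1.trans (by gcongr)
    have hXy : X ≤ Real.exp y := by rw [hX]; apply Real.exp_le_exp.2; nlinarith only [hc1', hyb]
    have hσm : (σ - 1) ^ 2 = 1 / y ^ 4 := by rw [hσd]; field_simp; ring
    have hbd : 44 * x ^ σ / ((σ - 1) ^ 2 * Real.exp y) + 4 * x ^ σ * B / Real.exp y ^ 2 +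
        16 * B * x ^ (1 - c1 / ℓ / 4) ≤ N * (3.3 * 10 ^ 17 * y ^ 4 / X) := by
      have k1 : 44 * x ^ σ / ((σ - 1) ^ 2 * Real.exp y) ≤ 704 * N * y ^ 4 / X := by
        rw [hσm]
        calc 44 * x ^ σ / (1 / y ^ 4 * Real.exp y) ≤ 44 * (16 * N) / (1 / y ^ 4 * X) := by gcongr
          _ = _ := by field_simp; norm_num
      have k2 : 4 * x ^ σ * B / Real.exp y ^ 2 ≤ 4 * (16 * N) * (10 ^ 16 * y ^ 2) / X := by
        have : X ≤ Real.exp y ^ 2 := hXy.trans (by nlinarith only [hexpy, hyb])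
        gcongr
      have k3 : 16 * B * x ^ (1 - c1 / ℓ / 4) ≤ 16 * (10 ^ 16 * y ^ 2) * (2 * N / X) := by gcongr
      have hNX : 0 < N / X := by positivity
      have hy4 : y ^ 2 * 1000 ≤ y ^ 4 := by
        have : (1000:ℝ) ≤ y ^ 2 := by nlinarith only [hyb]
        calc y ^ 2 * 1000 ≤ y ^ 2 * y ^ 2 := by gcongr
          _ = y ^ 4 := by ring
      calc _ ≤ 704 * N * y ^ 4 / X + 4 * (16 * N) * (10 ^ 16 * y ^ 2) / X +
            16 * (10 ^ 16 * y ^ 2) * (2 * N / X) := by linarith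
        _ = (N / X) * (704 * y ^ 4 + 96 * 10 ^ 16 * y ^ 2) := by ring
        _ ≤ (N / X) * (3.3 * 10 ^ 17 * y ^ 4) := by gcongr; linarith
        _ = _ := by ring
    have hid := smooth_id (a := chl χ) (p := pri χ) (e := e) hx0 (show 0 < β by linarith)
    rw [hid]
    refine (norm_add_le _ _).trans ?_
    have hsm : ‖((pri χ * (- x + 1 / 2) + e * (x / β - 1 / (β + 1)) : ℝ) : ℂ)‖ ≤ 4 * x := by
      rw [norm_real, Real.norm_eq_abs]
      have p1 : (pri χ : ℝ) ≤ 1 := by exact_mod_cast pri_le χ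
      have p2 : (e : ℝ) ≤ 1 := by exact_mod_cast he1
      have p3 : (0 : ℝ) ≤ pri χ := by positivity
      have p4 : (0 : ℝ) ≤ e := by positivity
      have p5 : x / β ≤ 2 * x := by rw [div_le_iff₀ (by linarith)]; nlinarith only [hβ2, hx0]
      have p6 : 0 ≤ x / β := by positivity
      have p7 : 0 ≤ 1 / (β + 1) := by positivity
      have p8 : 1 / (β + 1) ≤ 1 := by rw [div_le_one (by linarith)]; linarith
      rw [abs_le]
      have p9 : (pri χ : ℝ) * (x - 1 / 2) ≤ x := by nlinarith only [p1, p3, hx]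
      have p10 : 0 ≤ (pri χ : ℝ) * (x - 1 / 2) := mul_nonneg p3 (by linarith)
      have p11 : |(e : ℝ) * (x / β - 1 / (β + 1))| ≤ 2 * x := by
        rw [abs_mul, abs_of_nonneg p4]
        have : |x / β - 1 / (β + 1)| ≤ 2 * x := by
          rw [abs_le]; constructor <;> linarith only [p5, p6, p7, p8, hx]
        nlinarith only [this, p2, abs_nonneg (x / β - 1 / (β + 1)), hx]
      rw [abs_le] at p11
      constructor <;> linarith only [p9, p10, p11.1, p11.2, hx]
    rw [norm_mul, norm_real, Real.norm_eq_abs, abs_of_pos hx0]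
    have hfin1 : x * (N * (3.3 * 10 ^ 17 * y ^ 4 / X)) ≤ 2 * N * (N * (3.3 * 10 ^ 17 * y ^ 4 / X)) := by
      gcongr
    have hXN : X ≤ N := by
      rw [hX, hNe]
      apply Real.exp_le_exp.2; nlinarith only [hc1', hyb, hc1]
    have hfin2 : 4 * x ≤ N ^ 2 * (8 * y ^ 4 / X) := by
      have : X * (4 * x) ≤ N * (8 * N) := by
        calc X * (4 * x) ≤ N * (4 * (2 * N)) := by gcongr
          _ = _ := by ring
      have h2 : 4 * x ≤ N * (8 * N) / X := by rw [le_div_iff₀ (by positivity)]; linarith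
      have h3 : (1:ℝ) ≤ y ^ 4 := one_le_pow₀ (by linarith)
      calc 4 * x ≤ N * (8 * N) / X := h2
        _ = N ^ 2 * (8 * 1 / X) := by ring
        _ ≤ _ := by gcongr
    calc _ ≤ x * (N * (3.3 * 10 ^ 17 * y ^ 4 / X)) + 4 * x := by
          gcongr; exact hp.trans hbd
      _ ≤ 2 * N * (N * (3.3 * 10 ^ 17 * y ^ 4 / X)) + N ^ 2 * (8 * y ^ 4 / X) := by linarith
      _ = N ^ 2 * ((6.6 * 10 ^ 17 + 8) * y ^ 4 / X) := by ring
      _ ≤ _ := by gcongr; norm_num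
  -- choose h
  set Z := Real.exp (c1 / 48 * y) with hZ
  have hZ1 : 1 ≤ Z := Real.one_le_exp (by positivity)
  have hZX : X = Z ^ 4 := by rw [hX, hZ, ← Real.exp_nat_mul]; congr 1; push_cast; ring
  have hZA : 10 ^ 18 * y ^ 4 ≤ Z ^ 2 := by
    refine hA.trans (le_of_eq ?_)
    rw [hZ, ← Real.exp_nat_mul]; congr 1; push_cast; ring
  have hZN : Z ≤ N := by
    rw [hZ, hNe]; apply Real.exp_le_exp.2; nlinarith only [hc1', hyb, hc1]
  have hs := sharp_step ha (pri_le χ) he1 (by linarith) hβ1 (by linarith) hE hx hxN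
    (h := N / Z) (by positivity) (div_le_self hN0.le hZ1)
  have hE2 : N ^ 2 * (10 ^ 18 * y ^ 4 / X) ≤ (N / Z) ^ 2 := by
    rw [hZX]
    calc N ^ 2 * (10 ^ 18 * y ^ 4 / Z ^ 4) ≤ N ^ 2 * (Z ^ 2 / Z ^ 4) := by gcongr
      _ = _ := by field_simp
  have hNZ1 : 1 ≤ N / Z := by rw [le_div_iff₀ (by positivity)]; linarith
  have hlog2 : Real.log (2 * N) ≤ 2 * y ^ 2 := by
    have h2 : Real.log (2 * N) ≤ Real.log (N ^ 2) := Real.log_le_log (by positivity) (by nlinarith only [hN10])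
    rw [Real.log_pow, ← hy2] at h2
    exact_mod_cast h2
  have hfin : N / Z * ‖(∑ n ∈ Finset.Icc 1 ⌊x⌋₊, chl χ n) - ((pri χ * x - e * (x ^ β / β) : ℝ) : ℂ)‖ ≤
      N / Z * (N / Z * (9 * y ^ 2)) := by
    refine hs.trans ?_
    have h5 : (N / Z + 1) * Real.log (2 * N) ≤ (2 * (N / Z)) * (2 * y ^ 2) := by
      gcongr
      · exact Real.log_nonneg (by linarith)
      · linarith
    have h6 : 0 < N / Z := by positivity
    have h7 : N / Z * ((N / Z + 1) * Real.log (2 * N)) ≤ N / Z * ((2 * (N / Z)) * (2 * y ^ 2)) := by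
      gcongr
    have h8 : (N / Z) ^ 2 * 1 ≤ (N / Z) ^ 2 * y ^ 2 := by gcongr; nlinarith only [hyb]
    nlinarith only [h7, h8, hE2]
  have hfin2 := le_of_mul_le_mul_left hfin (by positivity)
  refine hfin2.trans ?_
  have hZ2 : Z = Real.exp (c1 / 96 * y) * Real.exp (c1 / 96 * y) := by
    rw [hZ, ← Real.exp_add]; ring_nf
  have hpos := Real.exp_pos (c1 / 96 * y)
  rw [Real.exp_neg, hZ2]
  calc N / (Real.exp (c1 / 96 * y) * Real.exp (c1 / 96 * y)) * (9 * y ^ 2)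
      ≤ N / (Real.exp (c1 / 96 * y) * Real.exp (c1 / 96 * y)) * Real.exp (c1 / 96 * y) := by
        gcongr
        linarith only [hB, sq_nonneg y]
    _ = _ := by field_simp

end MA
end


section
open Complex Metric Set Filter Topology

namespace MA

open scoped ComplexOrder

open Nat in
/-- sign pattern of the derivatives of `F`, when `F' = - g F` -/
lemma alt_deriv {F g : ℂ → ℂ} (hF : AnalyticAt ℂ F 2) (hg : AnalyticAt ℂ g 2)
    (h1 : F 2 = 1) (hd : ∀ᶠ s in 𝓝 (2:ℂ), deriv F s = - (g s * F s))
    (hgn : ∀ n, 0 ≤ (-1) ^ n * iteratedDeriv n g 2) (n : ℕ) :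
    0 ≤ (-1) ^ n * iteratedDeriv n F 2 := by
  induction n using Nat.strong_induction_on with
  | _ n ih =>
  cases n with
  | zero => simp [h1]
  | succ n =>
    have e : iteratedDeriv (n + 1) F 2 = - iteratedDeriv n (fun s => g s * F s) 2 := by
      rw [iteratedDeriv_succ']
      have h2 : deriv F =ᶠ[𝓝 2] fun s => - (g s * F s) := hd
      rw [h2.iteratedDeriv_eq]
      exact iteratedDeriv_fun_neg n _ _
    rw [e, iteratedDeriv_fun_mul hg.contDiffAt hF.contDiffAt, pow_succ]
    have e2 : (-1:ℂ) ^ n * -1 * -(∑ i ∈ Finset.range (n + 1), (n.choose i : ℂ) * iteratedDeriv i g 2 *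
        iteratedDeriv (n - i) F 2) = ∑ i ∈ Finset.range (n + 1), (n.choose i : ℂ) *
        (((-1) ^ i * iteratedDeriv i g 2) * ((-1) ^ (n - i) * iteratedDeriv (n - i) F 2)) := by
      rw [show ∀ S : ℂ, (-1:ℂ) ^ n * -1 * -S = (-1) ^ n * S by intro S; ring, Finset.mul_sum]
      refine Finset.sum_congr rfl fun i hi => ?_
      have : (-1:ℂ) ^ n = (-1) ^ i * (-1) ^ (n - i) := by
        rw [← pow_add]; congr 1; rw [Finset.mem_range] at hi; omega
      rw [this]; ring
    rw [e2]
    refine Finset.sum_nonneg fun i hi => ?_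
    refine mul_nonneg (by exact_mod_cast Nat.zero_le _) (mul_nonneg (hgn i) (ih _ (by omega)))

open Nat in
lemma est_core {h F g : ℂ → ℂ} {lam : ℂ} (hd : Differentiable ℂ h) (hh : h 1 = lam)
    (hFh : ∀ s : ℂ, s ≠ 1 → F s = h s / (s - 1))
    (hg : AnalyticAt ℂ g 2) (h1 : F 2 = 1)
    (hder : ∀ᶠ s in 𝓝 (2:ℂ), deriv F s = - (g s * F s))
    (hgn : ∀ n, 0 ≤ (-1) ^ n * iteratedDeriv n g 2)
    {M : ℝ} (hM : ∀ s : ℂ, ‖s - 2‖ = 3/2 → ‖h s‖ ≤ M) (hM1 : ‖lam‖ ≤ M)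
    {β : ℝ} (hβ : 7/8 ≤ β) (hβ1 : β < 1) (hz : h β = 0)
    {m : ℕ} (hm0 : 0 < m) (hm : 32 * M ≤ (4/3:ℝ) ^ m) :
    (1 - β) / 2 * Real.exp (-((1 - β) * m)) ≤ lam.re := by
  set D := dslope h 1 with hD
  have hDd : Differentiable ℂ D := by
    rw [← differentiableOn_univ] at *
    exact (Complex.differentiableOn_dslope univ_mem).2 hd
  have hDe : ∀ s : ℂ, s ≠ 1 → D s = (h s - lam) / (s - 1) := by
    intro s hs
    rw [hD, dslope_of_ne _ hs, slope_def_field, hh]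
  have h21 : (2:ℂ) ≠ 1 := by norm_num
  have hne : ∀ᶠ s in 𝓝 (2:ℂ), s ≠ 1 := isOpen_ne.mem_nhds h21
  have hFa : AnalyticAt ℂ F 2 := by
    have h3 : AnalyticAt ℂ (fun s => h s / (s - 1)) 2 :=
      (hd.analyticAt 2).div (by fun_prop) (by norm_num)
    refine h3.congr ?_
    filter_upwards [hne] with s hs
    exact (hFh s hs).symm
  have hIa : AnalyticAt ℂ (fun s : ℂ => (s - 1)⁻¹) 2 :=
    AnalyticAt.fun_inv (by fun_prop) (by norm_num)
  have hFn := alt_deriv hFa hg h1 hder hgn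
  have hDn : ∀ n, iteratedDeriv n D 2 = iteratedDeriv n F 2 - lam * ((-1) ^ n * n !) := by
    intro n
    have e1 : D =ᶠ[𝓝 2] fun s => F s - lam * (s - 1)⁻¹ := by
      filter_upwards [hne] with s hs
      rw [hDe s hs, hFh s hs]; field_simp
    rw [e1.iteratedDeriv_eq, iteratedDeriv_fun_sub hFa.contDiffAt
      (hIa.contDiffAt.const_smul lam |>.congr_of_eventuallyEq (Eventually.of_forall fun s => by simp)),
      iteratedDeriv_const_mul_field]
    congr 2
    have e3 : iteratedDeriv n (fun s : ℂ => (s - 1)⁻¹) 2 = iteratedDeriv n (fun s : ℂ => s⁻¹) (2 - 1) :=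
      congrFun (iteratedDeriv_comp_sub_const n (fun s : ℂ => s⁻¹) 1) 2
    rw [e3, iteratedDeriv_eq_iterate, iter_deriv_inv]
    norm_num
  set x : ℝ := 2 - β with hx
  have hts := Complex.hasSum_taylorSeries_of_entire hDd 2 (β:ℂ)
  set t : ℕ → ℂ := fun n => (-1) ^ n * iteratedDeriv n F 2 / n ! with ht
  have htn : ∀ n, 0 ≤ (t n).re := by
    intro n
    have := hFn n
    have h2 : 0 ≤ t n := by
      rw [ht]; simp only [div_eq_mul_inv]
      refine mul_nonneg this ?_
      rw [← ofReal_natCast, ← ofReal_inv]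
      exact_mod_cast (by positivity)
    exact (Complex.le_def.1 h2).1
  have hterm : ∀ n, (n ! : ℂ)⁻¹ • ((β:ℂ) - 2) ^ n • iteratedDeriv n D 2 = (x:ℂ) ^ n * (t n - lam) := by
    intro n
    have hf : (n ! : ℂ) ≠ 0 := by exact_mod_cast n.factorial_ne_zero
    rw [hDn, ht, smul_eq_mul, smul_eq_mul, show ((β:ℂ) - 2) = (-1) * x by rw [hx]; push_cast; ring, mul_pow]
    have h2 : (-1:ℂ) ^ n * (-1) ^ n = 1 := by rw [← mul_pow]; simp
    field_simp
    linear_combination (-(n ! : ℂ) * (x:ℂ) ^ n * lam) * h2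
  simp_rw [hterm] at hts
  have hx1 : 1 < x := by rw [hx]; linarith
  have hx2 : x ≤ 9/8 := by rw [hx]; linarith
  have hM0 : 0 ≤ M := (norm_nonneg _).trans hM1
  have hbn : ∀ n, ‖(x:ℂ) ^ n * (t n - lam)‖ ≤ 4 * M * (3/4) ^ n := by
    intro n
    rw [← hterm]
    have hc := Complex.norm_iteratedDeriv_le_of_forall_mem_sphere_norm_le (c := 2) (R := 3/2)
      (C := 4 * M) n (by norm_num) hDd.diffContOnCl (by
      intro s hs
      rw [mem_sphere_iff_norm] at hs
      have hs1 : s ≠ 1 := by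
        rintro rfl; norm_num at hs
      have hs2 : 1/2 ≤ ‖s - 1‖ := by
        have := norm_sub_norm_le (s - 2) (-1)
        rw [hs, norm_neg, norm_one, show s - 2 - -1 = s - 1 by ring] at this
        linarith
      rw [hDe s hs1, norm_div, div_le_iff₀ (by linarith)]
      have := norm_sub_le (h s) lam
      have := hM s hs
      nlinarith)
    rw [norm_smul, norm_smul, norm_inv, norm_pow]
    have e1 : ‖(β:ℂ) - 2‖ = x := by
      rw [show (β:ℂ) - 2 = ((β - 2 : ℝ) : ℂ) by push_cast; ring, norm_real, Real.norm_eq_abs,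
        abs_of_neg (by linarith), hx]; ring
    have e2 : ‖(n ! : ℂ)‖ = (n ! : ℝ) := by simp
    rw [e1, e2]
    have hfp : (0:ℝ) < n ! := by exact_mod_cast n.factorial_pos
    calc (n ! : ℝ)⁻¹ * (x ^ n * ‖iteratedDeriv n D 2‖) ≤
        (n ! : ℝ)⁻¹ * ((9/8) ^ n * (n ! * (4 * M) / (3/2) ^ n)) := by gcongr
      _ = 4 * M * ((9/8) ^ n / (3/2) ^ n) := by field_simp
      _ = 4 * M * (3/4) ^ n := by rw [← div_pow]; norm_num
  have hDβ : D β = lam / ((1 - β : ℝ) : ℂ) := by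
    have hb1 : (β:ℂ) ≠ 1 := by exact_mod_cast hβ1.ne
    rw [hDe _ hb1, hz]
    push_cast
    rw [zero_sub, ← neg_sub (1:ℂ), neg_div_neg_eq]
  rw [hDβ] at hts
  -- tail
  have htail := (hasSum_nat_add_iff' m).2 hts
  have htb : ‖lam / ((1 - β : ℝ) : ℂ) - ∑ n ∈ Finset.range m, (x:ℂ) ^ n * (t n - lam)‖ ≤
      16 * M * (3/4) ^ m := by
    rw [← htail.tsum_eq]
    have hgs : HasSum (fun n : ℕ => 4 * M * (3/4:ℝ) ^ (n + m)) (16 * M * (3/4) ^ m) := by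
      have := (hasSum_geometric_of_lt_one (r := 3/4) (by norm_num) (by norm_num)).mul_left (4 * M * (3/4:ℝ) ^ m)
      convert! this using 1
      · ext n; rw [pow_add]; ring
      · norm_num; ring
    exact tsum_of_norm_bounded hgs fun n => hbn (n + m)
  have htl : 16 * M * (3/4) ^ m ≤ 1/2 := by
    have e : (3/4:ℝ) ^ m = ((4/3:ℝ) ^ m)⁻¹ := by rw [← inv_pow]; norm_num
    rw [e, ← div_eq_mul_inv, div_le_iff₀ (by positivity)]
    linarith
  have hre : -(1/2) ≤ (lam / ((1 - β : ℝ) : ℂ) - ∑ n ∈ Finset.range m, (x:ℂ) ^ n * (t n - lam)).re := by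
    have := (abs_le.1 (abs_re_le_norm (lam / ((1 - β : ℝ) : ℂ) - ∑ n ∈ Finset.range m, (x:ℂ) ^ n * (t n - lam)))).1
    linarith
  rw [sub_re, div_ofReal_re, re_sum] at hre
  have hterms : ∀ n, ((x:ℂ) ^ n * (t n - lam)).re = x ^ n * (t n).re - lam.re * x ^ n := by
    intro n
    rw [← ofReal_pow, re_ofReal_mul, sub_re]; ring
  simp_rw [hterms] at hre
  rw [Finset.sum_sub_distrib, ← Finset.mul_sum, geom_sum_eq hx1.ne'] at hre
  have hhead : 1 ≤ ∑ n ∈ Finset.range m, x ^ n * (t n).re := by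
    have h0 : x ^ 0 * (t 0).re = 1 := by simp [ht, h1]
    rw [← h0]
    exact Finset.single_le_sum (f := fun n => x ^ n * (t n).re)
      (fun n _ => mul_nonneg (by positivity) (htn n)) (Finset.mem_range.2 hm0)
  have hx1' : x - 1 = 1 - β := by rw [hx]; ring
  rw [hx1'] at hre
  have hbp : 0 < 1 - β := by linarith
  have key : 1/2 * (1 - β) ≤ lam.re * x ^ m := by
    have : 1/2 ≤ lam.re * x ^ m / (1 - β) := by
      have e : lam.re / (1 - β) + lam.re * ((x ^ m - 1) / (1 - β)) = lam.re * x ^ m / (1 - β) := by ring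
      linarith
    rwa [le_div_iff₀ hbp] at this
  have hxe : x ^ m ≤ Real.exp ((1 - β) * m) := by
    have : x ≤ Real.exp (1 - β) := by
      have := Real.add_one_le_exp (1 - β); linarith
    rw [mul_comm, Real.exp_nat_mul]
    gcongr
  have hlp : 0 < lam.re := by
    by_contra hc
    push Not at hc
    have : lam.re * x ^ m ≤ 0 := mul_nonpos_of_nonpos_of_nonneg hc (by positivity)
    linarith
  rw [Real.exp_neg, ← div_eq_mul_inv, div_le_iff₀ (Real.exp_pos _)]
  calc (1 - β) / 2 ≤ lam.re * x ^ m := by linarith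
    _ ≤ _ := by gcongr

end MA
end


section
open Complex Metric Set Filter Topology

namespace MA

open scoped ComplexOrder

variable {q : ℕ} [NeZero q]

lemma four_nonneg {A B : DirichletCharacter ℂ q} (hA : A ^ 2 = 1) (hB : B ^ 2 = 1) (n : ℕ) :
    0 ≤ chl (1 : DirichletCharacter ℂ q) n + chl A n + chl B n + chl (A * B) n := by
  have hL : (0:ℂ) ≤ ((ArithmeticFunction.vonMangoldt n : ℝ) : ℂ) := by
    exact_mod_cast ArithmeticFunction.vonMangoldt_nonneg
  simp only [chl, ← add_mul]
  refine mul_nonneg ?_ hL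
  by_cases hu : IsUnit (n : ZMod q)
  · rw [MulChar.one_apply hu, MulChar.mul_apply]
    rcases real_char hA (n : ZMod q) with (a | a) | a
    all_goals rcases real_char hB (n : ZMod q) with (b | b) | b
    all_goals first
      | exact absurd hu a.1
      | exact absurd hu b.1
      | (rw [a, b]; norm_num)
  · rw [MulChar.map_nonunit _ hu, MulChar.map_nonunit _ hu, MulChar.map_nonunit _ hu,
      MulChar.map_nonunit _ hu]; simp

lemma chl_abs (χ : DirichletCharacter ℂ q) : LSeries.abscissaOfAbsConv (chl χ) ≤ 1 := by
  refine LSeries.abscissaOfAbsConv_le_of_forall_lt_LSeriesSummable' fun y hy => ?_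
  exact chl_summable χ (by rw [ofReal_re]; exact_mod_cast hy)

lemma siegel_prod {A B : DirichletCharacter ℂ q} (hA : A ^ 2 = 1) (hB : B ^ 2 = 1)
    (hA1 : A ≠ 1) (hB1 : B ≠ 1) (hAB : A * B ≠ 1) {β : ℝ} (hβ : 7/8 ≤ β) (hβ1 : β < 1)
    (hz : LF A β = 0) :
    (1 - β) * (Real.exp (-16) / 1250) * (q:ℝ) ^ (-(16 * (1 - β))) ≤
      ‖LF (1 : DirichletCharacter ℂ q) 1‖ * ‖LF A 1‖ * ‖LF B 1‖ * ‖LF (A * B) 1‖ := by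
  have hq1 : (1:ℝ) ≤ q := by exact_mod_cast NeZero.pos q
  set h0 : ℂ → ℂ := fun s => LF (1 : DirichletCharacter ℂ q) s * LF A s * LF B s * LF (A * B) s with hh0
  have d0 := LF_diff (1 : DirichletCharacter ℂ q)
  have dA := LF_diff A
  have dB := LF_diff B
  have dC := LF_diff (A * B)
  have hd0 : Differentiable ℂ h0 := ((d0.mul dA).mul dB).mul dC
  have hlow : ∀ χ : DirichletCharacter ℂ q, 1/5 ≤ ‖LF χ 2‖ := by
    intro χ
    have := LF_lower χ (s := 2) (by simp) (by simp)
    norm_num at this ⊢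
    exact this
  have h02 : 1/625 ≤ ‖h0 2‖ := by
    rw [hh0]; simp only [norm_mul]
    calc (1/625:ℝ) = 1/5 * (1/5) * (1/5) * (1/5) := by norm_num
      _ ≤ _ := by gcongr <;> exact hlow _
  have h02' : h0 2 ≠ 0 := by
    intro h; rw [h, norm_zero] at h02; norm_num at h02
  have hupp : ∀ χ : DirichletCharacter ℂ q, ∀ s : ℂ, ‖s - 2‖ ≤ 3/2 → ‖LF χ s‖ ≤ 147 * q := by
    intro χ s hs
    have hre : 1/2 ≤ s.re := by
      have := (abs_le.1 ((abs_re_le_norm _).trans hs)).1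
      simp at this; linarith
    have hn : ‖s‖ ≤ 7/2 := by
      have := norm_sub_norm_le s 2
      have h2 : ‖(2:ℂ)‖ = 2 := by simp
      linarith
    calc ‖LF χ s‖ ≤ 7 * q * (‖s‖ + 1) ^ 2 := LF_bound χ hre
      _ ≤ 7 * q * (7/2 + 1) ^ 2 := by gcongr
      _ ≤ _ := by nlinarith
  set M : ℝ := 625 * (147 * q) ^ 4 with hM
  have hMb : ∀ s : ℂ, ‖s - 2‖ ≤ 3/2 → ‖h0 s / h0 2‖ ≤ M := by
    intro s hs
    rw [norm_div, div_le_iff₀ (by linarith), hM]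
    have : ‖h0 s‖ ≤ (147 * q) ^ 4 := by
      rw [hh0]; simp only [norm_mul]
      calc _ ≤ (147 * q) * (147 * q) * (147 * q) * (147 * (q:ℝ)) := by
            gcongr <;> exact hupp _ _ hs
        _ = _ := by ring
    have h3 : 0 ≤ (147 * (q:ℝ)) ^ 4 := by positivity
    nlinarith
  set g : ℂ → ℂ := LSeries (fun n => chl (1 : DirichletCharacter ℂ q) n + chl A n + chl B n + chl (A * B) n) with hg
  have habs : LSeries.abscissaOfAbsConv (fun n => chl (1 : DirichletCharacter ℂ q) n + chl A n + chl B n + chl (A * B) n) ≤ 1 := by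
    refine LSeries.abscissaOfAbsConv_le_of_forall_lt_LSeriesSummable' fun y hy => ?_
    have hy' : 1 < ((y:ℝ):ℂ).re := by rw [ofReal_re]; exact_mod_cast hy
    exact (((chl_summable 1 hy').add (chl_summable A hy')).add (chl_summable B hy')).add
      (chl_summable (A * B) hy')
  have habs2 : LSeries.abscissaOfAbsConv (fun n => chl (1 : DirichletCharacter ℂ q) n + chl A n + chl B n + chl (A * B) n) < (2:ℝ) :=
    habs.trans_lt (by norm_cast)
  have hgan : AnalyticAt ℂ g 2 := by
    have := LSeries_analyticOnNhd (fun n => chl (1 : DirichletCharacter ℂ q) n + chl A n + chl B n + chl (A * B) n)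
    exact this 2 (by simpa using habs2)
  have hgs : ∀ s : ℂ, 1 < s.re → g s = LSeries (chl (1 : DirichletCharacter ℂ q)) s + LSeries (chl A) s
      + LSeries (chl B) s + LSeries (chl (A * B)) s := by
    intro s hs
    have c0 := chl_summable (1 : DirichletCharacter ℂ q) hs
    have cA := chl_summable A hs
    have cB := chl_summable B hs
    have cC := chl_summable (A * B) hs
    rw [← LSeries_add c0 cA, ← LSeries_add (c0.add cA) cB, ← LSeries_add ((c0.add cA).add cB) cC]
    rfl
  set F : ℂ → ℂ := fun s => (h0 s / h0 2) / (s - 1) with hF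
  have hder : ∀ᶠ s in 𝓝 (2:ℂ), deriv F s = - (g s * F s) := by
    have : {s : ℂ | 1 < s.re} ∈ 𝓝 (2:ℂ) :=
      (isOpen_lt continuous_const continuous_re).mem_nhds (by simp)
    filter_upwards [this] with s hs
    have hs : 1 < s.re := hs
    have hs1 : s - 1 ≠ 0 := by
      intro h; rw [sub_eq_zero] at h; rw [h] at hs; simp at hs
    rw [hgs s hs, LF_logDeriv _ hs, LF_logDeriv _ hs, LF_logDeriv _ hs, LF_logDeriv _ hs,
      pri_one, pri_ne hA1, pri_ne hB1, pri_ne hAB]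
    have n0 := LF_ne_zero (1 : DirichletCharacter ℂ q) hs.le
    have nA := LF_ne_zero A hs.le
    have nB := LF_ne_zero B hs.le
    have nC := LF_ne_zero (A * B) hs.le
    have k0 := (d0 s).hasDerivAt
    have kA := (dA s).hasDerivAt
    have kB := (dB s).hasDerivAt
    have kC := (dC s).hasDerivAt
    have k := ((((k0.mul kA).mul kB).mul kC).div_const (h0 2)).div ((hasDerivAt_id s).sub_const 1) hs1
    have k2 := k.deriv
    have e : F = fun s => (h0 s / h0 2) / (s - 1) := rfl
    refine Eq.trans k2 ?_
    simp only [hF, hh0, Pi.mul_apply, id]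
    field_simp
    ring
  set m : ℕ := ⌈4 * Real.log (32 * M)⌉₊ with hm
  have hMpos : 1 ≤ M := by
    rw [hM]
    have : 1 ≤ (147 * (q:ℝ)) ^ 4 := one_le_pow₀ (by linarith)
    linarith
  have hlogM : Real.log (32 * M) ≤ 30 + 4 * Real.log q := by
    have e : 32 * M = (32 * 625 * 147 ^ 4) * (q:ℝ) ^ 4 := by rw [hM]; ring
    rw [e, Real.log_mul (by norm_num) (by positivity), Real.log_pow]
    have : Real.log (32 * 625 * 147 ^ 4) ≤ 30 := by
      rw [Real.log_le_iff_le_exp (by norm_num)]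
      have h1 : (2.7:ℝ) ≤ Real.exp 1 := by have := Real.exp_one_gt_d9; linarith
      calc (32 * 625 * 147 ^ 4 : ℝ) ≤ 2.715 ^ 30 := by norm_num
        _ ≤ (Real.exp 1) ^ 30 := by
          have := Real.exp_one_gt_d9
          gcongr; linarith
        _ = Real.exp 30 := by rw [← Real.exp_nat_mul]; norm_num
    push_cast
    linarith
  have hlpos : 0 < Real.log (32 * M) := Real.log_pos (by linarith)
  have hm0 : 0 < m := Nat.ceil_pos.2 (by linarith)
  have hm1 : 4 * Real.log (32 * M) ≤ m := Nat.le_ceil _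
  have hm2 : (m:ℝ) ≤ 121 + 16 * Real.log q := by
    have := Nat.ceil_lt_add_one (a := 4 * Real.log (32 * M)) (by linarith)
    linarith
  have hmM : 32 * M ≤ (4/3:ℝ) ^ m := by
    have h43 : Real.exp (1/4) ≤ 4/3 := by
      have h1 : Real.exp (1/4) ^ 4 ≤ (4/3:ℝ) ^ 4 := by
        rw [← Real.exp_nat_mul]
        have := Real.exp_one_lt_d9
        norm_num at this ⊢; linarith
      exact le_of_pow_le_pow_left₀ (by norm_num) (by norm_num) h1
    calc 32 * M = Real.exp (Real.log (32 * M)) := (Real.exp_log (by linarith)).symm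
      _ ≤ Real.exp (m * (1/4)) := Real.exp_le_exp.2 (by linarith)
      _ = Real.exp (1/4) ^ m := by rw [Real.exp_nat_mul]
      _ ≤ _ := by gcongr
  have hcore := est_core (h := fun s => h0 s / h0 2) (F := F) (g := g) (lam := h0 1 / h0 2)
    (hd0.div_const _) rfl (fun s _ => rfl) hgan (by simp only [hF]; rw [div_self h02']; norm_num) hder
    (fun n => by
      have := LSeries.iteratedDeriv_alternating (a := fun n => chl (1 : DirichletCharacter ℂ q) n + chl A n + chl B n + chl (A * B) n)
        (fun n => four_nonneg hA hB n) habs2 n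
      exact_mod_cast this)
    (M := M) (fun s hs => hMb s hs.le) (hMb 1 (by norm_num)) hβ hβ1
    (by simp only [hh0]; rw [hz]; simp) hm0 hmM
  have hnorm : (h0 1 / h0 2).re ≤ ‖h0 1‖ * 625 := by
    refine (re_le_norm _).trans ?_
    rw [norm_div, div_le_iff₀ (by linarith)]
    nlinarith [norm_nonneg (h0 1)]
  have hexp : Real.exp (-16) * (q:ℝ) ^ (-(16 * (1 - β))) ≤ Real.exp (-((1 - β) * m)) := by
    rw [Real.rpow_def_of_pos (by linarith), ← Real.exp_add]
    apply Real.exp_le_exp.2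
    have hl0 : 0 ≤ Real.log q := Real.log_nonneg hq1
    have : (1 - β) * m ≤ (1 - β) * (121 + 16 * Real.log q) := by
      gcongr
    nlinarith
  have hn2 : ‖h0 1‖ = ‖LF (1 : DirichletCharacter ℂ q) 1‖ * ‖LF A 1‖ * ‖LF B 1‖ * ‖LF (A * B) 1‖ := by
    simp only [hh0, norm_mul]
  rw [← hn2]
  have h5 : (1 - β) / 2 * (Real.exp (-16) * (q:ℝ) ^ (-(16 * (1 - β)))) ≤
      (1 - β) / 2 * Real.exp (-((1 - β) * m)) := by
    gcongr
  linarith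

lemma LF_near {χ : DirichletCharacter ℂ q} (hχ : χ ≠ 1) {e : ℝ} (he : 0 ≤ e) (he2 : e ≤ 1/2)
    {s : ℂ} (hs : 1 - e ≤ s.re) (hn : ‖s‖ ≤ 2) :
    ‖LF χ s‖ ≤ 2 * ((q:ℝ) ^ e * (2 * Real.log q + 6)) := by
  have hq1 : (1:ℝ) ≤ q := by exact_mod_cast NeZero.pos q
  have hs0 : 1/2 ≤ s.re := by linarith
  rw [LF_eq_cint χ (by linarith), pri_ne hχ, cden_eq_zero χ hχ]
  simp only [pow_zero, one_mul, zero_mul, add_zero, norm_mul]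
  have hc := norm_cint_gen χ (s := s) (by linarith) (K := (q:ℝ) ^ e) (by
    intro u hu hu2
    calc u ^ (1 - s.re) ≤ u ^ e := Real.rpow_le_rpow_of_exponent_le hu.le (by linarith)
      _ ≤ _ := by gcongr)
  have h3 : 3 / s.re ≤ 6 := by
    rw [div_le_iff₀ (by linarith)]; linarith
  have h4 : (q:ℝ) ^ (1 - s.re) ≤ (q:ℝ) ^ e := Real.rpow_le_rpow_of_exponent_le hq1 (by linarith)
  have h5 : ‖cint χ s‖ ≤ (q:ℝ) ^ e * (2 * Real.log q + 6) := by
    refine hc.trans ?_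
    rw [mul_add]
    gcongr
  gcongr

lemma LF_one_one : ‖LF (1 : DirichletCharacter ℂ q) 1‖ ≤ 1 := by
  rw [LF_eq_cint _ (by simp), pri_one]
  simpa using norm_cden (1 : DirichletCharacter ℂ q)

/-- a zero close to one forces a small value at one -/
lemma LF_diff_one {χ : DirichletCharacter ℂ q} (hχ : χ ≠ 1) {e : ℝ} (he : 0 < e) (he2 : e ≤ 1/2)
    {β : ℝ} (hβ : 1 - e < β) (hβ1 : β < 1) (hz : LF χ β = 0) :
    ‖LF χ 1‖ ≤ (1 - β) * (5 / e * ((q:ℝ) ^ e * (2 * Real.log q + 6))) := by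
  have hq1 : (1:ℝ) ≤ q := by exact_mod_cast NeZero.pos q
  have hl0 : 0 ≤ Real.log q := Real.log_nonneg hq1
  set K := (q:ℝ) ^ e * (2 * Real.log q + 6) with hK
  have hKp : 0 < K := by positivity
  have hb : ∀ s ∈ ball (1:ℂ) e, ‖LF χ s‖ ≤ 2 * K := by
    intro s hs
    rw [mem_ball_iff_norm] at hs
    refine LF_near hχ he.le he2 ?_ ?_
    · have := (abs_le.1 ((abs_re_le_norm _).trans hs.le)).1
      simp at this; linarith
    · have := norm_sub_norm_le s 1
      rw [norm_one] at this; linarith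
  have h1 : ‖LF χ 1‖ ≤ 2 * K := hb 1 (mem_ball_self he)
  have := Complex.dist_le_div_mul_dist_of_mapsTo_ball (f := LF χ) (c := 1) (R₁ := e) (R₂ := 5 * K)
    (z := (β:ℂ)) (LF_diff χ).differentiableOn (by
      intro s hs
      rw [mem_closedBall_iff_norm]
      refine (norm_sub_le _ _).trans ?_
      have := hb s hs
      linarith) (by
      rw [mem_ball_iff_norm, ← ofReal_one, ← ofReal_sub, norm_real, Real.norm_eq_abs, abs_of_neg (by linarith)]
      linarith)
  rw [hz, dist_zero_left, dist_eq_norm, ← ofReal_one, ← ofReal_sub, norm_real, Real.norm_eq_abs,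
    abs_of_neg (by linarith)] at this
  simp only [ofReal_one] at this
  calc _ ≤ 5 * K / e * -(β - 1) := this
    _ = _ := by ring

end MA
end


section
open Complex Metric Set Filter Topology

namespace MA

open DirichletCharacter in
lemma LF_level {q Q : ℕ} [NeZero q] [NeZero Q] (h : q ∣ Q) {χ : DirichletCharacter ℂ q} (hχ : χ ≠ 1)
    {β : ℝ} (hβ : 0 < β) : LF (changeLevel h χ) β = 0 ↔ LF χ β = 0 := by
  have h1 : changeLevel h χ ≠ 1 := by
    rw [Ne, changeLevel_eq_one_iff h]; exact hχ
  rw [LF_of_ne_one _ h1, LF_of_ne_one _ hχ, LFunction_changeLevel h χ (Or.inl hχ), mul_eq_zero,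
    or_iff_left]
  rw [Finset.prod_eq_zero_iff]
  rintro ⟨p, hp, h0⟩
  have hpp := Nat.prime_of_mem_primeFactors hp
  have : ‖χ p * (p:ℂ) ^ (-(β:ℂ))‖ < 1 := by
    rw [norm_mul, Complex.norm_natCast_cpow_of_pos hpp.pos, neg_re, ofReal_re]
    have h2 : (p:ℝ) ^ (-β) < 1 := Real.rpow_lt_one_of_one_lt_of_neg (by exact_mod_cast hpp.one_lt) (by linarith)
    have h3 : 0 ≤ (p:ℝ) ^ (-β) := by positivity
    have h4 := χ.norm_le_one p
    nlinarith [norm_nonneg (χ p)]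
  rw [sub_eq_zero] at h0
  rw [← h0, norm_one] at this
  exact lt_irrefl _ this

open DirichletCharacter in
theorem siegel {ε : ℝ} (hε : 0 < ε) : ∃ C : ℝ, 0 < C ∧ ∀ (q : ℕ) [NeZero q] (χ : DirichletCharacter ℂ q),
    χ ^ 2 = 1 → χ ≠ 1 → ∀ β : ℝ, β < 1 → LF χ β = 0 → C * (q:ℝ) ^ (-ε) ≤ 1 - β := by
  set e := min (ε / 20) (1/100) with he
  have he0 : 0 < e := by rw [he]; positivity
  have heε : 20 * e ≤ ε := by have := min_le_left (ε / 20) (1/100); rw [← he] at this; linarith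
  have he1 : e ≤ 1/100 := min_le_right _ _
  have hqe : ∀ q : ℕ, NeZero q → (q:ℝ) ^ (-ε) ≤ 1 := fun q _ =>
    Real.rpow_le_one_of_one_le_of_nonpos (by exact_mod_cast NeZero.pos q) (by linarith)
  by_cases H : ∃ (q1 : ℕ) (_ : NeZero q1) (χ1 : DirichletCharacter ℂ q1) (β1 : ℝ),
      χ1 ^ 2 = 1 ∧ χ1 ≠ 1 ∧ 1 - e < β1 ∧ β1 < 1 ∧ LF χ1 β1 = 0
  swap
  · refine ⟨e, he0, fun q _ χ h2 h1 β hβ hz => ?_⟩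
    by_contra hc
    push Not at hc
    refine H ⟨q, inferInstance, χ, β, h2, h1, ?_, hβ, hz⟩
    have := hqe q inferInstance
    nlinarith
  obtain ⟨q1, _, χ1, β1, hχ12, hχ11, hβ1, hβ11, hz1⟩ := H
  obtain ⟨δ, hδ, hδz⟩ : ∃ δ > 0, ∀ s : ℂ, ‖s - 1‖ < δ → LF χ1 s ≠ 0 := by
    have h1 : ∀ᶠ s in 𝓝 (1:ℂ), LF χ1 s ≠ 0 :=
      (LF_diff χ1).continuous.continuousAt.eventually_ne (LF_ne_zero χ1 (by simp))
    obtain ⟨δ, hδ, h⟩ := Metric.eventually_nhds_iff.1 h1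
    exact ⟨δ, hδ, fun s hs => h (by rwa [dist_eq_norm])⟩
  have hq1 : (1:ℝ) ≤ q1 := by exact_mod_cast NeZero.pos q1
  set C' := (1 - β1) * (Real.exp (-16) / 1250) * (q1:ℝ) ^ (-(20 * e)) / (20 / e * (2 / e + 6) ^ 3) with hC'
  have hC'0 : 0 < C' := by
    have : 0 < 1 - β1 := by linarith
    positivity
  refine ⟨min (min δ e) C', by positivity, fun q _ χ h2 h1 β hβ hz => ?_⟩
  have hqε := hqe q inferInstance
  have hqε0 : 0 ≤ (q:ℝ) ^ (-ε) := by positivity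
  set Cm := min (min δ e) C' with hCm
  have m1 : Cm ≤ δ := (min_le_left _ _).trans (min_le_left _ _)
  have m2 : Cm ≤ e := (min_le_left _ _).trans (min_le_right _ _)
  have m3 : Cm ≤ C' := min_le_right _ _
  by_contra hc
  push Not at hc
  have hc1 : 1 - β < δ := by nlinarith
  have hc2 : 1 - β < e := by nlinarith
  have hq : (1:ℝ) ≤ q := by exact_mod_cast NeZero.pos q
  set Q := q1 * q with hQ
  haveI : NeZero Q := ⟨mul_ne_zero (NeZero.ne _) (NeZero.ne _)⟩
  have hQ1 : (1:ℝ) ≤ Q := by exact_mod_cast NeZero.pos Q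
  have d1 : q1 ∣ Q := Dvd.intro _ rfl
  have d2 : q ∣ Q := Dvd.intro_left _ rfl
  set A := changeLevel d1 χ1 with hA
  set B := changeLevel d2 χ with hB
  have hA2 : A ^ 2 = 1 := by rw [hA, ← map_pow, hχ12, map_one]
  have hB2 : B ^ 2 = 1 := by rw [hB, ← map_pow, h2, map_one]
  have hA1 : A ≠ 1 := by rw [Ne, changeLevel_eq_one_iff d1]; exact hχ11
  have hB1 : B ≠ 1 := by rw [Ne, changeLevel_eq_one_iff d2]; exact h1
  have hAz : LF A β1 = 0 := (LF_level d1 hχ11 (by linarith)).2 hz1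
  have hBz : LF B β = 0 := (LF_level d2 h1 (by linarith)).2 hz
  by_cases hAB : A * B = 1
  · have hBA : B = A := by
      calc B = A ^ 2 * B := by rw [hA2, one_mul]
        _ = A * (A * B) := by rw [sq, mul_assoc]
        _ = A := by rw [hAB, mul_one]
    rw [hBA, LF_level d1 hχ11 (by linarith)] at hBz
    refine hδz β ?_ hBz
    rw [← ofReal_one, ← ofReal_sub, norm_real, Real.norm_eq_abs, abs_of_neg (by linarith)]
    linarith
  have hprod := siegel_prod hA2 hB2 hA1 hB1 hAB (by linarith) hβ11 hAz
  have hBd := LF_diff_one hB1 he0 (by linarith) (by linarith) hβ hBz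
  have n1 := LF_near hA1 (e := 0) le_rfl (by norm_num) (s := 1) (by simp) (by simp)
  have n2 := LF_near hAB (e := 0) le_rfl (by norm_num) (s := 1) (by simp) (by simp)
  rw [Real.rpow_zero, one_mul] at n1 n2
  have hl0 : 0 ≤ Real.log Q := Real.log_nonneg hQ1
  have hQe : 1 ≤ (Q:ℝ) ^ e := Real.one_le_rpow hQ1 he0.le
  have hlog : 2 * Real.log Q + 6 ≤ (2 / e + 6) * (Q:ℝ) ^ e := by
    have := Real.log_le_rpow_div (x := (Q:ℝ)) (by linarith) he0
    have h5 : (2 / e + 6) * (Q:ℝ) ^ e = 2 * ((Q:ℝ) ^ e / e) + 6 * (Q:ℝ) ^ e := by ring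
    linarith
  set W := (Q:ℝ) ^ e with hW
  set E := (2 / e + 6) * W with hE
  have hup : ‖LF (1 : DirichletCharacter ℂ Q) 1‖ * ‖LF A 1‖ * ‖LF B 1‖ * ‖LF (A * B) 1‖ ≤
      1 * (2 * E) * ((1 - β) * (5 / e * (W * E))) * (2 * E) := by
    have hβ0 : 0 ≤ 1 - β := by linarith
    have b1 : ‖LF A 1‖ ≤ 2 * E := n1.trans (by linarith)
    have b2 : ‖LF (A * B) 1‖ ≤ 2 * E := n2.trans (by linarith)
    have b3 : ‖LF B 1‖ ≤ (1 - β) * (5 / e * (W * E)) := hBd.trans (by gcongr)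
    have b0 := LF_one_one (q := Q)
    have : 0 ≤ E := by positivity
    gcongr
  have hlowQ : (q1:ℝ) ^ (-(20 * e)) * (q:ℝ) ^ (-ε) ≤ (Q:ℝ) ^ (-(16 * (1 - β1))) * ((Q:ℝ) ^ (4 * e))⁻¹ := by
    rw [← Real.rpow_neg (by linarith), ← Real.rpow_add (by linarith)]
    calc _ ≤ (q1:ℝ) ^ (-(20 * e)) * (q:ℝ) ^ (-(20 * e)) := by
          gcongr
      _ = (Q:ℝ) ^ (-(20 * e)) := by
          rw [hQ, Nat.cast_mul, Real.mul_rpow (by linarith) (by linarith)]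
      _ ≤ _ := Real.rpow_le_rpow_of_exponent_le hQ1 (by linarith)
  have hW4 : (Q:ℝ) ^ (4 * e) = W ^ 4 := by
    rw [hW, ← Real.rpow_natCast, ← Real.rpow_mul (by linarith)]; congr 1; push_cast; ring
  have hk : (1 - β1) * (Real.exp (-16) / 1250) * (Q:ℝ) ^ (-(16 * (1 - β1))) ≤
      (1 - β) * (20 / e * (2 / e + 6) ^ 3) * W ^ 4 := by
    refine (hprod.trans hup).trans (le_of_eq ?_)
    rw [hE]; ring
  have hW0 : 0 < W ^ 4 := by positivity
  rw [hW4] at hlowQ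
  have hb1 : 0 < (1 - β1) * (Real.exp (-16) / 1250) := by
    have : 0 < 1 - β1 := by linarith
    positivity
  have hD : 0 < 20 / e * (2 / e + 6) ^ 3 := by positivity
  have hfin : C' * (q:ℝ) ^ (-ε) ≤ 1 - β := by
    have h6 : (1 - β1) * (Real.exp (-16) / 1250) * ((q1:ℝ) ^ (-(20 * e)) * (q:ℝ) ^ (-ε)) ≤
        (1 - β1) * (Real.exp (-16) / 1250) * ((Q:ℝ) ^ (-(16 * (1 - β1))) * (W ^ 4)⁻¹) := by gcongr
    have h7 : (1 - β1) * (Real.exp (-16) / 1250) * ((Q:ℝ) ^ (-(16 * (1 - β1))) * (W ^ 4)⁻¹) ≤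
        (1 - β) * (20 / e * (2 / e + 6) ^ 3) := by
      rw [← mul_assoc, ← div_eq_mul_inv, div_le_iff₀ hW0]; exact hk
    rw [hC', div_mul_eq_mul_div, div_le_iff₀ hD]
    linarith
  have : Cm * (q:ℝ) ^ (-ε) ≤ C' * (q:ℝ) ^ (-ε) := by gcongr
  linarith

end MA
end


section
open Complex Metric Set Filter Topology

namespace MA

lemma real_inv {q : ℕ} [NeZero q] {χ : DirichletCharacter ℂ q} (h : χ ^ 2 = 1) {b : ZMod q} (hb : IsUnit b) :
    χ b⁻¹ = χ b := by
  have h1 : χ b * χ b = 1 := by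
    have := congrArg (fun f : DirichletCharacter ℂ q => f b) h
    simp only [sq, MulChar.mul_apply, MulChar.one_apply hb] at this
    exact this
  have h2 : χ b * χ b⁻¹ = 1 := by
    rw [← map_mul, ZMod.mul_inv_of_unit b hb, map_one]
  have h3 : χ b ≠ 0 := fun h => by rw [h] at h1; simp at h1
  exact mul_left_cancel₀ h3 (h2.trans h1.symm)

lemma avg_char {q : ℕ} [NeZero q] {χ1 : DirichletCharacter ℂ q} {κ : ℕ} {E A B : ℝ}
    (hκ : κ = 0 ∨ χ1 ^ 2 = 1) (s : Finset ℕ)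
    (H : ∀ χ : DirichletCharacter ℂ q, ‖∑ n ∈ s, chl χ n - ((pri χ * A - exq χ1 κ χ * B : ℝ) : ℂ)‖ ≤ E)
    {b : ZMod q} (hb : IsUnit b) :
    |∑ n ∈ s with ((n : ℕ) : ZMod q) = b, ArithmeticFunction.vonMangoldt n
      - (A - κ * (χ1 b).re * B) / q.totient| ≤ E := by
  classical
  have hφ : (0 : ℝ) < q.totient := by exact_mod_cast Nat.totient_pos.2 (NeZero.pos q)
  have hcard : (Fintype.card (DirichletCharacter ℂ q) : ℝ) = q.totient := by
    rw [← Nat.card_eq_fintype_card, DirichletCharacter.card_eq_totient_of_hasEnoughRootsOfUnity]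
  have e1 : ∑ χ : DirichletCharacter ℂ q, χ b⁻¹ * ∑ n ∈ s, chl χ n
      = (q.totient : ℂ) * ((∑ n ∈ s with ((n : ℕ) : ZMod q) = b, ArithmeticFunction.vonMangoldt n : ℝ) : ℂ) := by
    simp_rw [Finset.mul_sum]
    rw [Finset.sum_comm]
    push_cast
    rw [Finset.mul_sum, Finset.sum_filter]
    refine Finset.sum_congr rfl fun n _ => ?_
    simp_rw [chl, ← mul_assoc]
    rw [← Finset.sum_mul, DirichletCharacter.sum_char_inv_mul_char_eq ℂ hb]
    by_cases h : (n : ZMod q) = b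
    · rw [if_pos h.symm, if_pos h]
    · rw [if_neg (fun h' => h h'.symm), if_neg h, zero_mul]
  have e2 : ∑ χ : DirichletCharacter ℂ q, χ b⁻¹ * ((pri χ * A - exq χ1 κ χ * B : ℝ) : ℂ)
      = (A : ℂ) - κ * χ1 b⁻¹ * B := by
    push_cast
    simp_rw [mul_sub]
    rw [Finset.sum_sub_distrib]
    congr 1
    · rw [Finset.sum_eq_single 1]
      · have : IsUnit b⁻¹ := by
          exact ⟨(hb.unit)⁻¹, by rw [← ZMod.inv_coe_unit]; rfl⟩
        rw [MulChar.one_apply this]; simp [pri]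
      · intro χ _ h; simp [pri, h]
      · simp
    · rw [Finset.sum_eq_single χ1]
      · simp [exq]; ring
      · intro χ _ h; simp [exq, h]
      · simp
  have e3 : ‖(q.totient : ℂ) * ((∑ n ∈ s with ((n : ℕ) : ZMod q) = b, ArithmeticFunction.vonMangoldt n : ℝ) : ℂ)
      - ((A : ℂ) - κ * χ1 b⁻¹ * B)‖ ≤ q.totient * E := by
    rw [← e1, ← e2, ← Finset.sum_sub_distrib, ← hcard]
    refine (norm_sum_le _ _).trans ?_
    refine (Finset.sum_le_card_nsmul _ _ E fun χ _ => ?_).trans ?_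
    · rw [← mul_sub, norm_mul]
      have := χ.norm_le_one b⁻¹
      have := H χ
      nlinarith [norm_nonneg (χ b⁻¹), norm_nonneg (∑ n ∈ s, chl χ n - ((pri χ * A - exq χ1 κ χ * B : ℝ) : ℂ))]
    · simp [nsmul_eq_mul]
  have e4 := (Complex.abs_re_le_norm _).trans e3
  have hre : (κ : ℝ) * (χ1 b⁻¹).re = κ * (χ1 b).re := by
    rcases hκ with h | h
    · simp [h]
    · rw [real_inv h hb]
  have e5 : ((q.totient : ℂ) * ((∑ n ∈ s with ((n : ℕ) : ZMod q) = b, ArithmeticFunction.vonMangoldt n : ℝ) : ℂ)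
      - ((A : ℂ) - κ * χ1 b⁻¹ * B)).re = q.totient * (∑ n ∈ s with ((n : ℕ) : ZMod q) = b, ArithmeticFunction.vonMangoldt n)
      - (A - κ * (χ1 b).re * B) := by
    rw [← hre]
    generalize (∑ n ∈ s with ((n : ℕ) : ZMod q) = b, ArithmeticFunction.vonMangoldt n) = S
    simp
  rw [e5] at e4
  generalize (∑ n ∈ s with ((n : ℕ) : ZMod q) = b, ArithmeticFunction.vonMangoldt n) = S at *
  have : q.totient * |S - (A - κ * (χ1 b).re * B) / q.totient| ≤ q.totient * E := by
    rw [← abs_of_pos hφ, ← abs_mul, abs_of_pos hφ]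
    convert! e4 using 2
    field_simp
  exact le_of_mul_le_mul_left this hφ

lemma psi_theta_ap : ∃ C : ℝ, 0 < C ∧ ∀ (q : ℕ) (b : ZMod q) (n : ℕ),
    |∑ m ∈ Finset.Icc 1 n with ((m : ℕ) : ZMod q) = b, ArithmeticFunction.vonMangoldt m
      - ∑ p ∈ Finset.Icc 1 n with (Nat.Prime p ∧ ((p : ℕ) : ZMod q) = b), Real.log p| ≤ C * Real.sqrt n := by
  obtain ⟨C, hC⟩ := Chebyshev.psi_sub_theta_le_mul_sqrt
  refine ⟨|C| + 1, by positivity, fun q b n => ?_⟩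
  have h1 : ∑ p ∈ Finset.Icc 1 n with (Nat.Prime p ∧ ((p : ℕ) : ZMod q) = b), Real.log p
     = ∑ m ∈ Finset.Icc 1 n with ((m : ℕ) : ZMod q) = b, if m.Prime then Real.log m else 0 := by
    rw [← Finset.sum_filter, Finset.filter_filter]
    exact Finset.sum_congr (by ext; simp; tauto) fun _ _ => rfl
  have hpt : ∀ m : ℕ, 0 ≤ ArithmeticFunction.vonMangoldt m - if m.Prime then Real.log m else 0 := by
    intro m
    split_ifs with h
    · rw [ArithmeticFunction.vonMangoldt_apply_prime h, sub_self]
    · simp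
  have h2 : ∑ m ∈ Finset.Icc 1 n, (ArithmeticFunction.vonMangoldt m - if m.Prime then Real.log m else 0)
      ≤ C * √n := by
    have := hC n
    rw [Chebyshev.psi, Chebyshev.theta, Nat.floor_natCast] at this
    rw [Finset.sum_sub_distrib, ← Finset.sum_filter]
    exact this
  rw [h1, ← Finset.sum_sub_distrib, abs_of_nonneg (Finset.sum_nonneg fun m _ => hpt m)]
  refine (Finset.sum_le_sum_of_subset_of_nonneg (Finset.filter_subset _ _) fun m _ _ => hpt m).trans (h2.trans ?_)
  have := le_abs_self C
  have := Real.sqrt_nonneg n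
  nlinarith

theorem prime_ap : ∃ c : ℝ, 0 < c ∧ ∀ᶠ N : ℝ in atTop, ∀ q : ℕ, ∀ _ : NeZero q, (q : ℝ) ≤ Real.exp (√(Real.log N)) →
    ∃ (χ1 : DirichletCharacter ℂ q) (β : ℝ) (κ : ℕ),
      (κ = 0 ∨ κ = 1 ∧ χ1 ≠ 1 ∧ χ1 ^ 2 = 1 ∧ LF χ1 β = 0) ∧ 1 / 2 ≤ β ∧ β < 1 ∧
      ∀ b : ZMod q, IsUnit b → ∀ n : ℕ, (n : ℝ) ≤ N →
        |∑ p ∈ Finset.Icc 1 n with (Nat.Prime p ∧ ((p : ℕ) : ZMod q) = b), Real.log p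
          - (n - κ * (χ1 b).re * ((n : ℝ) ^ β / β)) / q.totient| ≤ N * Real.exp (-(c * √(Real.log N))) := by
  obtain ⟨c, hc, h⟩ := psi_char
  obtain ⟨C, hC, hCb⟩ := psi_theta_ap
  refine ⟨c / 2, by positivity, ?_⟩
  have t1 := tend_sqrtlog.eventually (ev_exp 2 0 (by positivity : (0 : ℝ) < c / 2))
  have t2 := tend_sqrtlog.eventually (ev_exp (2 * C) 0 (by norm_num : (0 : ℝ) < 1 / 2))
  have t3 := tend_sqrtlog.eventually (eventually_ge_atTop (c + 1))
  filter_upwards [h, t1, t2, t3, eventually_ge_atTop 1] with N hN t1 t2 t3 hN1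
  intro q hq hqN
  obtain ⟨χ1, β, κ, h1, h2, h3, h4⟩ := hN q hqN
  refine ⟨χ1, β, κ, h1, h2, h3, fun b hb n hn => ?_⟩
  rcases Nat.eq_zero_or_pos n with rfl | hn0
  · have : (0 : ℝ) ^ β = 0 := Real.zero_rpow (by linarith)
    simp [this]; positivity
  have h5 := avg_char (E := N * Real.exp (-(c * √(Real.log N)))) (A := n) (B := (n : ℝ) ^ β / β)
    (χ1 := χ1) (κ := κ) (by tauto) (Finset.Icc 1 n)
    (fun χ => by
      have := h4 χ n (by exact_mod_cast hn0) hn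
      rwa [Nat.floor_natCast] at this) hb
  have h6 := hCb q b n
  rw [abs_sub_comm] at h6
  refine (abs_sub_le _ _ _).trans ((add_le_add h6 h5).trans ?_)
  have h7 : √(n : ℝ) ≤ √N := Real.sqrt_le_sqrt hn
  set y := √(Real.log N) with hy
  have hy2 : y ^ 2 = Real.log N := Real.sq_sqrt (Real.log_nonneg hN1)
  have hNe : N = Real.exp (y ^ 2) := by rw [hy2, Real.exp_log (by linarith)]
  have hs : √N = Real.exp (y ^ 2 / 2) := by rw [hNe, Real.sqrt_eq_rpow, ← Real.exp_mul]; ring_nf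
  rw [pow_zero, mul_one] at t1 t2
  have g1 : N * Real.exp (-(c * y)) ≤ (1 / 2) * (N * Real.exp (-(c / 2 * y))) := by
    have : Real.exp (-(c / 2 * y)) = Real.exp (-(c * y)) * Real.exp (c / 2 * y) := by
      rw [← Real.exp_add]; ring_nf
    rw [this]
    have : 0 < N * Real.exp (-(c * y)) := by positivity
    nlinarith
  have g2 : C * √N ≤ (1 / 2) * (N * Real.exp (-(c / 2 * y))) := by
    rw [hs]
    have : Real.exp (y ^ 2 / 2 + 1 / 2 * y) ≤ N * Real.exp (-(c / 2 * y)) := by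
      rw [hNe, ← Real.exp_add, Real.exp_le_exp]
      have : 0 ≤ y := Real.sqrt_nonneg _
      nlinarith
    rw [Real.exp_add] at this
    have : 0 < Real.exp (y ^ 2 / 2) := by positivity
    nlinarith
  have := mul_le_mul_of_nonneg_left h7 hC.le
  linarith

end MA
end


section
open Complex Set Filter Topology
open scoped BigOperators

namespace MA

lemma divisor_bound {ε : ℝ} (hε : 0 < ε) : ∃ C : ℝ, 1 ≤ C ∧ ∀ n : ℕ, n ≠ 0 → (n.divisors.card : ℝ) ≤ C * (n : ℝ) ^ ε := by
  have hl2 : 0 < Real.log 2 := Real.log_pos (by norm_num)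
  set K : ℝ := 1 + 1 / (ε * Real.log 2) with hK
  have hK1 : 1 ≤ K := by rw [hK]; have : 0 ≤ 1 / (ε * Real.log 2) := by positivity
                         linarith
  set B : ℕ := ⌈(2 : ℝ) ^ (1 / ε)⌉₊ with hB
  refine ⟨K ^ B, one_le_pow₀ hK1, fun n hn => ?_⟩
  have key : ∀ p ∈ n.primeFactors, ((n.factorization p : ℝ) + 1) ≤
      (if p < B then K else 1) * ((p : ℝ) ^ (n.factorization p)) ^ ε := by
    intro p hp
    have hp2 : (2 : ℝ) ≤ p := by exact_mod_cast (Nat.prime_of_mem_primeFactors hp).two_le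
    set a := n.factorization p
    rw [← Real.rpow_natCast, ← Real.rpow_mul (by linarith), mul_comm (a : ℝ) ε, Real.rpow_mul (by linarith), Real.rpow_natCast]
    split_ifs with h
    · have h1 : (1 + a * (ε * Real.log 2)) ≤ ((p : ℝ) ^ ε) ^ a := by
        have : ((2 : ℝ) ^ ε) ^ a ≤ ((p : ℝ) ^ ε) ^ a := by gcongr
        refine le_trans ?_ this
        rw [Real.rpow_def_of_pos (by norm_num), ← Real.exp_nat_mul]
        have := Real.add_one_le_exp ((a : ℝ) * (Real.log 2 * ε))
        nlinarith
      have h2 : (a : ℝ) + 1 ≤ K * (1 + a * (ε * Real.log 2)) := by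
        have hz : 0 < ε * Real.log 2 := by positivity
        rw [hK]
        have : (1 + 1 / (ε * Real.log 2)) * (1 + a * (ε * Real.log 2)) = 1 + a + (a * (ε * Real.log 2)) + 1 / (ε * Real.log 2) := by
          field_simp
          ring
        rw [this]
        have : 0 ≤ a * (ε * Real.log 2) := by positivity
        have : 0 ≤ 1 / (ε * Real.log 2) := by positivity
        linarith
      exact h2.trans (mul_le_mul_of_nonneg_left h1 (by linarith))
    · rw [one_mul]
      have h1 : (2 : ℝ) ≤ (p : ℝ) ^ ε := by
        have : (2 : ℝ) ^ (1 / ε) ≤ p := (Nat.le_ceil _).trans (by exact_mod_cast not_lt.1 h)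
        calc (2 : ℝ) = ((2 : ℝ) ^ (1 / ε)) ^ ε := by
              rw [← Real.rpow_mul (by norm_num)]; field_simp; simp
          _ ≤ _ := by gcongr
      calc (a : ℝ) + 1 ≤ 2 ^ a := by exact_mod_cast Nat.lt_two_pow_self (n := a)
        _ ≤ _ := by gcongr
  rw [Nat.card_divisors hn]
  push_cast
  refine (Finset.prod_le_prod (fun p _ => by positivity) key).trans ?_
  rw [Finset.prod_mul_distrib, Real.finset_prod_rpow _ _ (fun p _ => by positivity)]
  have e1 : ∏ p ∈ n.primeFactors, (p : ℝ) ^ (n.factorization p) = n := by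
    conv_rhs => rw [← Nat.prod_factorization_pow_eq_self hn]
    rw [Finsupp.prod, Nat.support_factorization]; push_cast; rfl
  rw [e1]
  gcongr
  rw [← Finset.prod_filter, Finset.prod_const]
  refine pow_le_pow_right₀ hK1 ?_
  calc _ ≤ (Finset.range B).card := Finset.card_le_card fun p hp => by simp at hp ⊢; exact hp.2
    _ = B := Finset.card_range B

variable {q : ℕ} [NeZero q]

/-- gcd with modulus -/
def gq (x : ZMod q) : ℕ := Nat.gcd q x.val

lemma gq_pos (x : ZMod q) : 0 < gq x := Nat.gcd_pos_of_pos_left _ (NeZero.pos q)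

lemma gq_mul (x y : ZMod q) : gq (x * y) ≤ gq x * gq y := by
  refine Nat.le_of_dvd (Nat.mul_pos (gq_pos x) (gq_pos y)) ?_
  unfold gq
  rw [ZMod.val_mul, Nat.gcd_comm, ← Nat.gcd_rec]
  exact Nat.gcd_mul_right_dvd_mul_gcd q x.val y.val

lemma gq_natCast {n : ℕ} (hn : 0 < n) : gq (n : ZMod q) ≤ n := by
  unfold gq
  rw [ZMod.val_natCast, Nat.gcd_comm, ← Nat.gcd_rec]
  exact Nat.gcd_le_right _ hn

lemma gq_unit {x : ZMod q} (hx : IsUnit x) : gq x = 1 := by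
  unfold gq
  obtain ⟨u, rfl⟩ := hx
  exact (ZMod.val_coe_unit_coprime u).symm

lemma gq_le (x : ZMod q) : gq x ≤ q := Nat.gcd_le_left _ (NeZero.pos q)

lemma gq_zero : gq (0 : ZMod q) = q := by simp [gq]

lemma gq_pow (x : ZMod q) (n : ℕ) : gq (x ^ n) ≤ gq x ^ n := by
  induction n with
  | zero => simp [gq_unit isUnit_one]
  | succ n ih => rw [pow_succ, pow_succ]; exact (gq_mul _ _).trans (Nat.mul_le_mul_right _ ih)

lemma gq_prod {ι : Type*} (s : Finset ι) (f : ι → ZMod q) : gq (∏ i ∈ s, f i) ≤ ∏ i ∈ s, gq (f i) := by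
  classical
  induction s using Finset.induction_on with
  | empty => simp [gq_unit isUnit_one]
  | insert a s h ih => rw [Finset.prod_insert h, Finset.prod_insert h]; exact (gq_mul _ _).trans (Nat.mul_le_mul_left _ ih)

lemma sum_gq : ∑ x : ZMod q, gq x ≤ q * q.divisors.card := by
  have h1 : ∑ x : ZMod q, gq x = ∑ j ∈ Finset.range q, Nat.gcd q j := by
    obtain _ | n := q
    · exact absurd rfl (NeZero.ne 0)
    · exact Fin.sum_univ_eq_sum_range (fun j => Nat.gcd (n + 1) j) (n + 1)
  rw [h1, ← Finset.sum_fiberwise_of_maps_to (t := q.divisors) (g := fun j => Nat.gcd q j)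
    (fun j _ => Nat.mem_divisors.2 ⟨Nat.gcd_dvd_left _ _, NeZero.ne q⟩)]
  refine (Finset.sum_le_card_nsmul _ _ q fun e he => ?_).trans (by rw [smul_eq_mul, mul_comm])
  rw [Finset.sum_congr rfl (g := fun _ => e) (by intro j hj; exact (Finset.mem_filter.1 hj).2), Finset.sum_const,
    smul_eq_mul]
  have hd := Nat.dvd_of_mem_divisors he
  rw [← Nat.totient_div_of_dvd hd]
  calc _ ≤ (q / e) * e := Nat.mul_le_mul_right _ (Nat.totient_le _)
    _ = q := Nat.div_mul_cancel hd

lemma ex_gq : 𝔼 x : ZMod q, (gq x : ℝ) ≤ q.divisors.card := by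
  rw [Fintype.expect_eq_sum_div_card, ZMod.card, div_le_iff₀ (by exact_mod_cast NeZero.pos q), mul_comm]
  exact_mod_cast sum_gq

/-- totient lower bound -/
lemma q_le_tot : q ≤ q.totient * q.divisors.card := by
  conv_lhs => rw [← Nat.sum_totient q]
  refine (Finset.sum_le_card_nsmul _ _ q.totient fun e he => ?_).trans (by rw [smul_eq_mul, mul_comm])
  exact Nat.le_of_dvd (Nat.totient_pos.2 (NeZero.pos q)) (Nat.totient_dvd_of_dvd (Nat.dvd_of_mem_divisors he))

/-- `Z m c` = probability that `c h₁⋯h_m = 0`. -/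
noncomputable def Zp : ℕ → ZMod q → ℝ
  | 0, c => if c = 0 then 1 else 0
  | m + 1, c => 𝔼 h : ZMod q, Zp m (c * h)

lemma Zp_nonneg (m : ℕ) (c : ZMod q) : 0 ≤ Zp m c := by
  induction m generalizing c with
  | zero => unfold Zp; split_ifs <;> norm_num
  | succ m ih => unfold Zp; exact Finset.expect_nonneg fun h _ => ih _

lemma Zp_le_one (m : ℕ) (c : ZMod q) : Zp m c ≤ 1 := by
  induction m generalizing c with
  | zero => unfold Zp; split_ifs <;> norm_num
  | succ m ih => unfold Zp; exact Finset.expect_le Finset.univ_nonempty fun h _ => ih _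

lemma Zp_le (m : ℕ) (c : ZMod q) : Zp m c ≤ (q.divisors.card : ℝ) ^ m * (gq c / q) := by
  have hq : (0 : ℝ) < q := by exact_mod_cast NeZero.pos q
  induction m generalizing c with
  | zero =>
    unfold Zp
    split_ifs with h
    · rw [h, gq_zero, div_self hq.ne']; simp
    · positivity
  | succ m ih =>
    unfold Zp
    calc 𝔼 h : ZMod q, Zp m (c * h) ≤ 𝔼 h : ZMod q, (q.divisors.card : ℝ) ^ m * (gq c / q) * gq h := by
          refine Finset.expect_le_expect fun h _ => (ih _).trans ?_
          have : (gq (c * h) : ℝ) ≤ gq c * gq h := by exact_mod_cast gq_mul c h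
          rw [mul_assoc, div_mul_eq_mul_div]
          gcongr
      _ = (q.divisors.card : ℝ) ^ m * (gq c / q) * 𝔼 h : ZMod q, (gq h : ℝ) := by rw [Finset.mul_expect]
      _ ≤ (q.divisors.card : ℝ) ^ m * (gq c / q) * q.divisors.card := by
          gcongr; exact ex_gq
      _ = _ := by ring

end MA
end


section
open Complex Set Filter Topology
open scoped BigOperators

namespace MA

lemma ex_norm {α : Type*} (s : Finset α) (f : α → ℂ) : ‖𝔼 x ∈ s, f x‖ ≤ 𝔼 x ∈ s, ‖f x‖ :=
  RCLike.norm_expect_le (K := ℂ)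

lemma ex_sq {α : Type*} [Fintype α] (f : α → ℂ) :
    ((‖𝔼 x, f x‖ ^ 2 : ℝ) : ℂ) = 𝔼 x, 𝔼 y, f x * (starRingEnd ℂ) (f y) := by
  rw [← Complex.normSq_eq_norm_sq, Complex.normSq_eq_conj_mul_self, mul_comm]
  have : (starRingEnd ℂ) (𝔼 x, f x) = 𝔼 x, (starRingEnd ℂ) (f x) := by
    rw [Fintype.expect_eq_sum_div_card, Fintype.expect_eq_sum_div_card, map_div₀, map_sum, map_natCast]
  rw [this, Fintype.expect_mul_expect]

lemma ex_rot {α β γ M : Type*} [Fintype α] [Fintype β] [Fintype γ] [AddCommMonoid M] [Module ℚ≥0 M]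
    (F : α → β → γ → M) : (𝔼 t, 𝔼 x, 𝔼 y, F t x y) = 𝔼 x, 𝔼 y, 𝔼 t, F t x y := by
  rw [Finset.expect_comm]
  exact Finset.expect_congr rfl fun x _ => Finset.expect_comm _ _ _

lemma ex_cast {α : Type*} [Fintype α] (f : α → ℝ) : ((𝔼 x, f x : ℝ) : ℂ) = 𝔼 x, (f x : ℂ) := by
  simp_rw [Fintype.expect_eq_sum_div_card]
  push_cast; rfl

lemma ex_pow {α : Type*} [Fintype α] [Nonempty α] {f : α → ℝ} (hf : ∀ x, 0 ≤ f x) (n : ℕ) :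
    (𝔼 x, f x) ^ n ≤ 𝔼 x, f x ^ n := by
  have hc : (0 : ℝ) < Fintype.card α := by exact_mod_cast Fintype.card_pos
  rw [Fintype.expect_eq_sum_div_card, Fintype.expect_eq_sum_div_card]
  have := Real.pow_arith_mean_le_arith_mean_pow Finset.univ (fun _ : α => (Fintype.card α : ℝ)⁻¹) f
    (fun _ _ => by positivity) (by simp) (fun i _ => hf i) n
  rw [← Finset.mul_sum, ← Finset.mul_sum] at this
  rwa [div_eq_inv_mul, div_eq_inv_mul]

variable {q : ℕ} [NeZero q]

/-- the standard character -/
noncomputable abbrev ps (x : ZMod q) : ℂ := ZMod.stdAddChar x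

lemma ps_norm (x : ZMod q) : ‖ps x‖ = 1 := by
  rw [ps, ZMod.stdAddChar_apply]; exact Circle.norm_coe _

lemma ps_conj (x : ZMod q) : (starRingEnd ℂ) (ps x) = ps (-x) := (AddChar.map_neg_eq_conj _ _).symm

lemma ps_add (x y : ZMod q) : ps (x + y) = ps x * ps y := AddChar.map_add_eq_mul _ _ _

lemma ps_sub (x y : ZMod q) : ps (x - y) = ps x * (starRingEnd ℂ) (ps y) := by
  rw [sub_eq_add_neg, ps_add, ps_conj]

lemma orth (b : ZMod q) : 𝔼 x : ZMod q, ps (x * b) = if b = 0 then 1 else 0 := by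
  have hq : (q : ℂ) ≠ 0 := by exact_mod_cast NeZero.ne q
  rw [Fintype.expect_eq_sum_div_card, ZMod.card]
  have := AddChar.sum_mulShift b (ZMod.isPrimitive_stdAddChar q)
  rw [ZMod.card] at this
  unfold ps
  rw [this]
  split_ifs
  · exact div_self hq
  · simp

lemma vdc (F : ZMod q → ZMod q) :
    ‖𝔼 x, ps (F x)‖ ^ 2 ≤ 𝔼 h, ‖𝔼 x, ps (F (x + h) - F x)‖ := by
  have h1 : ((‖𝔼 x, ps (F x)‖ ^ 2 : ℝ) : ℂ) = 𝔼 h, 𝔼 x, ps (F (x + h) - F x) := by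
    rw [ex_sq, Finset.expect_comm, Finset.expect_comm Finset.univ Finset.univ (fun h x => ps (F (x + h) - F x))]
    refine Finset.expect_congr rfl fun y _ => ?_
    refine (Fintype.expect_equiv (Equiv.addLeft y) _ _ fun h => ?_).symm
    rw [ps_sub]; rfl
  have h2 : ‖𝔼 x, ps (F x)‖ ^ 2 = ‖𝔼 h, 𝔼 x, ps (F (x + h) - F x)‖ := by
    rw [← h1, Complex.norm_real, Real.norm_of_nonneg (by positivity)]
  rw [h2]; exact ex_norm _ _

open Polynomial in
lemma weyl (m : ℕ) (P : (ZMod q)[X]) (hP : P.natDegree ≤ m + 1) :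
    ‖𝔼 x, ps (P.eval x)‖ ^ (2 ^ m) ≤ Zp m (((m + 1).factorial : ZMod q) * P.coeff (m + 1)) := by
  induction m generalizing P with
  | zero =>
    have h1 : ∀ x, P.eval x = x * P.coeff 1 + P.coeff 0 := by
      intro x
      rw [eval_eq_sum_range' (n := 2) (by omega)]
      simp [Finset.sum_range_succ]; ring
    simp_rw [h1, ps_add]
    rw [← Finset.expect_mul, orth, norm_mul, ps_norm]
    simp only [Zp, pow_zero, pow_one, mul_one, zero_add, Nat.factorial_one, Nat.cast_one, one_mul]
    split_ifs <;> simp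
  | succ m ih =>
    have h1 : ∀ h : ZMod q, ‖𝔼 x, ps (P.eval (x + h) - P.eval x)‖ ^ (2 ^ m) ≤
        Zp m (((m + 1 + 1).factorial : ZMod q) * P.coeff (m + 1 + 1) * h) := by
      intro h
      have hT : ∀ n, (taylor h P - P).coeff n = (hasseDeriv n P).eval h - P.coeff n := by
        intro n; rw [coeff_sub, taylor_coeff]
      have e1 : ∀ n, m + 1 ≤ n → (taylor h P - P).coeff n = (n + 1 : ℕ) * P.coeff (n + 1) * h := by
        intro n hn
        rw [hT, eval_eq_sum_range' (n := 2) (by have := natDegree_hasseDeriv_le P n; omega)]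
        simp only [Finset.sum_range_succ, Finset.range_zero, Finset.sum_empty, hasseDeriv_coeff]
        have : (1 + n).choose n = n + 1 := by
          rw [add_comm, Nat.choose_succ_self_right]
        rw [this, Nat.zero_add, Nat.choose_self, add_comm 1 n]
        push_cast; ring
      have hd : (taylor h P - P).natDegree ≤ m + 1 := by
        rw [natDegree_le_iff_coeff_eq_zero]
        intro n hn
        rw [e1 n (by omega), coeff_eq_zero_of_natDegree_lt (by omega)]
        simp
      have := ih _ hd
      rw [e1 _ le_rfl] at this
      convert! this using 1
      · simp only [eval_sub, taylor_eval]
      · congr 1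
        rw [Nat.factorial_succ (m + 1)]; push_cast; ring
    rw [pow_succ', pow_mul]
    have h2 := vdc (fun x => P.eval x)
    calc (‖𝔼 x, ps (P.eval x)‖ ^ 2) ^ (2 ^ m) ≤ (𝔼 h, ‖𝔼 x, ps (P.eval (x + h) - P.eval x)‖) ^ (2 ^ m) := by
          gcongr
      _ ≤ 𝔼 h, ‖𝔼 x, ps (P.eval (x + h) - P.eval x)‖ ^ (2 ^ m) := ex_pow (fun _ => norm_nonneg _) _
      _ ≤ _ := by
          rw [Zp]; exact Finset.expect_le_expect fun h _ => h1 h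

lemma Zdiff (m e : ℕ) (C : ZMod q) :
    (𝔼 x : ZMod q, 𝔼 y : ZMod q, Zp m (C * (x ^ (e + 1) - y ^ (e + 1)))) ^ (2 ^ e)
      ≤ Zp (m + 1 + e) (((e + 1).factorial : ZMod q) * C) := by
  have hnn : ∀ m (C : ZMod q), 0 ≤ 𝔼 x : ZMod q, 𝔼 y : ZMod q, Zp m (C * (x ^ (e + 1) - y ^ (e + 1))) :=
    fun m C => Finset.expect_nonneg fun x _ => Finset.expect_nonneg fun y _ => Zp_nonneg _ _
  induction m generalizing C with
  | zero =>
    have h1 : (𝔼 x : ZMod q, 𝔼 y : ZMod q, Zp 0 (C * (x ^ (e + 1) - y ^ (e + 1))))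
        ≤ 𝔼 t : ZMod q, ‖𝔼 x : ZMod q, ps (C * t * x ^ (e + 1))‖ := by
      have h2 : ((𝔼 x : ZMod q, 𝔼 y : ZMod q, Zp 0 (C * (x ^ (e + 1) - y ^ (e + 1))) : ℝ) : ℂ)
          = 𝔼 t : ZMod q, ((‖𝔼 x : ZMod q, ps (C * t * x ^ (e + 1))‖ ^ 2 : ℝ) : ℂ) := by
        simp_rw [ex_sq]
        rw [ex_rot, ex_cast]
        refine Finset.expect_congr rfl fun x _ => ?_
        rw [ex_cast]
        refine Finset.expect_congr rfl fun y _ => ?_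
        have := orth (C * (x ^ (e + 1) - y ^ (e + 1)))
        have h3 : (𝔼 t : ZMod q, ps (C * t * x ^ (e + 1)) * (starRingEnd ℂ) (ps (C * t * y ^ (e + 1))))
            = 𝔼 t : ZMod q, ps (t * (C * (x ^ (e + 1) - y ^ (e + 1)))) :=
          Finset.expect_congr rfl fun t _ => by rw [← ps_sub]; congr 1; ring
        rw [h3, this, Zp]; split_ifs <;> simp
      have h4 : (𝔼 x : ZMod q, 𝔼 y : ZMod q, Zp 0 (C * (x ^ (e + 1) - y ^ (e + 1))))
          = 𝔼 t : ZMod q, ‖𝔼 x : ZMod q, ps (C * t * x ^ (e + 1))‖ ^ 2 := by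
        apply Complex.ofReal_injective
        rw [h2, ex_cast]
      rw [h4]
      refine Finset.expect_le_expect fun t _ => ?_
      have : ‖𝔼 x : ZMod q, ps (C * t * x ^ (e + 1))‖ ≤ 1 :=
        (ex_norm _ _).trans (Finset.expect_le Finset.univ_nonempty fun x _ => (ps_norm _).le)
      exact pow_le_of_le_one (norm_nonneg _) this (by norm_num)
    calc _ ≤ (𝔼 t : ZMod q, ‖𝔼 x : ZMod q, ps (C * t * x ^ (e + 1))‖) ^ (2 ^ e) := by
          gcongr; exact hnn 0 C
      _ ≤ 𝔼 t : ZMod q, ‖𝔼 x : ZMod q, ps (C * t * x ^ (e + 1))‖ ^ (2 ^ e) := ex_pow (fun _ => norm_nonneg _) _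
      _ ≤ _ := by
          rw [show 0 + 1 + e = e + 1 by ring, Zp]
          refine Finset.expect_le_expect fun t _ => ?_
          have := weyl e (Polynomial.C (C * t) * Polynomial.X ^ (e + 1)) (Polynomial.natDegree_C_mul_X_pow_le _ _)
          rw [Polynomial.coeff_C_mul_X_pow, if_pos rfl] at this
          simp only [Polynomial.eval_mul, Polynomial.eval_C, Polynomial.eval_pow, Polynomial.eval_X] at this
          rwa [mul_assoc]
  | succ m ih =>
    have h1 : (𝔼 x : ZMod q, 𝔼 y : ZMod q, Zp (m + 1) (C * (x ^ (e + 1) - y ^ (e + 1))))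
        = 𝔼 h : ZMod q, 𝔼 x : ZMod q, 𝔼 y : ZMod q, Zp m (C * h * (x ^ (e + 1) - y ^ (e + 1))) := by
      rw [ex_rot]
      refine Finset.expect_congr rfl fun x _ => ?_
      refine Finset.expect_congr rfl fun y _ => ?_
      rw [Zp]
      refine Finset.expect_congr rfl fun h _ => ?_
      congr 1; ring
    rw [h1]
    refine (ex_pow (fun h => hnn m _) _).trans ?_
    rw [show m + 1 + 1 + e = (m + 1 + e) + 1 by ring, Zp]
    refine Finset.expect_le_expect fun h _ => (ih _).trans (le_of_eq ?_)
    congr 1; ring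

lemma ex_unit : (𝔼 x : ZMod q, (1 : MulChar (ZMod q) ℂ) x) = (q.totient : ℂ) / q := by
  rw [Fintype.expect_eq_sum_div_card, ZMod.card, MulChar.sum_one_eq_card_units, ZMod.card_units_eq_totient]

lemma hom_avg {G : ZMod q → ℂ} (H : ZMod q → ℂ) (h : ∀ u : (ZMod q)ˣ, H u = G 1) :
    (q.totient : ℂ) / q * G 1 = 𝔼 u : ZMod q, (1 : MulChar (ZMod q) ℂ) u * H u := by
  rw [← ex_unit, Finset.expect_mul]
  refine Finset.expect_congr rfl fun u _ => ?_
  by_cases hu : IsUnit u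
  · obtain ⟨u, rfl⟩ := hu; rw [h]
  · rw [MulChar.map_nonunit _ hu, zero_mul, zero_mul]

lemma one_norm (x : ZMod q) : ‖(1 : MulChar (ZMod q) ℂ) x‖ ≤ 1 := DirichletCharacter.norm_le_one 1 x

open Polynomial in
lemma bil (e : ℕ) (f : ZMod q →* ℂ) (hf : ∀ x, ‖f x‖ ≤ 1) (P : (ZMod q)[X]) (hP : P.natDegree ≤ e + 1) :
    ((q.totient : ℝ) / q * ‖𝔼 x, f x * ps (P.eval x)‖) ^ (2 * 2 ^ e * 2 ^ e)
      ≤ Zp (2 * e + 1) (((e + 1).factorial : ZMod q) ^ 2 * P.coeff (e + 1)) := by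
  have h1 : (q.totient : ℂ) / q * (𝔼 x, f x * ps (P.eval x))
      = 𝔼 x : ZMod q, f x * 𝔼 y : ZMod q, ((1 : MulChar (ZMod q) ℂ) y * f y * ps (P.eval (x * y))) := by
    rw [hom_avg (G := fun _ => 𝔼 x, f x * ps (P.eval x)) (fun u => 𝔼 x, f (x * u) * ps (P.eval (x * u)))]
    · simp_rw [Finset.mul_expect]
      rw [Finset.expect_comm]
      refine Finset.expect_congr rfl fun x _ => Finset.expect_congr rfl fun y _ => ?_
      rw [map_mul]; ring
    · intro u
      exact Fintype.expect_equiv (Units.mulRight u) _ _ fun x => rfl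
  have h2 : (q.totient : ℝ) / q * ‖𝔼 x, f x * ps (P.eval x)‖
      = ‖(q.totient : ℂ) / q * (𝔼 x, f x * ps (P.eval x))‖ := by
    rw [norm_mul, norm_div, Complex.norm_natCast, Complex.norm_natCast]
  set W : ZMod q → ℂ := fun x => 𝔼 y : ZMod q, ((1 : MulChar (ZMod q) ℂ) y * f y * ps (P.eval (x * y))) with hW
  set A := (q.totient : ℝ) / q * ‖𝔼 x, f x * ps (P.eval x)‖ with hA
  have hA0 : 0 ≤ A := by positivity
  have h3 : A ^ 2 ≤ 𝔼 x, ‖W x‖ ^ 2 := by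
    rw [h2, h1]
    refine le_trans ?_ (ex_pow (fun x => norm_nonneg (W x)) 2)
    gcongr
    refine (ex_norm _ _).trans (Finset.expect_le_expect fun x _ => ?_)
    rw [norm_mul]
    exact mul_le_of_le_one_left (norm_nonneg _) (hf x)
  have h4 : 𝔼 x, ‖W x‖ ^ 2 ≤ 𝔼 y : ZMod q, 𝔼 z : ZMod q, ‖𝔼 x : ZMod q, ps (P.eval (x * y) - P.eval (x * z))‖ := by
    have e1 : ((𝔼 x, ‖W x‖ ^ 2 : ℝ) : ℂ) = 𝔼 y : ZMod q, 𝔼 z : ZMod q,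
        ((1 : MulChar (ZMod q) ℂ) y * f y) * (starRingEnd ℂ) ((1 : MulChar (ZMod q) ℂ) z * f z) *
          𝔼 x : ZMod q, ps (P.eval (x * y) - P.eval (x * z)) := by
      rw [ex_cast]
      simp_rw [hW, ex_sq]
      rw [ex_rot]
      refine Finset.expect_congr rfl fun y _ => ?_
      refine Finset.expect_congr rfl fun z _ => ?_
      rw [Finset.mul_expect]
      refine Finset.expect_congr rfl fun x _ => ?_
      rw [ps_sub, map_mul, map_mul]; ring
    have e2 : (𝔼 x, ‖W x‖ ^ 2) = ‖((𝔼 x, ‖W x‖ ^ 2 : ℝ) : ℂ)‖ := by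
      rw [Complex.norm_real, Real.norm_of_nonneg]
      exact Finset.expect_nonneg fun x _ => by positivity
    rw [e2, e1]
    refine (ex_norm _ _).trans (Finset.expect_le_expect fun y _ => (ex_norm _ _).trans (Finset.expect_le_expect fun z _ => ?_))
    rw [norm_mul, norm_mul, norm_mul, RCLike.norm_conj, norm_mul]
    refine mul_le_of_le_one_left (norm_nonneg _) ?_
    have a1 := one_norm y
    have a2 := one_norm z
    have a3 := hf y
    have a4 := hf z
    calc _ ≤ (1 * 1) * (1 * 1 : ℝ) := by gcongr
      _ = 1 := by norm_num
  have h5 : (𝔼 y : ZMod q, 𝔼 z : ZMod q, ‖𝔼 x : ZMod q, ps (P.eval (x * y) - P.eval (x * z))‖) ^ (2 ^ e)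
      ≤ 𝔼 y : ZMod q, 𝔼 z : ZMod q, Zp e (((e + 1).factorial : ZMod q) * P.coeff (e + 1) * (y ^ (e + 1) - z ^ (e + 1))) := by
    refine (ex_pow (fun y => Finset.expect_nonneg fun z _ => norm_nonneg _) _).trans (Finset.expect_le_expect fun y _ => ?_)
    refine (ex_pow (fun y => norm_nonneg _) _).trans (Finset.expect_le_expect fun z _ => ?_)
    have hdeg : ∀ r : ZMod q, (P.comp (C r * X)).natDegree ≤ e + 1 := by
      intro r
      rw [natDegree_le_iff_coeff_eq_zero]
      intro n hn
      rw [comp_C_mul_X_coeff, coeff_eq_zero_of_natDegree_lt (by omega), zero_mul]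
    have := weyl e (P.comp (C y * X) - P.comp (C z * X)) ((natDegree_sub_le _ _).trans (max_le (hdeg _) (hdeg _)))
    rw [coeff_sub, comp_C_mul_X_coeff, comp_C_mul_X_coeff, ← mul_sub, ← mul_assoc] at this
    simp only [eval_sub, eval_comp, eval_mul, eval_C, eval_X] at this
    simpa only [mul_comm] using this
  have h6 := Zdiff e e (((e + 1).factorial : ZMod q) * P.coeff (e + 1))
  calc A ^ (2 * 2 ^ e * 2 ^ e) = ((A ^ 2) ^ (2 ^ e)) ^ (2 ^ e) := by rw [← pow_mul, ← pow_mul, mul_assoc]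
    _ ≤ ((𝔼 y : ZMod q, 𝔼 z : ZMod q, ‖𝔼 x : ZMod q, ps (P.eval (x * y) - P.eval (x * z))‖) ^ (2 ^ e)) ^ (2 ^ e) := by
        gcongr; exact h3.trans h4
    _ ≤ (𝔼 y : ZMod q, 𝔼 z : ZMod q, Zp e (((e + 1).factorial : ZMod q) * P.coeff (e + 1) * (y ^ (e + 1) - z ^ (e + 1)))) ^ (2 ^ e) := by
        gcongr
    _ ≤ _ := by
        refine h6.trans (le_of_eq ?_)
        rw [show e + 1 + e = 2 * e + 1 by ring]; congr 1; ring

end MA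
end


section
open Complex Set Filter Topology
open scoped BigOperators

namespace MA

variable {q : ℕ} [NeZero q]

lemma Zp_root {k : ℕ} (m : ℕ) {s K : ℕ} (hs : 1 ≤ s) (hK : 1 ≤ K) (g : Fin k → ℕ) (hg : ∀ i, g i ≤ s)
    {a : ZMod q} (ha : IsUnit a) (v : Fin k → ZMod q) :
    Zp m ((K : ZMod q) * (a * ∏ i, v i ^ g i)) ≤
      (q.divisors.card : ℝ) ^ m * K * (q : ℝ) ^ (-(1 / s : ℝ)) * ∏ i, (gq (v i) : ℝ) := by
  have hq : (0 : ℝ) < q := by exact_mod_cast NeZero.pos q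
  have hd : (1 : ℝ) ≤ q.divisors.card := by
    exact_mod_cast Finset.card_pos.2 ⟨1, Nat.one_mem_divisors.2 (NeZero.ne q)⟩
  have hK' : (1 : ℝ) ≤ K := by exact_mod_cast hK
  set x := Zp m ((K : ZMod q) * (a * ∏ i, v i ^ g i)) with hx
  have hx0 : 0 ≤ x := Zp_nonneg _ _
  have hx1 : x ≤ 1 := Zp_le_one _ _
  set A := (q.divisors.card : ℝ) ^ m * K with hA
  have hA1 : 1 ≤ A := one_le_mul_of_one_le_of_one_le (one_le_pow₀ hd) hK'
  have h1 : (gq ((K : ZMod q) * (a * ∏ i, v i ^ g i)) : ℝ) ≤ K * (∏ i, (gq (v i) : ℝ)) ^ s := by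
    have : gq ((K : ZMod q) * (a * ∏ i, v i ^ g i)) ≤ K * (1 * ∏ i, gq (v i) ^ s) := by
      refine (gq_mul _ _).trans (Nat.mul_le_mul (gq_natCast hK) ((gq_mul _ _).trans
        (Nat.mul_le_mul (gq_unit ha).le ((gq_prod _ _).trans (Finset.prod_le_prod' fun i _ => ?_)))))
      exact (gq_pow _ _).trans (Nat.pow_le_pow_right (gq_pos _) (hg i))
    rw [one_mul, Finset.prod_pow] at this
    exact_mod_cast this
  have h2 : x ≤ A * (∏ i, (gq (v i) : ℝ)) ^ s / q := by
    refine (Zp_le _ _).trans ?_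
    rw [hA, mul_div_assoc', mul_assoc]; gcongr
  set G := ∏ i, (gq (v i) : ℝ) with hG
  have hG0 : 0 ≤ G := Finset.prod_nonneg fun i _ => by positivity
  have h3 : (A * (q : ℝ) ^ (-(1 / s : ℝ)) * G) ^ s = A ^ s * G ^ s / q := by
    rw [mul_pow, mul_pow, ← Real.rpow_natCast ((q : ℝ) ^ (-(1 / s : ℝ))), ← Real.rpow_mul hq.le]
    have : -(1 / s : ℝ) * s = -1 := by
      have : (s : ℝ) ≠ 0 := by positivity
      field_simp
    rw [this, Real.rpow_neg_one]; ring
  have h4 : x ^ s ≤ (A * (q : ℝ) ^ (-(1 / s : ℝ)) * G) ^ s := by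
    rw [h3]
    refine (pow_le_of_le_one hx0 hx1 (by omega)).trans (h2.trans ?_)
    gcongr
    exact le_self_pow₀ hA1 (by omega)
  exact (pow_le_pow_iff_left₀ hx0 (by positivity) (by omega)).1 h4

lemma ex_prod {k : ℕ} (g : ZMod q → ℝ) : (𝔼 v : Fin k → ZMod q, ∏ i, g (v i)) = (𝔼 x, g x) ^ k := by
  rw [Fintype.expect_eq_sum_div_card, Fintype.expect_eq_sum_div_card, div_pow]
  congr 1
  · have := Finset.prod_univ_sum (fun _ : Fin k => (Finset.univ : Finset (ZMod q))) (fun _ x => g x)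
    rw [Fintype.piFinset_univ] at this
    rw [← this]; simp
  · simp

open Polynomial in
lemma twist_core {k : ℕ} {Γ : Finset (Fin k → ℕ)} {g : Fin k → ℕ} (hg : g ∈ Γ) {e : ℕ} (he : ∑ i, g i * g i = e + 1)
    (hmax : ∀ γ ∈ Γ, ∑ i, γ i * γ i ≤ e + 1)
    (a : (Fin k → ℕ) → ZMod q) (ha : ∀ γ ∈ Γ, IsUnit (a γ)) (f : Fin k → (ZMod q →* ℂ)) (hf : ∀ i x, ‖f i x‖ ≤ 1) :
    (((q.totient : ℝ) / q) ^ 2 * ‖𝔼 v : Fin k → ZMod q, (∏ i, f i (v i)) * ps (∑ γ ∈ Γ, a γ * ∏ i, v i ^ γ i)‖)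
        ^ (2 * 2 ^ e * 2 ^ e)
      ≤ (q.divisors.card : ℝ) ^ (2 * e + 1) * (((e + 1).factorial ^ 2 : ℕ) : ℝ) * (q : ℝ) ^ (-(1 / ((∑ i, g i : ℕ)) : ℝ))
        * (q.divisors.card : ℝ) ^ k := by
  have hlt : ∀ γ ∈ Γ, γ ≠ g → ∑ i, g i * γ i < e + 1 := by
    intro γ hγ hne
    have h1 : 0 < ∑ i, ((g i : ℤ) - γ i) ^ 2 := by
      obtain ⟨i, hi⟩ := Function.ne_iff.1 hne
      refine Finset.sum_pos' (fun i _ => sq_nonneg _) ⟨i, Finset.mem_univ _, ?_⟩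
      have : (g i : ℤ) - γ i ≠ 0 := by omega
      positivity
    have h2 : ∑ i, ((g i : ℤ) - γ i) ^ 2 = (∑ i, g i * g i : ℕ) + (∑ i, γ i * γ i : ℕ) - 2 * (∑ i, g i * γ i : ℕ) := by
      push_cast
      rw [Finset.mul_sum, ← Finset.sum_add_distrib, ← Finset.sum_sub_distrib]
      exact Finset.sum_congr rfl fun i _ => by ring
    have h3 := hmax γ hγ
    rw [h2, he] at h1
    omega
  set s := ∑ i, g i with hs
  have hs1 : 1 ≤ s := by
    by_contra h
    have : ∀ i ∈ Finset.univ, g i = 0 := Finset.sum_eq_zero_iff.1 (by omega : ∑ i, g i = 0)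
    have : ∑ i, g i * g i = 0 := Finset.sum_eq_zero fun i hi => by simp [this i hi]
    omega
  set F : ZMod q →* ℂ := (1 : MulChar (ZMod q) ℂ).toMonoidHom * ∏ i, f i ^ g i with hF
  have hFv : ∀ u, F u = (1 : MulChar (ZMod q) ℂ) u * ∏ i, f i u ^ g i := by
    intro u; simp [hF, MonoidHom.finset_prod_apply]
  have hFb : ∀ u, ‖F u‖ ≤ 1 := by
    intro u
    rw [hFv, norm_mul, norm_prod]
    refine mul_le_one₀ (one_norm u) (by positivity) (Finset.prod_le_one (fun i _ => norm_nonneg _) fun i _ => ?_)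
    rw [norm_pow]; exact pow_le_one₀ (norm_nonneg _) (hf i u)
  set P : (Fin k → ZMod q) → (ZMod q)[X] := fun v => ∑ γ ∈ Γ, C (a γ * ∏ i, v i ^ γ i) * X ^ (∑ i, g i * γ i) with hP
  have hle : ∀ γ ∈ Γ, ∑ i, g i * γ i ≤ e + 1 := by
    intro γ hγ
    by_cases h : γ = g
    · rw [h, he]
    · exact (hlt γ hγ h).le
  have hPdeg : ∀ v, (P v).natDegree ≤ e + 1 := by
    intro v
    exact natDegree_sum_le_of_forall_le _ _ fun γ hγ => (natDegree_C_mul_X_pow_le _ _).trans (hle γ hγ)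
  have hPc : ∀ v, (P v).coeff (e + 1) = a g * ∏ i, v i ^ g i := by
    intro v
    rw [hP, finset_sum_coeff, Finset.sum_eq_single g]
    · rw [coeff_C_mul_X_pow, if_pos he.symm]
    · intro γ hγ hne
      rw [coeff_C_mul_X_pow, if_neg (hlt γ hγ hne).ne']
    · exact fun h => absurd hg h
  have hPe : ∀ v u, (P v).eval u = ∑ γ ∈ Γ, a γ * ∏ i, (v i * u ^ g i) ^ γ i := by
    intro v u
    rw [hP, eval_finset_sum]
    refine Finset.sum_congr rfl fun γ _ => ?_
    simp only [eval_mul, eval_C, eval_pow, eval_X, mul_pow]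
    rw [Finset.prod_mul_distrib, ← Finset.prod_pow_eq_pow_sum]
    simp_rw [← pow_mul, mul_assoc]
  set T0 := 𝔼 v : Fin k → ZMod q, (∏ i, f i (v i)) * ps (∑ γ ∈ Γ, a γ * ∏ i, v i ^ γ i) with hT0
  have h1 : (q.totient : ℂ) / q * T0 = 𝔼 v : Fin k → ZMod q, (∏ i, f i (v i)) * 𝔼 u : ZMod q, F u * ps ((P v).eval u) := by
    rw [hom_avg (G := fun _ => T0) (fun u => 𝔼 v : Fin k → ZMod q, (∏ i, f i (v i * u ^ g i)) *
      ps (∑ γ ∈ Γ, a γ * ∏ i, (v i * u ^ g i) ^ γ i))]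
    · simp_rw [Finset.mul_expect]
      rw [Finset.expect_comm]
      refine Finset.expect_congr rfl fun v _ => Finset.expect_congr rfl fun u _ => ?_
      rw [hPe, hFv]
      simp_rw [map_mul, map_pow]
      rw [Finset.prod_mul_distrib]; ring
    · intro u
      exact Fintype.expect_equiv (Equiv.piCongrRight fun i => Units.mulRight (u ^ g i)) _ _ fun v => by
        simp
  set c : ℝ := (q.totient : ℝ) / q with hc
  have h2 : c * ‖T0‖ ≤ 𝔼 v : Fin k → ZMod q, ‖𝔼 u : ZMod q, F u * ps ((P v).eval u)‖ := by
    have : c * ‖T0‖ = ‖(q.totient : ℂ) / q * T0‖ := by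
      rw [norm_mul, norm_div, Complex.norm_natCast, Complex.norm_natCast]
    rw [this, h1]
    refine (ex_norm _ _).trans (Finset.expect_le_expect fun v _ => ?_)
    rw [norm_mul, norm_prod]
    exact mul_le_of_le_one_left (norm_nonneg _) (Finset.prod_le_one (fun i _ => norm_nonneg _) fun i _ => hf i _)
  have hc0 : 0 ≤ c := by positivity
  have h3 : (c ^ 2 * ‖T0‖) ^ (2 * 2 ^ e * 2 ^ e) ≤
      𝔼 v : Fin k → ZMod q, Zp (2 * e + 1) ((((e + 1).factorial ^ 2 : ℕ) : ZMod q) * (a g * ∏ i, v i ^ g i)) := by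
    calc _ ≤ (𝔼 v : Fin k → ZMod q, c * ‖𝔼 u : ZMod q, F u * ps ((P v).eval u)‖) ^ (2 * 2 ^ e * 2 ^ e) := by
          rw [← Finset.mul_expect, sq, mul_assoc]; gcongr
      _ ≤ _ := (ex_pow (fun v => by positivity) _).trans (Finset.expect_le_expect fun v _ => by
          have := bil e F hFb (P v) (hPdeg v)
          rw [hPc] at this
          push_cast
          exact this)
  refine h3.trans ?_
  calc _ ≤ 𝔼 v : Fin k → ZMod q, (q.divisors.card : ℝ) ^ (2 * e + 1) * (((e + 1).factorial ^ 2 : ℕ) : ℝ) * (q : ℝ) ^ (-(1 / s : ℝ)) * ∏ i, (gq (v i) : ℝ) :=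
        Finset.expect_le_expect fun v _ => Zp_root _ hs1 (Nat.one_le_pow _ _ (Nat.factorial_pos _)) g
          (fun i => Finset.single_le_sum (fun _ _ => Nat.zero_le _) (Finset.mem_univ i)) (ha g hg) v
    _ = (q.divisors.card : ℝ) ^ (2 * e + 1) * (((e + 1).factorial ^ 2 : ℕ) : ℝ) * (q : ℝ) ^ (-(1 / s : ℝ)) * (𝔼 x : ZMod q, (gq x : ℝ)) ^ k := by
        rw [← Finset.mul_expect, ex_prod (fun x => (gq x : ℝ))]
    _ ≤ _ := by
        gcongr
        exact ex_gq

theorem gauss_twist {k : ℕ} (Γ : Finset (Fin k → ℕ)) (hΓ : Γ.Nonempty) (h0 : (0 : Fin k → ℕ) ∉ Γ) :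
    ∃ C δ : ℝ, 0 < C ∧ 0 < δ ∧ ∀ (q : ℕ) [NeZero q] (a : (Fin k → ℕ) → ZMod q), (∀ γ ∈ Γ, IsUnit (a γ)) →
      ∀ (f : Fin k → (ZMod q →* ℂ)), (∀ i x, ‖f i x‖ ≤ 1) →
      ((q : ℝ) / q.totient) ^ k * ‖𝔼 v : Fin k → ZMod q, (∏ i, f i (v i)) * ps (∑ γ ∈ Γ, a γ * ∏ i, v i ^ γ i)‖
        ≤ C * (q : ℝ) ^ (-δ) := by
  obtain ⟨g, hg, hmax⟩ := Γ.exists_max_image (fun γ => ∑ i, γ i * γ i) hΓ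
  have hpos : ∑ i, g i * g i ≠ 0 := by
    intro h
    rw [Finset.sum_eq_zero_iff] at h
    apply h0
    convert! hg
    ext i
    have := h i (Finset.mem_univ i)
    simp at this; simp [this]
  obtain ⟨e, he⟩ := Nat.exists_eq_succ_of_ne_zero hpos
  have he' : ∑ i, g i * g i = e + 1 := he
  set D := 2 * 2 ^ e * 2 ^ e with hD
  have hD1 : 1 ≤ D := Nat.one_le_iff_ne_zero.2 (by positivity)
  set s := ∑ i, g i with hs
  have hs1 : 1 ≤ s := by
    by_contra h
    have : ∀ i ∈ Finset.univ, g i = 0 := Finset.sum_eq_zero_iff.1 (by omega : ∑ i, g i = 0)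
    exact hpos (Finset.sum_eq_zero fun i hi => by simp [this i hi])
  set M := (k + 2) * D + (2 * e + 1) + k with hM
  have hM1 : 1 ≤ M := by omega
  set ε : ℝ := 1 / (2 * s * M) with hε
  have hs' : (0 : ℝ) < s := by exact_mod_cast hs1
  have hM' : (0 : ℝ) < M := by exact_mod_cast hM1
  have hD' : (0 : ℝ) < D := by exact_mod_cast hD1
  obtain ⟨C, hC1, hC⟩ := divisor_bound (ε := ε) (by positivity)
  set K : ℝ := (((e + 1).factorial ^ 2 : ℕ) : ℝ) with hK
  have hK1 : 1 ≤ K := by rw [hK]; exact_mod_cast Nat.one_le_pow _ _ (Nat.factorial_pos _)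
  refine ⟨C ^ M * K, 1 / (2 * s * D), by positivity, by positivity, fun q _ a ha f hf => ?_⟩
  have hq : (0 : ℝ) < q := by exact_mod_cast NeZero.pos q
  have hφ : (0 : ℝ) < q.totient := by exact_mod_cast Nat.totient_pos.2 (NeZero.pos q)
  have core := twist_core hg he' (fun γ hγ => he' ▸ hmax γ hγ) a ha f hf
  rw [← hD, ← hK] at core
  set T := ‖𝔼 v : Fin k → ZMod q, (∏ i, f i (v i)) * ps (∑ γ ∈ Γ, a γ * ∏ i, v i ^ γ i)‖ with hT
  have hT0 : 0 ≤ T := norm_nonneg _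
  clear_value T K
  set d : ℝ := ((q.divisors.card : ℕ) : ℝ) with hd
  have hd1 : 1 ≤ d := by
    rw [hd]; exact_mod_cast Finset.card_pos.2 ⟨1, Nat.one_mem_divisors.2 (NeZero.ne q)⟩
  have hqd : (q : ℝ) / q.totient ≤ d := by
    rw [div_le_iff₀ hφ, mul_comm, hd]; exact_mod_cast q_le_tot (q := q)
  have hdC := hC q (NeZero.ne q)
  rw [← hd] at hdC
  clear_value d
  have h1 : ((q : ℝ) / q.totient) ^ k * T ≤ d ^ (k + 2) * (((q.totient : ℝ) / q) ^ 2 * T) := by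
    have : ((q : ℝ) / q.totient) ^ k * T = ((q : ℝ) / q.totient) ^ (k + 2) * (((q.totient : ℝ) / q) ^ 2 * T) := by
      rw [pow_add]; field_simp
    rw [this]; gcongr
  have h2 : (((q : ℝ) / q.totient) ^ k * T) ^ D ≤ d ^ M * K * (q : ℝ) ^ (-(1 / s : ℝ)) := by
    calc _ ≤ (d ^ (k + 2) * (((q.totient : ℝ) / q) ^ 2 * T)) ^ D := by gcongr
      _ = d ^ ((k + 2) * D) * (((q.totient : ℝ) / q) ^ 2 * T) ^ D := by rw [mul_pow, ← pow_mul]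
      _ ≤ d ^ ((k + 2) * D) * (d ^ (2 * e + 1) * K * (q : ℝ) ^ (-(1 / s : ℝ)) * d ^ k) := by gcongr
      _ = _ := by rw [hM, pow_add, pow_add]; ring
  have h3 : d ^ M ≤ C ^ M * (q : ℝ) ^ (1 / (2 * s) : ℝ) := by
    calc d ^ M ≤ (C * (q : ℝ) ^ ε) ^ M := by gcongr
      _ = _ := by
        rw [mul_pow, ← Real.rpow_natCast ((q : ℝ) ^ ε), ← Real.rpow_mul hq.le]
        congr 2; rw [hε]; field_simp
  have h4 : (((q : ℝ) / q.totient) ^ k * T) ^ D ≤ (C ^ M * K * (q : ℝ) ^ (-(1 / (2 * s * D) : ℝ))) ^ D := by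
    refine h2.trans ?_
    have e1 : (C ^ M * K * (q : ℝ) ^ (-(1 / (2 * s * D) : ℝ))) ^ D = (C ^ M * K) ^ D * (q : ℝ) ^ (-(1 / (2 * s) : ℝ)) := by
      rw [mul_pow, ← Real.rpow_natCast ((q : ℝ) ^ (-(1 / (2 * s * D) : ℝ))), ← Real.rpow_mul hq.le]
      congr 2; field_simp
    have e2 : (q : ℝ) ^ (1 / (2 * s) : ℝ) * (q : ℝ) ^ (-(1 / s : ℝ)) = (q : ℝ) ^ (-(1 / (2 * s) : ℝ)) := by
      rw [← Real.rpow_add hq]; congr 1; field_simp; norm_num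
    rw [e1]
    calc d ^ M * K * (q : ℝ) ^ (-(1 / s : ℝ)) ≤ (C ^ M * (q : ℝ) ^ (1 / (2 * s) : ℝ)) * K * (q : ℝ) ^ (-(1 / s : ℝ)) := by gcongr
      _ = (C ^ M * K) * (q : ℝ) ^ (-(1 / (2 * s) : ℝ)) := by rw [← e2]; ring
      _ ≤ _ := by
        gcongr
        exact le_self_pow₀ (one_le_mul_of_one_le_of_one_le (one_le_pow₀ hC1) hK1) (by omega)
  exact (pow_le_pow_iff_left₀ (by positivity) (by positivity) (by omega)).1 h4

end MA
end


section
open Complex Set Filter Topology MeasureTheory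
open scoped BigOperators

namespace MA

lemma ind_inter (J S : Set ℝ) (u : ℝ) :
    (J ∩ S).indicator (1 : ℝ → ℂ) u = J.indicator 1 u * S.indicator 1 u := by
  by_cases h1 : u ∈ J <;> by_cases h2 : u ∈ S <;> simp [h1, h2]

lemma layer {h h' : ℝ → ℂ} (hh : ∀ s, HasDerivAt h (h' s) s) (hc : Continuous h') {N t : ℝ}
    (ht : |t| ≤ N) :
    h t = h N - ∫ s in Set.Ioc (-N) N, (Set.Iio s).indicator (1 : ℝ → ℂ) t * h' s := by
  obtain ⟨h1, h2⟩ := abs_le.1 ht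
  have e1 : ∫ s in Set.Ioc (-N) N, (Set.Iio s).indicator (1 : ℝ → ℂ) t * h' s
      = ∫ s in Set.Ioc t N, h' s := by
    have : (fun s => (Set.Iio s).indicator (1 : ℝ → ℂ) t * h' s) = (Set.Ioi t).indicator h' := by
      ext s
      by_cases hs : t < s <;> simp [hs]
    rw [this, setIntegral_indicator measurableSet_Ioi]
    congr 2
    ext s; simp only [Set.mem_inter_iff, Set.mem_Ioc, Set.mem_Ioi]
    constructor
    · rintro ⟨⟨_, b⟩, c⟩; exact ⟨c, b⟩
    · rintro ⟨c, b⟩; exact ⟨⟨by linarith, b⟩, c⟩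
  rw [e1, ← intervalIntegral.integral_of_le h2,
    intervalIntegral.integral_eq_sub_of_hasDerivAt (fun s _ => hh s) (hc.intervalIntegrable _ _)]
  ring

lemma oneD {X : Type*} [Fintype X] (x : X → ℝ) (w : X → ℂ) {D : ℝ → ℂ} (hD : Integrable D)
    {N : ℝ} (hN : 0 ≤ N) (hx : ∀ t, |x t| ≤ N) (hDs : ∀ u, N < |u| → D u = 0) {E0 : ℝ}
    (hL : ∀ L : Set ℝ, IsLowerSet L →
      ‖∑ t, w t * L.indicator (1 : ℝ → ℂ) (x t) - ∫ u, D u * L.indicator (1 : ℝ → ℂ) u‖ ≤ E0)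
    {J : Set ℝ} (hJ : J.OrdConnected) {h h' : ℝ → ℂ} (hh : ∀ s, HasDerivAt h (h' s) s)
    (hc : Continuous h') (hb : ‖h N‖ ≤ 1) {K : ℝ} (hK : ∀ s, |s| ≤ N → ‖h' s‖ ≤ K) :
    ‖∑ t, w t * J.indicator h (x t) - ∫ u, D u * J.indicator h u‖ ≤ 2 * E0 * (1 + 2 * N * K) := by
  have hind : ∀ (S : Set ℝ), MeasurableSet S → ∀ {f : ℝ → ℂ}, Integrable f →
      Integrable (fun u => f u * S.indicator (1 : ℝ → ℂ) u) := by
    intro S hS f hf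
    refine hf.mul_bdd (c := 1) ((measurable_const.indicator hS).aestronglyMeasurable) ?_
    refine ae_of_all _ fun u => ?_
    by_cases hu : u ∈ S <;> simp [hu]
  have hE0 : 0 ≤ E0 := (norm_nonneg _).trans (hL ∅ (isLowerSet_empty))
  have hΔ : ∀ S : Set ℝ, S.OrdConnected →
      ‖∑ t, w t * S.indicator (1 : ℝ → ℂ) (x t) - ∫ u, D u * S.indicator (1 : ℝ → ℂ) u‖ ≤ 2 * E0 := by
    intro S hS
    set L1 : Set ℝ := {u | ∃ s ∈ S, u ≤ s} with hL1
    set L2 : Set ℝ := {u | ∃ s ∈ S, u ≤ s} \ S with hL2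
    have l1 : IsLowerSet L1 := fun a b hab ⟨s, hs, h⟩ => ⟨s, hs, hab.trans h⟩
    have l2 : IsLowerSet L2 := by
      rintro a b hab ⟨⟨s, hs, h⟩, h3⟩
      refine ⟨⟨s, hs, hab.trans h⟩, fun hb => h3 (hS.out hb hs ⟨hab, h⟩)⟩
    have hi : ∀ u, S.indicator (1 : ℝ → ℂ) u = L1.indicator 1 u - L2.indicator 1 u := by
      intro u
      by_cases hu : u ∈ S
      · have : u ∈ L1 := ⟨u, hu, le_rfl⟩
        have h2 : u ∉ L2 := fun h => h.2 hu
        simp [hu, this, h2]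
      · by_cases h1 : u ∈ L1
        · have h2 : u ∈ L2 := ⟨h1, hu⟩
          simp [hu, h1, h2]
        · have h2 : u ∉ L2 := fun h => h1 h.1
          simp [hu, h1, h2]
    simp_rw [hi, mul_sub, Finset.sum_sub_distrib]
    rw [integral_sub (hind L1 l1.ordConnected.measurableSet hD) (hind L2 l2.ordConnected.measurableSet hD)]
    have a1 := hL L1 l1
    have a2 := hL L2 l2
    calc _ = ‖(∑ t, w t * L1.indicator (1 : ℝ → ℂ) (x t) - ∫ u, D u * L1.indicator (1 : ℝ → ℂ) u)
        - (∑ t, w t * L2.indicator (1 : ℝ → ℂ) (x t) - ∫ u, D u * L2.indicator (1 : ℝ → ℂ) u)‖ := by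
          congr 1; ring
      _ ≤ _ := (norm_sub_le _ _).trans (by linarith)
  have hJm := hJ.measurableSet
  set ν := (volume : Measure ℝ).restrict (Set.Ioc (-N) N) with hν
  have hiν : Integrable h' ν := (hc.integrableOn_Icc (a := -N) (b := N)).mono_set Set.Ioc_subset_Icc_self
  have e0 : ∀ u, |u| ≤ N → J.indicator h u = h N * J.indicator (1 : ℝ → ℂ) u
      - ∫ s, h' s * (J ∩ Set.Iio s).indicator (1 : ℝ → ℂ) u ∂ν := by
    intro u hu
    have : ∫ s, h' s * (J ∩ Set.Iio s).indicator (1 : ℝ → ℂ) u ∂ν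
        = J.indicator (1 : ℝ → ℂ) u * ∫ s, (Set.Iio s).indicator (1 : ℝ → ℂ) u * h' s ∂ν := by
      rw [← integral_const_mul]
      refine integral_congr_ae (ae_of_all _ fun s => ?_)
      simp only [ind_inter]; ring
    rw [this]
    by_cases hJu : u ∈ J
    · simp only [hJu, Set.indicator_of_mem, Pi.one_apply, mul_one, one_mul]
      exact layer hh hc hu
    · simp [hJu]
  have iS : ∀ t, Integrable (fun s => w t * (h' s * (J ∩ Set.Iio s).indicator (1 : ℝ → ℂ) (x t))) ν := by
    intro t
    refine Integrable.const_mul ?_ _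
    have : ∀ s, (J ∩ Set.Iio s).indicator (1 : ℝ → ℂ) (x t) =
        (Set.Ioi (x t)).indicator (fun _ => J.indicator (1 : ℝ → ℂ) (x t)) s := by
      intro s; rw [ind_inter]; by_cases hs : x t < s <;> simp [hs]
    simp_rw [this]
    refine hiν.mul_bdd (c := 1) ((measurable_const.indicator measurableSet_Ioi).aestronglyMeasurable) ?_
    refine ae_of_all _ fun s => ?_
    by_cases hs : s ∈ Set.Ioi (x t) <;> by_cases hs' : x t ∈ J <;> simp [hs, hs']
  have hprod : Integrable (Function.uncurry fun (u s : ℝ) =>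
      D u * (h' s * (J ∩ Set.Iio s).indicator (1 : ℝ → ℂ) u)) (volume.prod ν) := by
    have h1 : Integrable (fun z : ℝ × ℝ => D z.1 * h' z.2) (volume.prod ν) := hD.mul_prod hiν
    have h2 : MeasurableSet {z : ℝ × ℝ | z.1 ∈ J ∧ z.1 < z.2} :=
      (measurable_fst hJm).inter (measurableSet_lt measurable_fst measurable_snd)
    have h3 := h1.mul_bdd (c := 1) (g := {z : ℝ × ℝ | z.1 ∈ J ∧ z.1 < z.2}.indicator 1)
      ((measurable_const.indicator h2).aestronglyMeasurable) (ae_of_all _ fun z => by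
        by_cases hz : z ∈ {z : ℝ × ℝ | z.1 ∈ J ∧ z.1 < z.2} <;> simp only [hz, Set.indicator_of_mem, Set.indicator_of_notMem, not_false_eq_true] <;> simp)
    refine h3.congr (ae_of_all _ fun z => ?_)
    obtain ⟨u, s⟩ := z
    simp only [Function.uncurry_apply_pair]
    by_cases h4 : u ∈ J <;> by_cases h5 : u < s <;> simp [Set.indicator, h4, h5]
  have T1 : ∑ t, w t * J.indicator h (x t) = h N * ∑ t, w t * J.indicator (1 : ℝ → ℂ) (x t)
      - ∫ s, h' s * ∑ t, w t * (J ∩ Set.Iio s).indicator (1 : ℝ → ℂ) (x t) ∂ν := by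
    have : ∫ s, h' s * ∑ t, w t * (J ∩ Set.Iio s).indicator (1 : ℝ → ℂ) (x t) ∂ν
        = ∑ t, ∫ s, w t * (h' s * (J ∩ Set.Iio s).indicator (1 : ℝ → ℂ) (x t)) ∂ν := by
      rw [← integral_finsetSum _ fun t _ => iS t]
      refine integral_congr_ae (ae_of_all _ fun s => ?_)
      simp only [Finset.mul_sum]
      exact Finset.sum_congr rfl fun t _ => by ring
    rw [this, Finset.mul_sum, ← Finset.sum_sub_distrib]
    refine Finset.sum_congr rfl fun t _ => ?_
    rw [e0 _ (hx t), integral_const_mul]; ring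
  have T2 : ∫ u, D u * J.indicator h u = h N * (∫ u, D u * J.indicator (1 : ℝ → ℂ) u)
      - ∫ s, h' s * (∫ u, D u * (J ∩ Set.Iio s).indicator (1 : ℝ → ℂ) u) ∂ν := by
    have e2 : ∫ s, h' s * (∫ u, D u * (J ∩ Set.Iio s).indicator (1 : ℝ → ℂ) u) ∂ν
        = ∫ u, ∫ s, D u * (h' s * (J ∩ Set.Iio s).indicator (1 : ℝ → ℂ) u) ∂ν := by
      rw [integral_integral_swap hprod]
      refine integral_congr_ae (ae_of_all _ fun s => ?_)
      simp only [← integral_const_mul]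
      refine integral_congr_ae (ae_of_all _ fun u => ?_)
      simp only; ring
    have hpl : Integrable (fun u => ∫ s, D u * (h' s * (J ∩ Set.Iio s).indicator (1 : ℝ → ℂ) u) ∂ν) :=
      hprod.integral_prod_left
    rw [e2, ← integral_const_mul, ← integral_sub ((hind J hJm hD).const_mul _) hpl]
    refine integral_congr_ae (ae_of_all _ fun u => ?_)
    simp only
    by_cases hu : |u| ≤ N
    · rw [e0 _ hu, integral_const_mul]; ring
    · simp [hDs u (not_le.1 hu)]
  have i1 : Integrable (fun s => h' s * ∑ t, w t * (J ∩ Set.Iio s).indicator (1 : ℝ → ℂ) (x t)) ν := by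
    refine (integrable_finsetSum Finset.univ fun t _ => iS t).congr (ae_of_all _ fun s => ?_)
    simp only [Finset.mul_sum]
    exact Finset.sum_congr rfl fun t _ => by ring
  have i2 : Integrable (fun s => h' s * ∫ u, D u * (J ∩ Set.Iio s).indicator (1 : ℝ → ℂ) u) ν := by
    refine hprod.integral_prod_right.congr (ae_of_all _ fun s => ?_)
    simp only [← integral_const_mul, Function.uncurry_apply_pair]
    refine integral_congr_ae (ae_of_all _ fun u => ?_)
    simp only; ring
  have key : ∑ t, w t * J.indicator h (x t) - ∫ u, D u * J.indicator h u
      = h N * (∑ t, w t * J.indicator (1 : ℝ → ℂ) (x t) - ∫ u, D u * J.indicator (1 : ℝ → ℂ) u)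
      - ∫ s, h' s * (∑ t, w t * (J ∩ Set.Iio s).indicator (1 : ℝ → ℂ) (x t)
          - ∫ u, D u * (J ∩ Set.Iio s).indicator (1 : ℝ → ℂ) u) ∂ν := by
    simp_rw [mul_sub]
    rw [T1, T2, integral_sub i1 i2]; ring
  have hK0 : 0 ≤ K := (norm_nonneg _).trans (hK 0 (by simpa using hN))
  have b2 : ‖∫ s, h' s * (∑ t, w t * (J ∩ Set.Iio s).indicator (1 : ℝ → ℂ) (x t)
          - ∫ u, D u * (J ∩ Set.Iio s).indicator (1 : ℝ → ℂ) u) ∂ν‖ ≤ K * (2 * E0) * (2 * N) := by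
    have := norm_setIntegral_le_of_norm_le_const (μ := volume) (s := Set.Ioc (-N) N) (C := K * (2 * E0))
      (f := fun s => h' s * (∑ t, w t * (J ∩ Set.Iio s).indicator (1 : ℝ → ℂ) (x t)
          - ∫ u, D u * (J ∩ Set.Iio s).indicator (1 : ℝ → ℂ) u)) (by simp) (fun s hs => by
        rw [norm_mul]
        exact mul_le_mul (hK s (abs_le.2 ⟨hs.1.le, hs.2⟩)) (hΔ _ (hJ.inter Set.ordConnected_Iio))
          (norm_nonneg _) hK0)
    refine this.trans (le_of_eq ?_)
    rw [Measure.real, Real.volume_Ioc, ENNReal.toReal_ofReal (by linarith)]; ring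
  have b1 := hΔ J hJ
  rw [key]
  refine (norm_sub_le _ _).trans ?_
  rw [norm_mul]
  have : ‖h N‖ * ‖∑ t, w t * J.indicator (1 : ℝ → ℂ) (x t) - ∫ u, D u * J.indicator (1 : ℝ → ℂ) u‖
      ≤ 1 * (2 * E0) := mul_le_mul hb b1 (norm_nonneg _) zero_le_one
  nlinarith only [this, b2]

end MA
end


section
open Complex Set Filter Topology MeasureTheory
open scoped BigOperators

namespace MA

lemma pi_symm {k : ℕ} (z : ℝ × (Fin k → ℝ)) :
    (MeasurableEquiv.piFinSuccAbove (fun _ : Fin (k + 1) => ℝ) 0).symm z = Fin.cons z.1 z.2 := by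
  simp [MeasurableEquiv.piFinSuccAbove_symm_apply, Fin.insertNthEquiv]

lemma integral_cons {k : ℕ} (f : (Fin (k + 1) → ℝ) → ℂ) :
    ∫ u, f u = ∫ z : ℝ × (Fin k → ℝ), f (Fin.cons z.1 z.2) := by
  rw [← ((volume_preserving_piFinSuccAbove (fun _ : Fin (k + 1) => ℝ) 0).symm).integral_comp']
  simp only [pi_symm]

lemma integrable_cons {k : ℕ} {f : (Fin (k + 1) → ℝ) → ℂ} (hf : Integrable f) :
    Integrable (fun z : ℝ × (Fin k → ℝ) => f (Fin.cons z.1 z.2)) := by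
  have := ((volume_preserving_piFinSuccAbove (fun _ : Fin (k + 1) => ℝ) 0).symm)
  rw [← this.integrable_comp_emb (MeasurableEquiv.measurableEmbedding _)] at hf
  refine hf.congr (ae_of_all _ fun z => ?_)
  simp only [Function.comp_apply, pi_symm]

lemma sum_cons {k : ℕ} {X : Type*} [Fintype X] (f : (Fin (k + 1) → X) → ℂ) :
    ∑ v, f v = ∑ t : X, ∑ v : Fin k → X, f (Fin.cons t v) := by
  rw [← (Fin.consEquiv fun _ : Fin (k + 1) => X).sum_comp, Fintype.sum_prod_type]
  rfl

lemma hyb_int {k : ℕ} {D : Fin k → ℝ → ℂ} (hD : ∀ i, Integrable (D i)) {F : (Fin k → ℝ) → ℂ}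
    (hF : Measurable F) (hF1 : ∀ u, ‖F u‖ ≤ 1) : Integrable (fun u => (∏ i, D i (u i)) * F u) := by
  have := Integrable.fintype_prod (μ := fun _ : Fin k => (volume : Measure ℝ)) hD
  exact Integrable.mul_bdd (c := 1) this hF.aestronglyMeasurable (ae_of_all _ hF1)

lemma hybrid {X : Type*} [Fintype X] (x : X → ℝ) {E M : ℝ} (hE : 0 ≤ E) (hM : 0 ≤ M) :
    ∀ (k : ℕ) (w : Fin k → X → ℂ) (D : Fin k → ℝ → ℂ) (_ : ∀ i, Integrable (D i))
    (_ : ∀ i, ∑ t, ‖w i t‖ ≤ M) (_ : ∀ i, ∫ u, ‖D i u‖ ≤ M)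
    (F : (Fin k → ℝ) → ℂ) (_ : Measurable F) (_ : ∀ u, ‖F u‖ ≤ 1)
    (_ : ∀ (i : Fin k) (u : Fin k → ℝ), ‖∑ t, w i t * F (Function.update u i (x t))
      - ∫ s, D i s * F (Function.update u i s)‖ ≤ E),
    ‖∑ v : Fin k → X, (∏ i, w i (v i)) * F (fun i => x (v i)) - ∫ u, (∏ i, D i (u i)) * F u‖
      ≤ k * E * M ^ (k - 1) := by
  intro k
  induction k with
  | zero =>
    intro w D _ _ _ F _ _ _
    have : ∫ u : Fin 0 → ℝ, (∏ i, D i (u i)) * F u = F (fun i => x (i.elim0)) := by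
      rw [integral_unique]
      simp [Measure.real, volume_pi, Measure.pi_empty_univ]
      congr 1; ext i; exact i.elim0
    rw [this, Fintype.sum_unique]
    simp only [Finset.univ_eq_empty, Finset.prod_empty, one_mul]
    have : (fun i : Fin 0 => x ((default : Fin 0 → X) i)) = fun i => x (i.elim0) := by
      ext i; exact i.elim0
    rw [this]; simp
  | succ k ih =>
    intro w D hD hw hDM F hF hF1 hs
    have mcons : ∀ s : ℝ, Measurable fun y : Fin k → ℝ => (Fin.cons s y : Fin (k + 1) → ℝ) := by
      intro s
      refine measurable_pi_lambda _ fun i => ?_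
      refine Fin.cases ?_ (fun j => ?_) i
      · simp
      · simpa using measurable_pi_apply j
    have mcons2 : ∀ y : Fin k → ℝ, Measurable fun s : ℝ => (Fin.cons s y : Fin (k + 1) → ℝ) := by
      intro y
      refine measurable_pi_lambda _ fun i => ?_
      refine Fin.cases ?_ (fun j => ?_) i
      · simpa using measurable_id'
      · simp
    set I : ℝ → ℂ := fun s => ∫ y : Fin k → ℝ, (∏ i, D i.succ (y i)) * F (Fin.cons s y) with hI
    -- first: replace the tail
    have h1 : ∀ t, ‖∑ v : Fin k → X, (∏ i, w i.succ (v i)) * F (Fin.cons (x t) fun i => x (v i)) - I (x t)‖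
        ≤ k * E * M ^ (k - 1) := by
      intro t
      refine ih (fun i => w i.succ) (fun i => D i.succ) (fun i => hD _) (fun i => hw _) (fun i => hDM _)
        (fun y => F (Fin.cons (x t) y)) (hF.comp (mcons _)) (fun u => hF1 _) (fun i u => ?_)
      have := hs i.succ (Fin.cons (x t) u)
      simpa only [Fin.cons_update] using this
    have hIntg := hyb_int hD hF hF1
    have e1 : ∑ v : Fin (k + 1) → X, (∏ i, w i (v i)) * F (fun i => x (v i))
        = ∑ t, w 0 t * ∑ v : Fin k → X, (∏ i, w i.succ (v i)) * F (Fin.cons (x t) fun i => x (v i)) := by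
      rw [sum_cons]
      refine Finset.sum_congr rfl fun t _ => ?_
      rw [Finset.mul_sum]
      refine Finset.sum_congr rfl fun v _ => ?_
      rw [Fin.prod_univ_succ]
      simp only [Fin.cons_zero, Fin.cons_succ]
      have : (fun i => x ((Fin.cons t v : Fin (k + 1) → X) i)) = Fin.cons (x t) fun i => x (v i) := by
        ext i; refine Fin.cases ?_ (fun j => ?_) i <;> simp
      rw [this]; ring
    have hint2 := integrable_cons hIntg
    have e2 : ∫ u, (∏ i, D i (u i)) * F u = ∫ y : Fin k → ℝ, (∏ i, D i.succ (y i)) *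
        ∫ s, D 0 s * F (Fin.cons s y) := by
      rw [integral_cons, Measure.volume_eq_prod, integral_prod_symm _ hint2]
      refine integral_congr_ae (ae_of_all _ fun y => ?_)
      simp only [← integral_const_mul]
      refine integral_congr_ae (ae_of_all _ fun s => ?_)
      simp only [Fin.prod_univ_succ, Fin.cons_zero, Fin.cons_succ]; ring
    have hy : ∀ s, Integrable (fun y : Fin k → ℝ => (∏ i, D i.succ (y i)) * F (Fin.cons s y)) :=
      fun s => hyb_int (fun i => hD _) (hF.comp (mcons s)) fun u => hF1 _
    have e3 : ∑ t, w 0 t * I (x t) = ∫ y : Fin k → ℝ, (∏ i, D i.succ (y i)) *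
        ∑ t, w 0 t * F (Fin.cons (x t) y) := by
      simp_rw [hI, ← integral_const_mul]
      rw [← integral_finsetSum _ fun t _ => (hy _).const_mul _]
      refine integral_congr_ae (ae_of_all _ fun y => ?_)
      simp only [Finset.mul_sum]
      exact Finset.sum_congr rfl fun t _ => by ring
    have hp : Integrable (fun y : Fin k → ℝ => ∏ i, D i.succ (y i)) :=
      Integrable.fintype_prod (μ := fun _ : Fin k => (volume : Measure ℝ)) fun i => hD i.succ
    have i1 : Integrable (fun y : Fin k → ℝ => (∏ i, D i.succ (y i)) * ∑ t, w 0 t * F (Fin.cons (x t) y)) := by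
      refine (integrable_finsetSum Finset.univ fun t _ => (hy (x t)).const_mul (w 0 t)).congr (ae_of_all _ fun y => ?_)
      simp only [Finset.mul_sum]
      exact Finset.sum_congr rfl fun t _ => by ring
    have i2 : Integrable (fun y : Fin k → ℝ => (∏ i, D i.succ (y i)) * ∫ s, D 0 s * F (Fin.cons s y)) := by
      rw [Measure.volume_eq_prod] at hint2
      refine hint2.integral_prod_right.congr (ae_of_all _ fun y => ?_)
      simp only [← integral_const_mul]
      refine integral_congr_ae (ae_of_all _ fun s => ?_)
      simp only [Fin.prod_univ_succ, Fin.cons_zero, Fin.cons_succ]; ring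
    have key : ∑ v : Fin (k + 1) → X, (∏ i, w i (v i)) * F (fun i => x (v i)) - ∫ u, (∏ i, D i (u i)) * F u
        = ∑ t, w 0 t * (∑ v : Fin k → X, (∏ i, w i.succ (v i)) * F (Fin.cons (x t) fun i => x (v i)) - I (x t))
        + ∫ y : Fin k → ℝ, (∏ i, D i.succ (y i)) *
          (∑ t, w 0 t * F (Fin.cons (x t) y) - ∫ s, D 0 s * F (Fin.cons s y)) := by
      simp_rw [mul_sub, Finset.sum_sub_distrib]
      rw [integral_sub i1 i2, e1, e2, e3]; ring
    rw [key]
    have b1 : ‖∑ t, w 0 t * (∑ v : Fin k → X, (∏ i, w i.succ (v i)) * F (Fin.cons (x t) fun i => x (v i)) - I (x t))‖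
        ≤ M * (k * E * M ^ (k - 1)) := by
      refine (norm_sum_le _ _).trans ?_
      calc _ ≤ ∑ t, ‖w 0 t‖ * (k * E * M ^ (k - 1)) := by
            refine Finset.sum_le_sum fun t _ => ?_
            rw [norm_mul]; exact mul_le_mul_of_nonneg_left (h1 t) (norm_nonneg _)
        _ = (∑ t, ‖w 0 t‖) * (k * E * M ^ (k - 1)) := by rw [Finset.sum_mul]
        _ ≤ _ := mul_le_mul_of_nonneg_right (hw 0) (by positivity)
    have b2 : ‖∫ y : Fin k → ℝ, (∏ i, D i.succ (y i)) *
          (∑ t, w 0 t * F (Fin.cons (x t) y) - ∫ s, D 0 s * F (Fin.cons s y))‖ ≤ M ^ k * E := by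
      have : ∀ y : Fin k → ℝ, ‖(∏ i, D i.succ (y i)) *
          (∑ t, w 0 t * F (Fin.cons (x t) y) - ∫ s, D 0 s * F (Fin.cons s y))‖
          ≤ (∏ i, ‖D i.succ (y i)‖) * E := by
        intro y
        rw [norm_mul, norm_prod]
        refine mul_le_mul_of_nonneg_left ?_ (Finset.prod_nonneg fun i _ => norm_nonneg _)
        have := hs 0 (Fin.cons 0 y)
        simpa only [Fin.update_cons_zero] using this
      refine (norm_integral_le_of_norm_le ((Integrable.fintype_prod (μ := fun _ : Fin k => (volume : Measure ℝ))
        fun i => (hD i.succ).norm).mul_const E) (ae_of_all _ this)).trans ?_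
      rw [integral_mul_const]
      refine mul_le_mul_of_nonneg_right ?_ hE
      have := integral_fintype_prod_volume_eq_prod (𝕜 := ℝ) (ι := Fin k) (fun i (s : ℝ) => ‖D i.succ s‖)
      refine this.le.trans ?_
      calc _ ≤ ∏ i : Fin k, M := Finset.prod_le_prod (fun i _ => integral_nonneg fun s => norm_nonneg _) fun i _ => hDM _
        _ = M ^ k := by simp
    refine (norm_add_le _ _).trans ((add_le_add b1 b2).trans (le_of_eq ?_))
    rcases k with _ | k
    · simp
    · simp only [Nat.add_sub_cancel]; push_cast; ring

end MA
end


section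
open Complex Set Filter Topology MeasureTheory
open scoped BigOperators

namespace MA

noncomputable def PR {k : ℕ} (Γ : Finset (Fin k → ℕ)) (θ : (Fin k → ℕ) → ℝ) (u : Fin k → ℝ) : ℝ :=
  ∑ γ ∈ Γ, θ γ * ∏ i, (u i) ^ (γ i)

lemma eC_norm (x : ℝ) : ‖eC x‖ = 1 := by
  rw [eC, show 2 * (Real.pi : ℂ) * I * x = ((2 * Real.pi * x : ℝ) : ℂ) * I by push_cast; ring]
  exact Complex.norm_exp_ofReal_mul_I _

lemma eC_cont : Continuous eC := by unfold eC; fun_prop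

lemma eC_add (x y : ℝ) : eC (x + y) = eC x * eC y := by
  unfold eC; rw [← Complex.exp_add]; congr 1; push_cast; ring

lemma eC_deriv {P : ℝ → ℝ} {P' s : ℝ} (h : HasDerivAt P P' s) :
    HasDerivAt (fun s => eC (P s)) (eC (P s) * (2 * Real.pi * I * P')) s := by
  unfold eC
  exact ((h.ofReal_comp).const_mul (2 * (Real.pi : ℂ) * I)).cexp

lemma PR_cont {k : ℕ} (Γ : Finset (Fin k → ℕ)) (θ : (Fin k → ℕ) → ℝ) : Continuous (PR Γ θ) := by
  unfold PR; fun_prop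

noncomputable def FU {k : ℕ} (Γ : Finset (Fin k → ℕ)) (θ : (Fin k → ℕ) → ℝ) (U : Set (Fin k → ℝ))
    (u : Fin k → ℝ) : ℂ := U.indicator (fun u => eC (PR Γ θ u)) u

lemma FU_meas {k : ℕ} (Γ : Finset (Fin k → ℕ)) (θ : (Fin k → ℕ) → ℝ) {U : Set (Fin k → ℝ)}
    (hU : MeasurableSet U) : Measurable (FU Γ θ U) :=
  (eC_cont.comp (PR_cont Γ θ)).measurable.indicator hU

lemma FU_norm {k : ℕ} (Γ : Finset (Fin k → ℕ)) (θ : (Fin k → ℕ) → ℝ) (U : Set (Fin k → ℝ))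
    (u : Fin k → ℝ) : ‖FU Γ θ U u‖ ≤ 1 := by
  unfold FU
  by_cases h : u ∈ U <;> simp [h, eC_norm]

lemma slice {k : ℕ} (Γ : Finset (Fin k → ℕ)) (θ : (Fin k → ℕ) → ℝ) {U : Set (Fin k → ℝ)}
    (hU : Convex ℝ U) {N R : ℝ} (hN : 0 < N) (hR : 0 ≤ R) (hUN : ∀ u ∈ U, ∀ i, |u i| ≤ N)
    (hθ : ∀ γ ∈ Γ, |θ γ| * N ^ (∑ i, γ i) ≤ R)
    {X : Type*} [Fintype X] (x : X → ℝ) (w : X → ℂ) {D : ℝ → ℂ} (hD : Integrable D)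
    (hx : ∀ t, |x t| ≤ N) (hDs : ∀ u, N < |u| → D u = 0) {E0 : ℝ}
    (hL : ∀ L : Set ℝ, IsLowerSet L →
      ‖∑ t, w t * L.indicator (1 : ℝ → ℂ) (x t) - ∫ u, D u * L.indicator (1 : ℝ → ℂ) u‖ ≤ E0)
    (i : Fin k) (u : Fin k → ℝ) :
    ‖∑ t, w t * FU Γ θ U (Function.update u i (x t)) - ∫ s, D s * FU Γ θ U (Function.update u i s)‖
      ≤ 2 * E0 * (1 + 4 * Real.pi * R * ∑ γ ∈ Γ, (γ i : ℝ)) := by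
  have hE0 : 0 ≤ E0 := (norm_nonneg _).trans (hL ∅ (isLowerSet_empty))
  have hS0 : 0 ≤ ∑ γ ∈ Γ, (γ i : ℝ) := Finset.sum_nonneg fun _ _ => Nat.cast_nonneg _
  set J : Set ℝ := {s | Function.update u i s ∈ U} with hJ
  set c : (Fin k → ℕ) → ℝ := fun γ => θ γ * ∏ j ∈ Finset.univ.erase i, u j ^ γ j with hc
  have hPR : ∀ s, PR Γ θ (Function.update u i s) = ∑ γ ∈ Γ, c γ * s ^ γ i := by
    intro s
    unfold PR
    refine Finset.sum_congr rfl fun γ _ => ?_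
    rw [← Finset.mul_prod_erase _ _ (Finset.mem_univ i), Function.update_self, hc]
    simp only
    rw [Finset.prod_congr rfl fun j hj => by rw [Function.update_of_ne (Finset.ne_of_mem_erase hj)]]
    ring
  set h : ℝ → ℂ := fun s => eC (∑ γ ∈ Γ, c γ * s ^ γ i) with hh
  have hFU : ∀ s, FU Γ θ U (Function.update u i s) = J.indicator h s := by
    intro s
    unfold FU
    by_cases hs : s ∈ J
    · rw [Set.indicator_of_mem hs, Set.indicator_of_mem (show Function.update u i s ∈ U from hs), hPR]
    · rw [Set.indicator_of_notMem hs, Set.indicator_of_notMem (show Function.update u i s ∉ U from hs)]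
  simp_rw [hFU]
  rcases Set.eq_empty_or_nonempty J with h0 | ⟨s0, hs0⟩
  · rw [h0]; simp only [Set.indicator_empty, mul_zero, Finset.sum_const_zero, integral_zero, sub_zero, norm_zero]
    have := Real.pi_pos
    positivity
  have hu : ∀ j, j ≠ i → |u j| ≤ N := by
    intro j hj
    have := hUN _ hs0 j
    rwa [Function.update_of_ne hj] at this
  have hJo : J.OrdConnected := by
    refine Convex.ordConnected ?_
    intro a ha b hb p r hp hr hpr
    have := hU ha hb hp hr hpr
    show Function.update u i (p • a + r • b) ∈ U
    convert this using 1
    ext j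
    by_cases hj : j = i
    · subst hj; simp
    · simp only [Function.update_of_ne hj, Pi.add_apply, Pi.smul_apply, smul_eq_mul]
      rw [← add_mul, hpr, one_mul]
  set P' : ℝ → ℝ := fun s => ∑ γ ∈ Γ, c γ * ((γ i : ℝ) * s ^ (γ i - 1)) with hP'
  have hd : ∀ s, HasDerivAt h (h s * (2 * Real.pi * I * P' s)) s := by
    intro s
    refine eC_deriv ?_
    exact HasDerivAt.fun_sum fun γ _ => (hasDerivAt_pow (γ i) s).const_mul (c γ)
  have hcont : Continuous fun s => h s * (2 * Real.pi * I * P' s) := by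
    have : Continuous h := continuous_iff_continuousAt.2 fun s => (hd s).continuousAt
    fun_prop
  have hP'b : ∀ s, |s| ≤ N → |P' s| ≤ R * (∑ γ ∈ Γ, (γ i : ℝ)) / N := by
    intro s hs
    rw [le_div_iff₀ hN, Finset.mul_sum]
    calc |P' s| * N ≤ (∑ γ ∈ Γ, |c γ * ((γ i : ℝ) * s ^ (γ i - 1))|) * N := by
          gcongr; exact Finset.abs_sum_le_sum_abs _ _
      _ = ∑ γ ∈ Γ, |c γ * ((γ i : ℝ) * s ^ (γ i - 1))| * N := Finset.sum_mul _ _ _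
      _ ≤ _ := by
          refine Finset.sum_le_sum fun γ hγ => ?_
          rcases Nat.eq_zero_or_pos (γ i) with h0 | h0
          · rw [h0]; simp
          have hcb : |c γ| ≤ |θ γ| * ∏ j ∈ Finset.univ.erase i, N ^ γ j := by
            rw [hc]; simp only
            rw [abs_mul, Finset.abs_prod]
            gcongr with j hj
            rw [abs_pow]
            exact pow_le_pow_left₀ (abs_nonneg _) (hu j (Finset.ne_of_mem_erase hj)) _
          have e1 : (∏ j ∈ Finset.univ.erase i, N ^ γ j) * N ^ (γ i - 1) * N = N ^ (∑ i, γ i) := by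
            rw [← Finset.add_sum_erase _ _ (Finset.mem_univ i), pow_add, ← Finset.prod_pow_eq_pow_sum]
            rw [mul_assoc, ← pow_succ, Nat.sub_add_cancel h0]; ring
          rw [abs_mul (c γ), abs_mul (γ i : ℝ), abs_pow, Nat.abs_cast]
          calc |c γ| * (γ i * |s| ^ (γ i - 1)) * N
              ≤ (|θ γ| * ∏ j ∈ Finset.univ.erase i, N ^ γ j) * (γ i * N ^ (γ i - 1)) * N := by gcongr
            _ = (|θ γ| * N ^ (∑ i, γ i)) * γ i := by rw [← e1]; ring
            _ ≤ R * γ i := by gcongr; exact hθ γ hγ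
  have := oneD x w hD hN.le hx hDs hL hJo hd hcont (by rw [hh]; exact (eC_norm _).le)
    (K := 2 * Real.pi * (R * (∑ γ ∈ Γ, (γ i : ℝ)) / N)) (fun s hs => by
      rw [norm_mul, norm_mul, norm_mul, norm_mul]
      have : ‖h s‖ = 1 := eC_norm _
      rw [this, one_mul, Complex.norm_real, Complex.norm_real, Complex.norm_I, mul_one, Real.norm_eq_abs, Real.norm_eq_abs,
        abs_of_pos Real.pi_pos, Complex.norm_ofNat]
      exact mul_le_mul_of_nonneg_left (hP'b s hs) (by positivity))
  refine this.trans (le_of_eq ?_)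
  field_simp
  ring

end MA
end


section
open Complex Set Filter Topology MeasureTheory
open scoped BigOperators

namespace MA

lemma half_lower {W : ℕ → ℂ} {D : ℝ → ℂ} {N : ℕ} {E B : ℝ} (hD : Integrable D) (hB : ∀ u, ‖D u‖ ≤ B)
    (h : ∀ n ≤ N, ‖∑ m ∈ Finset.Icc 1 n, W m - ∫ u in Set.Ioc (0 : ℝ) n, D u‖ ≤ E)
    {L : Set ℝ} (hL : IsLowerSet L) :
    ‖∑ m ∈ Finset.Icc 1 N, W m * L.indicator (1 : ℝ → ℂ) m
      - ∫ u in Set.Ioc (0 : ℝ) N, D u * L.indicator (1 : ℝ → ℂ) u‖ ≤ E + B := by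
  classical
  have hLm := hL.ordConnected.measurableSet
  have hDL : Integrable (fun u => D u * L.indicator (1 : ℝ → ℂ) u) := by
    refine hD.mul_bdd (c := 1) ((measurable_const.indicator hLm).aestronglyMeasurable) ?_
    refine ae_of_all _ fun u => ?_
    by_cases hu : u ∈ L <;> simp [hu]
  set n := Nat.findGreatest (fun m : ℕ => (m : ℝ) ∈ L) N with hn
  have hnN : n ≤ N := Nat.findGreatest_le N
  have hn1 : n ≠ 0 → (n : ℝ) ∈ L := fun h0 => Nat.findGreatest_of_ne_zero (P := fun m : ℕ => (m : ℝ) ∈ L) hn.symm h0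
  have hn2 : ∀ m, n < m → m ≤ N → (m : ℝ) ∉ L := fun m h1 h2 => Nat.findGreatest_is_greatest h1 h2
  have e1 : ∑ m ∈ Finset.Icc 1 N, W m * L.indicator (1 : ℝ → ℂ) m = ∑ m ∈ Finset.Icc 1 n, W m := by
    rw [← Finset.sum_subset (Finset.Icc_subset_Icc_right hnN)]
    · refine Finset.sum_congr rfl fun m hm => ?_
      rw [Finset.mem_Icc] at hm
      have : (m : ℝ) ∈ L := hL (show (m : ℝ) ≤ n by exact_mod_cast hm.2) (hn1 (by omega))
      simp [this]
    · intro m hm hm'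
      rw [Finset.mem_Icc] at hm hm'
      have := hn2 m (by omega) hm.2
      simp [this]
  have hnN' : (n : ℝ) ≤ N := by exact_mod_cast hnN
  have e2 : ∫ u in Set.Ioc (0 : ℝ) N, D u * L.indicator (1 : ℝ → ℂ) u
      = (∫ u in Set.Ioc (0 : ℝ) n, D u) + ∫ u in Set.Ioc (n : ℝ) N, D u * L.indicator (1 : ℝ → ℂ) u := by
    rw [← Set.Ioc_union_Ioc_eq_Ioc (Nat.cast_nonneg n) hnN',
      setIntegral_union (Set.Ioc_disjoint_Ioc_of_le le_rfl) measurableSet_Ioc hDL.integrableOn hDL.integrableOn]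
    congr 1
    refine setIntegral_congr_fun measurableSet_Ioc fun u hu => ?_
    have : u ∈ L := hL hu.2 (hn1 (by
      rintro h0; rw [h0] at hu; exact absurd (hu.1.trans_le hu.2) (by simp)))
    simp [this]
  have hB0 : 0 ≤ B := (norm_nonneg _).trans (hB 0)
  have b2 : ‖∫ u in Set.Ioc (n : ℝ) N, D u * L.indicator (1 : ℝ → ℂ) u‖ ≤ B := by
    have : ∫ u in Set.Ioc (n : ℝ) N, D u * L.indicator (1 : ℝ → ℂ) u
        = ∫ u in Set.Ioc (n : ℝ) (n + 1), (Set.Ioc (n : ℝ) N).indicator (fun u => D u * L.indicator (1 : ℝ → ℂ) u) u := by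
      rw [setIntegral_indicator measurableSet_Ioc, ← integral_indicator measurableSet_Ioc,
        ← integral_indicator (measurableSet_Ioc.inter measurableSet_Ioc)]
      refine integral_congr_ae (ae_of_all _ fun u => ?_)
      by_cases h1 : u ∈ Set.Ioc (n : ℝ) N
      · by_cases h2 : u ∈ Set.Ioc (n : ℝ) (n + 1)
        · rw [Set.indicator_of_mem h1, Set.indicator_of_mem (show u ∈ Set.Ioc (n : ℝ) (n + 1) ∩ Set.Ioc (n : ℝ) N from ⟨h2, h1⟩)]
        · rw [Set.indicator_of_mem h1, Set.indicator_of_notMem (show u ∉ Set.Ioc (n : ℝ) (n + 1) ∩ Set.Ioc (n : ℝ) N from fun h => h2 h.1)]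
          have h3 : (n : ℝ) + 1 < u := by
            by_contra h; exact h2 ⟨h1.1, not_lt.1 h⟩
          have : u ∉ L := fun hu => hn2 (n + 1) (by omega) (by
            have : (n : ℝ) + 1 < N := h3.trans_le h1.2
            exact_mod_cast this.le) (hL (by push_cast; exact h3.le) hu)
          simp [this]
      · rw [Set.indicator_of_notMem h1, Set.indicator_of_notMem (show u ∉ Set.Ioc (n : ℝ) (n + 1) ∩ Set.Ioc (n : ℝ) N from fun h => h1 h.2)]
    rw [this]
    have := norm_setIntegral_le_of_norm_le_const (μ := volume) (s := Set.Ioc (n : ℝ) (n + 1)) (C := B)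
      (f := (Set.Ioc (n : ℝ) N).indicator (fun u => D u * L.indicator (1 : ℝ → ℂ) u)) (by simp) (fun u hu => by
        by_cases h1 : u ∈ Set.Ioc (n : ℝ) N <;> by_cases h2 : u ∈ L <;>
        simp only [h1, h2, Set.indicator_of_mem, Set.indicator_of_notMem, not_false_eq_true, Pi.one_apply, mul_one, mul_zero, norm_zero, hB0, hB])
    refine this.trans (le_of_eq ?_)
    simp [Measure.real]
  rw [e1, e2, ← sub_sub]
  exact (norm_sub_le _ _).trans (add_le_add (h n hnN) b2)

lemma sum_sym (N : ℕ) (f : ℤ → ℂ) : ∑ m ∈ Finset.Icc (-(N : ℤ)) N, f m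
    = f 0 + ∑ m ∈ Finset.Icc 1 N, f m + ∑ m ∈ Finset.Icc 1 N, f (-(m : ℤ)) := by
  induction N with
  | zero => simp
  | succ N ih =>
    have : Finset.Icc (-((N + 1 : ℕ) : ℤ)) ((N + 1 : ℕ) : ℤ) =
        insert (-((N + 1 : ℕ) : ℤ)) (insert ((N + 1 : ℕ) : ℤ) (Finset.Icc (-(N : ℤ)) N)) := by
      ext m; simp only [Finset.mem_insert, Finset.mem_Icc]; push_cast; omega
    rw [this, Finset.sum_insert, Finset.sum_insert, ih, Finset.sum_Icc_succ_top (by omega),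
      Finset.sum_Icc_succ_top (by omega)]
    · ring
    · simp
    · simp only [Finset.mem_insert, Finset.mem_Icc]; push_cast; omega

lemma two_sided {W : ℤ → ℂ} {D : ℝ → ℂ} {N : ℕ} {E B : ℝ} (hD : Integrable D) (hB : ∀ u, ‖D u‖ ≤ B)
    (hDs : ∀ u, (N : ℝ) < |u| → D u = 0) (hW0 : ‖W 0‖ ≤ 1)
    (hp : ∀ n ≤ N, ‖∑ m ∈ Finset.Icc 1 n, W m - ∫ u in Set.Ioc (0 : ℝ) n, D u‖ ≤ E)
    (hn : ∀ n ≤ N, ‖∑ m ∈ Finset.Icc 1 n, W (-(m : ℤ)) - ∫ u in Set.Ioc (0 : ℝ) n, D (-u)‖ ≤ E)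
    {L : Set ℝ} (hL : IsLowerSet L) :
    ‖∑ t : ↥(Finset.Icc (-(N : ℤ)) N), W t * L.indicator (1 : ℝ → ℂ) ((t : ℤ) : ℝ)
      - ∫ u, D u * L.indicator (1 : ℝ → ℂ) u‖ ≤ 3 * E + 2 * B + 1 := by
  have hLm := hL.ordConnected.measurableSet
  have hDL : ∀ {D : ℝ → ℂ} {L : Set ℝ}, MeasurableSet L → Integrable D → Integrable (fun u => D u * L.indicator (1 : ℝ → ℂ) u) := by
    intro D L hLm hD
    refine hD.mul_bdd (c := 1) ((measurable_const.indicator hLm).aestronglyMeasurable) ?_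
    refine ae_of_all _ fun u => ?_
    by_cases hu : u ∈ L <;> simp [hu]
  set L' : Set ℝ := {u | -u ∉ L} with hL'
  have hl' : IsLowerSet L' := by
    intro a b hab ha hb
    exact ha (hL (neg_le_neg hab) hb)
  have hind : ∀ u, L.indicator (1 : ℝ → ℂ) (-u) = 1 - L'.indicator 1 u := by
    intro u
    by_cases hu : -u ∈ L
    · have : u ∉ L' := fun h => h hu
      simp [hu, this]
    · have : u ∈ L' := hu
      simp [hu, this]
  have s1 : ∑ t : ↥(Finset.Icc (-(N : ℤ)) N), W t * L.indicator (1 : ℝ → ℂ) ((t : ℤ) : ℝ)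
      = W 0 * L.indicator (1 : ℝ → ℂ) 0 + ∑ m ∈ Finset.Icc 1 N, W m * L.indicator (1 : ℝ → ℂ) m
        + (∑ m ∈ Finset.Icc 1 N, W (-(m : ℤ)) - ∑ m ∈ Finset.Icc 1 N, W (-(m : ℤ)) * L'.indicator (1 : ℝ → ℂ) m) := by
    rw [Finset.sum_coe_sort (Finset.Icc (-(N : ℤ)) N) (fun m : ℤ => W m * L.indicator (1 : ℝ → ℂ) (m : ℝ)), sum_sym]
    push_cast
    simp_rw [hind, mul_sub, mul_one, Finset.sum_sub_distrib]
  have hN0 : (0 : ℝ) ≤ N := Nat.cast_nonneg N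
  have hDn : Integrable fun u => D (-u) := hD.comp_neg
  have s2 : ∫ u, D u * L.indicator (1 : ℝ → ℂ) u
      = (∫ u in Set.Ioc (0 : ℝ) N, D u * L.indicator (1 : ℝ → ℂ) u) +
        ((∫ u in Set.Ioc (0 : ℝ) N, D (-u)) - ∫ u in Set.Ioc (0 : ℝ) N, D (-u) * L'.indicator (1 : ℝ → ℂ) u) := by
    have hI := hDL hLm hD
    have a1 : ∫ u, D u * L.indicator (1 : ℝ → ℂ) u
        = ∫ u in (-(N : ℝ))..N, D u * L.indicator (1 : ℝ → ℂ) u := by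
      rw [intervalIntegral.integral_of_le (by linarith), ← integral_Icc_eq_integral_Ioc]
      refine (setIntegral_eq_integral_of_forall_compl_eq_zero fun u hu => ?_).symm
      have : (N : ℝ) < |u| := by
        by_contra h
        exact hu (abs_le.1 (not_lt.1 h))
      rw [hDs u this, zero_mul]
    have a2 := intervalIntegral.integral_comp_neg (a := 0) (b := (N : ℝ)) (fun u => D u * L.indicator (1 : ℝ → ℂ) u)
    rw [neg_zero] at a2
    rw [a1, ← intervalIntegral.integral_add_adjacent_intervals (b := 0) hI.intervalIntegrable hI.intervalIntegrable,
      ← a2, intervalIntegral.integral_of_le hN0, intervalIntegral.integral_of_le hN0, add_comm]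
    congr 1
    rw [← integral_sub hDn.integrableOn (hDL hl'.ordConnected.measurableSet hDn).integrableOn]
    refine integral_congr_ae (ae_of_all _ fun u => ?_)
    simp only [hind]; ring
  rw [s1, s2]
  have c1 := half_lower hD hB hp hL
  have c2 := half_lower hDn (fun u => hB _) hn hl'
  have c3 := hn N le_rfl
  have c0 : ‖W 0 * L.indicator (1 : ℝ → ℂ) 0‖ ≤ 1 := by
    by_cases h : (0 : ℝ) ∈ L <;> simp [h, hW0]
  have := norm_add_le (W 0 * L.indicator (1 : ℝ → ℂ) 0) ((∑ m ∈ Finset.Icc 1 N, W m * L.indicator (1 : ℝ → ℂ) m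
      - ∫ u in Set.Ioc (0 : ℝ) N, D u * L.indicator (1 : ℝ → ℂ) u) + ((∑ m ∈ Finset.Icc 1 N, W (-(m : ℤ)) - ∫ u in Set.Ioc (0 : ℝ) N, D (-u)) -
      (∑ m ∈ Finset.Icc 1 N, W (-(m : ℤ)) * L'.indicator (1 : ℝ → ℂ) m
      - ∫ u in Set.Ioc (0 : ℝ) N, D (-u) * L'.indicator (1 : ℝ → ℂ) u)))
  have t2 := norm_add_le (∑ m ∈ Finset.Icc 1 N, W m * L.indicator (1 : ℝ → ℂ) m
      - ∫ u in Set.Ioc (0 : ℝ) N, D u * L.indicator (1 : ℝ → ℂ) u) ((∑ m ∈ Finset.Icc 1 N, W (-(m : ℤ)) - ∫ u in Set.Ioc (0 : ℝ) N, D (-u)) -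
      (∑ m ∈ Finset.Icc 1 N, W (-(m : ℤ)) * L'.indicator (1 : ℝ → ℂ) m
      - ∫ u in Set.Ioc (0 : ℝ) N, D (-u) * L'.indicator (1 : ℝ → ℂ) u))
  have t3 := norm_sub_le (∑ m ∈ Finset.Icc 1 N, W (-(m : ℤ)) - ∫ u in Set.Ioc (0 : ℝ) N, D (-u))
      (∑ m ∈ Finset.Icc 1 N, W (-(m : ℤ)) * L'.indicator (1 : ℝ → ℂ) m
      - ∫ u in Set.Ioc (0 : ℝ) N, D (-u) * L'.indicator (1 : ℝ → ℂ) u)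
  refine (le_of_eq ?_).trans (this.trans (by linarith only [c0, c1, c2, c3, t2, t3]))
  congr 1; ring

/-- the exceptional density profile -/
noncomputable def tau (ε : ℂ) (β u : ℝ) : ℂ :=
  (Set.Ici (1 : ℝ)).indicator (fun u => ((u ^ (β - 1) : ℝ) : ℂ)) u
    + ε * (Set.Ici (1 : ℝ)).indicator (fun u => ((u ^ (β - 1) : ℝ) : ℂ)) (-u)

lemma tau_meas (ε : ℂ) (β : ℝ) : Measurable (tau ε β) := by
  have h : Measurable ((Set.Ici (1 : ℝ)).indicator (fun u : ℝ => ((u ^ (β - 1) : ℝ) : ℂ))) :=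
    Measurable.indicator (by fun_prop) measurableSet_Ici
  exact h.add ((h.comp measurable_neg).const_mul ε)

lemma rpow_cut_le {β u : ℝ} (hβ : β < 1) :
    ‖(Set.Ici (1 : ℝ)).indicator (fun u => ((u ^ (β - 1) : ℝ) : ℂ)) u‖
      ≤ (Set.Ici (1 : ℝ)).indicator (fun _ => (1 : ℝ)) u := by
  by_cases h : 1 ≤ u
  · have : u ∈ Set.Ici (1 : ℝ) := h
    rw [Set.indicator_of_mem this, Set.indicator_of_mem this, Complex.norm_real,
      Real.norm_of_nonneg (by positivity)]
    exact Real.rpow_le_one_of_one_le_of_nonpos h (by linarith)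
  · have : u ∉ Set.Ici (1 : ℝ) := h
    rw [Set.indicator_of_notMem this, Set.indicator_of_notMem this, norm_zero]

lemma tau_le {ε : ℂ} (hε : ‖ε‖ ≤ 1) {β : ℝ} (hβ : β < 1) (u : ℝ) : ‖tau ε β u‖ ≤ 1 := by
  unfold tau
  refine (norm_add_le _ _).trans ?_
  rw [norm_mul]
  have h1 := rpow_cut_le (u := u) hβ
  have h2 := rpow_cut_le (u := -u) hβ
  have h3 : (Set.Ici (1 : ℝ)).indicator (fun _ => (1 : ℝ)) u + (Set.Ici (1 : ℝ)).indicator (fun _ => (1 : ℝ)) (-u) ≤ 1 := by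
    by_cases h : 1 ≤ u
    · have h' : ¬ (1 ≤ -u) := by linarith
      simp only [Set.indicator, Set.mem_Ici, h, h', if_true, if_false]; norm_num
    · by_cases h' : 1 ≤ -u <;> simp only [Set.indicator, Set.mem_Ici, h, h', if_true, if_false] <;> norm_num
  have h4 := mul_le_mul hε h2 (norm_nonneg _) zero_le_one
  linarith

lemma tau_neg {ε : ℂ} {β u : ℝ} (hu : 0 < u) : tau ε β (-u) = ε * tau ε β u := by
  unfold tau
  have : -u ∉ Set.Ici (1 : ℝ) := by simp; linarith
  rw [Set.indicator_of_notMem this, neg_neg]; ring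

lemma tau_pos {ε : ℂ} {β u : ℝ} (hu : 0 < u) :
    tau ε β u = (Set.Ici (1 : ℝ)).indicator (fun u => ((u ^ (β - 1) : ℝ) : ℂ)) u := by
  unfold tau
  have : -u ∉ Set.Ici (1 : ℝ) := by simp; linarith
  rw [Set.indicator_of_notMem this]; ring

lemma tau_int {ε : ℂ} {β : ℝ} (hβ : 1 / 2 ≤ β) (n : ℕ) :
    ‖(∫ u in Set.Ioc (0 : ℝ) n, tau ε β u) - (((n : ℝ) ^ β / β : ℝ) : ℂ)‖ ≤ 2 := by
  have e : ∫ u in Set.Ioc (0 : ℝ) n, tau ε β u =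
      ∫ u in Set.Ioc (0 : ℝ) n, (Set.Ici (1 : ℝ)).indicator (fun u => ((u ^ (β - 1) : ℝ) : ℂ)) u :=
    setIntegral_congr_fun measurableSet_Ioc fun u hu => tau_pos hu.1
  rw [e, setIntegral_indicator measurableSet_Ici]
  rcases Nat.eq_zero_or_pos n with rfl | hn
  · simp [Real.zero_rpow (by linarith : β ≠ 0)]
  have hn1 : (1 : ℝ) ≤ n := by exact_mod_cast hn
  have e2 : Set.Ioc (0 : ℝ) n ∩ Set.Ici 1 = Set.Icc 1 (n : ℝ) := by
    ext u; simp only [Set.mem_inter_iff, Set.mem_Ioc, Set.mem_Ici, Set.mem_Icc]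
    constructor
    · rintro ⟨⟨_, b⟩, c⟩; exact ⟨c, b⟩
    · rintro ⟨c, b⟩; exact ⟨⟨by linarith, b⟩, c⟩
  rw [e2, integral_complex_ofReal, integral_Icc_eq_integral_Ioc, ← intervalIntegral.integral_of_le hn1,
    integral_rpow (Or.inl (by linarith)), ← Complex.ofReal_sub, Complex.norm_real]
  rw [sub_add_cancel, Real.one_rpow, sub_div, sub_sub_cancel_left, norm_neg,
    Real.norm_of_nonneg (by positivity), div_le_iff₀ (by linarith)]
  linarith

noncomputable def Den (N : ℕ) (c A B ε : ℂ) (β u : ℝ) : ℂ :=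
  (Set.Icc (-(N : ℝ)) N).indicator (fun u => c * (A - B * tau ε β u)) u

lemma Den_le {N : ℕ} {c A B ε : ℂ} {β : ℝ} (hc : ‖c‖ ≤ 1) (hA : ‖A‖ ≤ 1) (hB : ‖B‖ ≤ 1) (hε : ‖ε‖ ≤ 1)
    (hβ : β < 1) (u : ℝ) : ‖Den N c A B ε β u‖ ≤ 2 := by
  unfold Den
  refine (norm_indicator_le_norm_self _ _).trans ?_
  rw [norm_mul]
  have h1 : ‖A - B * tau ε β u‖ ≤ 2 := by
    refine (norm_sub_le _ _).trans ?_
    rw [norm_mul]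
    have := mul_le_mul hB (tau_le hε hβ u) (norm_nonneg _) zero_le_one
    linarith
  calc _ ≤ 1 * 2 := mul_le_mul hc h1 (norm_nonneg _) zero_le_one
    _ = 2 := by norm_num

lemma Den_meas (N : ℕ) (c A B ε : ℂ) (β : ℝ) : Measurable (Den N c A B ε β) :=
  Measurable.indicator (((measurable_const).sub ((tau_meas ε β).const_mul B)).const_mul c) measurableSet_Icc

lemma Den_supp {N : ℕ} {c A B ε : ℂ} {β : ℝ} (u : ℝ) (hu : (N : ℝ) < |u|) : Den N c A B ε β u = 0 := by
  unfold Den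
  refine Set.indicator_of_notMem (fun h => ?_) _
  exact absurd (abs_le.2 h) (not_le.2 hu)

lemma Den_norm_le {N : ℕ} {c A B ε : ℂ} {β : ℝ} (hc : ‖c‖ ≤ 1) (hA : ‖A‖ ≤ 1) (hB : ‖B‖ ≤ 1) (hε : ‖ε‖ ≤ 1)
    (hβ : β < 1) (u : ℝ) : ‖Den N c A B ε β u‖ ≤ (Set.Icc (-(N : ℝ)) N).indicator (fun _ => (2 : ℝ)) u := by
  by_cases h : u ∈ Set.Icc (-(N : ℝ)) N
  · rw [Set.indicator_of_mem h]; exact Den_le hc hA hB hε hβ u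
  · rw [Set.indicator_of_notMem h, Den, Set.indicator_of_notMem h, norm_zero]

lemma Den_dom (N : ℕ) : Integrable ((Set.Icc (-(N : ℝ)) N).indicator (fun _ => (2 : ℝ))) := by
  rw [integrable_indicator_iff measurableSet_Icc]
  exact integrableOn_const (by simp)

lemma Den_integrable {N : ℕ} {c A B ε : ℂ} {β : ℝ} (hc : ‖c‖ ≤ 1) (hA : ‖A‖ ≤ 1) (hB : ‖B‖ ≤ 1) (hε : ‖ε‖ ≤ 1)
    (hβ : β < 1) : Integrable (Den N c A B ε β) :=
  (Den_dom N).mono' (Den_meas N c A B ε β).aestronglyMeasurable (ae_of_all _ fun u => Den_norm_le hc hA hB hε hβ u)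

lemma Den_mass {N : ℕ} {c A B ε : ℂ} {β : ℝ} (hc : ‖c‖ ≤ 1) (hA : ‖A‖ ≤ 1) (hB : ‖B‖ ≤ 1) (hε : ‖ε‖ ≤ 1)
    (hβ : β < 1) : ∫ u, ‖Den N c A B ε β u‖ ≤ 4 * N := by
  refine (integral_mono (Den_integrable hc hA hB hε hβ).norm (Den_dom N) fun u => Den_norm_le hc hA hB hε hβ u).trans (le_of_eq ?_)
  rw [integral_indicator measurableSet_Icc, setIntegral_const, Measure.real, Real.volume_Icc,
    ENNReal.toReal_ofReal (by have : (0 : ℝ) ≤ N := Nat.cast_nonneg N; linarith), smul_eq_mul]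
  ring

lemma Den_int {N n : ℕ} (hn : n ≤ N) {c A B ε : ℂ} {β : ℝ} (hc : ‖c‖ ≤ 1) (hB : ‖B‖ ≤ 1) (hε : ‖ε‖ ≤ 1)
    (hβ : β < 1) (hβ' : 1 / 2 ≤ β) :
    ‖(∫ u in Set.Ioc (0 : ℝ) n, Den N c A B ε β u) - c * (A * n - B * (((n : ℝ) ^ β / β : ℝ) : ℂ))‖ ≤ 2 := by
  have hn' : (n : ℝ) ≤ N := by exact_mod_cast hn
  have it : IntegrableOn (tau ε β) (Set.Ioc (0 : ℝ) n) := by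
    refine Measure.integrableOn_of_bounded (M := 1) (by simp) (tau_meas ε β).aestronglyMeasurable ?_
    exact ae_of_all _ fun u => tau_le hε hβ u
  have ic : Integrable (fun _ : ℝ => A) (volume.restrict (Set.Ioc (0 : ℝ) n)) :=
    integrableOn_const (by simp) (by simp)
  have e : ∫ u in Set.Ioc (0 : ℝ) n, Den N c A B ε β u = c * (A * n - B * ∫ u in Set.Ioc (0 : ℝ) n, tau ε β u) := by
    rw [← integral_const_mul, show A * n = ∫ u in Set.Ioc (0 : ℝ) n, A by
      rw [setIntegral_const, Measure.real, Real.volume_Ioc, sub_zero, ENNReal.toReal_ofReal (by positivity), Complex.real_smul]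
      push_cast; ring, ← integral_sub ic (it.const_mul B), ← integral_const_mul]
    refine setIntegral_congr_fun measurableSet_Ioc fun u hu => ?_
    unfold Den
    rw [Set.indicator_of_mem]
    exact ⟨by linarith [hu.1], hu.2.trans hn'⟩
  rw [e, ← mul_sub, sub_sub_sub_cancel_left, ← mul_sub, norm_mul, norm_mul, norm_sub_rev]
  have := tau_int (ε := ε) hβ' n
  calc ‖c‖ * (‖B‖ * ‖(∫ u in Set.Ioc (0 : ℝ) n, tau ε β u) - (((n : ℝ) ^ β / β : ℝ) : ℂ)‖) ≤ 1 * (1 * 2) := by gcongr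
    _ = 2 := by norm_num

lemma Den_neg {N : ℕ} {c A B ε : ℂ} {β u : ℝ} (hu : 0 < u) :
    Den N c A B ε β (-u) = Den N c A (B * ε) ε β u := by
  unfold Den
  have : -u ∈ Set.Icc (-(N : ℝ)) N ↔ u ∈ Set.Icc (-(N : ℝ)) N := by
    simp only [Set.mem_Icc]; constructor <;> rintro ⟨a, b⟩ <;> constructor <;> linarith
  by_cases h : u ∈ Set.Icc (-(N : ℝ)) N
  · rw [Set.indicator_of_mem h, Set.indicator_of_mem (this.2 h), tau_neg hu, mul_assoc]
  · rw [Set.indicator_of_notMem h, Set.indicator_of_notMem (fun h' => h (this.1 h'))]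

lemma lower_den {W : ℤ → ℂ} {N : ℕ} {E : ℝ} {c A B ε : ℂ} {β : ℝ} (hc : ‖c‖ ≤ 1) (hA : ‖A‖ ≤ 1) (hB : ‖B‖ ≤ 1)
    (hε : ‖ε‖ ≤ 1) (hβ : β < 1) (hβ' : 1 / 2 ≤ β) (hW0 : ‖W 0‖ ≤ 1)
    (hp : ∀ n ≤ N, ‖∑ m ∈ Finset.Icc 1 n, W m - c * (A * n - B * (((n : ℝ) ^ β / β : ℝ) : ℂ))‖ ≤ E)
    (hn : ∀ n ≤ N, ‖∑ m ∈ Finset.Icc 1 n, W (-(m : ℤ)) - c * (A * n - B * ε * (((n : ℝ) ^ β / β : ℝ) : ℂ))‖ ≤ E)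
    {L : Set ℝ} (hL : IsLowerSet L) :
    ‖∑ t : ↥(Finset.Icc (-(N : ℤ)) N), W t * L.indicator (1 : ℝ → ℂ) ((t : ℤ) : ℝ)
      - ∫ u, Den N c A B ε β u * L.indicator (1 : ℝ → ℂ) u‖ ≤ 3 * E + 11 := by
  have hBε : ‖B * ε‖ ≤ 1 := by
    rw [norm_mul]; exact mul_le_one₀ hB (norm_nonneg _) hε
  refine (two_sided (E := E + 2) (Den_integrable hc hA hB hε hβ) (Den_le hc hA hB hε hβ)
    (fun u => Den_supp u) hW0 (fun n h => ?_) (fun n h => ?_) hL).trans (by linarith)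
  · have h1 := hp n h
    have h2 := Den_int h (A := A) hc hB hε hβ hβ'
    rw [norm_sub_rev] at h2
    calc _ = ‖(∑ m ∈ Finset.Icc 1 n, W m - c * (A * n - B * (((n : ℝ) ^ β / β : ℝ) : ℂ))) +
        (c * (A * n - B * (((n : ℝ) ^ β / β : ℝ) : ℂ)) - ∫ u in Set.Ioc (0 : ℝ) n, Den N c A B ε β u)‖ := by congr 1; ring
      _ ≤ _ := (norm_add_le _ _).trans (add_le_add h1 h2)
  · have h1 := hn n h
    have h2 := Den_int h (A := A) hc hBε hε hβ hβ'
    rw [norm_sub_rev] at h2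
    rw [setIntegral_congr_fun measurableSet_Ioc fun u hu => Den_neg hu.1]
    calc _ = ‖(∑ m ∈ Finset.Icc 1 n, W (-(m : ℤ)) - c * (A * n - B * ε * (((n : ℝ) ^ β / β : ℝ) : ℂ))) +
        (c * (A * n - B * ε * (((n : ℝ) ^ β / β : ℝ) : ℂ)) - ∫ u in Set.Ioc (0 : ℝ) n, Den N c A (B * ε) ε β u)‖ := by congr 1; ring
      _ ≤ _ := (norm_add_le _ _).trans (add_le_add h1 h2)

end MA
end


section
open Complex Set Filter Topology MeasureTheory
open scoped BigOperators

namespace MA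

open Classical in
noncomputable def intW (q : ℕ) (b : ZMod q) (m : ℤ) : ℂ := if (m : ZMod q) = b then 1 else 0

open Classical in
noncomputable def prW (q : ℕ) (b : ZMod q) (m : ℤ) : ℂ :=
  if Prime m ∧ (m : ZMod q) = b then ((Real.log |(m : ℝ)| : ℝ) : ℂ) else 0

/-- the prime number theorem in progressions, as a hypothesis -/
def PA (N q : ℕ) (χ : DirichletCharacter ℂ q) (β : ℝ) (κ : ℕ) (E : ℝ) : Prop :=
  ∀ b : ZMod q, IsUnit b → ∀ n : ℕ, n ≤ N →
    |∑ p ∈ Finset.Icc 1 n with (Nat.Prime p ∧ ((p : ℕ) : ZMod q) = b), Real.log p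
      - (n - κ * (χ b).re * ((n : ℝ) ^ β / β)) / q.totient| ≤ E

lemma intW_count {q : ℕ} [NeZero q] (b : ZMod q) (n : ℕ) :
    ‖∑ m ∈ Finset.Icc 1 n, intW q b (m : ℤ) - (1 / q : ℂ) * n‖ ≤ 1 := by
  classical
  have hq : 0 < q := NeZero.pos q
  have e1 : ∑ m ∈ Finset.Icc 1 n, intW q b (m : ℤ) =
      (((Finset.Ioc (0 : ℤ) n).filter fun x => x ≡ (b.val : ℤ) [ZMOD (q : ℤ)]).card : ℂ) := by
    rw [Finset.card_filter]
    push_cast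
    refine Finset.sum_bij (fun m _ => (m : ℤ)) (fun m hm => ?_) (fun a _ b _ h => by exact_mod_cast h) (fun m hm => ?_) (fun m hm => ?_)
    · rw [Finset.mem_Icc] at hm; rw [Finset.mem_Ioc]; omega
    · rw [Finset.mem_Ioc] at hm
      exact ⟨m.toNat, by rw [Finset.mem_Icc]; omega, by omega⟩
    · unfold intW
      have : ((m : ℤ) : ZMod q) = b ↔ (m : ℤ) ≡ (b.val : ℤ) [ZMOD (q : ℤ)] := by
        rw [← ZMod.intCast_eq_intCast_iff]
        simp
      by_cases h : (m : ℤ) ≡ (b.val : ℤ) [ZMOD (q : ℤ)]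
      · rw [if_pos (this.2 h), if_pos h]
      · rw [if_neg (fun h' => h (this.1 h')), if_neg h]
  have e2 := Int.Ioc_filter_modEq_card (0 : ℤ) n (r := (q : ℤ)) (by exact_mod_cast hq) (b.val : ℤ)
  rw [e1, show (1 / q : ℂ) * n = ((n / q : ℝ) : ℂ) by push_cast; ring]
  rw [show (((Finset.Ioc (0 : ℤ) n).filter fun x => x ≡ (b.val : ℤ) [ZMOD (q : ℤ)]).card : ℂ) =
    (((((Finset.Ioc (0 : ℤ) n).filter fun x => x ≡ (b.val : ℤ) [ZMOD (q : ℤ)]).card : ℤ) : ℝ) : ℂ) by push_cast; rfl]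
  rw [← Complex.ofReal_sub, Complex.norm_real, Real.norm_eq_abs, e2]
  have hx : ∀ x y : ℚ, x - y = (n : ℚ) / q → |(((max (⌊x⌋ - ⌊y⌋) 0 : ℤ)) : ℝ) - (n : ℝ) / q| ≤ 1 := by
    intro x y hxy
    have h0 : (0 : ℚ) ≤ (n : ℚ) / q := by positivity
    have hyx : ⌊y⌋ ≤ ⌊x⌋ := Int.floor_le_floor (by linarith)
    rw [max_eq_left (by omega)]
    have : |(((⌊x⌋ - ⌊y⌋ : ℤ)) : ℚ) - (n : ℚ) / q| ≤ 1 := by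
      have h1 := Int.floor_le x
      have h2 := Int.lt_floor_add_one x
      have h3 := Int.floor_le y
      have h4 := Int.lt_floor_add_one y
      rw [abs_le]; push_cast
      constructor <;> linarith
    have h' := (Rat.cast_le (K := ℝ)).2 this
    push_cast at h' ⊢
    exact h'
  refine hx _ _ ?_
  have : (q : ℚ) ≠ 0 := by exact_mod_cast hq.ne'
  push_cast
  field_simp
  ring

lemma prW_neg (q : ℕ) (b : ZMod q) (m : ℤ) : prW q b (-m) = prW q (-b) m := by
  classical
  unfold prW
  have : (Prime (-m) ∧ ((-m : ℤ) : ZMod q) = b) ↔ (Prime m ∧ (m : ZMod q) = -b) := by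
    have hp : Prime (-m) ↔ Prime m := ⟨fun h => by simpa using h.neg, fun h => h.neg⟩
    rw [hp]; push_cast
    rw [neg_eq_iff_eq_neg]
  by_cases h : Prime m ∧ (m : ZMod q) = -b
  · rw [if_pos h, if_pos (this.2 h)]; push_cast; rw [abs_neg]
  · rw [if_neg h, if_neg (fun h' => h (this.1 h'))]

lemma prW_sum (q : ℕ) (b : ZMod q) (n : ℕ) : ∑ m ∈ Finset.Icc 1 n, prW q b (m : ℤ) =
    ((∑ p ∈ Finset.Icc 1 n with (Nat.Prime p ∧ ((p : ℕ) : ZMod q) = b), Real.log p : ℝ) : ℂ) := by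
  classical
  rw [Finset.sum_filter]
  push_cast
  refine Finset.sum_congr rfl fun m _ => ?_
  unfold prW
  have : (Prime (m : ℤ) ∧ ((m : ℤ) : ZMod q) = b) ↔ (Nat.Prime m ∧ ((m : ℕ) : ZMod q) = b) := by
    rw [Nat.prime_iff_prime_int]; simp
  by_cases h : Nat.Prime m ∧ ((m : ℕ) : ZMod q) = b
  · rw [if_pos h, if_pos (this.2 h)]; simp
  · rw [if_neg h, if_neg (fun h' => h (this.1 h'))]; simp

lemma prW_unit {N q : ℕ} [NeZero q] {χ : DirichletCharacter ℂ q} {β : ℝ} {κ : ℕ} {E : ℝ}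
    (hκ : κ = 0 ∨ κ = 1 ∧ χ ^ 2 = 1) (h : PA N q χ β κ E) {b : ZMod q} (hb : IsUnit b) {n : ℕ} (hn : n ≤ N) :
    ‖∑ m ∈ Finset.Icc 1 n, prW q b (m : ℤ) -
      (1 / q.totient : ℂ) * ((1 : DirichletCharacter ℂ q) b * n - κ * χ b * (((n : ℝ) ^ β / β : ℝ) : ℂ))‖ ≤ E := by
  have h1 := h b hb n hn
  have hre : (κ : ℂ) * χ b = ((κ * (χ b).re : ℝ) : ℂ) := by
    rcases hκ with h0 | ⟨-, h2⟩
    · simp [h0]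
    · have : (χ b) ^ 2 = 1 := by
        have := congrArg (fun f : DirichletCharacter ℂ q => f b) h2
        simp only [MulChar.pow_apply' _ two_ne_zero, MulChar.one_apply hb] at this
        exact this
      rcases sq_eq_one_iff.1 this with h3 | h3 <;> simp [h3]
  rw [prW_sum, MulChar.one_apply hb, hre]
  rw [← Real.norm_eq_abs, ← Complex.norm_real] at h1
  refine (le_of_eq ?_).trans h1
  congr 1
  push_cast
  ring

lemma prW_nonunit {q : ℕ} [NeZero q] {b : ZMod q} (hb : ¬ IsUnit b) (n : ℕ) :
    ‖∑ m ∈ Finset.Icc 1 n, prW q b (m : ℤ)‖ ≤ (q : ℝ) ^ 2 := by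
  classical
  rw [prW_sum, Complex.norm_real]
  refine (norm_sum_le _ _).trans ?_
  have hsub : ((Finset.Icc 1 n).filter fun p => Nat.Prime p ∧ ((p : ℕ) : ZMod q) = b) ⊆ Finset.Icc 1 q := by
    intro p hp
    rw [Finset.mem_filter] at hp
    obtain ⟨-, hp1, hp2⟩ := hp
    rw [Finset.mem_Icc]
    refine ⟨hp1.one_lt.le, Nat.le_of_dvd (NeZero.pos q) ?_⟩
    by_contra hd
    exact hb (hp2 ▸ (ZMod.isUnit_iff_coprime p q).2 ((Nat.Prime.coprime_iff_not_dvd hp1).2 hd))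
  calc _ ≤ ∑ p ∈ Finset.Icc 1 q, ‖Real.log (p : ℝ)‖ := Finset.sum_le_sum_of_subset_of_nonneg hsub fun _ _ _ => norm_nonneg _
    _ ≤ ∑ p ∈ Finset.Icc 1 q, (q : ℝ) := by
        refine Finset.sum_le_sum fun p hp => ?_
        rw [Finset.mem_Icc] at hp
        have hp1 : (1 : ℝ) ≤ p := by exact_mod_cast hp.1
        rw [Real.norm_of_nonneg (Real.log_nonneg hp1)]
        have := Real.log_le_sub_one_of_pos (by linarith : (0 : ℝ) < p)
        have : (p : ℝ) ≤ q := by exact_mod_cast hp.2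
        linarith
    _ = (q : ℝ) ^ 2 := by rw [Finset.sum_const, Nat.card_Icc, Nat.add_sub_cancel, nsmul_eq_mul]; ring

section
variable {k : ℕ} (k' : ℕ)

noncomputable def wq (q : ℕ) (i : Fin k) (b : ZMod q) (m : ℤ) : ℂ :=
  if k' ≤ (i : ℕ) then prW q b m else intW q b m

noncomputable def cc (q : ℕ) (i : Fin k) : ℂ := if k' ≤ (i : ℕ) then 1 / q.totient else 1 / q

noncomputable def psi (q : ℕ) (i : Fin k) : ZMod q →* ℂ :=
  if k' ≤ (i : ℕ) then (1 : DirichletCharacter ℂ q).toMonoidHom else 1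

noncomputable def kap (κ : ℕ) (i : Fin k) : ℂ := if k' ≤ (i : ℕ) then κ else 0

noncomputable def DD (N q : ℕ) (χ : DirichletCharacter ℂ q) (β : ℝ) (κ : ℕ) (i : Fin k) (b : ZMod q) : ℝ → ℂ :=
  Den N (cc k' q i) (psi k' q i b) (kap k' κ i * χ b) (χ (-1)) β

lemma cc_le {q : ℕ} [NeZero q] (i : Fin k) : ‖cc k' q i‖ ≤ 1 := by
  unfold cc
  split_ifs
  · rw [norm_div, norm_one, Complex.norm_natCast]
    refine div_le_one_of_le₀ ?_ (Nat.cast_nonneg _)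
    exact_mod_cast Nat.totient_pos.2 (NeZero.pos q)
  · rw [norm_div, norm_one, Complex.norm_natCast]
    refine div_le_one_of_le₀ ?_ (Nat.cast_nonneg _)
    exact_mod_cast NeZero.pos q

lemma psi_le {q : ℕ} (i : Fin k) (b : ZMod q) : ‖psi k' q i b‖ ≤ 1 := by
  unfold psi
  split_ifs
  · exact DirichletCharacter.norm_le_one _ _
  · simp

lemma kap_le {κ : ℕ} (hκ : κ ≤ 1) (i : Fin k) : ‖kap k' κ i‖ ≤ κ := by
  unfold kap
  split_ifs <;> simp

lemma kapchi_le {q : ℕ} {κ : ℕ} (hκ : κ ≤ 1) (χ : DirichletCharacter ℂ q) (i : Fin k) (b : ZMod q) :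
    ‖kap k' κ i * χ b‖ ≤ 1 := by
  rw [norm_mul]
  have h1 := kap_le k' hκ i
  have h2 : (κ : ℝ) ≤ 1 := by exact_mod_cast hκ
  exact mul_le_one₀ (h1.trans h2) (norm_nonneg _) (DirichletCharacter.norm_le_one _ _)

lemma lower_wq {N q : ℕ} [NeZero q] {χ : DirichletCharacter ℂ q} {β : ℝ} {κ : ℕ} {E : ℝ} (hE : 0 ≤ E)
    (hκ : κ = 0 ∨ κ = 1 ∧ χ ^ 2 = 1) (hβ : β < 1) (hβ' : 1 / 2 ≤ β) (h : PA N q χ β κ E)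
    (i : Fin k) (b : ZMod q) {L : Set ℝ} (hL : IsLowerSet L) :
    ‖∑ t : ↥(Finset.Icc (-(N : ℤ)) N), wq k' q i b t * L.indicator (1 : ℝ → ℂ) ((t : ℤ) : ℝ)
      - ∫ u, DD k' N q χ β κ i b u * L.indicator (1 : ℝ → ℂ) u‖ ≤ 3 * (E + (q : ℝ) ^ 2) + 11 := by
  have hκ1 : κ ≤ 1 := by omega
  have hq1 : (1 : ℝ) ≤ (q : ℝ) ^ 2 := by
    have : (1 : ℝ) ≤ q := by exact_mod_cast NeZero.pos q
    nlinarith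
  refine lower_den (cc_le k' i) (psi_le k' i b) (kapchi_le k' hκ1 χ i b) (DirichletCharacter.norm_le_one _ _) hβ hβ'
    ?_ ?_ ?_ hL
  · unfold wq prW intW
    split_ifs <;> simp
  · intro n hn
    unfold wq cc psi kap
    split_ifs with hi
    · by_cases hb : IsUnit b
      · exact (prW_unit hκ h hb hn).trans (by linarith)
      · have := prW_nonunit hb n
        have h1 : (1 : DirichletCharacter ℂ q).toMonoidHom b = 0 := MulChar.map_nonunit _ hb
        rw [h1, MulChar.map_nonunit _ hb]
        simp only [mul_zero, zero_mul, sub_zero]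
        linarith
    · have := intW_count b n
      simp only [MonoidHom.one_apply, one_mul, zero_mul, sub_zero]
      linarith
  · intro n hn
    have e : ∀ m : ℕ, wq k' q i b (-(m : ℤ)) = wq k' q i (-b) m := by
      intro m
      unfold wq
      split_ifs
      · exact prW_neg q b m
      · classical
        unfold intW
        have : ((-(m : ℤ) : ℤ) : ZMod q) = b ↔ ((m : ℤ) : ZMod q) = -b := by
          push_cast; exact neg_eq_iff_eq_neg
        by_cases h : ((m : ℤ) : ZMod q) = -b
        · rw [if_pos h, if_pos (this.2 h)]
        · rw [if_neg h, if_neg (fun h' => h (this.1 h'))]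
    simp_rw [e]
    unfold wq cc psi kap
    split_ifs with hi
    · by_cases hb : IsUnit b
      · have h1 := prW_unit hκ h hb.neg hn
        rw [mul_assoc (κ : ℂ), ← map_mul, mul_neg_one]
        have h2 : (1 : DirichletCharacter ℂ q).toMonoidHom b = (1 : DirichletCharacter ℂ q) (-b) := by
          rw [MulChar.one_apply hb.neg]; exact MulChar.one_apply hb
        rw [h2]
        exact h1.trans (by linarith)
      · have := prW_nonunit (q := q) (b := -b) (fun h => hb (by simpa using h.neg)) n
        have h1 : (1 : DirichletCharacter ℂ q).toMonoidHom b = 0 := MulChar.map_nonunit _ hb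
        rw [h1, MulChar.map_nonunit _ hb]
        simp only [mul_zero, zero_mul, sub_zero]
        linarith
    · have := intW_count (-b) n
      simp only [MonoidHom.one_apply, one_mul, zero_mul, sub_zero]
      linarith

lemma DD_integrable {N q : ℕ} [NeZero q] {χ : DirichletCharacter ℂ q} {β : ℝ} {κ : ℕ} (hκ : κ ≤ 1)
    (hβ : β < 1) (i : Fin k) (b : ZMod q) : Integrable (DD k' N q χ β κ i b) :=
  Den_integrable (cc_le k' i) (psi_le k' i b) (kapchi_le k' hκ χ i b) (DirichletCharacter.norm_le_one _ _) hβ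

lemma DD_mass {N q : ℕ} [NeZero q] {χ : DirichletCharacter ℂ q} {β : ℝ} {κ : ℕ} (hκ : κ ≤ 1)
    (hβ : β < 1) (i : Fin k) (b : ZMod q) : ∫ u, ‖DD k' N q χ β κ i b u‖ ≤ 4 * N :=
  Den_mass (cc_le k' i) (psi_le k' i b) (kapchi_le k' hκ χ i b) (DirichletCharacter.norm_le_one _ _) hβ

lemma wq_nonneg {q : ℕ} (i : Fin k) (b : ZMod q) (m : ℤ) : (‖wq k' q i b m‖ : ℂ) = wq k' q i b m := by
  unfold wq prW intW
  split_ifs with h1 h2 h3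
  · rw [Complex.norm_real, Real.norm_of_nonneg]
    refine Real.log_nonneg ?_
    have : (1 : ℤ) ≤ |m| := Int.one_le_abs h2.1.ne_zero
    exact_mod_cast this
  all_goals simp

lemma wq_mass {N q : ℕ} [NeZero q] {χ : DirichletCharacter ℂ q} {β : ℝ} {κ : ℕ} {E : ℝ} (hE : 0 ≤ E)
    (hκ : κ = 0 ∨ κ = 1 ∧ χ ^ 2 = 1) (hβ : β < 1) (hβ' : 1 / 2 ≤ β) (h : PA N q χ β κ E)
    (i : Fin k) (b : ZMod q) :
    ∑ t : ↥(Finset.Icc (-(N : ℤ)) N), ‖wq k' q i b t‖ ≤ 4 * N + (3 * (E + (q : ℝ) ^ 2) + 11) := by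
  have hκ1 : κ ≤ 1 := by omega
  have h1 := lower_wq k' hE hκ hβ hβ' h i b isLowerSet_univ
  simp only [Set.indicator_univ, Pi.one_apply, mul_one] at h1
  have h2 : ‖∫ u, DD k' N q χ β κ i b u‖ ≤ 4 * N := (norm_integral_le_integral_norm _).trans (DD_mass k' hκ1 hβ i b)
  have h3 : ∑ t : ↥(Finset.Icc (-(N : ℤ)) N), wq k' q i b t = ((∑ t : ↥(Finset.Icc (-(N : ℤ)) N), ‖wq k' q i b t‖ : ℝ) : ℂ) := by
    push_cast; exact Finset.sum_congr rfl fun t _ => (wq_nonneg k' i b t).symm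
  have h4 : ‖∑ t : ↥(Finset.Icc (-(N : ℤ)) N), wq k' q i b t‖ = ∑ t : ↥(Finset.Icc (-(N : ℤ)) N), ‖wq k' q i b t‖ := by
    rw [h3, Complex.norm_real, Real.norm_of_nonneg (Finset.sum_nonneg fun _ _ => norm_nonneg _)]
  rw [← h4]
  have := norm_sub_norm_le (∑ t : ↥(Finset.Icc (-(N : ℤ)) N), wq k' q i b t) (∫ u, DD k' N q χ β κ i b u)
  linarith

lemma residue (Γ : Finset (Fin k → ℕ)) (θ : (Fin k → ℕ) → ℝ) {U : Set (Fin k → ℝ)}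
    (hU : Convex ℝ U) (hUm : MeasurableSet U) {N : ℕ} {R : ℝ} (hN : 0 < N) (hR : 0 ≤ R)
    (hUN : ∀ u ∈ U, ∀ i, |u i| ≤ N) (hθ : ∀ γ ∈ Γ, |θ γ| * (N : ℝ) ^ (∑ i, γ i) ≤ R)
    {q : ℕ} [NeZero q] {χ : DirichletCharacter ℂ q} {β : ℝ} {κ : ℕ} {E : ℝ} (hE : 0 ≤ E)
    (hκ : κ = 0 ∨ κ = 1 ∧ χ ^ 2 = 1) (hβ : β < 1) (hβ' : 1 / 2 ≤ β) (h : PA N q χ β κ E)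
    (b : Fin k → ZMod q) :
    ‖∑ v : Fin k → ↥(Finset.Icc (-(N : ℤ)) N), (∏ i, wq k' q i (b i) (v i)) * FU Γ θ U (fun i => ((v i : ℤ) : ℝ))
      - ∫ u, (∏ i, DD k' N q χ β κ i (b i) (u i)) * FU Γ θ U u‖
    ≤ k * (2 * (3 * (E + (q : ℝ) ^ 2) + 11) * (1 + 4 * Real.pi * R * ∑ γ ∈ Γ, ∑ i, (γ i : ℝ)))
      * (4 * N + (3 * (E + (q : ℝ) ^ 2) + 11)) ^ (k - 1) := by
  have hκ1 : κ ≤ 1 := by omega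
  have hpi := Real.pi_pos
  have hS0 : 0 ≤ ∑ γ ∈ Γ, ∑ i, (γ i : ℝ) := Finset.sum_nonneg fun _ _ => Finset.sum_nonneg fun _ _ => Nat.cast_nonneg _
  refine hybrid (fun t : ↥(Finset.Icc (-(N : ℤ)) N) => ((t : ℤ) : ℝ)) (by positivity) (by positivity) k
    (fun i t => wq k' q i (b i) t) (fun i => DD k' N q χ β κ i (b i)) (fun i => DD_integrable k' hκ1 hβ i (b i))
    (fun i => wq_mass k' hE hκ hβ hβ' h i (b i)) (fun i => (DD_mass k' hκ1 hβ i (b i)).trans (le_add_of_nonneg_right (by positivity)))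
    (FU Γ θ U) (FU_meas Γ θ hUm) (FU_norm Γ θ U) (fun i u => ?_)
  refine (slice Γ θ hU (N := N) (by exact_mod_cast hN) hR hUN hθ (fun t : ↥(Finset.Icc (-(N : ℤ)) N) => ((t : ℤ) : ℝ))
    (fun t => wq k' q i (b i) t) (DD_integrable k' hκ1 hβ i (b i)) (fun t => ?_) (fun u hu => Den_supp u hu)
    (fun L hL => lower_wq k' hE hκ hβ hβ' h i (b i) hL) i u).trans ?_
  · have := t.2
    rw [Finset.mem_Icc] at this
    have : |(t : ℤ)| ≤ N := abs_le.2 this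
    exact_mod_cast this
  · gcongr with γ hγ
    exact Finset.single_le_sum (f := fun i => (γ i : ℝ)) (fun _ _ => Nat.cast_nonneg _) (Finset.mem_univ i)

end

end MA
end


section
open Complex Set Filter Topology MeasureTheory
open scoped BigOperators

namespace MA

section
variable {k : ℕ} (k' : ℕ)

open Classical in
noncomputable def w0 (i : Fin k) (m : ℤ) : ℂ :=
  if k' ≤ (i : ℕ) then (if Prime m then ((Real.log |(m : ℝ)| : ℝ) : ℂ) else 0) else 1

noncomputable def aQ {q : ℕ} (Γ : Finset (Fin k → ℕ)) (a : (Fin k → ℕ) → ℕ) (b : Fin k → ZMod q) : ZMod q :=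
  ∑ γ ∈ Γ, (a γ : ZMod q) * ∏ i, b i ^ γ i

lemma wq_w0 {q : ℕ} (i : Fin k) (m : ℤ) : wq k' q i (m : ZMod q) m = w0 k' i m := by
  classical
  unfold wq w0 prW intW
  split_ifs <;> simp_all

lemma wq_ne {q : ℕ} (i : Fin k) (m : ℤ) {b : ZMod q} (h : b ≠ m) : wq k' q i b m = 0 := by
  classical
  unfold wq prW intW
  split_ifs with h1 h2 h3
  · exact absurd h2.2.symm h
  · rfl
  · exact absurd h3.symm h
  · rfl

lemma sum_res {q : ℕ} [NeZero q] (Γ : Finset (Fin k → ℕ)) (a : (Fin k → ℕ) → ℕ) (v : Fin k → ℤ) :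
    ∑ b : Fin k → ZMod q, ps (aQ Γ a b) * ∏ i, wq k' q i (b i) (v i)
      = ps (aQ (q := q) Γ a (fun i => (v i : ZMod q))) * ∏ i, w0 k' i (v i) := by
  rw [Finset.sum_eq_single (fun i => (v i : ZMod q))]
  · simp_rw [wq_w0]
  · intro b _ hb
    obtain ⟨i, hi⟩ := Function.ne_iff.1 hb
    rw [Finset.prod_eq_zero (Finset.mem_univ i) (wq_ne k' i (v i) hi), mul_zero]
  · simp

lemma ps_eC {q : ℕ} [NeZero q] (Γ : Finset (Fin k → ℕ)) (a : (Fin k → ℕ) → ℕ) (v : Fin k → ℤ) :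
    ps (aQ (q := q) Γ a (fun i => (v i : ZMod q))) = eC (PR Γ (fun γ => (a γ : ℝ) / q) (fun i => (v i : ℝ))) := by
  have : aQ (q := q) Γ a (fun i => (v i : ZMod q)) = ((∑ γ ∈ Γ, (a γ : ℤ) * ∏ i, v i ^ γ i : ℤ) : ZMod q) := by
    unfold aQ; push_cast; rfl
  rw [this]
  unfold ps
  rw [ZMod.stdAddChar_coe, eC, PR]
  congr 1
  push_cast
  rw [Finset.mul_sum, Finset.mul_sum, Finset.sum_div]
  refine Finset.sum_congr rfl fun γ _ => ?_
  ring

lemma FU_split {q : ℕ} [NeZero q] (Γ : Finset (Fin k → ℕ)) (a : (Fin k → ℕ) → ℕ) (ξ : (Fin k → ℕ) → ℝ)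
    (U : Set (Fin k → ℝ)) (v : Fin k → ℤ) :
    FU Γ ξ U (fun i => (v i : ℝ)) = ps (aQ (q := q) Γ a (fun i => (v i : ZMod q))) *
      FU Γ (fun γ => ξ γ - (a γ : ℝ) / q) U (fun i => (v i : ℝ)) := by
  unfold FU
  by_cases h : (fun i => (v i : ℝ)) ∈ U
  · rw [Set.indicator_of_mem h, Set.indicator_of_mem h, ps_eC, ← eC_add]
    congr 1
    unfold PR
    rw [← Finset.sum_add_distrib]
    exact Finset.sum_congr rfl fun γ _ => by ring
  · rw [Set.indicator_of_notMem h, Set.indicator_of_notMem h, mul_zero]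

lemma S_eq {q N : ℕ} [NeZero q] (Γ : Finset (Fin k → ℕ)) (a : (Fin k → ℕ) → ℕ) (ξ : (Fin k → ℕ) → ℝ)
    (U : Set (Fin k → ℝ)) :
    ∑ v : Fin k → ↥(Finset.Icc (-(N : ℤ)) N), (∏ i, w0 k' i (v i)) * FU Γ ξ U (fun i => ((v i : ℤ) : ℝ)) =
    ∑ b : Fin k → ZMod q, ps (aQ Γ a b) * ∑ v : Fin k → ↥(Finset.Icc (-(N : ℤ)) N),
      (∏ i, wq k' q i (b i) (v i)) * FU Γ (fun γ => ξ γ - (a γ : ℝ) / q) U (fun i => ((v i : ℤ) : ℝ)) := by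
  simp_rw [Finset.mul_sum]
  rw [Finset.sum_comm]
  refine Finset.sum_congr rfl fun v _ => ?_
  rw [FU_split (q := q) Γ a ξ U (fun i => (v i : ℤ))]
  have := sum_res k' (q := q) Γ a (fun i => (v i : ℤ))
  simp_rw [← mul_assoc]
  rw [← Finset.sum_mul, this]
  ring

lemma FU_supp (Γ : Finset (Fin k → ℕ)) (θ : (Fin k → ℕ) → ℝ) (U : Set (Fin k → ℝ)) {N : ℕ}
    (hUN : ∀ u ∈ U, ∀ i, |u i| ≤ N) (u : Fin k → ℝ) :
    ‖FU Γ θ U u‖ ≤ ∏ i, (Set.Icc (-(N : ℝ)) N).indicator (fun _ => (1 : ℝ)) (u i) := by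
  by_cases h : u ∈ U
  · refine (FU_norm Γ θ U u).trans (le_of_eq ?_)
    rw [Finset.prod_eq_one fun i _ => ?_]
    rw [Set.indicator_of_mem (show u i ∈ Set.Icc (-(N : ℝ)) N from abs_le.1 (hUN u h i))]
  · unfold FU
    rw [Set.indicator_of_notMem h, norm_zero]
    exact Finset.prod_nonneg fun i _ => Set.indicator_nonneg (fun _ _ => zero_le_one) _

lemma box_int (N : ℕ) : Integrable ((Set.Icc (-(N : ℝ)) N).indicator (fun _ => (1 : ℝ))) := by
  rw [integrable_indicator_iff measurableSet_Icc]
  exact integrableOn_const (by simp) (by simp)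

lemma FU_int (Γ : Finset (Fin k → ℕ)) (θ : (Fin k → ℕ) → ℝ) {U : Set (Fin k → ℝ)} (hUm : MeasurableSet U) {N : ℕ}
    (hUN : ∀ u ∈ U, ∀ i, |u i| ≤ N) : Integrable (FU Γ θ U) := by
  refine Integrable.mono' (g := fun u : Fin k → ℝ => ∏ i, (Set.Icc (-(N : ℝ)) N).indicator (fun _ => (1 : ℝ)) (u i)) ?_
    (FU_meas Γ θ hUm).aestronglyMeasurable (Eventually.of_forall fun u => FU_supp Γ θ U hUN u)
  exact Integrable.fintype_prod (f := fun _ : Fin k => (Set.Icc (-(N : ℝ)) N).indicator (fun _ => (1 : ℝ))) fun _ => box_int N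

lemma DDFU_int (Γ : Finset (Fin k → ℕ)) (θ : (Fin k → ℕ) → ℝ) {U : Set (Fin k → ℝ)} (hUm : MeasurableSet U)
    {N q : ℕ} [NeZero q] {χ : DirichletCharacter ℂ q} {β : ℝ} {κ : ℕ} (hκ : κ ≤ 1)
    (hβ : β < 1) (b : Fin k → ZMod q) :
    Integrable (fun u : Fin k → ℝ => (∏ i, DD k' N q χ β κ i (b i) (u i)) * FU Γ θ U u) := by
  have h1 : Integrable (fun u : Fin k → ℝ => ∏ i, DD k' N q χ β κ i (b i) (u i)) :=
    Integrable.fintype_prod (f := fun i => DD k' N q χ β κ i (b i)) fun i => DD_integrable k' hκ hβ i (b i)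
  exact h1.mul_bdd (c := 1) (FU_meas Γ θ hUm).aestronglyMeasurable (Eventually.of_forall fun u => FU_norm Γ θ U u)

/-- the bracket -/
noncomputable def Br (Γ : Finset (Fin k → ℕ)) (a : (Fin k → ℕ) → ℕ) (N q : ℕ) [NeZero q] (χ : DirichletCharacter ℂ q) (β : ℝ)
    (κ : ℕ) (u : Fin k → ℝ) : ℂ :=
  ∑ b : Fin k → ZMod q, ps (aQ Γ a b) * ∏ i, DD k' N q χ β κ i (b i) (u i)

lemma step1 (Γ : Finset (Fin k → ℕ)) (ξ : (Fin k → ℕ) → ℝ) {U : Set (Fin k → ℝ)}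
    (hU : Convex ℝ U) (hUm : MeasurableSet U) {N : ℕ} {R : ℝ} (hN : 0 < N) (hR : 0 ≤ R)
    (hUN : ∀ u ∈ U, ∀ i, |u i| ≤ N)
    {q : ℕ} [NeZero q] (a : (Fin k → ℕ) → ℕ)
    (hθ : ∀ γ ∈ Γ, |ξ γ - (a γ : ℝ) / q| * (N : ℝ) ^ (∑ i, γ i) ≤ R)
    {χ : DirichletCharacter ℂ q} {β : ℝ} {κ : ℕ} {E : ℝ} (hE : 0 ≤ E)
    (hκ : κ = 0 ∨ κ = 1 ∧ χ ^ 2 = 1) (hβ : β < 1) (hβ' : 1 / 2 ≤ β) (h : PA N q χ β κ E) :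
    ‖∑ v : Fin k → ↥(Finset.Icc (-(N : ℤ)) N), (∏ i, w0 k' i (v i)) * FU Γ ξ U (fun i => ((v i : ℤ) : ℝ))
      - ∫ u, Br k' Γ a N q χ β κ u * FU Γ (fun γ => ξ γ - (a γ : ℝ) / q) U u‖
    ≤ (q : ℝ) ^ k * (k * (2 * (3 * (E + (q : ℝ) ^ 2) + 11) * (1 + 4 * Real.pi * R * ∑ γ ∈ Γ, ∑ i, (γ i : ℝ)))
      * (4 * N + (3 * (E + (q : ℝ) ^ 2) + 11)) ^ (k - 1)) := by
  have hκ1 : κ ≤ 1 := by omega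
  have e : ∫ u, Br k' Γ a N q χ β κ u * FU Γ (fun γ => ξ γ - (a γ : ℝ) / q) U u =
      ∑ b : Fin k → ZMod q, ps (aQ Γ a b) *
        ∫ u, (∏ i, DD k' N q χ β κ i (b i) (u i)) * FU Γ (fun γ => ξ γ - (a γ : ℝ) / q) U u := by
    unfold Br
    simp_rw [Finset.sum_mul, mul_assoc]
    rw [integral_finsetSum _ fun b _ => (DDFU_int k' Γ _ hUm hκ1 hβ b).const_mul _]
    exact Finset.sum_congr rfl fun b _ => integral_const_mul _ _
  rw [e, S_eq k' (q := q) Γ a, ← Finset.sum_sub_distrib]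
  refine (norm_sum_le _ _).trans ?_
  calc _ ≤ ∑ b : Fin k → ZMod q, (k * (2 * (3 * (E + (q : ℝ) ^ 2) + 11) * (1 + 4 * Real.pi * R * ∑ γ ∈ Γ, ∑ i, (γ i : ℝ)))
      * (4 * N + (3 * (E + (q : ℝ) ^ 2) + 11)) ^ (k - 1)) := by
        refine Finset.sum_le_sum fun b _ => ?_
        rw [← mul_sub, norm_mul, ps_norm, one_mul]
        exact residue k' Γ _ hU hUm hN hR hUN hθ hE hκ hβ hβ' h b
    _ = _ := by
        rw [Finset.sum_const, Finset.card_univ, Fintype.card_fun, ZMod.card, Fintype.card_fin, nsmul_eq_mul]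
        push_cast; rfl

/-- the main Gauss sum -/
noncomputable def GG (Γ : Finset (Fin k → ℕ)) (a : (Fin k → ℕ) → ℕ) (q : ℕ) [NeZero q] : ℂ :=
  ∑ b : Fin k → ZMod q, ps (aQ Γ a b) * ∏ i, (cc k' q i * psi k' q i (b i))

lemma cc_q_le {q : ℕ} [NeZero q] (i : Fin k) : ‖cc k' q i‖ ≤ 1 / (q.totient : ℝ) := by
  unfold cc
  have : 0 < q.totient := Nat.totient_pos.2 (NeZero.pos q)
  split_ifs
  · rw [norm_div, norm_one, Complex.norm_natCast]
  · rw [norm_div, norm_one, Complex.norm_natCast]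
    have : (q.totient : ℝ) ≤ q := by exact_mod_cast Nat.totient_le q
    gcongr

lemma bracket (Γ : Finset (Fin k → ℕ)) (a : (Fin k → ℕ) → ℕ) {N q : ℕ} [NeZero q] (χ : DirichletCharacter ℂ q) {β : ℝ}
    {κ : ℕ} (hκ : κ ≤ 1) (hβ : β < 1) {T : ℝ} (hT : ∀ f : Fin k → (ZMod q →* ℂ), (∀ i x, ‖f i x‖ ≤ 1) →
      ((q : ℝ) / q.totient) ^ k * ‖𝔼 v : Fin k → ZMod q, (∏ i, f i (v i)) * ps (∑ γ ∈ Γ, (a γ : ZMod q) * ∏ i, v i ^ γ i)‖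
        ≤ T) (u : Fin k → ℝ) (hu : ∀ i, |u i| ≤ N) :
    ‖Br k' Γ a N q χ β κ u - GG k' Γ a q‖ ≤ 2 ^ k * (T * (κ * ∑ i, ‖tau (χ (-1)) β (u i)‖)) := by
  classical
  have hT0 : 0 ≤ T := le_trans (by positivity) (hT (fun _ => 1) (by simp))
  set fch : Finset (Fin k) → Fin k → (ZMod q →* ℂ) := fun t i => if i ∈ t then psi k' q i else χ.toMonoidHom with hfch
  have e1 : ∀ b : Fin k → ZMod q, ∏ i, DD k' N q χ β κ i (b i) (u i) =
      ∑ t ∈ (Finset.univ : Finset (Fin k)).powerset, (∏ i : Fin k, cc k' q i) * (∏ i ∈ Finset.univ \ t, (- (kap k' κ i * tau (χ (-1)) β (u i))))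
        * ∏ i, fch t i (b i) := by
    intro b
    have : ∀ i, DD k' N q χ β κ i (b i) (u i) = cc k' q i * (psi k' q i (b i) + (- (kap k' κ i * tau (χ (-1)) β (u i))) * χ (b i)) := by
      intro i
      unfold DD Den
      rw [Set.indicator_of_mem (show u i ∈ Set.Icc (-(N : ℝ)) N from abs_le.1 (hu i))]
      ring
    simp_rw [this]
    rw [Finset.prod_mul_distrib, Finset.prod_add, Finset.mul_sum]
    refine Finset.sum_congr rfl fun t ht => ?_
    rw [Finset.prod_mul_distrib, mul_assoc]
    congr 1
    rw [mul_left_comm]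
    congr 1
    rw [← Finset.prod_sdiff (Finset.subset_univ t) (f := fun i => fch t i (b i)), mul_comm]
    congr 1
    · refine Finset.prod_congr rfl fun i hi => ?_
      simp only [hfch]
      rw [if_neg (Finset.mem_sdiff.1 hi).2]; rfl
    · refine Finset.prod_congr rfl fun i hi => ?_
      simp only [hfch]
      rw [if_pos hi]
  have e2 : Br k' Γ a N q χ β κ u = ∑ t ∈ (Finset.univ : Finset (Fin k)).powerset,
      (∏ i : Fin k, cc k' q i) * (∏ i ∈ Finset.univ \ t, (- (kap k' κ i * tau (χ (-1)) β (u i)))) *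
        ∑ b : Fin k → ZMod q, ps (aQ Γ a b) * ∏ i, fch t i (b i) := by
    unfold Br
    simp_rw [e1, Finset.mul_sum]
    rw [Finset.sum_comm]
    refine Finset.sum_congr rfl fun t _ => Finset.sum_congr rfl fun b _ => by ring
  have e3 : GG k' Γ a q = (∏ i : Fin k, cc k' q i) * (∏ i ∈ Finset.univ \ (Finset.univ : Finset (Fin k)), (- (kap k' κ i * tau (χ (-1)) β (u i)))) *
        ∑ b : Fin k → ZMod q, ps (aQ Γ a b) * ∏ i, fch Finset.univ i (b i) := by
    unfold GG
    rw [Finset.sdiff_self, Finset.prod_empty, mul_one, Finset.mul_sum]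
    refine Finset.sum_congr rfl fun b _ => ?_
    rw [Finset.prod_mul_distrib]
    simp only [hfch, Finset.mem_univ, if_true]
    ring
  rw [e2, e3, ← Finset.sum_erase_eq_sub (Finset.mem_powerset_self _)]
  refine (norm_sum_le _ _).trans ?_
  have hS : ∀ t, ‖∏ i : Fin k, cc k' q i‖ * ‖∑ b : Fin k → ZMod q, ps (aQ Γ a b) * ∏ i, fch t i (b i)‖ ≤ T := by
    intro t
    refine le_trans ?_ (hT (fch t) (fun i x => ?_))
    · have h1 : ‖∏ i : Fin k, cc k' q i‖ ≤ (1 / (q.totient : ℝ)) ^ k := by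
        rw [norm_prod]
        refine (Finset.prod_le_prod (fun _ _ => norm_nonneg _) fun i _ => cc_q_le k' i).trans (le_of_eq ?_)
        simp
      have h2 : ‖∑ b : Fin k → ZMod q, ps (aQ Γ a b) * ∏ i, fch t i (b i)‖ =
          (q : ℝ) ^ k * ‖𝔼 v : Fin k → ZMod q, (∏ i, fch t i (v i)) * ps (∑ γ ∈ Γ, (a γ : ZMod q) * ∏ i, v i ^ γ i)‖ := by
        rw [Fintype.expect_eq_sum_div_card, norm_div, Complex.norm_natCast, Fintype.card_fun, ZMod.card, Fintype.card_fin]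
        have : (q : ℝ) ≠ 0 := by exact_mod_cast NeZero.ne q
        push_cast
        rw [mul_div_cancel₀ _ (pow_ne_zero k this)]
        congr 1
        exact Finset.sum_congr rfl fun b _ => mul_comm _ _
      rw [h2, div_pow, ← mul_assoc]
      gcongr
      rw [div_eq_mul_one_div, mul_comm, ← one_div_pow]
      gcongr
    · simp only [hfch]
      split_ifs
      · exact psi_le k' i x
      · exact DirichletCharacter.norm_le_one _ _
  have hsum0 : 0 ≤ ∑ i, ‖tau (χ (-1)) β (u i)‖ := Finset.sum_nonneg fun _ _ => norm_nonneg _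
  calc _ ≤ ∑ t ∈ ((Finset.univ : Finset (Fin k)).powerset).erase Finset.univ, T * (κ * ∑ i, ‖tau (χ (-1)) β (u i)‖) := by
        refine Finset.sum_le_sum fun t ht => ?_
        have hne := (Finset.mem_erase.1 ht).1
        obtain ⟨j, hj⟩ : ∃ j, j ∉ t := by
          by_contra hcon; push Not at hcon
          exact hne (Finset.eq_univ_iff_forall.2 hcon)
        have hκ' : (κ : ℝ) ≤ 1 := by exact_mod_cast hκ
        have hp : ‖∏ i ∈ Finset.univ \ t, (- (kap k' κ i * tau (χ (-1)) β (u i)))‖ ≤ κ * ∑ i, ‖tau (χ (-1)) β (u i)‖ := by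
          rw [norm_prod, ← Finset.mul_prod_erase _ _ (Finset.mem_sdiff.2 ⟨Finset.mem_univ j, hj⟩)]
          have b1 : ∀ i, ‖-(kap k' κ i * tau (χ (-1)) β (u i))‖ ≤ κ * ‖tau (χ (-1)) β (u i)‖ := by
            intro i
            rw [norm_neg, norm_mul]
            exact mul_le_mul_of_nonneg_right (kap_le k' hκ i) (norm_nonneg _)
          have b2 : ∏ i ∈ (Finset.univ \ t).erase j, ‖-(kap k' κ i * tau (χ (-1)) β (u i))‖ ≤ 1 := by
            refine Finset.prod_le_one (fun _ _ => norm_nonneg _) fun i _ => (b1 i).trans ?_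
            exact mul_le_one₀ hκ' (norm_nonneg _) (tau_le (DirichletCharacter.norm_le_one _ _) hβ _)
          calc _ ≤ (κ * ‖tau (χ (-1)) β (u j)‖) * 1 := mul_le_mul (b1 j) b2 (Finset.prod_nonneg fun _ _ => norm_nonneg _) (by positivity)
            _ ≤ _ := by
              rw [mul_one]
              gcongr
              exact Finset.single_le_sum (f := fun i => ‖tau (χ (-1)) β (u i)‖) (fun _ _ => norm_nonneg _) (Finset.mem_univ j)
        rw [norm_mul, norm_mul, mul_right_comm]
        exact mul_le_mul (hS t) hp (norm_nonneg _) hT0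
    _ ≤ _ := by
        rw [Finset.sum_const, nsmul_eq_mul]
        gcongr
        calc ((((Finset.univ : Finset (Fin k)).powerset).erase Finset.univ).card : ℝ) ≤ ((Finset.univ : Finset (Fin k)).powerset).card := by
              exact_mod_cast Finset.card_le_card (Finset.erase_subset _ _)
          _ = 2 ^ k := by rw [Finset.card_powerset, Finset.card_univ, Fintype.card_fin]; push_cast; rfl

end
end MA
end


section
open Complex Set Filter Topology MeasureTheory
open scoped BigOperators

namespace MA

lemma tau_mass_pt {N : ℕ} {ε : ℂ} (hε : ‖ε‖ ≤ 1) {β : ℝ} (u : ℝ) :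
    (Set.Icc (-(N : ℝ)) N).indicator (fun u => ‖tau ε β u‖) u ≤
      (Set.Icc (1 : ℝ) N).indicator (fun u => u ^ (β - 1)) u + (Set.Icc (1 : ℝ) N).indicator (fun u => u ^ (β - 1)) (-u) := by
  have key : ∀ u ≤ (N : ℝ), ‖(Set.Ici (1 : ℝ)).indicator (fun u => ((u ^ (β - 1) : ℝ) : ℂ)) u‖ ≤
      (Set.Icc (1 : ℝ) N).indicator (fun u => u ^ (β - 1)) u := by
    intro u hu
    by_cases h : 1 ≤ u
    · rw [Set.indicator_of_mem (show u ∈ Set.Ici (1 : ℝ) from h),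
        Set.indicator_of_mem (show u ∈ Set.Icc (1 : ℝ) N from ⟨h, hu⟩), Complex.norm_real,
        Real.norm_of_nonneg (by positivity)]
    · rw [Set.indicator_of_notMem (show u ∉ Set.Ici (1 : ℝ) from h),
        Set.indicator_of_notMem (show u ∉ Set.Icc (1 : ℝ) N from fun h' => h h'.1), norm_zero]
  have nn : ∀ u, 0 ≤ (Set.Icc (1 : ℝ) N).indicator (fun u : ℝ => u ^ (β - 1)) u := fun u =>
    Set.indicator_nonneg (fun x hx => Real.rpow_nonneg (by linarith [hx.1]) _) u
  by_cases h : u ∈ Set.Icc (-(N : ℝ)) N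
  · rw [Set.indicator_of_mem h]
    unfold tau
    refine (norm_add_le _ _).trans (add_le_add (key u h.2) ?_)
    rw [norm_mul]
    exact (mul_le_of_le_one_left (norm_nonneg _) hε).trans (key (-u) (by linarith [h.1]))
  · rw [Set.indicator_of_notMem h]
    exact add_nonneg (nn _) (nn _)

lemma rpow_int {N : ℕ} (hN : 0 < N) {β : ℝ} (hβ' : 1 / 2 ≤ β) :
    Integrable ((Set.Icc (1 : ℝ) N).indicator (fun u : ℝ => u ^ (β - 1))) ∧
    ∫ u, (Set.Icc (1 : ℝ) N).indicator (fun u : ℝ => u ^ (β - 1)) u ≤ 2 * (N : ℝ) ^ β := by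
  have hN1 : (1 : ℝ) ≤ N := by exact_mod_cast hN
  constructor
  · rw [integrable_indicator_iff measurableSet_Icc]
    refine ContinuousOn.integrableOn_Icc ?_
    intro x hx
    exact (Real.continuousAt_rpow_const _ _ (Or.inl (by linarith [hx.1]))).continuousWithinAt
  · rw [integral_indicator measurableSet_Icc, integral_Icc_eq_integral_Ioc,
      ← intervalIntegral.integral_of_le hN1, integral_rpow (Or.inl (by linarith))]
    rw [sub_add_cancel, Real.one_rpow, div_le_iff₀ (by linarith)]
    have : 0 ≤ (N : ℝ) ^ β := by positivity
    nlinarith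

lemma tau_mass {N : ℕ} (hN : 0 < N) {ε : ℂ} (hε : ‖ε‖ ≤ 1) {β : ℝ} (hβ' : 1 / 2 ≤ β) (hβ : β < 1) :
    Integrable ((Set.Icc (-(N : ℝ)) N).indicator (fun u => ‖tau ε β u‖)) ∧
    ∫ u, (Set.Icc (-(N : ℝ)) N).indicator (fun u => ‖tau ε β u‖) u ≤ 4 * (N : ℝ) ^ β := by
  obtain ⟨h1, h2⟩ := rpow_int hN hβ'
  have hi : Integrable ((Set.Icc (-(N : ℝ)) N).indicator (fun u => ‖tau ε β u‖)) := by
    rw [integrable_indicator_iff measurableSet_Icc]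
    refine Integrable.mono' (g := fun _ => (1 : ℝ)) (integrableOn_const (by simp) (by simp)) ?_ ?_
    · exact (tau_meas ε β).norm.aestronglyMeasurable
    · exact Eventually.of_forall fun u => by rw [norm_norm]; exact tau_le hε hβ u
  refine ⟨hi, ?_⟩
  calc _ ≤ ∫ u, ((Set.Icc (1 : ℝ) N).indicator (fun u => u ^ (β - 1)) u + (Set.Icc (1 : ℝ) N).indicator (fun u => u ^ (β - 1)) (-u)) :=
        integral_mono hi (h1.add h1.comp_neg) fun u => tau_mass_pt hε u
    _ = _ := integral_add h1 h1.comp_neg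
    _ ≤ _ := by
      rw [integral_neg_eq_self (fun u => (Set.Icc (1 : ℝ) N).indicator (fun u : ℝ => u ^ (β - 1)) u)]
      linarith

section
variable {k : ℕ} (k' : ℕ)

/-- the majorant on the box -/
noncomputable def bx (N : ℕ) (ε : ℂ) (β : ℝ) (i j : Fin k) : ℝ → ℝ :=
  if j = i then (Set.Icc (-(N : ℝ)) N).indicator (fun u => ‖tau ε β u‖) else (Set.Icc (-(N : ℝ)) N).indicator (fun _ => (1 : ℝ))

lemma bx_int {N : ℕ} (hN : 0 < N) {ε : ℂ} (hε : ‖ε‖ ≤ 1) {β : ℝ} (hβ' : 1 / 2 ≤ β) (hβ : β < 1) (i : Fin k) :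
    Integrable (fun u : Fin k → ℝ => ∏ j, bx N ε β i j (u j)) ∧
    ∫ u : Fin k → ℝ, ∏ j, bx N ε β i j (u j) ≤ (2 * N) ^ (k - 1) * (4 * (N : ℝ) ^ β) := by
  obtain ⟨h1, h2⟩ := tau_mass hN hε hβ' hβ
  constructor
  · refine Integrable.fintype_prod (f := fun j => bx N ε β i j) fun j => ?_
    unfold bx
    split_ifs
    · exact h1
    · exact box_int N
  · rw [integral_fintype_prod_volume_eq_prod (fun j => bx N ε β i j), ← Finset.mul_prod_erase _ _ (Finset.mem_univ i)]
    have e : ∏ j ∈ Finset.univ.erase i, ∫ x, bx N ε β i j x = (2 * N : ℝ) ^ (k - 1) := by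
      rw [Finset.prod_congr rfl (g := fun _ => (2 * N : ℝ))]
      · rw [Finset.prod_const, Finset.card_erase_of_mem (Finset.mem_univ i), Finset.card_univ, Fintype.card_fin]
      · intro j hj
        unfold bx
        rw [if_neg (Finset.ne_of_mem_erase hj), integral_indicator measurableSet_Icc]
        simp
        ring
    rw [e, mul_comm]
    gcongr
    unfold bx
    rw [if_pos rfl]
    exact h2

lemma mainQ (Γ : Finset (Fin k → ℕ)) (ξ : (Fin k → ℕ) → ℝ) {U : Set (Fin k → ℝ)}
    (hU : Convex ℝ U) (hUm : MeasurableSet U) {N : ℕ} {R : ℝ} (hN : 0 < N) (hR : 0 ≤ R)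
    (hUN : ∀ u ∈ U, ∀ i, |u i| ≤ N)
    {q : ℕ} [NeZero q] (a : (Fin k → ℕ) → ℕ)
    (hθ : ∀ γ ∈ Γ, |ξ γ - (a γ : ℝ) / q| * (N : ℝ) ^ (∑ i, γ i) ≤ R)
    {χ : DirichletCharacter ℂ q} {β : ℝ} {κ : ℕ} {E : ℝ} (hE : 0 ≤ E)
    (hκ : κ = 0 ∨ κ = 1 ∧ χ ^ 2 = 1) (hβ : β < 1) (hβ' : 1 / 2 ≤ β) (h : PA N q χ β κ E)
    {T : ℝ} (hT : ∀ f : Fin k → (ZMod q →* ℂ), (∀ i x, ‖f i x‖ ≤ 1) →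
      ((q : ℝ) / q.totient) ^ k * ‖𝔼 v : Fin k → ZMod q, (∏ i, f i (v i)) * ps (∑ γ ∈ Γ, (a γ : ZMod q) * ∏ i, v i ^ γ i)‖
        ≤ T) :
    ‖∑ v : Fin k → ↥(Finset.Icc (-(N : ℤ)) N), (∏ i, w0 k' i (v i)) * FU Γ ξ U (fun i => ((v i : ℤ) : ℝ))
      - GG k' Γ a q * ∫ u, FU Γ (fun γ => ξ γ - (a γ : ℝ) / q) U u‖
    ≤ (q : ℝ) ^ k * (k * (2 * (3 * (E + (q : ℝ) ^ 2) + 11) * (1 + 4 * Real.pi * R * ∑ γ ∈ Γ, ∑ i, (γ i : ℝ)))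
      * (4 * N + (3 * (E + (q : ℝ) ^ 2) + 11)) ^ (k - 1))
      + 2 ^ k * (T * (κ * (k * ((2 * N) ^ (k - 1) * (4 * (N : ℝ) ^ β))))) := by
  have hκ1 : κ ≤ 1 := by omega
  have hT0 : 0 ≤ T := le_trans (by positivity) (hT (fun _ => 1) (by simp))
  have s1 := step1 k' Γ ξ hU hUm hN hR hUN a hθ hE hκ hβ hβ' h
  set θ : (Fin k → ℕ) → ℝ := fun γ => ξ γ - (a γ : ℝ) / q with hθd
  have hε : ‖χ (-1)‖ ≤ 1 := DirichletCharacter.norm_le_one _ _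
  have s2 : ‖(∫ u, Br k' Γ a N q χ β κ u * FU Γ θ U u) - GG k' Γ a q * ∫ u, FU Γ θ U u‖
      ≤ 2 ^ k * (T * (κ * (k * ((2 * N) ^ (k - 1) * (4 * (N : ℝ) ^ β))))) := by
    have hi1 : Integrable (fun u => Br k' Γ a N q χ β κ u * FU Γ θ U u) := by
      unfold Br
      simp_rw [Finset.sum_mul, mul_assoc]
      exact integrable_finsetSum _ fun b _ => (DDFU_int k' Γ _ hUm hκ1 hβ b).const_mul _
    have hi2 : Integrable (fun u => GG k' Γ a q * FU Γ θ U u) := (FU_int Γ θ hUm hUN).const_mul _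
    rw [← integral_const_mul, ← integral_sub hi1 hi2]
    have hb : ∀ u : Fin k → ℝ, ‖Br k' Γ a N q χ β κ u * FU Γ θ U u - GG k' Γ a q * FU Γ θ U u‖ ≤
        2 ^ k * (T * (κ * ∑ i, ∏ j, bx N (χ (-1)) β i j (u j))) := by
      intro u
      have bn : ∀ i j, 0 ≤ bx N (χ (-1)) β i j (u j) := by
        intro i j
        unfold bx
        split_ifs
        · exact Set.indicator_nonneg (fun _ _ => norm_nonneg _) _
        · exact Set.indicator_nonneg (fun _ _ => zero_le_one) _
      by_cases hu : u ∈ U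
      · rw [← sub_mul, norm_mul]
        refine (mul_le_of_le_one_right (norm_nonneg _) (FU_norm Γ θ U u)).trans ?_
        refine (bracket k' Γ a χ hκ1 hβ hT u (hUN u hu)).trans (le_of_eq ?_)
        congr 4
        funext i
        rw [← Finset.mul_prod_erase _ _ (Finset.mem_univ i)]
        have hm : ∀ j, u j ∈ Set.Icc (-(N : ℝ)) N := fun j => abs_le.1 (hUN u hu j)
        rw [Finset.prod_eq_one, mul_one]
        · unfold bx; rw [if_pos rfl, Set.indicator_of_mem (hm i)]
        · intro j hj
          unfold bx; rw [if_neg (Finset.ne_of_mem_erase hj), Set.indicator_of_mem (hm j)]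
      · unfold FU
        rw [Set.indicator_of_notMem hu, mul_zero, mul_zero, sub_zero, norm_zero]
        have := Finset.sum_nonneg fun i (_ : i ∈ (Finset.univ : Finset (Fin k))) =>
          Finset.prod_nonneg fun j (_ : j ∈ (Finset.univ : Finset (Fin k))) => bn i j
        positivity
    have hIntg : Integrable (fun u : Fin k → ℝ => 2 ^ k * (T * (κ * ∑ i, ∏ j, bx N (χ (-1)) β i j (u j)))) :=
      (((integrable_finsetSum _ fun i _ => (bx_int hN hε hβ' hβ i).1).const_mul _).const_mul _).const_mul _
    refine (norm_integral_le_of_norm_le hIntg (Eventually.of_forall hb)).trans ?_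
    rw [integral_const_mul, integral_const_mul, integral_const_mul,
      integral_finsetSum _ fun i _ => (bx_int hN hε hβ' hβ i).1]
    gcongr
    refine (Finset.sum_le_sum fun i _ => (bx_int hN hε hβ' hβ i).2).trans (le_of_eq ?_)
    rw [Finset.sum_const, Finset.card_univ, Fintype.card_fin, nsmul_eq_mul]
  refine (norm_sub_le_norm_sub_add_norm_sub _ _ _).trans (add_le_add s1 s2)

end
end MA
end


section
open Complex Set Filter Topology MeasureTheory
open scoped BigOperators

namespace MA

lemma ev_rpow (α : ℝ) {b : ℝ} (hb : 0 < b) : ∀ᶠ y : ℝ in atTop, Real.exp (-(b * y)) ≤ y ^ (-α) := by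
  filter_upwards [ev_exp 1 ⌈α⌉₊ hb, eventually_ge_atTop 1] with y h1 hy
  rw [Real.exp_neg, Real.rpow_neg (by linarith)]
  have h2 : y ^ α ≤ y ^ (⌈α⌉₊ : ℕ) := by
    rw [← Real.rpow_natCast]
    exact Real.rpow_le_rpow_of_exponent_le hy (Nat.le_ceil α)
  have : 0 < y ^ α := Real.rpow_pos_of_pos (by linarith) _
  gcongr
  linarith

/-- combining Siegel with decay in `q` -/
lemma sieg_dec (α : ℝ) (hα : 0 < α) {δ : ℝ} (hδ : 0 < δ) : ∀ᶠ y : ℝ in atTop, ∀ (q : ℕ) [NeZero q] (χ : DirichletCharacter ℂ q),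
    χ ^ 2 = 1 → χ ≠ 1 → ∀ β : ℝ, β < 1 → LF χ β = 0 →
      (q : ℝ) ^ (-δ) * Real.exp (y ^ 2 * (β - 1)) ≤ y ^ (-(2 * α)) := by
  obtain ⟨C, hC, hS⟩ := siegel (ε := δ / (2 * α)) (by positivity)
  filter_upwards [ev_rpow (2 * α) hC, eventually_ge_atTop 1] with y h1 hy q _ χ hχ hχ1 β hβ hz
  have hy0 : 0 < y := by linarith
  have hq : (0 : ℝ) < q := by exact_mod_cast NeZero.pos q
  have hq1 : (1 : ℝ) ≤ q := by exact_mod_cast NeZero.pos q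
  by_cases hc : (q : ℝ) ^ (-δ) ≤ y ^ (-(2 * α))
  · have : Real.exp (y ^ 2 * (β - 1)) ≤ 1 := by
      rw [Real.exp_le_one_iff]
      exact mul_nonpos_of_nonneg_of_nonpos (by positivity) (by linarith)
    exact (mul_le_of_le_one_right (by positivity) this).trans hc
  · push Not at hc
    have h2 : (q : ℝ) ^ (-δ) ≤ 1 := Real.rpow_le_one_of_one_le_of_nonpos hq1 (by linarith)
    refine (mul_le_of_le_one_left (Real.exp_nonneg _) h2).trans (le_trans ?_ h1)
    have h3 := hS q χ hχ hχ1 β hβ hz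
    have h4 : y ^ (-1 : ℝ) ≤ (q : ℝ) ^ (-(δ / (2 * α))) := by
      have := Real.rpow_le_rpow (by positivity) hc.le (by positivity : (0 : ℝ) ≤ 1 / (2 * α))
      rw [← Real.rpow_mul hy0.le, ← Real.rpow_mul hq.le] at this
      rwa [show -(2 * α) * (1 / (2 * α)) = -1 by field_simp, show -δ * (1 / (2 * α)) = -(δ / (2 * α)) by ring] at this
    rw [Real.rpow_neg_one] at h4
    rw [Real.exp_le_exp]
    have h5 : C * y⁻¹ ≤ 1 - β := (mul_le_mul_of_nonneg_left h4 hC.le).trans h3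
    have h6 : C * y = y ^ 2 * (C * y⁻¹) := by field_simp
    have h7 : y ^ 2 * (C * y⁻¹) ≤ y ^ 2 * (1 - β) := mul_le_mul_of_nonneg_left h5 (by positivity)
    nlinarith only [h6, h7]

section
variable {k : ℕ}

theorem mainA (k' : ℕ) (Γ : Finset (Fin k → ℕ)) (hΓ : Γ.Nonempty) (h0 : (0 : Fin k → ℕ) ∉ Γ) {α : ℝ} (hα : 0 < α) :
    ∃ c C : ℝ, 0 < c ∧ 0 < C ∧ ∀ᶠ N : ℕ in atTop, ∀ (U : Set (Fin k → ℝ)), Convex ℝ U → MeasurableSet U →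
      (∀ u ∈ U, ∀ i, |u i| ≤ N) → ∀ (ξ : (Fin k → ℕ) → ℝ) (q : ℕ) [NeZero q] (a : (Fin k → ℕ) → ℕ),
      (∀ γ ∈ Γ, IsUnit (a γ : ZMod q)) → ∀ R : ℝ, 1 ≤ R → (q : ℝ) ≤ R → R ≤ Real.exp (c * √(Real.log N)) →
      (∀ γ ∈ Γ, |ξ γ - (a γ : ℝ) / q| * (N : ℝ) ^ (∑ i, γ i) ≤ R) →
      ‖∑ v : Fin k → ↥(Finset.Icc (-(N : ℤ)) N), (∏ i, w0 k' i (v i)) * FU Γ ξ U (fun i => ((v i : ℤ) : ℝ))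
      - GG k' Γ a q * ∫ u, FU Γ (fun γ => ξ γ - (a γ : ℝ) / q) U u‖ ≤ C * (N : ℝ) ^ k * (Real.log N) ^ (-α) := by
  obtain ⟨c0, hc0, hap⟩ := prime_ap
  obtain ⟨Cg, δ, hCg, hδ, hg⟩ := gauss_twist Γ hΓ h0
  have hk : 1 ≤ k := by
    rcases Nat.eq_zero_or_pos k with h | h
    · subst h
      obtain ⟨g, hgm⟩ := hΓ
      exact absurd (Subsingleton.elim g 0 ▸ hgm) h0
    · exact h
  set c := min 1 (c0 / (2 * (k + 1))) with hc
  have hcpos : 0 < c := by rw [hc]; positivity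
  have hc1 : c ≤ 1 := min_le_left _ _
  have hc2 : c * (k + 1) ≤ c0 / 2 := by
    have : c ≤ c0 / (2 * (k + 1)) := min_le_right _ _
    have hk0 : (0 : ℝ) < 2 * (k + 1) := by positivity
    rw [le_div_iff₀ hk0] at this
    linarith
  set Γs := ∑ γ ∈ Γ, ∑ i, (γ i : ℝ) with hΓs
  have hΓ0 : 0 ≤ Γs := Finset.sum_nonneg fun _ _ => Finset.sum_nonneg fun _ _ => Nat.cast_nonneg _
  have hpi := Real.pi_pos
  refine ⟨c, k * (34 * (1 + 4 * Real.pi * Γs)) * 21 ^ (k - 1) + 2 ^ k * (Cg * (k * (2 ^ (k - 1) * 4))), hcpos, by positivity, ?_⟩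
  have ty : Tendsto (fun N : ℕ => √(Real.log N)) atTop atTop := tend_sqrtlog.comp tendsto_natCast_atTop_atTop
  filter_upwards [tendsto_natCast_atTop_atTop.eventually hap, ty.eventually (sieg_dec α hα hδ),
    ty.eventually (ev_rpow (2 * α) (half_pos hc0)), ty.eventually (eventually_ge_atTop (2 * c + c0 + 1)),
    eventually_ge_atTop 1] with N hap hsd hev hy hN1 U hU hUm hUN ξ q hq a ha R hR1 hqR hRc hθ
  set y := √(Real.log N) with hyd
  have hN : (1 : ℝ) ≤ N := by exact_mod_cast hN1
  have hN0 : (0 : ℝ) < N := by linarith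
  have hlog : Real.log N = y ^ 2 := (Real.sq_sqrt (Real.log_nonneg hN)).symm
  have hy0 : 0 < y := by linarith
  have hNe : (N : ℝ) = Real.exp (y ^ 2) := by rw [← hlog, Real.exp_log hN0]
  have hlogα : (Real.log N) ^ (-α) = y ^ (-(2 * α)) := by
    rw [hlog, ← Real.rpow_natCast, ← Real.rpow_mul hy0.le]; congr 1; push_cast; ring
  have hXy : Real.exp (c * y) ≤ Real.exp y := Real.exp_le_exp.2 (mul_le_of_le_one_left hy0.le hc1)
  obtain ⟨χ, β, κ, hκ, hβ', hβ, hPA⟩ := hap q hq ((hqR.trans hRc).trans hXy)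
  have hκ' : κ = 0 ∨ κ = 1 ∧ χ ^ 2 = 1 := hκ.imp_right fun h => ⟨h.1, h.2.2.1⟩
  set E := (N : ℝ) * Real.exp (-(c0 * y)) with hE
  have hE0 : 0 ≤ E := by positivity
  have hEe : E = Real.exp (y ^ 2 - c0 * y) := by rw [hE, hNe, ← Real.exp_add]; congr 1
  have hE1 : 1 ≤ E := by
    rw [hEe]; refine Real.one_le_exp ?_
    nlinarith only [hy, hy0, hcpos]
  have hEN : E ≤ N := by
    rw [hE]; refine mul_le_of_le_one_right hN0.le ?_
    rw [Real.exp_le_one_iff]; nlinarith only [hc0, hy0]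
  have hq2 : (q : ℝ) ^ 2 ≤ E := by
    have h1 : (q : ℝ) ^ 2 ≤ (Real.exp (c * y)) ^ 2 := by
      have := hqR.trans hRc
      gcongr
    refine h1.trans ?_
    rw [hEe, ← Real.exp_nat_mul, Real.exp_le_exp]
    push_cast
    nlinarith only [hy, hy0, hcpos]
  have hPA' : PA N q χ β κ E := fun b hb n hn => hPA b hb n (by exact_mod_cast hn)
  have hR0 : 0 ≤ R := by linarith
  refine (mainQ k' Γ ξ hU hUm hN1 hR0 hUN a hθ hE0 hκ' hβ hβ' hPA' (T := Cg * (q : ℝ) ^ (-δ))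
    (fun f hf => hg q (fun γ => (a γ : ZMod q)) ha f hf)).trans ?_
  rw [add_mul, add_mul, hlogα]
  have hNk : (N : ℝ) ^ k = N * N ^ (k - 1) := by rw [← pow_succ', Nat.sub_add_cancel hk]
  refine add_le_add ?_ ?_
  · have hX : (Real.exp (c * y)) ^ (k + 1) ≤ Real.exp (c0 / 2 * y) := by
      rw [← Real.exp_nat_mul, Real.exp_le_exp]
      push_cast
      nlinarith only [hc2, hy0]
    set X := Real.exp (c * y) with hXd
    have hX0 : 0 < X := Real.exp_pos _
    have hX1 : 1 ≤ X := hR1.trans hRc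
    have a1 : 3 * (E + (q : ℝ) ^ 2) + 11 ≤ 17 * E := by linarith
    have a2 : 1 + 4 * Real.pi * R * Γs ≤ (1 + 4 * Real.pi * Γs) * X := by
      have : 4 * Real.pi * R * Γs ≤ 4 * Real.pi * X * Γs := by gcongr
      nlinarith only [this, hX1]
    have a3 : 4 * N + (3 * (E + (q : ℝ) ^ 2) + 11) ≤ 21 * N := by linarith
    have a4 : (q : ℝ) ^ k ≤ X ^ k := by
      have := hqR.trans hRc
      gcongr
    calc _ ≤ X ^ k * (k * (2 * (17 * E) * ((1 + 4 * Real.pi * Γs) * X)) * (21 * N) ^ (k - 1)) := by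
          gcongr
      _ = (k * (34 * (1 + 4 * Real.pi * Γs)) * 21 ^ (k - 1)) * N ^ k * (X ^ (k + 1) * Real.exp (-(c0 * y))) := by
          rw [hE, hNk, mul_pow]; ring
      _ ≤ (k * (34 * (1 + 4 * Real.pi * Γs)) * 21 ^ (k - 1)) * N ^ k * (Real.exp (c0 / 2 * y) * Real.exp (-(c0 * y))) := by
          gcongr
      _ = (k * (34 * (1 + 4 * Real.pi * Γs)) * 21 ^ (k - 1)) * N ^ k * Real.exp (-(c0 / 2 * y)) := by
          rw [← Real.exp_add]; congr 2; ring
      _ ≤ _ := by gcongr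
  · have hNβ : (N : ℝ) ^ β = N * Real.exp (y ^ 2 * (β - 1)) := by
      rw [Real.rpow_def_of_pos hN0, hlog]
      conv_rhs => rw [hNe, ← Real.exp_add]
      congr 1; ring
    have key : (κ : ℝ) * ((q : ℝ) ^ (-δ) * Real.exp (y ^ 2 * (β - 1))) ≤ y ^ (-(2 * α)) := by
      rcases hκ with h | ⟨h1, h2, h3, h4⟩
      · rw [h]; simp only [Nat.cast_zero, zero_mul]; positivity
      · rw [h1, Nat.cast_one, one_mul]
        exact hsd q χ h3 h2 β hβ h4
    calc _ = 2 ^ k * (Cg * (k * (2 ^ (k - 1) * 4))) * N ^ k * ((κ : ℝ) * ((q : ℝ) ^ (-δ) * Real.exp (y ^ 2 * (β - 1)))) := by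
          rw [hNβ, hNk, mul_pow]; ring
      _ ≤ _ := by gcongr
end
end MA
end


section
open Complex Set Filter Topology MeasureTheory
open scoped BigOperators

namespace MA

section
variable {k : ℕ}

/-- coordinates of the dilated body -/
def UU (Ω : Set (EuclideanSpace ℝ (Fin k))) (N : ℕ) : Set (Fin k → ℝ) := {u | WithLp.toLp 2 u ∈ dilate Ω (N : ℝ)}

lemma UU_conv {Ω : Set (EuclideanSpace ℝ (Fin k))} (h : Convex ℝ Ω) (N : ℕ) : Convex ℝ (UU Ω N) := by
  intro x hx y hy s t hs ht hst
  have := h hx hy hs ht hst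
  change (N : ℝ)⁻¹ • WithLp.toLp 2 (s • x + t • y) ∈ Ω
  convert this using 1
  rw [WithLp.toLp_add, WithLp.toLp_smul, WithLp.toLp_smul, smul_add, smul_comm _ s, smul_comm _ t]

lemma UU_meas {Ω : Set (EuclideanSpace ℝ (Fin k))} (h : IsOpen Ω) (N : ℕ) : MeasurableSet (UU Ω N) := by
  have : Continuous fun u : Fin k → ℝ => (N : ℝ)⁻¹ • (WithLp.toLp 2 u : EuclideanSpace ℝ (Fin k)) :=
    (continuous_const_smul ((N : ℝ)⁻¹)).comp (PiLp.continuous_toLp 2 (fun _ : Fin k => ℝ))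
  exact (h.preimage this).measurableSet

lemma dil_open {Ω : Set (EuclideanSpace ℝ (Fin k))} (h : IsOpen Ω) (t : ℝ) : IsOpen (dilate Ω t) :=
  h.preimage (continuous_const_smul t⁻¹)

lemma UU_box {Ω : Set (EuclideanSpace ℝ (Fin k))} (h : Ω ⊆ Metric.ball 0 1) {N : ℕ} (hN : 0 < N) :
    ∀ u ∈ UU Ω N, ∀ i, |u i| ≤ N := by
  intro u hu i
  have h1 := h hu
  rw [mem_ball_zero_iff, norm_smul, Real.norm_of_nonneg (by positivity)] at h1
  have hN0 : (0 : ℝ) < N := by exact_mod_cast hN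
  rw [inv_mul_lt_iff₀ hN0, mul_one] at h1
  have h2 := PiLp.norm_apply_le (WithLp.toLp 2 u : EuclideanSpace ℝ (Fin k)) i
  exact h2.trans h1.le

lemma pw_eq (k' : ℕ) (v : Fin k → ℤ) : ((primeWeight k' v : ℝ) : ℂ) = ∏ i, w0 k' i (v i) := by
  classical
  unfold primeWeight w0
  by_cases h : ∀ i : Fin k, k' ≤ (i : ℕ) → Prime (v i)
  · rw [Set.indicator_of_mem (show v ∈ {w : Fin k → ℤ | ∀ i : Fin k, k' ≤ (i : ℕ) → Prime (w i)} from h), one_mul]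
    push_cast
    refine Finset.prod_congr rfl fun i _ => ?_
    by_cases hi : k' ≤ (i : ℕ)
    · rw [if_pos hi, if_pos hi, if_pos (h i hi)]
    · rw [if_neg hi, if_neg hi]; simp
  · rw [Set.indicator_of_notMem (show v ∉ {w : Fin k → ℤ | ∀ i : Fin k, k' ≤ (i : ℕ) → Prime (w i)} from h), zero_mul]
    push Not at h
    obtain ⟨i, hi, hp⟩ := h
    rw [Finset.prod_eq_zero (Finset.mem_univ i)]
    · simp
    · rw [if_pos hi, if_neg hp]

/-- the finite exponential sum -/
noncomputable def SS (k' : ℕ) (Γ : Finset (Fin k → ℕ)) (ξ : (Fin k → ℕ) → ℝ) (Ω : Set (EuclideanSpace ℝ (Fin k))) (N : ℕ) : ℂ :=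
  ∑ v : Fin k → ↥(Finset.Icc (-(N : ℤ)) N), (∏ i, w0 k' i (v i)) * FU Γ ξ (UU Ω N) (fun i => ((v i : ℤ) : ℝ))

lemma tsum_SS (k' : ℕ) (Γ : Finset (Fin k → ℕ)) (ξ : (Fin k → ℕ) → ℝ) {Ω : Set (EuclideanSpace ℝ (Fin k))}
    (h : Ω ⊆ Metric.ball 0 1) {N : ℕ} (hN : 0 < N) :
    ∑' v : Fin k → ℤ, ((primeWeight k' v * Set.indicator (dilate Ω (N : ℝ)) (fun _ => 1) (zEmbed v) : ℝ) : ℂ) *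
        eC (qPair Γ ξ v) = SS k' Γ ξ Ω N := by
  have e : ∀ v : Fin k → ℤ, ((primeWeight k' v * Set.indicator (dilate Ω (N : ℝ)) (fun _ => 1) (zEmbed v) : ℝ) : ℂ) *
        eC (qPair Γ ξ v) = (∏ i, w0 k' i (v i)) * FU Γ ξ (UU Ω N) (fun i => (v i : ℝ)) := by
    intro v
    rw [Complex.ofReal_mul, pw_eq, mul_assoc]
    congr 1
    unfold FU
    by_cases hv : zEmbed v ∈ dilate Ω (N : ℝ)
    · rw [Set.indicator_of_mem hv, Set.indicator_of_mem (show (fun i => (v i : ℝ)) ∈ UU Ω N from hv)]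
      simp [qPair, PR]
    · rw [Set.indicator_of_notMem hv, Set.indicator_of_notMem (show (fun i => (v i : ℝ)) ∉ UU Ω N from hv)]
      simp
  simp_rw [e]
  unfold SS
  rw [← tsum_fintype (L := .unconditional _)]
  have hinj : Function.Injective (fun (v : Fin k → ↥(Finset.Icc (-(N : ℤ)) N)) (i : Fin k) => (v i : ℤ)) := by
    intro v w hvw
    funext i
    exact Subtype.ext (congrFun hvw i)
  symm
  refine hinj.tsum_eq (f := fun v : Fin k → ℤ => (∏ i, w0 k' i (v i)) * FU Γ ξ (UU Ω N) (fun i => (v i : ℝ))) ?_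
  intro v hv
  have hu : (fun i => (v i : ℝ)) ∈ UU Ω N := by
    by_contra hcon
    refine hv ?_
    simp only [FU, Set.indicator_of_notMem hcon, mul_zero]
  have hb := UU_box h hN _ hu
  refine ⟨fun i => ⟨v i, ?_⟩, rfl⟩
  rw [Finset.mem_Icc, ← abs_le]
  exact_mod_cast hb i

lemma eC_zero : eC 0 = 1 := by simp [eC]

lemma cheby_SS (k' : ℕ) (Γ : Finset (Fin k → ℕ)) {Ω : Set (EuclideanSpace ℝ (Fin k))}
    (h : Ω ⊆ Metric.ball 0 1) {N : ℕ} (hN : 0 < N) : ((cheby k' Ω N : ℝ) : ℂ) = SS k' Γ (fun _ => 0) Ω N := by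
  rw [← tsum_SS k' Γ _ h hN, cheby, Complex.ofReal_tsum]
  refine tsum_congr fun v => ?_
  simp [qPair, eC_zero]

lemma disc_SS (k' : ℕ) (Γ : Finset (Fin k → ℕ)) (ξ : (Fin k → ℕ) → ℝ) {Ω : Set (EuclideanSpace ℝ (Fin k))}
    (h : Ω ⊆ Metric.ball 0 1) {N : ℕ} (hN : 0 < N) :
    discMultA Γ k' Ω N ξ = (SS k' Γ (fun _ => 0) Ω N)⁻¹ * SS k' Γ ξ Ω N := by
  rw [discMultA, tsum_SS k' Γ ξ h hN, cheby_SS k' Γ h hN]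

lemma w0_nonneg (k' : ℕ) (i : Fin k) (m : ℤ) : (‖w0 k' i m‖ : ℂ) = w0 k' i m := by
  unfold w0
  split_ifs with h1 h2
  · rw [Complex.norm_real, Real.norm_of_nonneg]
    refine Real.log_nonneg ?_
    have : (1 : ℤ) ≤ |m| := Int.one_le_abs h2.ne_zero
    exact_mod_cast this
  all_goals simp

lemma SS_le (k' : ℕ) (Γ : Finset (Fin k → ℕ)) (ξ : (Fin k → ℕ) → ℝ) (Ω : Set (EuclideanSpace ℝ (Fin k))) (N : ℕ) :
    ‖SS k' Γ ξ Ω N‖ ≤ ‖SS k' Γ (fun _ => 0) Ω N‖ := by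
  have e : SS k' Γ (fun _ => 0) Ω N = ((∑ v : Fin k → ↥(Finset.Icc (-(N : ℤ)) N),
      ‖(∏ i, w0 k' i (v i)) * FU Γ ξ (UU Ω N) (fun i => ((v i : ℤ) : ℝ))‖ : ℝ) : ℂ) := by
    unfold SS
    rw [Complex.ofReal_sum]
    refine Finset.sum_congr rfl fun v _ => ?_
    rw [norm_mul, norm_prod]
    push_cast
    simp_rw [w0_nonneg]
    congr 1
    unfold FU
    by_cases hu : (fun i => ((v i : ℤ) : ℝ)) ∈ UU Ω N
    · rw [Set.indicator_of_mem hu, Set.indicator_of_mem hu, eC_norm]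
      simp [PR, eC_zero]
    · rw [Set.indicator_of_notMem hu, Set.indicator_of_notMem hu]; simp
  rw [e, Complex.norm_real, Real.norm_of_nonneg (Finset.sum_nonneg fun _ _ => norm_nonneg _)]
  exact norm_sum_le _ _

lemma disc_le (k' : ℕ) (Γ : Finset (Fin k → ℕ)) (ξ : (Fin k → ℕ) → ℝ) {Ω : Set (EuclideanSpace ℝ (Fin k))}
    (h : Ω ⊆ Metric.ball 0 1) {N : ℕ} (hN : 0 < N) : ‖discMultA Γ k' Ω N ξ‖ ≤ 1 := by
  rw [disc_SS k' Γ ξ h hN, norm_mul, norm_inv, inv_mul_eq_div]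
  exact div_le_one_of_le₀ (SS_le k' Γ ξ Ω N) (norm_nonneg _)

lemma int_FU (Γ : Finset (Fin k → ℕ)) (θ : (Fin k → ℕ) → ℝ) {Ω : Set (EuclideanSpace ℝ (Fin k))}
    (h : IsOpen Ω) (N : ℕ) : ∫ u in dilate Ω (N : ℝ), eC (qPairR Γ θ u) = ∫ u, FU Γ θ (UU Ω N) u := by
  have hp := PiLp.volume_preserving_toLp (Fin k)
  have he : MeasurableEmbedding (WithLp.toLp 2 : (Fin k → ℝ) → EuclideanSpace ℝ (Fin k)) :=
    (MeasurableEquiv.toLp 2 (Fin k → ℝ)).measurableEmbedding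
  rw [← hp.setIntegral_preimage_emb he]
  unfold FU
  rw [integral_indicator (UU_meas h N)]
  rfl

lemma vol_FU (Γ : Finset (Fin k → ℕ)) {Ω : Set (EuclideanSpace ℝ (Fin k))}
    (h : IsOpen Ω) (N : ℕ) : (((volume (dilate Ω (N : ℝ))).toReal : ℝ) : ℂ) = ∫ u, FU Γ (fun _ => 0) (UU Ω N) u := by
  rw [← int_FU Γ _ h]
  simp [qPairR, eC_zero, Measure.real]

lemma cont_le (Γ : Finset (Fin k → ℕ)) (θ : (Fin k → ℕ) → ℝ) (Ω : Set (EuclideanSpace ℝ (Fin k))) (t : ℝ) :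
    ‖contMultA Γ Ω t θ‖ ≤ 1 ∧ ‖∫ u in dilate Ω t, eC (qPairR Γ θ u)‖ ≤ (volume (dilate Ω t)).toReal := by
  have h2 : ‖∫ u in dilate Ω t, eC (qPairR Γ θ u)‖ ≤ (volume (dilate Ω t)).toReal := by
    refine (norm_integral_le_integral_norm _).trans (le_of_eq ?_)
    simp [eC_norm, Measure.real]
  refine ⟨?_, h2⟩
  rw [contMultA, norm_mul, norm_inv, Complex.norm_real, Real.norm_of_nonneg ENNReal.toReal_nonneg, inv_mul_eq_div]
  exact div_le_one_of_le₀ h2 ENNReal.toReal_nonneg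

lemma vol_dil (Ω : Set (EuclideanSpace ℝ (Fin k))) {N : ℕ} (hN : 0 < N) :
    (volume (dilate Ω (N : ℝ))).toReal = (N : ℝ) ^ k * (volume Ω).toReal := by
  have hN0 : (0 : ℝ) < N := by exact_mod_cast hN
  have : dilate Ω (N : ℝ) = (fun x => (N : ℝ)⁻¹ • x) ⁻¹' Ω := rfl
  rw [this, Measure.addHaar_preimage_smul volume (inv_ne_zero hN0.ne'), ENNReal.toReal_mul, ENNReal.toReal_ofReal (abs_nonneg _),
    finrank_euclideanSpace_fin, inv_pow, inv_inv, abs_of_pos (by positivity)]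

lemma vol_pos {Ω : Set (EuclideanSpace ℝ (Fin k))} {c : ℝ} (hc : 0 < c) (h : Metric.ball 0 c ⊆ Ω) (h' : Ω ⊆ Metric.ball 0 1) :
    0 < (volume Ω).toReal := by
  refine ENNReal.toReal_pos ?_ ?_
  · exact (lt_of_lt_of_le (Metric.measure_ball_pos volume _ hc) (measure_mono h)).ne'
  · exact (lt_of_le_of_lt (measure_mono h') measure_ball_lt_top).ne

end

lemma prod_split {k k' k'' : ℕ} (hk : k' + k'' = k) {M : Type*} [CommMonoid M] (x y : M) :
    ∏ i : Fin k, (if k' ≤ (i : ℕ) then x else y) = y ^ k' * x ^ k'' := by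
  subst hk
  rw [Fin.prod_univ_add]
  congr 1
  · rw [Finset.prod_congr rfl (g := fun _ => y)]
    · simp
    · intro i _
      rw [if_neg (by simp)]
  · rw [Finset.prod_congr rfl (g := fun _ => x)]
    · simp
    · intro i _
      rw [if_pos (by simp)]

lemma tot_Icc (q : ℕ) : ((Finset.Icc 1 q).filter fun m => Nat.Coprime m q).card = q.totient := by
  rw [← Nat.filter_coprime_Ico_eq_totient q 1, add_comm]
  congr 1
  ext x
  simp [Nat.coprime_comm, Nat.lt_succ_iff]

lemma gauss_le {k k' k'' : ℕ} (hk : k' + k'' = k) (Γ : Finset (Fin k → ℕ)) (q : ℕ) (a : (Fin k → ℕ) → ℕ) :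
    ‖gaussSumQ Γ k' k'' q a‖ ≤ 1 := by
  rw [gaussSumQ, norm_mul, norm_inv, inv_mul_eq_div]
  refine div_le_one_of_le₀ ?_ (norm_nonneg _)
  refine (norm_sum_le _ _).trans (le_of_eq ?_)
  simp_rw [eC_norm]
  rw [Finset.sum_const, Fintype.card_piFinset, nsmul_eq_mul, mul_one, norm_mul, norm_pow, norm_pow, Complex.norm_natCast,
    Complex.norm_natCast]
  have : ∀ i : Fin k, (if (i : ℕ) < k' then Finset.Icc 1 q
        else (Finset.Icc 1 q).filter fun m => Nat.Coprime m q).card = if k' ≤ (i : ℕ) then q.totient else q := by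
    intro i
    by_cases hi : k' ≤ (i : ℕ)
    · rw [if_neg (by omega), if_pos hi, tot_Icc]
    · rw [if_pos (by omega), if_neg hi, Nat.card_Icc, Nat.add_sub_cancel]
  simp_rw [this]
  rw [prod_split hk]
  push_cast; rfl

lemma gauss_GG {k k' k'' : ℕ} (hk : k' + k'' = k) (Γ : Finset (Fin k → ℕ)) (q : ℕ) [NeZero q] (a : (Fin k → ℕ) → ℕ) :
    gaussSumQ Γ k' k'' q a = GG k' Γ a q := by
  classical
  have hq : 0 < q := NeZero.pos q
  unfold gaussSumQ GG
  have ec : ∏ i : Fin k, cc k' q i = ((q : ℂ) ^ k' * (q.totient : ℂ) ^ k'')⁻¹ := by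
    unfold cc
    rw [prod_split hk, one_div, one_div, inv_pow, inv_pow, mul_inv]
  simp_rw [Finset.prod_mul_distrib, ec]
  rw [Finset.mul_sum]
  refine Finset.sum_of_injOn (fun (v : Fin k → ℕ) (i : Fin k) => (v i : ZMod q)) ?_ (fun _ _ => Finset.mem_coe.2 (Finset.mem_univ _)) ?_ ?_
  · intro v hv w hw hvw
    funext i
    have hv' := Fintype.mem_piFinset.1 (Finset.mem_coe.1 hv) i
    have hw' := Fintype.mem_piFinset.1 (Finset.mem_coe.1 hw) i
    have h1 : v i ∈ Finset.Icc 1 q := by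
      split_ifs at hv'
      · exact hv'
      · exact (Finset.mem_filter.1 hv').1
    have h2 : w i ∈ Finset.Icc 1 q := by
      split_ifs at hw'
      · exact hw'
      · exact (Finset.mem_filter.1 hw').1
    rw [Finset.mem_Icc] at h1 h2
    have h3 : v i ≡ w i [MOD q] := (ZMod.natCast_eq_natCast_iff _ _ _).1 (congrFun hvw i)
    refine Nat.ModEq.eq_of_abs_lt h3 ?_
    rw [abs_lt]; omega
  · intro b _ hb
    by_contra hne
    refine hb ⟨fun i => if (b i).val = 0 then q else (b i).val, ?_, ?_⟩
    · rw [Finset.mem_coe, Fintype.mem_piFinset]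
      intro i
      have hI : (if (b i).val = 0 then q else (b i).val) ∈ Finset.Icc 1 q := by
        have := ZMod.val_lt (b i)
        rw [Finset.mem_Icc]
        split_ifs <;> omega
      have hcast : ((if (b i).val = 0 then q else (b i).val : ℕ) : ZMod q) = b i := by
        split_ifs with h
        · rw [ZMod.natCast_self, (ZMod.val_eq_zero _).1 h]
        · exact ZMod.natCast_zmod_val _
      by_cases hi : (i : ℕ) < k'
      · rw [if_pos hi]; exact hI
      · rw [if_neg hi, Finset.mem_filter]
        refine ⟨hI, ?_⟩
        rw [← ZMod.isUnit_iff_coprime, hcast]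
        by_contra hu
        refine hne ?_
        rw [Finset.prod_eq_zero (Finset.mem_univ i) (i := i), mul_zero, mul_zero]
        unfold psi
        rw [if_pos (by omega)]
        exact MulChar.map_nonunit _ hu
    · funext i
      dsimp only
      split_ifs with h
      · rw [ZMod.natCast_self, (ZMod.val_eq_zero _).1 h]
      · exact ZMod.natCast_zmod_val _
  · intro v hv
    have hv' := fun i => Fintype.mem_piFinset.1 hv i
    have hpsi : ∏ i, psi k' q i ((v i : ZMod q)) = 1 := by
      refine Finset.prod_eq_one fun i _ => ?_
      unfold psi
      split_ifs with hi
      · have := hv' i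
        rw [if_neg (by omega), Finset.mem_filter] at this
        exact MulChar.one_apply ((ZMod.isUnit_iff_coprime _ _).2 this.2)
      · rfl
    rw [hpsi, mul_one, mul_comm]
    congr 1
    have := ps_eC (q := q) Γ a (fun i => (v i : ℤ))
    simp only [Int.cast_natCast, PR] at this
    exact this.symm

lemma GG_one {k : ℕ} (k' : ℕ) (Γ : Finset (Fin k → ℕ)) (a : (Fin k → ℕ) → ℕ) : GG k' Γ a 1 = 1 := by
  unfold GG
  rw [Fintype.sum_unique]
  have h1 : ∀ x : ZMod 1, ps x = 1 := fun x => by rw [Subsingleton.elim x 0]; exact AddChar.map_zero_eq_one _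
  rw [h1, one_mul]
  refine Finset.prod_eq_one fun i _ => ?_
  unfold cc psi
  split_ifs
  · rw [Nat.totient_one, Nat.cast_one, one_div_one, one_mul]
    exact MulChar.one_apply (isUnit_of_subsingleton _)
  · simp

end MA
end


section
open Complex Set Filter Topology MeasureTheory
open scoped BigOperators

namespace MA

lemma coreN (k k' k'' : ℕ) (hk : k' + k'' = k)
    (Γ : Finset (Fin k → ℕ)) (hΓ : Γ.Nonempty) (h0 : (0 : Fin k → ℕ) ∉ Γ)
    (Ω : Set (EuclideanSpace ℝ (Fin k))) (cΩ : ℝ)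
    (hc0 : 0 < cΩ) (hopen : IsOpen Ω) (hconv : Convex ℝ Ω)
    (hball : Metric.ball 0 cΩ ⊆ Ω) (hball' : Ω ⊆ Metric.ball 0 1) (α : ℝ) (hα : 0 < α) :
    ∃ c C : ℝ, 0 < c ∧ 0 < C ∧ ∀ᶠ N : ℕ in atTop,
      ∀ (ξ : (Fin k → ℕ) → ℝ) (q : ℕ) (L : ℝ) (a : (Fin k → ℕ) → ℕ),
        1 ≤ q → (q : ℝ) ≤ L → 1 ≤ L → L ≤ Real.exp (c * √(Real.log N)) →
        (∀ γ ∈ Γ, Nat.Coprime (a γ) q) →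
        (∀ γ ∈ Γ, |ξ γ - (a γ : ℝ) / (q : ℝ)| * (N : ℝ) ^ (∑ i, γ i) ≤ L) →
        ‖discMultA Γ k' Ω N ξ - gaussSumQ Γ k' k'' q a * contMultA Γ Ω N (fun γ => ξ γ - (a γ : ℝ) / (q : ℝ))‖
          ≤ C * (Real.log N) ^ (-α) := by
  obtain ⟨c, C, hc, hC, hev⟩ := mainA k' Γ hΓ h0 hα
  have hv := vol_pos hc0 hball hball'
  set v0 := (volume Ω).toReal with hv0
  have hlog : Tendsto (fun N : ℕ => (Real.log N) ^ (-α)) atTop (𝓝 0) :=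
    (tendsto_rpow_neg_atTop hα).comp (Real.tendsto_log_atTop.comp tendsto_natCast_atTop_atTop)
  refine ⟨c, 4 * C / v0, hc, by positivity, ?_⟩
  filter_upwards [hev, eventually_ge_atTop 2, hlog.eventually (ge_mem_nhds (show 0 < v0 / (2 * C) by positivity))] with N hev hN2 hsm ξ q L a hq hqL hL1 hLc ha hθ
  have hN : 0 < N := by omega
  have hN0 : (0 : ℝ) < N := by exact_mod_cast hN
  have hl0 : 0 ≤ (Real.log N) ^ (-α) := Real.rpow_nonneg (Real.log_nonneg (by exact_mod_cast hN)) _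
  set ℓ := (Real.log N) ^ (-α) with hℓ
  haveI : NeZero q := ⟨by omega⟩
  have m1 := hev (UU Ω N) (UU_conv hconv N) (UU_meas hopen N) (UU_box hball' hN) ξ q a
    (fun γ hγ => (ZMod.isUnit_iff_coprime _ _).2 (ha γ hγ)) L hL1 hqL hLc hθ
  have m2 := hev (UU Ω N) (UU_conv hconv N) (UU_meas hopen N) (UU_box hball' hN) (fun _ => 0) 1 (fun _ => 0)
    (fun γ hγ => isUnit_of_subsingleton _) L hL1 (by simpa using hL1) hLc (fun γ hγ => by simp; linarith)
  rw [GG_one, one_mul] at m2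
  simp only [Nat.cast_zero, zero_div, sub_zero] at m2
  rw [← vol_FU Γ hopen] at m2
  rw [← int_FU Γ _ hopen, ← gauss_GG hk] at m1
  change ‖SS k' Γ ξ Ω N - _‖ ≤ _ at m1
  change ‖SS k' Γ (fun _ => 0) Ω N - _‖ ≤ _ at m2
  rw [disc_SS k' Γ ξ hball' hN, contMultA]
  have hI := (cont_le Γ (fun γ => ξ γ - (a γ : ℝ) / (q : ℝ)) Ω (N : ℝ)).2
  have hG := gauss_le hk Γ q a
  have hV : (volume (dilate Ω (N : ℝ))).toReal = (N : ℝ) ^ k * v0 := vol_dil Ω hN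
  set V := (volume (dilate Ω (N : ℝ))).toReal with hVd
  set I := ∫ u in dilate Ω (N : ℝ), eC (qPairR Γ (fun γ => ξ γ - (a γ : ℝ) / (q : ℝ)) u) with hId
  set G := gaussSumQ Γ k' k'' q a with hGd
  set S := SS k' Γ ξ Ω N with hSd
  set ϑ := SS k' Γ (fun _ => 0) Ω N with hϑd
  clear_value V I G S ϑ ℓ v0
  have hNk : (0 : ℝ) < (N : ℝ) ^ k := by positivity
  have hVpos : 0 < V := by rw [hV]; positivity
  have hη : C * (N : ℝ) ^ k * ℓ ≤ V / 2 := by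
    rw [le_div_iff₀ (by positivity)] at hsm
    rw [hV]
    nlinarith only [hsm, hNk]
  have hϑ : V / 2 ≤ ‖ϑ‖ := by
    have := norm_sub_norm_le (V : ℂ) ϑ
    rw [Complex.norm_real, Real.norm_of_nonneg hVpos.le, norm_sub_rev] at this
    linarith
  have hϑ0 : 0 < ‖ϑ‖ := by linarith
  have hϑne : ϑ ≠ 0 := norm_pos_iff.1 hϑ0
  have hVne : (V : ℂ) ≠ 0 := by exact_mod_cast hVpos.ne'
  have e : ϑ⁻¹ * S - G * ((V : ℂ)⁻¹ * I) = ϑ⁻¹ * ((S - G * I) + G * ((I * (V : ℂ)⁻¹) * ((V : ℂ) - ϑ))) := by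
    field_simp
    ring
  rw [e, norm_mul, norm_inv, inv_mul_le_iff₀ hϑ0]
  have b1 : ‖G * ((I * (V : ℂ)⁻¹) * ((V : ℂ) - ϑ))‖ ≤ C * (N : ℝ) ^ k * ℓ := by
    rw [norm_mul, norm_mul, norm_mul, norm_inv, Complex.norm_real, Real.norm_of_nonneg hVpos.le, norm_sub_rev]
    have h1 : ‖I‖ * V⁻¹ ≤ 1 := by rw [← div_eq_mul_inv]; exact div_le_one_of_le₀ hI hVpos.le
    calc _ ≤ 1 * (1 * ‖ϑ - V‖) := by gcongr
      _ ≤ _ := by rw [one_mul, one_mul]; exact m2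
  calc _ ≤ C * (N : ℝ) ^ k * ℓ + C * (N : ℝ) ^ k * ℓ := (norm_add_le _ _).trans (add_le_add m1 b1)
    _ = (V / 2) * (4 * C / v0 * ℓ) := by rw [hV]; field_simp; ring
    _ ≤ _ := by gcongr

lemma Nseq_le (τ : ℝ) (n : ℕ) : (Nseq τ n : ℝ) ≤ (2 : ℝ) ^ ((n : ℝ) ^ τ) := Nat.floor_le (by positivity)

lemma Nseq_tendsto {τ : ℝ} (h : 0 < τ) : Tendsto (Nseq τ) atTop atTop := by
  refine tendsto_nat_floor_atTop.comp ?_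
  exact (tendsto_rpow_atTop_of_base_gt_one 2 (by norm_num)).comp
    ((tendsto_rpow_atTop h).comp tendsto_natCast_atTop_atTop)

lemma Nseq_pos (τ : ℝ) (n : ℕ) : 0 < Nseq τ n := by
  refine Nat.floor_pos.2 (Real.one_le_rpow (by norm_num) (by positivity))

lemma Nseq_two {τ : ℝ} (h : 0 < τ) {n : ℕ} (hn : 1 ≤ n) : 2 ≤ Nseq τ n := by
  refine Nat.le_floor ?_
  have h1 : (1 : ℝ) ≤ (n : ℝ) ^ τ := Real.one_le_rpow (by exact_mod_cast hn) h.le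
  have := Real.rpow_le_rpow_of_exponent_le (by norm_num : (1 : ℝ) ≤ 2) h1
  simpa using this

lemma Nseq_mono {τ : ℝ} (h : 0 < τ) (n : ℕ) : Nseq τ (n - 1) ≤ Nseq τ n := by
  refine Nat.floor_le_floor (Real.rpow_le_rpow_of_exponent_le (by norm_num) ?_)
  exact Real.rpow_le_rpow (Nat.cast_nonneg _) (by exact_mod_cast Nat.sub_le n 1) h.le

lemma Nseq_four {τ : ℝ} (h : 0 < τ) (h1 : τ ≤ 1) {n : ℕ} (hn : 1 ≤ n) : Nseq τ n ≤ 4 * Nseq τ (n - 1) := by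
  have a1 : ((n : ℝ)) ^ τ ≤ ((n - 1 : ℕ) : ℝ) ^ τ + 1 := by
    have := Real.rpow_add_le_add_rpow (Nat.cast_nonneg (n - 1) : (0 : ℝ) ≤ ((n - 1 : ℕ) : ℝ)) (zero_le_one) h.le h1
    rw [Real.one_rpow] at this
    refine le_trans (le_of_eq ?_) this
    congr 1
    exact_mod_cast (Nat.sub_add_cancel hn).symm
  have a2 : (Nseq τ n : ℝ) ≤ 2 * (2 : ℝ) ^ (((n - 1 : ℕ) : ℝ) ^ τ) := by
    refine (Nseq_le τ n).trans ((Real.rpow_le_rpow_of_exponent_le (by norm_num) a1).trans (le_of_eq ?_))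
    rw [Real.rpow_add (by norm_num), Real.rpow_one, mul_comm]
  have a3 : (2 : ℝ) ^ (((n - 1 : ℕ) : ℝ) ^ τ) < Nseq τ (n - 1) + 1 := Nat.lt_floor_add_one _
  have a4 : (1 : ℝ) ≤ Nseq τ (n - 1) := by exact_mod_cast Nseq_pos τ (n - 1)
  have : (Nseq τ n : ℝ) ≤ 4 * Nseq τ (n - 1) := by linarith
  exact_mod_cast this

lemma theta_conv {N M s : ℕ} (hM : 0 < M) (hMN : M ≤ N) {x L : ℝ} (h : |x| ≤ (N : ℝ) ^ (-((s : ℕ) : ℝ)) * L) (hL : 0 ≤ L) :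
    |x| * (M : ℝ) ^ s ≤ L := by
  have hN0 : (0 : ℝ) < N := by exact_mod_cast hM.trans_le hMN
  rw [Real.rpow_neg hN0.le, Real.rpow_natCast, inv_mul_eq_div, le_div_iff₀ (by positivity)] at h
  refine le_trans ?_ h
  have : (M : ℝ) ≤ N := by exact_mod_cast hMN
  gcongr

end MA
end


/-- Property 3, averages case: major arc asymptotics for the discrete
multipliers. If `|ξ_γ - a_γ/q| ≤ N_n^{-|γ|} L` for all `γ ∈ Γ`, with `1 ≤ q ≤ L`,
`a ∈ A_q^Γ` and `1 ≤ L ≤ exp(c√(log N_n)) (log N_n)^{-α}`, then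
`𝔪_{N_n}(ξ) - 𝔪_{N_{n-1}}(ξ) = G(a/q)(Φ_{N_n}(ξ - a/q) - Φ_{N_{n-1}}(ξ - a/q)) +
O((log N_n)^{-α})`, with `c` and the implicit constant independent of `n, ξ, a, q`. -/
theorem major_arc_multiplier_asymptotics
    (k k' k'' : ℕ) (hk : k' + k'' = k)
    (Γ : Finset (Fin k → ℕ)) (hΓ : Γ.Nonempty) (h0 : (0 : Fin k → ℕ) ∉ Γ)
    (Ω : Set (EuclideanSpace ℝ (Fin k))) (cΩ : ℝ)
    (hc0 : 0 < cΩ) (hc1 : cΩ < 1) (hopen : IsOpen Ω) (hconv : Convex ℝ Ω)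
    (hball : Metric.ball 0 cΩ ⊆ Ω) (hball' : Ω ⊆ Metric.ball 0 1)
    (τ : ℝ) (hτ0 : 0 < τ) (hτ1 : τ ≤ 1)
    (α : ℝ) (hα : 0 < α) :
    ∃ c : ℝ, 0 < c ∧ ∃ C : ℝ, 0 < C ∧
      ∀ n : ℕ, 1 ≤ n →
      ∀ (ξ : (Fin k → ℕ) → ℝ) (q : ℕ) (L : ℝ) (a : (Fin k → ℕ) → ℕ),
        1 ≤ q → (q : ℝ) ≤ L → 1 ≤ L →
        L ≤ Real.exp (c * Real.sqrt (Real.log (Nseq τ n))) *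
              (Real.log (Nseq τ n)) ^ (-α) →
        (∀ γ ∈ Γ, a γ ∈ Finset.Icc 1 q ∧ Nat.Coprime (a γ) q) →
        (∀ γ ∈ Γ, |ξ γ - (a γ : ℝ) / (q : ℝ)| ≤
            ((Nseq τ n : ℝ)) ^ (-((∑ i, γ i : ℕ) : ℝ)) * L) →
        ‖discMultA Γ k' Ω (Nseq τ n) ξ - discMultA Γ k' Ω (Nseq τ (n - 1)) ξ -
            gaussSumQ Γ k' k'' q a *
              (contMultA Γ Ω (Nseq τ n) (fun γ => ξ γ - (a γ : ℝ) / (q : ℝ)) -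
                contMultA Γ Ω (Nseq τ (n - 1)) (fun γ => ξ γ - (a γ : ℝ) / (q : ℝ)))‖
          ≤ C * (Real.log (Nseq τ n)) ^ (-α) := by
  obtain ⟨c, C, hc, hC, hev⟩ := MA.coreN k k' k'' hk Γ hΓ h0 Ω cΩ hc0 hopen hconv hball hball' α hα
  have ev1 := (MA.Nseq_tendsto hτ0).eventually (hev.and (Filter.eventually_ge_atTop 16))
  have ev2 : ∀ᶠ n : ℕ in Filter.atTop, _ := (Filter.tendsto_sub_atTop_nat 1).eventually ev1
  obtain ⟨n0, hn0⟩ := Filter.eventually_atTop.1 (ev1.and ev2)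
  refine ⟨c / 2, by positivity, C + C * 2 ^ α + 4 * ((n0 : ℝ) + 1) ^ α, by positivity, ?_⟩
  intro n hn ξ q L a hq hqL hL1 hL ha hθ
  have hNpos := MA.Nseq_pos τ n
  have hMpos := MA.Nseq_pos τ (n - 1)
  have hN2 : (2 : ℝ) ≤ Nseq τ n := by exact_mod_cast MA.Nseq_two hτ0 hn
  have hlogpos : 0 < Real.log (Nseq τ n) := Real.log_pos (by linarith)
  have hl0 : 0 < (Real.log (Nseq τ n)) ^ (-α) := Real.rpow_pos_of_pos hlogpos _
  have hMN := MA.Nseq_mono hτ0 n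
  set θ : (Fin k → ℕ) → ℝ := fun γ => ξ γ - (a γ : ℝ) / (q : ℝ) with hθd
  have hG := MA.gauss_le hk Γ q a
  by_cases hnn : n0 ≤ n
  · obtain ⟨⟨h1, h16⟩, ⟨h2, h16'⟩⟩ := hn0 n hnn
    have hM16 : (16 : ℝ) ≤ Nseq τ (n - 1) := by exact_mod_cast h16'
    have h4 : (Nseq τ n : ℝ) ≤ 4 * Nseq τ (n - 1) := by exact_mod_cast MA.Nseq_four hτ0 hτ1 hn
    have hMN' : (Nseq τ (n - 1) : ℝ) ≤ Nseq τ n := by exact_mod_cast hMN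
    generalize Nseq τ n = N at *
    generalize Nseq τ (n - 1) = M at *
    have hlogM : Real.log N ≤ 2 * Real.log M := by
      rw [← Real.log_rpow (by linarith), Real.rpow_two]
      refine Real.log_le_log (by linarith) ?_
      nlinarith only [h4, hM16]
    have hlogM0 : 0 < Real.log M := Real.log_pos (by linarith)
    have hlogN1 : 1 ≤ Real.log N := by
      rw [Real.le_log_iff_exp_le (by linarith)]
      have := Real.exp_one_lt_d9
      linarith
    have hl1 : (Real.log N) ^ (-α) ≤ 1 := Real.rpow_le_one_of_one_le_of_nonpos hlogN1 (by linarith)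
    have hL' : L ≤ Real.exp (c / 2 * √(Real.log N)) :=
      hL.trans (mul_le_of_le_one_right (Real.exp_nonneg _) hl1)
    have hsq : √(Real.log N) ≤ 2 * √(Real.log M) := by
      rw [show 2 * √(Real.log M) = √(4 * Real.log M) by
        rw [Real.sqrt_mul (by norm_num), show (4 : ℝ) = 2 ^ 2 by norm_num, Real.sqrt_sq (by norm_num)]]
      exact Real.sqrt_le_sqrt (by linarith)
    have hs0 := Real.sqrt_nonneg (Real.log N)
    have r1 := h1 ξ q L a hq hqL hL1 (hL'.trans (Real.exp_le_exp.2 (by nlinarith only [hc, hs0]))) (fun γ hγ => (ha γ hγ).2)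
      (fun γ hγ => MA.theta_conv hNpos le_rfl (hθ γ hγ) (by linarith))
    have r2 := h2 ξ q L a hq hqL hL1 (hL'.trans (Real.exp_le_exp.2 (by nlinarith only [hc, hsq]))) (fun γ hγ => (ha γ hγ).2)
      (fun γ hγ => MA.theta_conv hMpos hMN (hθ γ hγ) (by linarith))
    have hMα : (Real.log M) ^ (-α) ≤ 2 ^ α * (Real.log N) ^ (-α) := by
      have : (2 * Real.log M) ^ (-α) ≤ (Real.log N) ^ (-α) :=
        Real.rpow_le_rpow_of_nonpos hlogpos hlogM (by linarith)
      rw [Real.mul_rpow (by norm_num) hlogM0.le, Real.rpow_neg (by norm_num), inv_mul_le_iff₀ (by positivity)] at this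
      exact this
    have e : discMultA Γ k' Ω N ξ - discMultA Γ k' Ω M ξ - gaussSumQ Γ k' k'' q a * (contMultA Γ Ω N θ - contMultA Γ Ω M θ)
      = (discMultA Γ k' Ω N ξ - gaussSumQ Γ k' k'' q a * contMultA Γ Ω N θ) -
        (discMultA Γ k' Ω M ξ - gaussSumQ Γ k' k'' q a * contMultA Γ Ω M θ) := by ring
    rw [e]
    refine (norm_sub_le _ _).trans ((add_le_add r1 r2).trans ?_)
    have x1 := mul_le_mul_of_nonneg_left hMα hC.le
    have x2 : 0 ≤ 4 * ((n0 : ℝ) + 1) ^ α * (Real.log N) ^ (-α) := by positivity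
    nlinarith only [x1, x2]
  · push Not at hnn
    have hlogn : Real.log (Nseq τ n) ≤ (n0 : ℝ) + 1 := by
      have a1 : (Nseq τ n : ℝ) ≤ (2 : ℝ) ^ (n : ℝ) := by
        refine (MA.Nseq_le τ n).trans (Real.rpow_le_rpow_of_exponent_le (by norm_num) ?_)
        have hn1 : (1 : ℝ) ≤ n := by exact_mod_cast hn
        have := Real.rpow_le_rpow_of_exponent_le hn1 hτ1
        simpa using this
      have a2 := Real.log_le_log (by linarith) a1
      rw [Real.log_rpow (by norm_num)] at a2
      have a3 : Real.log 2 ≤ 1 := by have := Real.log_two_lt_d9; linarith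
      have a4 : (n : ℝ) ≤ n0 := by exact_mod_cast hnn.le
      have a5 : (n : ℝ) * Real.log 2 ≤ n := mul_le_of_le_one_right (Nat.cast_nonneg _) a3
      linarith
    have d1 := MA.disc_le k' Γ ξ hball' hNpos
    have d2 := MA.disc_le k' Γ ξ hball' hMpos
    have d3 := (MA.cont_le Γ θ Ω (Nseq τ n)).1
    have d4 := (MA.cont_le Γ θ Ω (Nseq τ (n - 1))).1
    have t1 : ‖gaussSumQ Γ k' k'' q a * (contMultA Γ Ω (Nseq τ n) θ - contMultA Γ Ω (Nseq τ (n - 1)) θ)‖ ≤ 2 := by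
      rw [norm_mul]
      have := norm_sub_le (contMultA Γ Ω (Nseq τ n) θ) (contMultA Γ Ω (Nseq τ (n - 1)) θ)
      refine (mul_le_of_le_one_left (norm_nonneg _) hG).trans ?_
      linarith
    have t2 := norm_sub_le (discMultA Γ k' Ω (Nseq τ n) ξ) (discMultA Γ k' Ω (Nseq τ (n - 1)) ξ)
    have t3 : 1 ≤ ((n0 : ℝ) + 1) ^ α * (Real.log (Nseq τ n)) ^ (-α) := by
      rw [Real.rpow_neg hlogpos.le, ← div_eq_mul_inv, one_le_div (by positivity)]
      exact Real.rpow_le_rpow hlogpos.le hlogn hα.le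
    refine (norm_sub_le _ _).trans ?_
    have x1 : 0 ≤ (C + C * 2 ^ α) * (Real.log (Nseq τ n)) ^ (-α) := by positivity
    nlinarith only [x1, t1, t2, t3, d1, d2]
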